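/- Let D be a pseudoconvex domain in ℂ^k_t × ℂ^n_z and let φ be a plurisubharmonic function on D. For each t let D_t = {z ∈ ℂ^n : (t,z) ∈ D}, let φ^t = φ(t,·), and let K_t(ζ,z) be the Bergman kernel of the weighted Bergman space A²(D_t, e^{-φ^t}). Then the function (t,z) ↦ log K_t(z,z) is plurisubharmonic on D, or identically equal to −∞. -/

import Mathlib

open MeasureTheory Filter Set Metric Complex
open scoped ENNReal NNReal Topology

noncomputable section

namespace Berndtsson

instance (n : ℕ) : MeasurableSpace (EuclideanSpace ℂ (Fin n)) := borel _
instance (n : ℕ) : BorelSpace (EuclideanSpace ℂ (Fin n)) := ⟨rfl⟩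
instance (n : ℕ) : MeasureSpace (EuclideanSpace ℂ (Fin n)) :=
  ⟨Measure.map (EuclideanSpace.equiv (Fin n) ℂ).symm volume⟩

abbrev Cn (n : ℕ) := EuclideanSpace ℂ (Fin n)

/-- A function `f`, with values in `EReal`, is plurisubharmonic on `s` if it is upper
semicontinuous on `s` and satisfies the sub-mean value inequality on every complex circle
whose corresponding closed disk is contained in `s` (formulated via continuous majorants,
which for upper semicontinuous integrands is equivalent to the upper-integral form). -/
def PlurisubharmonicOn {E : Type*} [NormedAddCommGroup E] [NormedSpace ℂ E]
    (f : E → EReal) (s : Set E) : Prop :=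
  UpperSemicontinuousOn f s ∧
    ∀ z ∈ s, ∀ w : E, ∀ r : ℝ, 0 < r →
      (∀ l : ℂ, ‖l‖ ≤ r → z + l • w ∈ s) →
      ∀ h : ℝ → ℝ, Continuous h →
        (∀ θ : ℝ, f (z + ((r : ℂ) * Complex.exp (θ * Complex.I)) • w) ≤ (h θ : EReal)) →
        f z ≤ (((2 * Real.pi)⁻¹ * ∫ θ in (0:ℝ)..(2 * Real.pi), h θ : ℝ) : EReal)

/-- Plurisubharmonicity for real-valued functions. -/
def PshOn {E : Type*} [NormedAddCommGroup E] [NormedSpace ℂ E] (f : E → ℝ) (s : Set E) : Prop :=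
  PlurisubharmonicOn (fun z => (f z : EReal)) s

/-- A pseudoconvex domain: an open set admitting a plurisubharmonic exhaustion function. -/
def Pseudoconvex {E : Type*} [NormedAddCommGroup E] [NormedSpace ℂ E] (D : Set E) : Prop :=
  IsOpen D ∧ ∃ u : E → ℝ, PshOn u D ∧ ∀ c : ℝ, IsCompact {z ∈ D | u z ≤ c}

/-- `log` with values in `EReal`, sending nonpositive reals to `⊥`. -/
def elog (x : ℝ) : EReal := if 0 < x then ((Real.log x : ℝ) : EReal) else ⊥

/-- Membership in the weighted Bergman space `A²(Ω, e^{-φ})`. -/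
def MemA2 {n : ℕ} (Ω : Set (Cn n)) (φ : Cn n → ℝ) (h : Cn n → ℂ) : Prop :=
  DifferentiableOn ℂ h Ω ∧
    IntegrableOn (fun ζ => ‖h ζ‖ ^ 2 * Real.exp (-φ ζ)) Ω volume

/-- `Kz` is the Bergman kernel of `A²(Ω, e^{-φ})` at the point `z`:
it belongs to the space and reproduces the value at `z` of every member. -/
def IsBergmanKernelAt {n : ℕ} (Ω : Set (Cn n)) (φ : Cn n → ℝ) (z : Cn n)
    (Kz : Cn n → ℂ) : Prop :=
  MemA2 Ω φ Kz ∧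
    ∀ h : Cn n → ℂ, MemA2 Ω φ h →
      ∫ ζ in Ω, h ζ * (starRingEnd ℂ) (Kz ζ) * (Real.exp (-φ ζ) : ℂ) = h z

/-- The Bergman kernel on the diagonal, via its extremal characterization
`K(z,z) = sup {|h(z)|² : h holomorphic on Ω, ∫_Ω |h|² e^{-φ} ≤ 1}`. -/
def bergmanDiag {n : ℕ} (Ω : Set (Cn n)) (φ : Cn n → ℝ) (z : Cn n) : ℝ :=
  sSup {v : ℝ | ∃ h : Cn n → ℂ, DifferentiableOn ℂ h Ω ∧
    IntegrableOn (fun ζ => ‖h ζ‖ ^ 2 * Real.exp (-φ ζ)) Ω volume ∧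
    (∫ ζ in Ω, ‖h ζ‖ ^ 2 * Real.exp (-φ ζ)) ≤ 1 ∧ v = ‖h z‖ ^ 2}

end Berndtsson

namespace Berndtsson

set_option linter.unusedSectionVars false

section Wirtinger

variable {E : Type*} [NormedAddCommGroup E] [NormedSpace ℂ E]

/-- The Wirtinger derivative `∂f` in the direction `e`. -/
def wd (f : E → ℂ) (e z : E) : ℂ := (fderiv ℝ f z e - I * fderiv ℝ f z (I • e)) / 2

/-- The conjugate Wirtinger derivative `∂̄f` in the direction `e`. -/
def wb (f : E → ℂ) (e z : E) : ℂ := (fderiv ℝ f z e + I * fderiv ℝ f z (I • e)) / 2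

lemma fderiv_conj {f : E → ℂ} {z : E} (hf : DifferentiableAt ℝ f z) (v : E) :
    fderiv ℝ (fun x => (starRingEnd ℂ) (f x)) z v = (starRingEnd ℂ) (fderiv ℝ f z v) := by
  have h := (conjCLE.toContinuousLinearMap.hasFDerivAt (x := f z)).comp z hf.hasFDerivAt
  have h2 : fderiv ℝ (fun x => (starRingEnd ℂ) (f x)) z
      = conjCLE.toContinuousLinearMap.comp (fderiv ℝ f z) := h.fderiv
  rw [h2]; simp

lemma wd_conj {f : E → ℂ} {z : E} (hf : DifferentiableAt ℝ f z) (e : E) :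
    wd (fun x => (starRingEnd ℂ) (f x)) e z = (starRingEnd ℂ) (wb f e z) := by
  simp only [wd, wb, fderiv_conj hf, map_div₀, map_add, map_mul, conj_I, map_ofNat]; ring

lemma wb_conj {f : E → ℂ} {z : E} (hf : DifferentiableAt ℝ f z) (e : E) :
    wb (fun x => (starRingEnd ℂ) (f x)) e z = (starRingEnd ℂ) (wd f e z) := by
  simp only [wd, wb, fderiv_conj hf, map_div₀, map_sub, map_mul, conj_I, map_ofNat]; ring

lemma wd_mul {f g : E → ℂ} {z : E} (hf : DifferentiableAt ℝ f z) (hg : DifferentiableAt ℝ g z)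
    (e : E) : wd (fun x => f x * g x) e z = wd f e z * g z + f z * wd g e z := by
  simp only [wd, fderiv_fun_mul hf hg, add_apply, smul_apply, smul_eq_mul]; ring

lemma wb_mul {f g : E → ℂ} {z : E} (hf : DifferentiableAt ℝ f z) (hg : DifferentiableAt ℝ g z)
    (e : E) : wb (fun x => f x * g x) e z = wb f e z * g z + f z * wb g e z := by
  simp only [wb, fderiv_fun_mul hf hg, add_apply, smul_apply, smul_eq_mul]; ring

lemma wd_sub {f g : E → ℂ} {z : E} (hf : DifferentiableAt ℝ f z) (hg : DifferentiableAt ℝ g z)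
    (e : E) : wd (fun x => f x - g x) e z = wd f e z - wd g e z := by
  simp only [wd, fderiv_fun_sub hf hg, sub_apply]; ring

lemma wb_sub {f g : E → ℂ} {z : E} (hf : DifferentiableAt ℝ f z) (hg : DifferentiableAt ℝ g z)
    (e : E) : wb (fun x => f x - g x) e z = wb f e z - wb g e z := by
  simp only [wb, fderiv_fun_sub hf hg, sub_apply]; ring

lemma wd_add {f g : E → ℂ} {z : E} (hf : DifferentiableAt ℝ f z) (hg : DifferentiableAt ℝ g z)
    (e : E) : wd (fun x => f x + g x) e z = wd f e z + wd g e z := by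
  simp only [wd, fderiv_fun_add hf hg, add_apply]; ring

lemma wb_add {f g : E → ℂ} {z : E} (hf : DifferentiableAt ℝ f z) (hg : DifferentiableAt ℝ g z)
    (e : E) : wb (fun x => f x + g x) e z = wb f e z + wb g e z := by
  simp only [wb, fderiv_fun_add hf hg, add_apply]; ring

lemma wd_congr {f g : E → ℂ} {z : E} (h : f =ᶠ[𝓝 z] g) (e : E) : wd f e z = wd g e z := by
  simp only [wd, h.fderiv_eq]

lemma wb_congr {f g : E → ℂ} {z : E} (h : f =ᶠ[𝓝 z] g) (e : E) : wb f e z = wb g e z := by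
  simp only [wb, h.fderiv_eq]

lemma fderiv_cexp_ofReal {φ : E → ℝ} {z : E} (hφ : DifferentiableAt ℝ φ z) (v : E) :
    fderiv ℝ (fun x => ((Real.exp (φ x) : ℝ) : ℂ)) z v
      = (Real.exp (φ z) : ℂ) * fderiv ℝ (fun x => (φ x : ℂ)) z v := by
  have h1 : HasFDerivAt (fun x => ((Real.exp (φ x) : ℝ) : ℂ))
      (ofRealCLM.comp (Real.exp (φ z) • fderiv ℝ φ z)) z :=
    ofRealCLM.hasFDerivAt.comp z hφ.hasFDerivAt.exp
  have h2 : HasFDerivAt (fun x => (φ x : ℂ)) (ofRealCLM.comp (fderiv ℝ φ z)) z :=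
    ofRealCLM.hasFDerivAt.comp z hφ.hasFDerivAt
  rw [h1.fderiv, h2.fderiv]; simp

lemma wd_exp {φ : E → ℝ} {z : E} (hφ : DifferentiableAt ℝ φ z) (e : E) :
    wd (fun x => ((Real.exp (φ x) : ℝ) : ℂ)) e z
      = (Real.exp (φ z) : ℂ) * wd (fun x => (φ x : ℂ)) e z := by
  simp only [wd, fderiv_cexp_ofReal hφ]; ring

lemma wb_exp {φ : E → ℝ} {z : E} (hφ : DifferentiableAt ℝ φ z) (e : E) :
    wb (fun x => ((Real.exp (φ x) : ℝ) : ℂ)) e z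
      = (Real.exp (φ z) : ℂ) * wb (fun x => (φ x : ℂ)) e z := by
  simp only [wb, fderiv_cexp_ofReal hφ]; ring

lemma conj_wd_ofReal {φ : E → ℝ} {z : E} (hφ : DifferentiableAt ℝ φ z) (e : E) :
    (starRingEnd ℂ) (wd (fun x => (φ x : ℂ)) e z) = wb (fun x => (φ x : ℂ)) e z := by
  have h : DifferentiableAt ℝ (fun x => (φ x : ℂ)) z := by
    exact ofRealCLM.differentiableAt.comp z hφ
  rw [← wb_conj h]; simp

lemma contDiff_wd {f : E → ℂ} (hf : ContDiff ℝ (⊤ : ℕ∞) f) (e : E) :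
    ContDiff ℝ (⊤ : ℕ∞) (wd f e) := by
  have h (v : E) : ContDiff ℝ (⊤ : ℕ∞) (fun z => fderiv ℝ f z v) :=
    (hf.fderiv_right (m := (⊤ : ℕ∞)) (by simp)).clm_apply contDiff_const
  exact ((h e).sub (contDiff_const.mul (h _))).div_const 2

lemma contDiff_wb {f : E → ℂ} (hf : ContDiff ℝ (⊤ : ℕ∞) f) (e : E) :
    ContDiff ℝ (⊤ : ℕ∞) (wb f e) := by
  have h (v : E) : ContDiff ℝ (⊤ : ℕ∞) (fun z => fderiv ℝ f z v) :=
    (hf.fderiv_right (m := (⊤ : ℕ∞)) (by simp)).clm_apply contDiff_const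
  exact ((h e).add (contDiff_const.mul (h _))).div_const 2

lemma tsupport_wd (f : E → ℂ) (e : E) : tsupport (wd f e) ⊆ tsupport f := by
  refine closure_minimal (fun z hz => ?_) (isClosed_tsupport f)
  by_contra h
  exact hz (by simp [wd, image_eq_zero_of_notMem_tsupport
    (fun hh => h (tsupport_fderiv_subset ℝ hh))])

lemma tsupport_wb (f : E → ℂ) (e : E) : tsupport (wb f e) ⊆ tsupport f := by
  refine closure_minimal (fun z hz => ?_) (isClosed_tsupport f)
  by_contra h
  exact hz (by simp [wb, image_eq_zero_of_notMem_tsupport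
    (fun hh => h (tsupport_fderiv_subset ℝ hh))])

lemma hasCompactSupport_wd {f : E → ℂ} (hf : HasCompactSupport f) (e : E) :
    HasCompactSupport (wd f e) := hf.mono' ((subset_tsupport _).trans (tsupport_wd f e))

lemma hasCompactSupport_wb {f : E → ℂ} (hf : HasCompactSupport f) (e : E) :
    HasCompactSupport (wb f e) := hf.mono' ((subset_tsupport _).trans (tsupport_wb f e))

lemma fderiv_wd {f : E → ℂ} {z : E} (hf : ContDiffAt ℝ 2 f z) (a v : E) :
    fderiv ℝ (wd f a) z v
      = (fderiv ℝ (fderiv ℝ f) z v a - I * fderiv ℝ (fderiv ℝ f) z v (I • a)) / 2 := by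
  have h : DifferentiableAt ℝ (fderiv ℝ f) z :=
    (hf.fderiv_right (m := 1) (by norm_num)).differentiableAt (by norm_num)
  have key (b : E) : HasFDerivAt (fun x => fderiv ℝ f x b)
      ((fderiv ℝ (fderiv ℝ f) z).flip b) z := by
    simpa using h.hasFDerivAt.clm_apply (hasFDerivAt_const b z)
  have := (((key a).sub ((key (I • a)).const_mul I)).mul_const (2⁻¹ : ℂ))
  have e2 : HasFDerivAt (wd f a) _ z := this.congr_of_eventuallyEq
    (Eventually.of_forall fun x => by simp [wd, div_eq_mul_inv])
  rw [e2.fderiv]; simp [div_eq_mul_inv]; ring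

lemma fderiv_wb {f : E → ℂ} {z : E} (hf : ContDiffAt ℝ 2 f z) (a v : E) :
    fderiv ℝ (wb f a) z v
      = (fderiv ℝ (fderiv ℝ f) z v a + I * fderiv ℝ (fderiv ℝ f) z v (I • a)) / 2 := by
  have h : DifferentiableAt ℝ (fderiv ℝ f) z :=
    (hf.fderiv_right (m := 1) (by norm_num)).differentiableAt (by norm_num)
  have key (b : E) : HasFDerivAt (fun x => fderiv ℝ f x b)
      ((fderiv ℝ (fderiv ℝ f) z).flip b) z := by
    simpa using h.hasFDerivAt.clm_apply (hasFDerivAt_const b z)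
  have := (((key a).add ((key (I • a)).const_mul I)).mul_const (2⁻¹ : ℂ))
  have e2 : HasFDerivAt (wb f a) _ z := this.congr_of_eventuallyEq
    (Eventually.of_forall fun x => by simp [wb, div_eq_mul_inv])
  rw [e2.fderiv]; simp [div_eq_mul_inv]; ring

lemma wb_wd_comm {f : E → ℂ} {z : E} (hf : ContDiffAt ℝ 2 f z) (a b : E) :
    wb (wd f a) b z = wd (wb f b) a z := by
  have hs : IsSymmSndFDerivAt ℝ f z := hf.isSymmSndFDerivAt (by simp)
  rw [wb, wd, fderiv_wd hf, fderiv_wd hf, fderiv_wb hf, fderiv_wb hf,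
    hs.eq a b, hs.eq a (I • b), hs.eq (I • a) b, hs.eq (I • a) (I • b)]
  ring

variable [MeasureSpace E] [BorelSpace E] [FiniteDimensional ℂ E]
  [(volume : Measure E).IsAddHaarMeasure]

lemma integral_mul_fderiv_test {f g : E → ℂ} (hf : ContDiff ℝ (⊤ : ℕ∞) f)
    (hg : ContDiff ℝ (⊤ : ℕ∞) g) (hs : HasCompactSupport f) (v : E) :
    ∫ z, f z * fderiv ℝ g z v = - ∫ z, fderiv ℝ f z v * g z := by
  have : FiniteDimensional ℝ E := FiniteDimensional.complexToReal E
  have hd {h : E → ℂ} (hh : ContDiff ℝ (⊤ : ℕ∞) h) : Continuous fun z => fderiv ℝ h z v :=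
    (hh.continuous_fderiv (by simp)).clm_apply continuous_const
  refine integral_mul_fderiv_eq_neg_fderiv_mul_of_integrable ?_ ?_ ?_
    (fun x _ => hf.differentiable (by simp) x) (fun x _ => hg.differentiable (by simp) x)
  · exact ((hd hf).mul hg.continuous).integrable_of_hasCompactSupport
      (HasCompactSupport.mul_right (hs.fderiv_apply ℝ v))
  · exact (hf.continuous.mul (hd hg)).integrable_of_hasCompactSupport hs.mul_right
  · exact (hf.continuous.mul hg.continuous).integrable_of_hasCompactSupport hs.mul_right

omit [NormedSpace ℂ E] [FiniteDimensional ℂ E] in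
lemma integrable_mul_test {f g : E → ℂ} (hf : Continuous f) (hg : Continuous g)
    (hs : HasCompactSupport f) : Integrable fun z => f z * g z :=
  (hf.mul hg).integrable_of_hasCompactSupport hs.mul_right

lemma integral_mul_wd {f g : E → ℂ} (hf : ContDiff ℝ (⊤ : ℕ∞) f)
    (hg : ContDiff ℝ (⊤ : ℕ∞) g) (hs : HasCompactSupport f) (e : E) :
    ∫ z, f z * wd g e z = - ∫ z, wd f e z * g z := by
  have : FiniteDimensional ℝ E := FiniteDimensional.complexToReal E
  have hd {h : E → ℂ} (hh : ContDiff ℝ (⊤ : ℕ∞) h) (v : E) :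
      Continuous fun z => fderiv ℝ h z v :=
    (hh.continuous_fderiv (by simp)).clm_apply continuous_const
  have i1 (v : E) := integrable_mul_test hf.continuous (hd hg v) hs
  have i2 (v : E) := integrable_mul_test (hd hf v) hg.continuous (hs.fderiv_apply ℝ v)
  have e1 : (fun z => f z * wd g e z) = fun z =>
      2⁻¹ * (f z * fderiv ℝ g z e) - (I / 2) * (f z * fderiv ℝ g z (I • e)) := by
    ext z; simp only [wd]; ring
  have e2 : (fun z => wd f e z * g z) = fun z =>
      2⁻¹ * (fderiv ℝ f z e * g z) - (I / 2) * (fderiv ℝ f z (I • e) * g z) := by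
    ext z; simp only [wd]; ring
  rw [e1, e2, integral_sub ((i1 e).const_mul _) ((i1 _).const_mul _),
    integral_sub ((i2 e).const_mul _) ((i2 _).const_mul _)]
  simp only [integral_const_mul, integral_mul_fderiv_test hf hg hs]
  ring

lemma integral_mul_wb {f g : E → ℂ} (hf : ContDiff ℝ (⊤ : ℕ∞) f)
    (hg : ContDiff ℝ (⊤ : ℕ∞) g) (hs : HasCompactSupport f) (e : E) :
    ∫ z, f z * wb g e z = - ∫ z, wb f e z * g z := by
  have : FiniteDimensional ℝ E := FiniteDimensional.complexToReal E
  have hd {h : E → ℂ} (hh : ContDiff ℝ (⊤ : ℕ∞) h) (v : E) :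
      Continuous fun z => fderiv ℝ h z v :=
    (hh.continuous_fderiv (by simp)).clm_apply continuous_const
  have i1 (v : E) := integrable_mul_test hf.continuous (hd hg v) hs
  have i2 (v : E) := integrable_mul_test (hd hf v) hg.continuous (hs.fderiv_apply ℝ v)
  have e1 : (fun z => f z * wb g e z) = fun z =>
      2⁻¹ * (f z * fderiv ℝ g z e) + (I / 2) * (f z * fderiv ℝ g z (I • e)) := by
    ext z; simp only [wb]; ring
  have e2 : (fun z => wb f e z * g z) = fun z =>
      2⁻¹ * (fderiv ℝ f z e * g z) + (I / 2) * (fderiv ℝ f z (I • e) * g z) := by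
    ext z; simp only [wb]; ring
  rw [e1, e2, integral_add ((i1 e).const_mul _) ((i1 _).const_mul _),
    integral_add ((i2 e).const_mul _) ((i2 _).const_mul _)]
  simp only [integral_const_mul, integral_mul_fderiv_test hf hg hs]
  ring

/-- The Chern-connection derivative `∂f - ∂Φ f`, adjoint to `∂̄` for the weight `e^{-Φ}`. -/
def chern (Φ : E → ℝ) (f : E → ℂ) (e z : E) : ℂ :=
  wd f e z - wd (fun x => (Φ x : ℂ)) e z * f z

lemma integral_chern_mul_conj_chern {Φ : E → ℝ} (hΦ : ContDiff ℝ (⊤ : ℕ∞) Φ) {f g : E → ℂ}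
    (hf : ContDiff ℝ (⊤ : ℕ∞) f) (hg : ContDiff ℝ (⊤ : ℕ∞) g)
    (hfs : HasCompactSupport f) (a b : E) :
    ∫ z, chern Φ f a z * (starRingEnd ℂ) (chern Φ g b z) * (Real.exp (-Φ z) : ℂ)
      = (∫ z, wb f b z * (starRingEnd ℂ) (wb g a z) * (Real.exp (-Φ z) : ℂ))
        + ∫ z, wb (wd (fun x => (Φ x : ℂ)) a) b z * f z * (starRingEnd ℂ) (g z)
          * (Real.exp (-Φ z) : ℂ) := by
  set P : E → ℂ := fun x => (Φ x : ℂ) with hP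
  set W : E → ℂ := fun x => ((Real.exp (-Φ x) : ℝ) : ℂ) with hW
  have cP : ContDiff ℝ (⊤ : ℕ∞) P := ofRealCLM.contDiff.comp hΦ
  have cW : ContDiff ℝ (⊤ : ℕ∞) W := ofRealCLM.contDiff.comp hΦ.neg.exp
  have cg : ContDiff ℝ (⊤ : ℕ∞) fun x => (starRingEnd ℂ) (g x) :=
    conjCLE.toContinuousLinearMap.contDiff.comp hg
  have ca : ContDiff ℝ (⊤ : ℕ∞) (chern Φ f a) :=
    (contDiff_wd hf a).sub ((contDiff_wd cP a).mul hf)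
  have csa : HasCompactSupport (chern Φ f a) :=
    (hasCompactSupport_wd hfs a).sub hfs.mul_left
  have df {h : E → ℂ} (hh : ContDiff ℝ (⊤ : ℕ∞) h) (z : E) : DifferentiableAt ℝ h z :=
    hh.differentiable (by simp) z
  have dΦ (z : E) : DifferentiableAt ℝ Φ z := hΦ.differentiable (by simp) z
  have wP (e z : E) : (starRingEnd ℂ) (wd P e z) = wb P e z := conj_wd_ofReal (dΦ z) e
  have wP' (e z : E) : (starRingEnd ℂ) (wb P e z) = wd P e z := by rw [← wP]; simp
  have negP : (fun x => ((-Φ x : ℝ) : ℂ)) = fun x => (fun _ => (0 : ℂ)) x - P x := by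
    ext x; simp [hP]
  have wdW (e z : E) : wd W e z = - (W z * wd P e z) := by
    rw [hW, wd_exp (φ := fun x => -Φ x) (dΦ z).neg, negP, wd_sub (by fun_prop) (df cP z)]
    simp [wd]
  have wbW (e z : E) : wb W e z = - (W z * wb P e z) := by
    rw [hW, wb_exp (φ := fun x => -Φ x) (dΦ z).neg, negP, wb_sub (by fun_prop) (df cP z)]
    simp [wb]
  have e1 : (fun z => chern Φ f a z * (starRingEnd ℂ) (chern Φ g b z) * W z)
      = fun z => chern Φ f a z * wb (fun x => (starRingEnd ℂ) (g x) * W x) b z := by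
    ext z
    rw [wb_mul (df cg z) (df cW z), wb_conj (df hg z), wbW]
    simp only [chern, map_sub, map_mul, ← hP, wP]
    ring
  have e2 (z : E) : wb (chern Φ f a) b z = wd (wb f b) a z
      - (wb (wd P a) b z * f z + wd P a z * wb f b z) := by
    have : chern Φ f a = fun x => wd f a x - wd P a x * f x := rfl
    rw [this, wb_sub (df (contDiff_wd hf a) z) (df ((contDiff_wd cP a).mul hf) z),
      wb_mul (df (contDiff_wd cP a) z) (df hf z), 
      wb_wd_comm (contDiff_infty.1 hf 2).contDiffAt]
  have e3 (z : E) : wd (fun x => (starRingEnd ℂ) (g x) * W x) a z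
      = (starRingEnd ℂ) (wb g a z) * W z - (starRingEnd ℂ) (g z) * W z * wd P a z := by
    rw [wd_mul (df cg z) (df cW z), wd_conj (df hg z), wdW]; ring
  have cgW : ContDiff ℝ (⊤ : ℕ∞) fun x => (starRingEnd ℂ) (g x) * W x := cg.mul cW
  have cwbf := contDiff_wb hf b
  have cwbg : Continuous fun z => (starRingEnd ℂ) (wb g a z) :=
    continuous_conj.comp (contDiff_wb hg a).continuous
  have swbf := hasCompactSupport_wb hfs b
  rw [e1, integral_mul_wb ca cgW csa b]
  have e4 : (fun z => wb (chern Φ f a) b z * ((starRingEnd ℂ) (g z) * W z))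
      = fun z => wd (wb f b) a z * ((starRingEnd ℂ) (g z) * W z)
        - (wb (wd P a) b z * f z * (starRingEnd ℂ) (g z) * W z
          + wb f b z * (wd P a z * ((starRingEnd ℂ) (g z) * W z))) := by
    ext z; rw [e2]; ring
  have j1 : Integrable fun z => wd (wb f b) a z * ((starRingEnd ℂ) (g z) * W z) :=
    integrable_mul_test (contDiff_wd cwbf a).continuous cgW.continuous
      (hasCompactSupport_wd swbf a)
  have j2 : Integrable fun z => wb (wd P a) b z * f z * (starRingEnd ℂ) (g z) * W z := by
    have := integrable_mul_test hf.continuous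
      (((contDiff_wb (contDiff_wd cP a) b).continuous).mul cgW.continuous) hfs
    exact this.congr (Eventually.of_forall fun z => by simp only [Pi.mul_apply]; ring)
  have j3 : Integrable fun z => wb f b z * (wd P a z * ((starRingEnd ℂ) (g z) * W z)) :=
    integrable_mul_test cwbf.continuous ((contDiff_wd cP a).continuous.mul cgW.continuous) swbf
  have j4 : Integrable fun z => wb f b z * (starRingEnd ℂ) (wb g a z) * W z := by
    have := integrable_mul_test cwbf.continuous (cwbg.mul cW.continuous) swbf
    exact this.congr (Eventually.of_forall fun z => by simp only [Pi.mul_apply]; ring)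
  have e5 := integral_mul_wd cwbf cgW swbf a
  have e6 : (fun z => wb f b z * wd (fun x => (starRingEnd ℂ) (g x) * W x) a z)
      = fun z => wb f b z * (starRingEnd ℂ) (wb g a z) * W z
        - wb f b z * (wd P a z * ((starRingEnd ℂ) (g z) * W z)) := by
    ext z; rw [e3]; ring
  rw [e6, integral_sub j4 j3] at e5
  have j23 : Integrable fun z => wb (wd P a) b z * f z * (starRingEnd ℂ) (g z) * W z
      + wb f b z * (wd P a z * ((starRingEnd ℂ) (g z) * W z)) := j2.add j3
  rw [e4, integral_sub j1 j23, integral_add j2 j3]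
  linear_combination -e5

end Wirtinger

section Mollification

variable {E : Type*} [NormedAddCommGroup E] [NormedSpace ℂ E]
  [MeasureSpace E] [BorelSpace E] [FiniteDimensional ℂ E]
  [(volume : Measure E).IsAddHaarMeasure]

/-- A smooth circle-invariant mollifying kernel supported in the ball of radius `r`. -/
structure IsMollifier (ρ : E → ℝ) (r : ℝ) : Prop where
  smooth : ContDiff ℝ (⊤ : ℕ∞) ρ
  nonneg : ∀ x, 0 ≤ ρ x
  integral_eq_one : ∫ x, ρ x = 1
  norm_le : ∀ x, ρ x ≠ 0 → ‖x‖ ≤ r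
  circle : ∀ (c : ℂ), ‖c‖ = 1 → ∀ x, ρ (c • x) = ρ x

omit [(volume : Measure E).IsAddHaarMeasure] [BorelSpace E] in
lemma IsMollifier.hasCompactSupport {ρ : E → ℝ} {r : ℝ} (h : IsMollifier ρ r) :
    HasCompactSupport ρ := by
  have : ProperSpace E := FiniteDimensional.proper ℂ E
  exact HasCompactSupport.intro (isCompact_closedBall (0 : E) r) fun x hx => by
    by_contra h2
    exact hx (by simpa using h.norm_le x h2)

omit [BorelSpace E] [FiniteDimensional ℂ E] [(volume : Measure E).IsAddHaarMeasure] in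
lemma IsMollifier.mono {ρ : E → ℝ} {r r' : ℝ} (h : IsMollifier ρ r) (hr : r ≤ r') :
    IsMollifier ρ r' :=
  { h with norm_le := fun x hx => (h.norm_le x hx).trans hr }

variable (E) in
lemma exists_isMollifier {r : ℝ} (hr : 0 < r) : ∃ ρ : E → ℝ, IsMollifier ρ r := by
  obtain ⟨L⟩ : Nonempty (E ≃L[ℂ] EuclideanSpace ℂ (Fin (Module.finrank ℂ E))) :=
    ⟨ContinuousLinearEquiv.ofFinrankEq (by simp)⟩
  obtain ⟨C, hC0, hC⟩ : ∃ C > 0, ∀ x : E, ‖x‖ ≤ C * ‖L x‖ := by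
    refine ⟨‖L.symm.toContinuousLinearMap‖ + 1, by positivity, fun x => ?_⟩
    have := L.symm.toContinuousLinearMap.le_opNorm (L x)
    simp only [ContinuousLinearEquiv.coe_coe, ContinuousLinearEquiv.symm_apply_apply] at this
    nlinarith [norm_nonneg (L x)]
  set g : E → ℝ := fun x => Real.smoothTransition (1 - (C / r) ^ 2 * ‖L x‖ ^ 2) with hg
  have gs : ContDiff ℝ (⊤ : ℕ∞) g := by
    refine Real.smoothTransition.contDiff.comp (contDiff_const.sub (contDiff_const.mul ?_))
    exact (contDiff_norm_sq ℂ).comp (L.contDiff.restrict_scalars ℝ)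
  have g0 (x : E) : 0 ≤ g x := Real.smoothTransition.nonneg _
  have gn (x : E) (hx : g x ≠ 0) : ‖x‖ ≤ r := by
    by_contra! h
    refine hx (Real.smoothTransition.zero_of_nonpos ?_)
    have h1 : r < C * ‖L x‖ := h.trans_le (hC x)
    have h2 : 1 < C / r * ‖L x‖ := by
      rw [div_mul_eq_mul_div, lt_div_iff₀ hr]; linarith
    nlinarith
  have gc : HasCompactSupport g := by
    have : ProperSpace E := FiniteDimensional.proper ℂ E
    exact HasCompactSupport.intro (isCompact_closedBall (0 : E) r) fun x hx => by
      by_contra h2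
      exact hx (by simpa using gn x h2)
  have gp : 0 < ∫ x, g x := by
    refine gs.continuous.integral_pos_of_hasCompactSupport_nonneg_nonzero gc g0 (x := 0) ?_
    simp [hg]
  refine ⟨fun x => (∫ x, g x)⁻¹ * g x, contDiff_const.mul gs,
    fun x => mul_nonneg (inv_nonneg.2 gp.le) (g0 x), ?_, fun x hx => gn x ?_, fun c hc x => ?_⟩
  · rw [integral_const_mul, inv_mul_cancel₀ gp.ne']
  · exact fun h => hx (by simp [h])
  · simp [hg, norm_smul, hc]

variable {F : Type*} [NormedAddCommGroup F] [NormedSpace ℝ F]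

/-- The mollification `ρ * f`. -/
def moll (ρ : E → ℝ) (f : E → F) : E → F :=
  convolution ρ f (ContinuousLinearMap.lsmul ℝ ℝ) volume

lemma moll_apply (ρ : E → ℝ) (f : E → F) (x : E) : moll ρ f x = ∫ t, ρ t • f (x - t) := rfl

lemma moll_apply' (ρ : E → ℝ) (f : E → F) (x : E) : moll ρ f x = ∫ t, ρ (x - t) • f t :=
  convolution_lsmul_swap

lemma contDiff_moll [CompleteSpace F] {ρ : E → ℝ} {r : ℝ} (hρ : IsMollifier ρ r) {f : E → F}
    (hf : LocallyIntegrable f volume) : ContDiff ℝ (⊤ : ℕ∞) (moll ρ f) :=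
  hρ.hasCompactSupport.contDiff_convolution_left _ hρ.smooth hf

lemma exists_of_moll_ne_zero {ρ : E → ℝ} {r : ℝ} (hρ : IsMollifier ρ r) {f : E → F} {x : E}
    (h : moll ρ f x ≠ 0) : ∃ y, f y ≠ 0 ∧ ‖x - y‖ ≤ r := by
  by_contra! h2
  refine h ?_
  rw [moll_apply']
  refine integral_eq_zero_of_ae (Eventually.of_forall fun t => ?_)
  by_cases ht : f t = 0
  · simp [ht]
  · have := h2 t ht
    have h3 : ρ (x - t) = 0 := by
      by_contra h4
      exact absurd (hρ.norm_le _ h4) (not_le.2 this)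
    simp [h3]

lemma hasCompactSupport_moll {ρ : E → ℝ} {r : ℝ} (hρ : IsMollifier ρ r) {f : E → F}
    (hf : HasCompactSupport f) : HasCompactSupport (moll ρ f) :=
  hρ.hasCompactSupport.convolution _ hf

lemma fderiv_moll [CompleteSpace F] {ρ : E → ℝ} {r : ℝ} (hρ : IsMollifier ρ r) {f : E → F}
    (hf : LocallyIntegrable f volume) (x v : E) :
    fderiv ℝ (moll ρ f) x v = ∫ t, fderiv ℝ ρ (x - t) v • f t := by
  have h := hρ.hasCompactSupport.hasFDerivAt_convolution_left (ContinuousLinearMap.lsmul ℝ ℝ)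
    (hρ.smooth.of_le (by simp)) hf x
  have hi := (hρ.hasCompactSupport.fderiv ℝ).convolutionExists_left
    ((ContinuousLinearMap.lsmul ℝ ℝ : ℝ →L[ℝ] F →L[ℝ] F).precompL E)
    (hρ.smooth.continuous_fderiv (by simp)) hf x
  have hi' := hi.integrable_swap
  unfold moll
  rw [h.fderiv, convolution_eq_swap, ContinuousLinearMap.integral_apply hi']
  rfl

lemma fderiv_ofReal_comp_sub {ρ : E → ℝ} {r : ℝ} (hρ : IsMollifier ρ r) (x t v : E) :
    fderiv ℝ (fun y => (ρ (x - y) : ℂ)) t v = -(fderiv ℝ ρ (x - t) v : ℂ) := by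
  have h1 : HasFDerivAt (fun y => x - y) (-ContinuousLinearMap.id ℝ E) t := by
    simpa using (hasFDerivAt_id (𝕜 := ℝ) t).const_sub x
  have h2 : HasFDerivAt ρ (fderiv ℝ ρ (x - t)) (x - t) :=
    (hρ.smooth.differentiable (by simp) _).hasFDerivAt
  have h3 := ofRealCLM.hasFDerivAt.comp t (h2.comp t h1)
  have h4 : HasFDerivAt (fun y => (ρ (x - y) : ℂ)) _ t := h3
  rw [h4.fderiv]
  simp

lemma integrable_fderiv_mul {ρ : E → ℝ} {r : ℝ} (hρ : IsMollifier ρ r) {f : E → ℂ}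
    (hf : LocallyIntegrable f volume) (x v : E) :
    Integrable fun t => (fderiv ℝ ρ (x - t) v : ℂ) * f t := by
  have c : Continuous fun t => fderiv ℝ ρ (x - t) v :=
    ((hρ.smooth.continuous_fderiv (by simp)).comp (continuous_const.sub continuous_id)).clm_apply
      continuous_const
  have cs : HasCompactSupport fun t => fderiv ℝ ρ (x - t) v :=
    (hρ.hasCompactSupport.fderiv_apply ℝ v).comp_homeomorph (Homeomorph.subLeft x)
  have := hf.integrable_smul_left_of_hasCompactSupport c cs
  exact this

lemma wd_moll {ρ : E → ℝ} {r : ℝ} (hρ : IsMollifier ρ r) {f : E → ℂ}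
    (hf : LocallyIntegrable f volume) (e x : E) :
    wd (moll ρ f) e x = -∫ t, f t * wd (fun y => (ρ (x - y) : ℂ)) e t := by
  have e1 : (fun t => f t * wd (fun y => (ρ (x - y) : ℂ)) e t) = fun t =>
      -(2⁻¹ * ((fderiv ℝ ρ (x - t) e : ℂ) * f t))
        + I / 2 * ((fderiv ℝ ρ (x - t) (I • e) : ℂ) * f t) := by
    ext t; simp only [wd, fderiv_ofReal_comp_sub hρ]; ring
  have i1 (v : E) := integrable_fderiv_mul hρ hf x v
  have i2 : Integrable fun t => -(2⁻¹ * ((fderiv ℝ ρ (x - t) e : ℂ) * f t)) :=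
    ((i1 e).const_mul _).neg
  rw [e1, integral_add i2 ((i1 _).const_mul _), integral_neg,
    integral_const_mul, integral_const_mul, wd, fderiv_moll hρ hf, fderiv_moll hρ hf]
  simp only [real_smul]
  ring

lemma wb_moll {ρ : E → ℝ} {r : ℝ} (hρ : IsMollifier ρ r) {f : E → ℂ}
    (hf : LocallyIntegrable f volume) (e x : E) :
    wb (moll ρ f) e x = -∫ t, f t * wb (fun y => (ρ (x - y) : ℂ)) e t := by
  have e1 : (fun t => f t * wb (fun y => (ρ (x - y) : ℂ)) e t) = fun t =>
      -(2⁻¹ * ((fderiv ℝ ρ (x - t) e : ℂ) * f t))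
        - I / 2 * ((fderiv ℝ ρ (x - t) (I • e) : ℂ) * f t) := by
    ext t; simp only [wb, fderiv_ofReal_comp_sub hρ]; ring
  have i1 (v : E) := integrable_fderiv_mul hρ hf x v
  have i2 : Integrable fun t => -(2⁻¹ * ((fderiv ℝ ρ (x - t) e : ℂ) * f t)) :=
    ((i1 e).const_mul _).neg
  rw [e1, integral_sub i2 ((i1 _).const_mul _), integral_neg,
    integral_const_mul, integral_const_mul, wb, fderiv_moll hρ hf, fderiv_moll hρ hf]
  simp only [real_smul]
  ring

lemma tendsto_eLpNorm_translate {f : E → ℂ} (hf : MemLp f 2 volume) :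
    Tendsto (fun t : E => eLpNorm (fun x => f (x - t) - f x) 2 volume) (𝓝 0) (𝓝 0) := by
  let g : C(E, C(E, E)) := ContinuousMap.curry ⟨fun p : E × E => p.2 - p.1, by fun_prop⟩
  have hgm (t : E) : MeasurePreserving (g t) volume volume :=
    measurePreserving_sub_right volume t
  have : ProperSpace E := FiniteDimensional.proper ℂ E
  have : Fact ((1 : ℝ≥0∞) ≤ 2) := ⟨by norm_num⟩
  have h1 : Continuous fun t => Lp.compMeasurePreserving (g t) (hgm t) (hf.toLp f) :=
    continuous_const.compMeasurePreservingLp g.continuous hgm (by norm_num)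
  have h2 := (h1.edist (continuous_const (y := hf.toLp f))).tendsto (0 : E)
  have h3 : (fun t => edist (Lp.compMeasurePreserving (g t) (hgm t) (hf.toLp f)) (hf.toLp f))
      = fun t : E => eLpNorm (fun x => f (x - t) - f x) 2 volume := by
    ext t
    rw [Lp.toLp_compMeasurePreserving, Lp.edist_toLp_toLp]
    rfl
  rw [h3, congrFun h3 0] at h2
  simpa using h2

lemma enorm_moll_sub_sq_le {ρ : E → ℝ} {r : ℝ} (hρ : IsMollifier ρ r) {f : E → ℂ}
    (hf : MemLp f 2 volume) (x : E) :
    ‖moll ρ f x - f x‖ₑ ^ (2 : ℝ)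
      ≤ ∫⁻ t, ENNReal.ofReal (ρ t) * ‖f (x - t) - f x‖ₑ ^ (2 : ℝ) := by
  have hloc : LocallyIntegrable f volume := hf.locallyIntegrable (by norm_num)
  have hρi : Integrable ρ :=
    hρ.smooth.continuous.integrable_of_hasCompactSupport hρ.hasCompactSupport
  have hi1 : Integrable fun t => ρ t • f (x - t) := by
    have := hρ.hasCompactSupport.convolutionExists_left (ContinuousLinearMap.lsmul ℝ ℝ)
      hρ.smooth.continuous hloc x
    exact this.integrable
  have e1 : moll ρ f x - f x = ∫ t, ρ t • (f (x - t) - f x) := by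
    simp only [smul_sub]
    rw [integral_sub hi1 (hρi.smul_const _), integral_smul_const, hρ.integral_eq_one, one_smul]
    rfl
  have hρ1 : ∫⁻ t, ENNReal.ofReal (ρ t) = 1 := by
    rw [← ofReal_integral_eq_lintegral_ofReal hρi (Eventually.of_forall hρ.nonneg),
      hρ.integral_eq_one, ENNReal.ofReal_one]
  have hm : AEMeasurable (fun t => ‖f (x - t) - f x‖ₑ) volume := by
    have : AEStronglyMeasurable (fun t => f (x - t)) volume :=
      hf.1.comp_measurePreserving (Measure.measurePreserving_sub_left volume x)
    exact (this.sub aestronglyMeasurable_const).enorm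
  have hmρ : Measurable fun t => ENNReal.ofReal (ρ t) := hρ.smooth.continuous.measurable.ennreal_ofReal
  have h2 : ‖moll ρ f x - f x‖ₑ ≤ ∫⁻ t, (ENNReal.ofReal (ρ t)) ^ (1 / 2 : ℝ)
      * ((ENNReal.ofReal (ρ t)) ^ (1 / 2 : ℝ) * ‖f (x - t) - f x‖ₑ) := by
    rw [e1]
    refine (enorm_integral_le_lintegral_enorm _).trans (le_of_eq (lintegral_congr fun t => ?_))
    rw [enorm_smul, ← mul_assoc, ← ENNReal.rpow_add_of_nonneg _ _ (by norm_num) (by norm_num),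
      Real.enorm_eq_ofReal (hρ.nonneg t)]
    norm_num
  have h3 := ENNReal.lintegral_mul_le_Lp_mul_Lq volume
    (Real.HolderConjugate.two_two)
    (hmρ.pow_const (1 / 2 : ℝ)).aemeasurable
    ((hmρ.pow_const (1 / 2 : ℝ)).aemeasurable.mul hm)
  have h4 := h2.trans h3
  simp only [Pi.mul_apply, ← ENNReal.rpow_mul, ENNReal.mul_rpow_of_nonneg _ _ (zero_le_two (α := ℝ))] at h4
  norm_num [hρ1] at h4
  calc ‖moll ρ f x - f x‖ₑ ^ (2 : ℝ) ≤ _ := ENNReal.rpow_le_rpow h4 (by norm_num)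
    _ = _ := by rw [← ENNReal.rpow_mul]; norm_num

lemma eLpNorm_moll_sub_le {ρ : E → ℝ} {r : ℝ} (hρ : IsMollifier ρ r) {f : E → ℂ}
    (hf : MemLp f 2 volume) {ε : ℝ≥0∞}
    (hε : ∀ t : E, ‖t‖ ≤ r → eLpNorm (fun x => f (x - t) - f x) 2 volume ≤ ε) :
    eLpNorm (fun x => moll ρ f x - f x) 2 volume ≤ ε := by
  have : ProperSpace E := FiniteDimensional.proper ℂ E
  have hρi : Integrable ρ :=
    hρ.smooth.continuous.integrable_of_hasCompactSupport hρ.hasCompactSupport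
  have hρ1 : ∫⁻ t, ENNReal.ofReal (ρ t) = 1 := by
    rw [← ofReal_integral_eq_lintegral_ofReal hρi (Eventually.of_forall hρ.nonneg),
      hρ.integral_eq_one, ENNReal.ofReal_one]
  have hmρ : Measurable fun t => ENNReal.ofReal (ρ t) := hρ.smooth.continuous.measurable.ennreal_ofReal
  have hs (t : E) : eLpNorm (fun x => f (x - t) - f x) 2 volume
      = (∫⁻ x, ‖f (x - t) - f x‖ₑ ^ (2 : ℝ)) ^ (1 / 2 : ℝ) := by
    rw [eLpNorm_eq_lintegral_rpow_enorm_toReal (by norm_num) (by norm_num)]; norm_num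
  have hs2 (t : E) (ht : ‖t‖ ≤ r) : ∫⁻ x, ‖f (x - t) - f x‖ₑ ^ (2 : ℝ) ≤ ε ^ (2 : ℝ) := by
    have := ENNReal.rpow_le_rpow (hε t ht) (z := 2) (by norm_num)
    rwa [hs, ← ENNReal.rpow_mul, show (1 / 2 : ℝ) * 2 = 1 by norm_num, ENNReal.rpow_one] at this
  have hmm : AEMeasurable (fun p : E × E => ENNReal.ofReal (ρ p.2)
      * ‖f (p.1 - p.2) - f p.1‖ₑ ^ (2 : ℝ)) (volume.prod volume) := by
    have h1 : AEStronglyMeasurable (fun p : E × E => f (p.1 - p.2)) (volume.prod volume) :=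
      hf.1.comp_quasiMeasurePreserving (quasiMeasurePreserving_sub volume volume)
    have h2 : AEStronglyMeasurable (fun p : E × E => f p.1) (volume.prod volume) := hf.1.comp_fst
    exact (hmρ.comp measurable_snd).aemeasurable.mul ((h1.sub h2).enorm.pow_const _)
  rw [eLpNorm_eq_lintegral_rpow_enorm_toReal (by norm_num) (by norm_num)]
  norm_num
  have key : ∫⁻ x, ‖moll ρ f x - f x‖ₑ ^ (2 : ℝ) ≤ ε ^ (2 : ℝ) := by
    calc ∫⁻ x, ‖moll ρ f x - f x‖ₑ ^ (2 : ℝ)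
        ≤ ∫⁻ x, ∫⁻ t, ENNReal.ofReal (ρ t) * ‖f (x - t) - f x‖ₑ ^ (2 : ℝ) :=
          lintegral_mono fun x => enorm_moll_sub_sq_le hρ hf x
      _ = ∫⁻ t, ∫⁻ x, ENNReal.ofReal (ρ t) * ‖f (x - t) - f x‖ₑ ^ (2 : ℝ) :=
          lintegral_lintegral_swap hmm
      _ ≤ ∫⁻ t, ENNReal.ofReal (ρ t) * ε ^ (2 : ℝ) := by
          refine lintegral_mono fun t => ?_
          rw [lintegral_const_mul' _ _ ENNReal.ofReal_ne_top]
          by_cases h : ρ t = 0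
          · simp [h]
          · exact mul_le_mul_right (hs2 t (hρ.norm_le t h)) _
      _ = ε ^ (2 : ℝ) := by rw [lintegral_mul_const _ hmρ, hρ1, one_mul]
  have := ENNReal.rpow_le_rpow key (z := 1 / 2) (by norm_num)
  rw [← ENNReal.rpow_mul ε] at this
  norm_num at this
  exact this

variable (E) in
/-- A fixed sequence of mollifiers. -/
lemma exists_mollifier_seq : ∃ ρ : ℕ → E → ℝ, ∀ n, IsMollifier (ρ n) (1 / ((n : ℝ) + 1)) := by
  choose ρ hρ using fun n : ℕ => exists_isMollifier E (r := 1 / ((n : ℝ) + 1)) (by positivity)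
  exact ⟨ρ, hρ⟩

lemma tendsto_eLpNorm_moll {ρ : ℕ → E → ℝ} (hρ : ∀ n, IsMollifier (ρ n) (1 / ((n : ℝ) + 1)))
    {f : E → ℂ} (hf : MemLp f 2 volume) :
    Tendsto (fun n => eLpNorm (fun x => moll (ρ n) f x - f x) 2 volume) atTop (𝓝 0) := by
  rw [ENNReal.tendsto_nhds_zero]
  intro ε hε
  have h1 := (ENNReal.tendsto_nhds_zero.1 (tendsto_eLpNorm_translate hf)) ε hε
  obtain ⟨r, hr, h2⟩ := Metric.eventually_nhds_iff.1 h1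
  have h3 : ∀ᶠ n : ℕ in atTop, 1 / ((n : ℝ) + 1) < r :=
    tendsto_one_div_add_atTop_nhds_zero_nat.eventually_lt_const hr
  filter_upwards [h3] with n hn
  exact eLpNorm_moll_sub_le (hρ n) hf fun t ht => h2 (by simpa using ht.trans_lt hn)

end Mollification

section BasicEstimate

variable {E : Type*} [NormedAddCommGroup E] [NormedSpace ℂ E]
  [MeasureSpace E] [BorelSpace E] [FiniteDimensional ℂ E]
  [(volume : Measure E).IsAddHaarMeasure]

lemma re_sum_mul_conj_swap {ι : Type*} [Fintype ι] (A : ι → ι → ℂ) :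
    -(1 / 2 * ∑ j, ∑ k, ‖A j k - A k j‖ ^ 2)
      ≤ (∑ j, ∑ k, A j k * (starRingEnd ℂ) (A k j)).re := by
  have h (j k : ι) : ‖A j k - A k j‖ ^ 2 = ‖A j k‖ ^ 2 + ‖A k j‖ ^ 2
      - 2 * (A j k * (starRingEnd ℂ) (A k j)).re := by
    rw [← normSq_eq_norm_sq, normSq_sub, normSq_eq_norm_sq, normSq_eq_norm_sq]
  have h1 : ∑ j, ∑ k, ‖A k j‖ ^ 2 = ∑ j, ∑ k, ‖A j k‖ ^ 2 := Finset.sum_comm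
  have h2 : 0 ≤ ∑ j, ∑ k, ‖A j k‖ ^ 2 := by positivity
  simp only [h, Finset.sum_sub_distrib, Finset.sum_add_distrib, h1, ← Finset.mul_sum, re_sum]
  linarith

lemma hasCompactSupport_sum {X F ι : Type*} [TopologicalSpace X] [NormedAddCommGroup F]
    [Fintype ι] {f : ι → X → F} (hf : ∀ j, HasCompactSupport (f j)) :
    HasCompactSupport fun z => ∑ j, f j z := by
  classical
  have : ∀ t : Finset ι, HasCompactSupport fun z => ∑ j ∈ t, f j z := by
    intro t
    induction t using Finset.induction_on with
    | empty => simpa [Pi.zero_def] using (HasCompactSupport.zero (α := X) (β := F))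
    | insert a t ha ih =>
      simp only [Finset.sum_insert ha]
      exact (hf a).add ih
  exact this _

/-- The Kohn–Morrey–Hörmander estimate for test forms, with a twist by `s`. -/
lemma basic_estimate {ι : Type*} [Fintype ι] (e : ι → E) {Φ s : E → ℝ} {δ : ℝ}
    (hΦ : ContDiff ℝ (⊤ : ℕ∞) Φ) (hs : ContDiff ℝ (⊤ : ℕ∞) s) {α : ι → E → ℂ}
    (hα : ∀ j, ContDiff ℝ (⊤ : ℕ∞) (α j)) (hαs : ∀ j, HasCompactSupport (α j))
    (hL : ∀ z, (∃ j, α j z ≠ 0) → ∀ ξ : ι → ℂ,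
      δ * ∑ j, ‖ξ j‖ ^ 2 + 2 * ‖∑ j, wd (fun x => (s x : ℂ)) (e j) z * ξ j‖ ^ 2
        ≤ (∑ j, ∑ k, wb (wd (fun x => (Φ x : ℂ)) (e j)) (e k) z * ξ j
            * (starRingEnd ℂ) (ξ k)).re) :
    δ * ∫ z, (∑ j, ‖α j z‖ ^ 2) * Real.exp (-Φ z)
      ≤ 2 * (∫ z, ‖∑ j, (wd (α j) (e j) z - (wd (fun x => (Φ x : ℂ)) (e j) z
            - wd (fun x => (s x : ℂ)) (e j) z) * α j z)‖ ^ 2 * Real.exp (-Φ z))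
        + 1 / 2 * ∫ z, (∑ j, ∑ k, ‖wb (α j) (e k) z - wb (α k) (e j) z‖ ^ 2)
            * Real.exp (-Φ z) := by
  set P : E → ℂ := fun x => (Φ x : ℂ) with hP
  set S : E → ℂ := fun x => (s x : ℂ) with hS
  have cP : ContDiff ℝ (⊤ : ℕ∞) P := ofRealCLM.contDiff.comp hΦ
  have cS : ContDiff ℝ (⊤ : ℕ∞) S := ofRealCLM.contDiff.comp hs
  have cW : Continuous fun z => Real.exp (-Φ z) := hΦ.continuous.neg.rexp
  have cWc : Continuous fun z => ((Real.exp (-Φ z) : ℝ) : ℂ) := continuous_ofReal.comp cW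
  have cwd (j : ι) := (contDiff_wd (hα j) (e j)).continuous
  have cwb (j k : ι) := (contDiff_wb (hα j) (e k)).continuous
  have cα (j : ι) := (hα j).continuous
  have cwP (j : ι) := (contDiff_wd cP (e j)).continuous
  have cwS (j : ι) := (contDiff_wd cS (e j)).continuous
  have cPP (j k : ι) := (contDiff_wb (contDiff_wd cP (e j)) (e k)).continuous
  have cch (j : ι) : Continuous (chern Φ (α j) (e j)) := (cwd j).sub ((cwP j).mul (cα j))
  have sch (j : ι) : HasCompactSupport (chern Φ (α j) (e j)) :=
    (hasCompactSupport_wd (hαs j) _).sub (hαs j).mul_left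
  set W : E → ℂ := fun z => ((Real.exp (-Φ z) : ℝ) : ℂ) with hW
  have int1 (j k : ι) : Integrable fun z =>
      chern Φ (α j) (e j) z * (starRingEnd ℂ) (chern Φ (α k) (e k) z) * W z :=
    (((cch j).mul (continuous_conj.comp (cch k))).mul cWc).integrable_of_hasCompactSupport
      (((sch j).mul_right).mul_right)
  have int2 (j k : ι) : Integrable fun z =>
      wb (α j) (e k) z * (starRingEnd ℂ) (wb (α k) (e j) z) * W z :=
    (((cwb j k).mul (continuous_conj.comp (cwb k j))).mul cWc).integrable_of_hasCompactSupport
      (((hasCompactSupport_wb (hαs j) _).mul_right).mul_right)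
  have int3 (j k : ι) : Integrable fun z =>
      wb (wd P (e j)) (e k) z * α j z * (starRingEnd ℂ) (α k z) * W z :=
    ((((cPP j k).mul (cα j)).mul (continuous_conj.comp (cα k))).mul
      cWc).integrable_of_hasCompactSupport ((((hαs j).mul_left).mul_right).mul_right)
  set q : E → ℂ := fun z => ∑ j, ∑ k,
    (chern Φ (α j) (e j) z * (starRingEnd ℂ) (chern Φ (α k) (e k) z) * W z
      - wb (α j) (e k) z * (starRingEnd ℂ) (wb (α k) (e j) z) * W z
      - wb (wd P (e j)) (e k) z * α j z * (starRingEnd ℂ) (α k z) * W z) with hq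
  have int123 (j k : ι) : Integrable fun z =>
      chern Φ (α j) (e j) z * (starRingEnd ℂ) (chern Φ (α k) (e k) z) * W z
      - wb (α j) (e k) z * (starRingEnd ℂ) (wb (α k) (e j) z) * W z
      - wb (wd P (e j)) (e k) z * α j z * (starRingEnd ℂ) (α k z) * W z :=
    ((int1 j k).sub (int2 j k)).sub (int3 j k)
  have int_k (j : ι) := integrable_finsetSum Finset.univ fun k _ => int123 j k
  have intq : Integrable q := integrable_finsetSum Finset.univ fun j _ => int_k j
  have q0 : ∫ z, q z = 0 := by
    simp only [hq]
    rw [integral_finsetSum _ fun j _ => int_k j]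
    refine Finset.sum_eq_zero fun j _ => ?_
    rw [integral_finsetSum _ fun k _ => int123 j k]
    refine Finset.sum_eq_zero fun k _ => ?_
    have i12 : Integrable fun z => chern Φ (α j) (e j) z
        * (starRingEnd ℂ) (chern Φ (α k) (e k) z) * W z
      - wb (α j) (e k) z * (starRingEnd ℂ) (wb (α k) (e j) z) * W z := (int1 j k).sub (int2 j k)
    rw [integral_sub i12 (int3 j k), integral_sub (int1 j k) (int2 j k),
      integral_chern_mul_conj_chern hΦ (hα j) (hα k) (hαs j)]
    ring
  set G : E → ℂ := fun z => ∑ j, (wd (α j) (e j) z - (wd P (e j) z - wd S (e j) z) * α j z)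
    with hG
  have cG : Continuous G := continuous_finset_sum _ fun j _ =>
    (cwd j).sub (((cwP j).sub (cwS j)).mul (cα j))
  have nsq {f : E → ℂ} (hf : HasCompactSupport f) : HasCompactSupport fun z => ‖f z‖ ^ 2 :=
    hf.comp_left (g := fun x : ℂ => ‖x‖ ^ 2) (by simp)
  have sG : HasCompactSupport G := hasCompactSupport_sum fun j =>
    (hasCompactSupport_wd (hαs j) _).sub (hαs j).mul_left
  have I1 : Integrable fun z => (∑ j, ‖α j z‖ ^ 2) * Real.exp (-Φ z) :=
    ((continuous_finset_sum _ fun j _ => (cα j).norm.pow 2).mul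
      cW).integrable_of_hasCompactSupport (hasCompactSupport_sum fun j => nsq (hαs j)).mul_right
  have I2 : Integrable fun z => ‖G z‖ ^ 2 * Real.exp (-Φ z) :=
    ((cG.norm.pow 2).mul cW).integrable_of_hasCompactSupport (nsq sG).mul_right
  have I3 : Integrable fun z => (∑ j, ∑ k, ‖wb (α j) (e k) z - wb (α k) (e j) z‖ ^ 2)
      * Real.exp (-Φ z) :=
    ((continuous_finset_sum _ fun j _ => continuous_finset_sum _ fun k _ =>
      ((cwb j k).sub (cwb k j)).norm.pow 2).mul cW).integrable_of_hasCompactSupport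
      (hasCompactSupport_sum fun j => hasCompactSupport_sum fun k => nsq
        ((hasCompactSupport_wb (hαs j) _).sub (hasCompactSupport_wb (hαs k) _))).mul_right
  have key (z : E) : (q z).re ≤ 2 * (‖G z‖ ^ 2 * Real.exp (-Φ z))
      + 1 / 2 * ((∑ j, ∑ k, ‖wb (α j) (e k) z - wb (α k) (e j) z‖ ^ 2) * Real.exp (-Φ z))
      - δ * ((∑ j, ‖α j z‖ ^ 2) * Real.exp (-Φ z)) := by
    have hqz : q z = (((∑ j, chern Φ (α j) (e j) z)
        * (starRingEnd ℂ) (∑ k, chern Φ (α k) (e k) z))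
        - (∑ j, ∑ k, wb (α j) (e k) z * (starRingEnd ℂ) (wb (α k) (e j) z))
        - (∑ j, ∑ k, wb (wd P (e j)) (e k) z * α j z * (starRingEnd ℂ) (α k z))) * W z := by
      simp only [hq, Finset.sum_sub_distrib, map_sum, sub_mul, Finset.sum_mul,
        Finset.mul_sum]
      congr 2
      rw [Finset.sum_comm]
    have hre : (q z).re = (‖∑ j, chern Φ (α j) (e j) z‖ ^ 2
        - (∑ j, ∑ k, wb (α j) (e k) z * (starRingEnd ℂ) (wb (α k) (e j) z)).re
        - (∑ j, ∑ k, wb (wd P (e j)) (e k) z * α j z * (starRingEnd ℂ) (α k z)).re)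
        * Real.exp (-Φ z) := by
      rw [hqz, hW, re_mul_ofReal, sub_re, sub_re, mul_conj, ofReal_re, normSq_eq_norm_sq]
    have h1 := re_sum_mul_conj_swap fun j k => wb (α j) (e k) z
    have hlev : δ * ∑ j, ‖α j z‖ ^ 2 + 2 * ‖∑ j, wd S (e j) z * α j z‖ ^ 2
        ≤ (∑ j, ∑ k, wb (wd P (e j)) (e k) z * α j z * (starRingEnd ℂ) (α k z)).re := by
      by_cases hz : ∃ j, α j z ≠ 0
      · exact hL z hz fun j => α j z
      · push Not at hz
        simp [hz]
    have hch : ∑ j, chern Φ (α j) (e j) z = G z - ∑ j, wd S (e j) z * α j z := by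
      simp only [hG, ← Finset.sum_sub_distrib, chern]
      exact Finset.sum_congr rfl fun j _ => by ring
    have hsq : ‖∑ j, chern Φ (α j) (e j) z‖ ^ 2
        ≤ 2 * ‖G z‖ ^ 2 + 2 * ‖∑ j, wd S (e j) z * α j z‖ ^ 2 := by
      rw [hch]
      have := norm_sub_le (G z) (∑ j, wd S (e j) z * α j z)
      nlinarith [norm_nonneg (G z - ∑ j, wd S (e j) z * α j z), norm_nonneg (G z),
        norm_nonneg (∑ j, wd S (e j) z * α j z),
        sq_nonneg (‖G z‖ - ‖∑ j, wd S (e j) z * α j z‖)]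
    rw [hre]
    have hW0 := (Real.exp_pos (-Φ z)).le
    calc _ ≤ (2 * ‖G z‖ ^ 2
        + 1 / 2 * (∑ j, ∑ k, ‖wb (α j) (e k) z - wb (α k) (e j) z‖ ^ 2)
        - δ * ∑ j, ‖α j z‖ ^ 2) * Real.exp (-Φ z) :=
          mul_le_mul_of_nonneg_right (by linarith) hW0
      _ = _ := by ring
  have hint : ∫ z, (q z).re ≤ ∫ z, (2 * (‖G z‖ ^ 2 * Real.exp (-Φ z))
      + 1 / 2 * ((∑ j, ∑ k, ‖wb (α j) (e k) z - wb (α k) (e j) z‖ ^ 2) * Real.exp (-Φ z))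
      - δ * ((∑ j, ‖α j z‖ ^ 2) * Real.exp (-Φ z))) := by
    refine integral_mono intq.re ?_ key
    exact ((I2.const_mul 2).add (I3.const_mul _)).sub (I1.const_mul _)
  have hre0 : ∫ z, (q z).re = 0 := by
    have := integral_re intq
    simp only [RCLike.re_to_complex] at this
    rw [this, q0]; simp
  have i23 : Integrable fun z => 2 * (‖G z‖ ^ 2 * Real.exp (-Φ z))
      + 1 / 2 * ((∑ j, ∑ k, ‖wb (α j) (e k) z - wb (α k) (e j) z‖ ^ 2) * Real.exp (-Φ z)) :=
    (I2.const_mul 2).add (I3.const_mul _)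
  rw [hre0, integral_sub i23 (I1.const_mul _), integral_add (I2.const_mul 2) (I3.const_mul _),
    integral_const_mul, integral_const_mul, integral_const_mul] at hint
  linarith

end BasicEstimate

section L2Convergence

variable {X : Type*} [MeasurableSpace X] {μ : Measure X}

/-- Convergence in `L²` of a sequence of functions. -/
structure L2Tendsto (μ : Measure X) (u : ℕ → X → ℂ) (f : X → ℂ) : Prop where
  memLp : ∀ n, MemLp (u n) 2 μ
  memLp_lim : MemLp f 2 μ
  tendsto : Tendsto (fun n => eLpNorm (fun x => u n x - f x) 2 μ) atTop (𝓝 0)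

lemma L2Tendsto.sub {u v : ℕ → X → ℂ} {f g : X → ℂ} (hu : L2Tendsto μ u f)
    (hv : L2Tendsto μ v g) :
    L2Tendsto μ (fun n x => u n x - v n x) fun x => f x - g x where
  memLp n := (hu.memLp n).sub (hv.memLp n)
  memLp_lim := hu.memLp_lim.sub hv.memLp_lim
  tendsto := by
    refine tendsto_of_tendsto_of_tendsto_of_le_of_le tendsto_const_nhds
      (by simpa using hu.tendsto.add hv.tendsto) (fun _ => zero_le) fun n => ?_
    have : (fun x => u n x - v n x - (f x - g x))
        = (fun x => u n x - f x) - fun x => v n x - g x := by ext x; simp; ring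
    rw [this]
    exact eLpNorm_sub_le ((hu.memLp n).sub hu.memLp_lim).1 ((hv.memLp n).sub hv.memLp_lim).1
      (by norm_num)

lemma L2Tendsto.sum {ι : Type*} [Fintype ι] {u : ι → ℕ → X → ℂ} {f : ι → X → ℂ}
    (hu : ∀ i, L2Tendsto μ (u i) (f i)) :
    L2Tendsto μ (fun n x => ∑ i, u i n x) fun x => ∑ i, f i x where
  memLp n := memLp_finsetSum _ fun i _ => (hu i).memLp n
  memLp_lim := memLp_finsetSum _ fun i _ => (hu i).memLp_lim
  tendsto := by
    refine tendsto_of_tendsto_of_tendsto_of_le_of_le tendsto_const_nhds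
      (by simpa using tendsto_finsetSum Finset.univ fun i _ => (hu i).tendsto)
      (fun _ => zero_le) fun n => ?_
    have : (fun x => ∑ i, u i n x - ∑ i, f i x) = ∑ i, fun x => u i n x - f i x := by
      ext x; simp
    rw [this]
    exact eLpNorm_sum_le (fun i _ => (((hu i).memLp n).sub (hu i).memLp_lim).1) (by norm_num)

lemma L2Tendsto.bdd_mul {u : ℕ → X → ℂ} {f : X → ℂ} (hu : L2Tendsto μ u f) {c : X → ℂ}
    (hc : AEStronglyMeasurable c μ) {C : ℝ} (hC : ∀ x, ‖c x‖ ≤ C) :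
    L2Tendsto μ (fun n x => c x * u n x) fun x => c x * f x where
  memLp n := (hu.memLp n).of_le_mul (c := C) (hc.mul (hu.memLp n).1) (Eventually.of_forall fun x => by
    rw [norm_mul]; exact mul_le_mul_of_nonneg_right (hC x) (norm_nonneg _))
  memLp_lim := (hu.memLp_lim).of_le_mul (c := C) (hc.mul (hu.memLp_lim).1) (Eventually.of_forall fun x => by
    rw [norm_mul]; exact mul_le_mul_of_nonneg_right (hC x) (norm_nonneg _))
  tendsto := by
    have h := ENNReal.Tendsto.const_mul (a := ENNReal.ofReal C) hu.tendsto
      (Or.inr ENNReal.ofReal_ne_top)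
    refine tendsto_of_tendsto_of_tendsto_of_le_of_le tendsto_const_nhds
      (by simpa using h) (fun _ => zero_le) fun n => ?_
    refine eLpNorm_le_mul_eLpNorm_of_ae_le_mul (Eventually.of_forall fun x => ?_) 2
    rw [← mul_sub, norm_mul]
    exact mul_le_mul_of_nonneg_right (hC x) (norm_nonneg _)

lemma integral_norm_sq_eq {f : X → ℂ} (hf : MemLp f 2 μ) :
    ∫ x, ‖f x‖ ^ 2 ∂μ = (eLpNorm f 2 μ).toReal ^ 2 := by
  have := hf.eLpNorm_eq_integral_rpow_norm (by norm_num) (by norm_num)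
  rw [this, ENNReal.toReal_ofReal (by positivity)]
  norm_num
  rw [← Real.sqrt_eq_rpow, Real.sq_sqrt (integral_nonneg fun _ => by positivity)]

lemma L2Tendsto.integral {u : ℕ → X → ℂ} {f : X → ℂ} (hu : L2Tendsto μ u f) :
    Tendsto (fun n => ∫ x, ‖u n x‖ ^ 2 ∂μ) atTop (𝓝 (∫ x, ‖f x‖ ^ 2 ∂μ)) := by
  rw [integral_norm_sq_eq hu.memLp_lim]
  simp only [integral_norm_sq_eq (hu.memLp _)]
  refine Tendsto.pow ?_ 2
  rw [tendsto_iff_dist_tendsto_zero]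
  have h0 : Tendsto (fun n => (eLpNorm (fun x => u n x - f x) 2 μ).toReal) atTop (𝓝 0) := by
    simpa [Function.comp_def] using (ENNReal.tendsto_toReal ENNReal.zero_ne_top).comp hu.tendsto
  refine squeeze_zero (fun _ => dist_nonneg) (fun n => ?_) h0
  have hd : MemLp (fun x => u n x - f x) 2 μ := (hu.memLp n).sub hu.memLp_lim
  have h1 : eLpNorm (u n) 2 μ ≤ eLpNorm (fun x => u n x - f x) 2 μ + eLpNorm f 2 μ := by
    have := eLpNorm_add_le hd.1 hu.memLp_lim.1 (p := 2) (by norm_num)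
    convert this using 2; ext x; simp
  have h2 : eLpNorm f 2 μ ≤ eLpNorm (u n) 2 μ + eLpNorm (fun x => u n x - f x) 2 μ := by
    have := eLpNorm_sub_le (hu.memLp n).1 hd.1 (p := 2) (by norm_num)
    convert this using 2; ext x; simp
  have t1 := ENNReal.toReal_mono (ENNReal.add_ne_top.2 ⟨hd.2.ne, hu.memLp_lim.2.ne⟩) h1
  have t2 := ENNReal.toReal_mono (ENNReal.add_ne_top.2 ⟨(hu.memLp n).2.ne, hd.2.ne⟩) h2
  rw [ENNReal.toReal_add hd.2.ne hu.memLp_lim.2.ne] at t1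
  rw [ENNReal.toReal_add (hu.memLp n).2.ne hd.2.ne] at t2
  rw [Real.dist_eq, abs_le]
  constructor <;> linarith

lemma L2Tendsto.integral_weight {u : ℕ → X → ℂ} {f : X → ℂ} (hu : L2Tendsto μ u f) {w : X → ℝ}
    (hw : Measurable w) (hw0 : ∀ x, 0 ≤ w x) {C : ℝ} (hC : ∀ x, w x ≤ C) :
    Tendsto (fun n => ∫ x, ‖u n x‖ ^ 2 * w x ∂μ) atTop (𝓝 (∫ x, ‖f x‖ ^ 2 * w x ∂μ)) := by
  have h := (hu.bdd_mul (c := fun x => (Real.sqrt (w x) : ℂ)) (C := Real.sqrt C)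
    (by exact (continuous_ofReal.measurable.comp hw.sqrt).aestronglyMeasurable)
    (fun x => by
      rw [norm_real, Real.norm_of_nonneg (Real.sqrt_nonneg _)]
      exact Real.sqrt_le_sqrt (hC x))).integral
  have e (g : X → ℂ) (x : X) : ‖(Real.sqrt (w x) : ℂ) * g x‖ ^ 2 = ‖g x‖ ^ 2 * w x := by
    rw [norm_mul, mul_pow, norm_real, Real.norm_of_nonneg (Real.sqrt_nonneg _),
      Real.sq_sqrt (hw0 x), mul_comm]
  simpa only [e] using h

end L2Convergence

section FriedrichsEstimate

variable {E : Type*} [NormedAddCommGroup E] [NormedSpace ℂ E]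
  [MeasureSpace E] [BorelSpace E] [FiniteDimensional ℂ E]
  [(volume : Measure E).IsAddHaarMeasure]

lemma integrable_mul_cs {f g : E → ℂ} (hf : LocallyIntegrable f volume) (hg : Continuous g)
    (hs : HasCompactSupport g) : Integrable fun z => f z * g z := by
  have := hf.integrable_smul_left_of_hasCompactSupport hg hs
  simpa [mul_comm] using this

lemma IsMollifier.test {ρ : E → ℝ} {r : ℝ} (hρ : IsMollifier ρ r) (x : E) :
    ContDiff ℝ (⊤ : ℕ∞) (fun y => (ρ (x - y) : ℂ)) ∧ HasCompactSupport fun y => (ρ (x - y) : ℂ) :=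
  ⟨ofRealCLM.contDiff.comp (hρ.smooth.comp (contDiff_const.sub contDiff_id)),
    (hρ.hasCompactSupport.comp_homeomorph (Homeomorph.subLeft x)).comp_left
      (g := fun y : ℝ => (y : ℂ)) (by simp)⟩

lemma moll_eq_integral_mul (ρ : E → ℝ) (f : E → ℂ) (x : E) :
    moll ρ f x = ∫ t, f t * (ρ (x - t) : ℂ) := by
  rw [moll_apply']
  exact integral_congr_ae (Eventually.of_forall fun t => by simp [mul_comm])

lemma L2Tendsto_moll {ρ : ℕ → E → ℝ} (hρ : ∀ n, IsMollifier (ρ n) (1 / ((n : ℝ) + 1)))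
    {f : E → ℂ} (hf : MemLp f 2 volume) :
    L2Tendsto volume (fun n => moll (ρ n) f) f := by
  have : ProperSpace E := FiniteDimensional.proper ℂ E
  have hc (n : ℕ) : Continuous (moll (ρ n) f) :=
    (contDiff_moll (hρ n) (hf.locallyIntegrable (by norm_num))).continuous
  refine ⟨fun n => ⟨(hc n).aestronglyMeasurable, ?_⟩, hf, tendsto_eLpNorm_moll hρ hf⟩
  have h1 : eLpNorm (fun x => moll (ρ n) f x - f x) 2 volume
      ≤ eLpNorm f 2 volume + eLpNorm f 2 volume := by
    refine eLpNorm_moll_sub_le (hρ n) hf fun t _ => ?_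
    have hmp : MeasurePreserving (fun x : E => x - t) volume volume :=
      measurePreserving_sub_right volume t
    have h2 : eLpNorm (fun x => f (x - t)) 2 volume = eLpNorm f 2 volume :=
      eLpNorm_comp_measurePreserving hf.1 hmp
    have h3 := eLpNorm_sub_le (p := 2) (hf.1.comp_measurePreserving hmp) hf.1 (by norm_num)
    refine h3.trans ?_
    exact le_of_eq (congrArg (· + _) h2)
  have h2 : moll (ρ n) f = (fun x => moll (ρ n) f x - f x) + f := by
    ext x; simp
  rw [h2]
  refine (eLpNorm_add_le (((hc n).aestronglyMeasurable).sub hf.1) hf.1 (by norm_num)).trans_lt ?_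
  exact ENNReal.add_lt_top.2 ⟨h1.trans_lt (ENNReal.add_lt_top.2 ⟨hf.2, hf.2⟩), hf.2⟩

lemma basic_estimate_L2 {ι : Type*} [Fintype ι] (e : ι → E) {Φ s : E → ℝ} {δ : ℝ}
    (hΦ : ContDiff ℝ (⊤ : ℕ∞) Φ) (hs : ContDiff ℝ (⊤ : ℕ∞) s)
    (hΦc : HasCompactSupport Φ) (hsc : HasCompactSupport s)
    {K V : Set E} (hK : IsCompact K) (hV : IsOpen V) (hKV : K ⊆ V)
    {b : ι → E → ℂ} (hb : ∀ j, MemLp (b j) 2 volume) (hbK : ∀ j x, b j x ≠ 0 → x ∈ K)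
    {G : E → ℂ} (hG : MemLp G 2 volume) {F : ι → ι → E → ℂ} (hF : ∀ j k, MemLp (F j k) 2 volume)
    (hdiv : ∀ χ : E → ℂ, ContDiff ℝ (⊤ : ℕ∞) χ → HasCompactSupport χ →
      ∑ j, ∫ z, b j z * wd χ (e j) z = -∫ z, G z * χ z)
    (hcurl : ∀ χ : E → ℂ, ContDiff ℝ (⊤ : ℕ∞) χ → HasCompactSupport χ → ∀ j k,
      (∫ z, b j z * wb χ (e k) z) - ∫ z, b k z * wb χ (e j) z = -∫ z, F j k z * χ z)
    (hL : ∀ z ∈ V, ∀ ξ : ι → ℂ,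
      δ * ∑ j, ‖ξ j‖ ^ 2 + 2 * ‖∑ j, wd (fun x => (s x : ℂ)) (e j) z * ξ j‖ ^ 2
        ≤ (∑ j, ∑ k, wb (wd (fun x => (Φ x : ℂ)) (e j)) (e k) z * ξ j
            * (starRingEnd ℂ) (ξ k)).re) :
    δ * ∑ j, ∫ z, ‖b j z‖ ^ 2 * Real.exp (-Φ z)
      ≤ 2 * (∫ z, ‖G z - ∑ j, (wd (fun x => (Φ x : ℂ)) (e j) z
            - wd (fun x => (s x : ℂ)) (e j) z) * b j z‖ ^ 2 * Real.exp (-Φ z))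
        + 1 / 2 * ∑ j, ∑ k, ∫ z, ‖F j k z‖ ^ 2 * Real.exp (-Φ z) := by
  have : ProperSpace E := FiniteDimensional.proper ℂ E
  obtain ⟨ρ, hρ⟩ := exists_mollifier_seq E
  have hloc {f : E → ℂ} (hf : MemLp f 2 volume) : LocallyIntegrable f volume :=
    hf.locallyIntegrable (by norm_num)
  set P : E → ℂ := fun x => (Φ x : ℂ) with hP
  set S : E → ℂ := fun x => (s x : ℂ) with hS
  have cP : ContDiff ℝ (⊤ : ℕ∞) P := ofRealCLM.contDiff.comp hΦ
  have cS : ContDiff ℝ (⊤ : ℕ∞) S := ofRealCLM.contDiff.comp hs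
  have sP : HasCompactSupport P := hΦc.comp_left (g := fun y : ℝ => (y : ℂ)) (by simp)
  have sS : HasCompactSupport S := hsc.comp_left (g := fun y : ℝ => (y : ℂ)) (by simp)
  have cc (j : ι) : Continuous fun z => wd P (e j) z - wd S (e j) z :=
    (contDiff_wd cP _).continuous.sub (contDiff_wd cS _).continuous
  have cbd (j : ι) : ∃ C, ∀ z, ‖wd P (e j) z - wd S (e j) z‖ ≤ C :=
    (cc j).bounded_above_of_compact_support
      ((hasCompactSupport_wd sP _).sub (hasCompactSupport_wd sS _))
  have cW : Continuous fun z => Real.exp (-Φ z) := hΦ.continuous.neg.rexp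
  obtain ⟨C0, hC0⟩ : ∃ C, ∀ z, ‖Φ z‖ ≤ C := hΦ.continuous.bounded_above_of_compact_support hΦc
  have hWb (z : E) : Real.exp (-Φ z) ≤ Real.exp C0 := by
    refine Real.exp_le_exp.2 ?_
    have := hC0 z
    rw [Real.norm_eq_abs] at this
    linarith [neg_abs_le (Φ z)]
  have lb (j : ι) := L2Tendsto_moll hρ (hb j)
  have lG := L2Tendsto_moll hρ hG
  have lF (j k : ι) := L2Tendsto_moll hρ (hF j k)
  have lsub := lG.sub (L2Tendsto.sum fun j => (lb j).bdd_mul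
    (cc j).aestronglyMeasurable (cbd j).choose_spec)
  have t1 := (tendsto_finsetSum Finset.univ fun j (_ : j ∈ Finset.univ) =>
    (lb j).integral_weight cW.measurable (fun z => (Real.exp_pos _).le) hWb).const_mul δ
  have t2 := (lsub.integral_weight cW.measurable (fun z => (Real.exp_pos _).le) hWb).const_mul 2
  have t3 := (tendsto_finsetSum Finset.univ fun j (_ : j ∈ Finset.univ) =>
    tendsto_finsetSum Finset.univ fun k (_ : k ∈ Finset.univ) =>
    (lF j k).integral_weight cW.measurable (fun z => (Real.exp_pos _).le) hWb).const_mul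
      (1 / 2 : ℝ)
  refine le_of_tendsto_of_tendsto t1 (t2.add t3) ?_
  obtain ⟨r, hr, hKr⟩ := hK.exists_cthickening_subset_open hV hKV
  have h3 : ∀ᶠ n : ℕ in atTop, 1 / ((n : ℝ) + 1) < r :=
    tendsto_one_div_add_atTop_nhds_zero_nat.eventually_lt_const hr
  filter_upwards [h3] with n hn
  have hbc (j : ι) : HasCompactSupport (b j) := HasCompactSupport.intro hK fun x hx => by
    by_contra h
    exact hx (hbK j x h)
  have hα (j : ι) : ContDiff ℝ (⊤ : ℕ∞) (moll (ρ n) (b j)) := contDiff_moll (hρ n) (hloc (hb j))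
  have hαs (j : ι) : HasCompactSupport (moll (ρ n) (b j)) := hasCompactSupport_moll (hρ n) (hbc j)
  have key := basic_estimate e (δ := δ) hΦ hs hα hαs (fun z hz => by
    obtain ⟨j, hj⟩ := hz
    obtain ⟨y, hy, hzy⟩ := exists_of_moll_ne_zero (hρ n) hj
    refine hL z (hKr ?_)
    exact mem_cthickening_of_dist_le z y r K (hbK j y hy)
      (by rw [dist_eq_norm]; exact hzy.trans hn.le))
  have ediv (z : E) : ∑ j, wd (moll (ρ n) (b j)) (e j) z = moll (ρ n) G z := by
    simp only [wd_moll (hρ n) (hloc (hb _)), Finset.sum_neg_distrib]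
    rw [hdiv _ ((hρ n).test z).1 ((hρ n).test z).2, neg_neg, moll_eq_integral_mul]
  have ecurl (z : E) (j k : ι) : wb (moll (ρ n) (b j)) (e k) z - wb (moll (ρ n) (b k)) (e j) z
      = moll (ρ n) (F j k) z := by
    rw [wb_moll (hρ n) (hloc (hb _)), wb_moll (hρ n) (hloc (hb _)), moll_eq_integral_mul]
    have := hcurl _ ((hρ n).test z).1 ((hρ n).test z).2 j k
    linear_combination -this
  have Iw {u : E → ℂ} (hu : MemLp u 2 volume) :
      Integrable fun z => ‖u z‖ ^ 2 * Real.exp (-Φ z) := by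
    have h1 : Integrable fun z => ‖u z‖ ^ 2 := (memLp_two_iff_integrable_sq_norm hu.1).1 hu
    exact h1.mul_bdd cW.aestronglyMeasurable (c := Real.exp C0) (Eventually.of_forall fun z => by
      rw [Real.norm_of_nonneg (Real.exp_pos _).le]; exact hWb z)
  simp only [Finset.sum_sub_distrib, ediv, ecurl, Finset.sum_mul] at key
  rw [integral_finsetSum _ fun j _ => Iw ((lb j).memLp n),
    integral_finsetSum _ fun j _ => integrable_finsetSum _ fun k _ => Iw ((lF j k).memLp n)] at key
  simp only [integral_finsetSum _ fun k _ => Iw ((lF _ k).memLp n)] at key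
  exact key

end FriedrichsEstimate

section Cutoff

variable {E : Type*} [NormedAddCommGroup E] [NormedSpace ℂ E]

lemma contDiff_zero_extend {F : Type*} [NormedAddCommGroup F] [NormedSpace ℝ F]
    {V K : Set E} (hV : IsOpen V) (hK : IsClosed K) (hKV : K ⊆ V) {f : E → F}
    (hf : ContDiffOn ℝ (⊤ : ℕ∞) f V) (h0 : ∀ z ∉ K, f z = 0) : ContDiff ℝ (⊤ : ℕ∞) f := by
  rw [contDiff_iff_contDiffAt]
  intro z
  by_cases hz : z ∈ V
  · exact hf.contDiffAt (hV.mem_nhds hz)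
  · have : f =ᶠ[𝓝 z] fun _ => 0 := by
      filter_upwards [hK.isOpen_compl.mem_nhds fun h => hz (hKV h)] with y hy using h0 y hy
    exact contDiffAt_const.congr_of_eventuallyEq this

lemma deriv_smoothTransition_eq_zero {x : ℝ} (hx : x ∉ Icc (0:ℝ) 1) :
    deriv Real.smoothTransition x = 0 := by
  rw [mem_Icc, not_and_or, not_le, not_le] at hx
  rcases hx with h | h
  · have : Real.smoothTransition =ᶠ[𝓝 x] fun _ => 0 := by
      filter_upwards [Iio_mem_nhds h] with y hy
      exact Real.smoothTransition.zero_of_nonpos (le_of_lt hy)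
    rw [this.deriv_eq]; simp
  · have : Real.smoothTransition =ᶠ[𝓝 x] fun _ => 1 := by
      filter_upwards [Ioi_mem_nhds h] with y hy
      exact Real.smoothTransition.one_of_one_le (le_of_lt hy)
    rw [this.deriv_eq]; simp

lemma exists_norm_deriv_smoothTransition_le :
    ∃ M : ℝ, 0 ≤ M ∧ ∀ x, |deriv Real.smoothTransition x| ≤ M := by
  have hc : Continuous (deriv Real.smoothTransition) :=
    (Real.smoothTransition.contDiff (n := 1)).continuous_deriv le_rfl
  have hs : HasCompactSupport (deriv Real.smoothTransition) := by
    refine HasCompactSupport.of_support_subset_isCompact (isCompact_Icc (a := 0) (b := 1)) ?_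
    intro x hx
    by_contra h
    exact hx (deriv_smoothTransition_eq_zero h)
  obtain ⟨M, hM⟩ := hc.bounded_above_of_compact_support hs
  exact ⟨M, (norm_nonneg _).trans (hM 0), hM⟩

open Classical in
/-- The cutoff function which is `1` on `{s ≤ J}` and vanishes outside `{s < J + 1}`. -/
def cutoff (V : Set E) (s : E → ℝ) (J : ℝ) (z : E) : ℝ :=
  if z ∈ V then Real.smoothTransition (J + 1 - s z) else 0

variable {V : Set E} {s : E → ℝ}

lemma cutoff_nonneg (J : ℝ) (z : E) : 0 ≤ cutoff V s J z := by
  unfold cutoff; split_ifs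
  exacts [Real.smoothTransition.nonneg _, le_rfl]

lemma cutoff_le_one (J : ℝ) (z : E) : cutoff V s J z ≤ 1 := by
  unfold cutoff; split_ifs
  exacts [Real.smoothTransition.le_one _, zero_le_one]

lemma cutoff_eq_one {J : ℝ} {z : E} (hz : z ∈ V) (h : s z ≤ J) : cutoff V s J z = 1 := by
  rw [cutoff, if_pos hz, Real.smoothTransition.one_of_one_le (by linarith)]

lemma cutoff_eq_zero {J : ℝ} {z : E} (hz : z ∉ {z ∈ V | s z ≤ J + 1}) : cutoff V s J z = 0 := by
  unfold cutoff
  split_ifs with h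
  · refine Real.smoothTransition.zero_of_nonpos ?_
    by_contra hh
    exact hz ⟨h, by linarith⟩
  · rfl

lemma contDiff_cutoff_mul {F : Type*} [NormedAddCommGroup F] [NormedSpace ℝ F] (hV : IsOpen V)
    (hs : ContDiffOn ℝ (⊤ : ℕ∞) s V) (hp : ∀ c : ℝ, IsCompact {z ∈ V | s z ≤ c}) (J : ℝ)
    {f : E → F} (hf : ContDiffOn ℝ (⊤ : ℕ∞) f V) :
    ContDiff ℝ (⊤ : ℕ∞) fun z => cutoff V s J z • f z := by
  refine contDiff_zero_extend hV (hp (J + 1)).isClosed (fun z hz => hz.1) ?_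
    fun z hz => by rw [cutoff_eq_zero hz, zero_smul]
  have : ContDiffOn ℝ (⊤ : ℕ∞) (fun z => Real.smoothTransition (J + 1 - s z)) V :=
    Real.smoothTransition.contDiff.comp_contDiffOn (contDiffOn_const.sub hs)
  exact (this.congr fun z hz => by rw [cutoff, if_pos hz]).smul hf

lemma hasCompactSupport_cutoff_mul {F : Type*} [NormedAddCommGroup F] [NormedSpace ℝ F]
    (hp : ∀ c : ℝ, IsCompact {z ∈ V | s z ≤ c}) (J : ℝ) (f : E → F) :
    HasCompactSupport fun z => cutoff V s J z • f z := by
  refine HasCompactSupport.of_support_subset_isCompact (hp (J + 1)) fun z hz => ?_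
  by_contra h
  exact hz (by simp only [cutoff_eq_zero h, zero_smul])

lemma contDiff_cutoff (hV : IsOpen V)
    (hs : ContDiffOn ℝ (⊤ : ℕ∞) s V) (hp : ∀ c : ℝ, IsCompact {z ∈ V | s z ≤ c}) (J : ℝ) :
    ContDiff ℝ (⊤ : ℕ∞) (cutoff V s J) := by
  simpa using contDiff_cutoff_mul hV hs hp J (f := fun _ => (1 : ℝ)) contDiffOn_const

lemma fderiv_cutoff (hV : IsOpen V) (hs : ContDiffOn ℝ (⊤ : ℕ∞) s V) {z : E} (hz : z ∈ V)
    (J : ℝ) (v : E) : fderiv ℝ (fun x => (cutoff V s J x : ℂ)) z v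
      = -((deriv Real.smoothTransition (J + 1 - s z) : ℝ) : ℂ) * fderiv ℝ (fun x => (s x : ℂ)) z v := by
  have hsd : HasFDerivAt s (fderiv ℝ s z) z :=
    ((hs.contDiffAt (hV.mem_nhds hz)).differentiableAt (by simp)).hasFDerivAt
  have h1 : HasFDerivAt (fun x => (s x : ℂ)) (ofRealCLM.comp (fderiv ℝ s z)) z :=
    ofRealCLM.hasFDerivAt.comp z hsd
  have hd : HasDerivAt Real.smoothTransition (deriv Real.smoothTransition (J + 1 - s z))
      (J + 1 - s z) :=
    ((Real.smoothTransition.contDiff (n := 1)).differentiable (by norm_num) _).hasDerivAt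
  have h2 := hd.comp_hasFDerivAt z (hsd.const_sub (J + 1))
  have h3 : (fun x => (cutoff V s J x : ℂ))
      =ᶠ[𝓝 z] fun x => ((Real.smoothTransition (J + 1 - s x) : ℝ) : ℂ) := by
    filter_upwards [hV.mem_nhds hz] with y hy
    rw [cutoff, if_pos hy]
  have h4 : HasFDerivAt (fun x => ((Real.smoothTransition (J + 1 - s x) : ℝ) : ℂ))
      (ofRealCLM.comp (deriv Real.smoothTransition (J + 1 - s z) • -fderiv ℝ s z)) z :=
    ofRealCLM.hasFDerivAt.comp z h2
  rw [h3.fderiv_eq, h4.fderiv, h1.fderiv]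
  simp

lemma wd_cutoff (hV : IsOpen V) (hs : ContDiffOn ℝ (⊤ : ℕ∞) s V) {z : E} (hz : z ∈ V)
    (J : ℝ) (e : E) : wd (fun x => (cutoff V s J x : ℂ)) e z
      = -((deriv Real.smoothTransition (J + 1 - s z) : ℝ) : ℂ) * wd (fun x => (s x : ℂ)) e z := by
  simp only [wd, fderiv_cutoff hV hs hz]; ring

lemma wd_cutoff_eq_zero (hp : ∀ c : ℝ, IsCompact {z ∈ V | s z ≤ c}) {J : ℝ} {z : E}
    (hz : z ∉ {z ∈ V | s z ≤ J + 1}) (e : E) : wd (fun x => (cutoff V s J x : ℂ)) e z = 0 := by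
  have : (fun x => (cutoff V s J x : ℂ)) =ᶠ[𝓝 z] fun _ => 0 := by
    filter_upwards [(hp (J + 1)).isClosed.isOpen_compl.mem_nhds hz] with y hy
    rw [cutoff_eq_zero hy, ofReal_zero]
  rw [wd_congr this]; simp [wd]

end Cutoff

section APriori

variable {E : Type*} [NormedAddCommGroup E] [NormedSpace ℂ E]

/-- An open set with a weight `Φ` whose Levi form is large with respect to an exhaustion `s`
of controlled gradient. -/
structure LeviExhaustion {ι : Type*} [Fintype ι] (V : Set E) (Φ s : E → ℝ) (e : ι → E)
    (δ C : ℝ) : Prop where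
  isOpen : IsOpen V
  smooth_weight : ContDiffOn ℝ (⊤ : ℕ∞) Φ V
  smooth : ContDiffOn ℝ (⊤ : ℕ∞) s V
  nonneg : ∀ z ∈ V, 0 ≤ s z
  proper : ∀ c : ℝ, IsCompact {z ∈ V | s z ≤ c}
  grad : ∀ z ∈ V, ∑ j, ‖wd (fun x => (s x : ℂ)) (e j) z‖ ^ 2 ≤ C * Real.exp (s z)
  levi : ∀ z ∈ V, ∀ ξ : ι → ℂ,
    δ * ∑ j, ‖ξ j‖ ^ 2 + 2 * ‖∑ j, wd (fun x => (s x : ℂ)) (e j) z * ξ j‖ ^ 2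
      ≤ (∑ j, ∑ k, wb (wd (fun x => (Φ x : ℂ)) (e j)) (e k) z * ξ j
          * (starRingEnd ℂ) (ξ k)).re

variable [MeasureSpace E] [BorelSpace E] [FiniteDimensional ℂ E]
  [(volume : Measure E).IsAddHaarMeasure]

lemma integrable_of_continuousOn {F : Type*} [NormedAddCommGroup F] {V K : Set E}
    (hK : IsCompact K) (hKV : K ⊆ V) {f : E → F} (hf : ContinuousOn f V) (h0 : ∀ z ∉ K, f z = 0) :
    Integrable f :=
  (integrableOn_iff_integrable_of_support_subset fun z hz => by
    by_contra h; exact hz (h0 z h)).1 ((hf.mono hKV).integrableOn_compact hK)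

lemma memLp_mul_of_weight {V K : Set E} (hK : IsCompact K) (hKV : K ⊆ V) {w : E → ℝ}
    (hw : ContinuousOn w V) {β : E → ℂ} (hβ : AEStronglyMeasurable β volume)
    (hi : Integrable fun z => ‖β z‖ ^ 2 * Real.exp (w z)) {c : E → ℂ} (hc : Continuous c)
    (h0 : ∀ z ∉ K, c z = 0) : MemLp (fun z => c z * β z) 2 volume := by
  have : ProperSpace E := FiniteDimensional.proper ℂ E
  refine (memLp_two_iff_integrable_sq_norm (hc.aestronglyMeasurable.mul hβ)).2 ?_
  have h1 : ContinuousOn (fun z => ‖c z‖ ^ 2 * Real.exp (-w z)) K :=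
    (hc.norm.pow 2).continuousOn.mul (hw.mono hKV).neg.rexp
  obtain ⟨M, hM⟩ := hK.exists_bound_of_continuousOn h1
  refine (hi.const_mul (max M 0)).mono ((hc.aestronglyMeasurable.mul hβ).norm.pow 2)
    (Eventually.of_forall fun z => ?_)
  by_cases hz : z ∈ K
  · have h2 := hM z hz
    rw [Real.norm_of_nonneg (by positivity)] at h2
    rw [Real.norm_of_nonneg (by positivity), Real.norm_of_nonneg (by positivity), Pi.mul_apply, norm_mul, mul_pow]
    calc ‖c z‖ ^ 2 * ‖β z‖ ^ 2
        = (‖c z‖ ^ 2 * Real.exp (-w z)) * (‖β z‖ ^ 2 * Real.exp (w z)) := by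
          rw [Real.exp_neg]; field_simp
      _ ≤ max M 0 * (‖β z‖ ^ 2 * Real.exp (w z)) := by
          gcongr; exact h2.trans (le_max_left _ _)
  · simp only [Pi.mul_apply, h0 z hz, zero_mul, norm_zero]
    norm_num
    positivity

lemma integrable_norm_sq_mul_exp {f : E → ℂ} (hf : MemLp f 2 volume) {Φ : E → ℝ}
    (hΦ : Continuous Φ) (hs : HasCompactSupport Φ) :
    Integrable fun z => ‖f z‖ ^ 2 * Real.exp (-Φ z) := by
  have h1 := (memLp_two_iff_integrable_sq_norm hf.1).1 hf
  obtain ⟨M, hM⟩ := hΦ.bounded_above_of_compact_support hs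
  refine (h1.mul_const (Real.exp M)).mono
    ((hf.1.norm.pow 2).mul hΦ.neg.rexp.aestronglyMeasurable) (Eventually.of_forall fun z => ?_)
  rw [Real.norm_of_nonneg (by positivity), Real.norm_of_nonneg (by positivity)]
  gcongr
  have := hM z
  rw [Real.norm_eq_abs] at this
  exact (neg_le_abs _).trans this

/-- The hypotheses satisfied by the projection of a test form onto the closed forms. -/
structure WeakDual {ι : Type*} [Fintype ι] (V : Set E) (Φ s : E → ℝ) (e : ι → E)
    (β : ι → E → ℂ) (D : E → ℂ) : Prop where
  meas : ∀ j, AEStronglyMeasurable (β j) volume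
  zero : ∀ j, ∀ z ∉ V, β j z = 0
  int : ∀ j, Integrable fun z => ‖β j z‖ ^ 2 * Real.exp (-Φ z + s z)
  closed : ∀ χ : E → ℂ, ContDiff ℝ (⊤ : ℕ∞) χ → HasCompactSupport χ → tsupport χ ⊆ V →
    ∀ j k, ∫ z, β j z * wb χ (e k) z = ∫ z, β k z * wb χ (e j) z
  adj : ∀ χ : E → ℂ, ContDiff ℝ (⊤ : ℕ∞) χ → HasCompactSupport χ → tsupport χ ⊆ V →
    ∑ j, ∫ z, β j z * (Real.exp (-Φ z + s z) : ℂ) * wd χ (e j) z = -∫ z, D z * χ z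
  cont : Continuous D
  supp : HasCompactSupport D
  tsupp : tsupport D ⊆ V

lemma norm_sum_mul_sq_le {ι : Type*} [Fintype ι] (a b : ι → ℂ) :
    ‖∑ j, a j * b j‖ ^ 2 ≤ (∑ j, ‖a j‖ ^ 2) * ∑ j, ‖b j‖ ^ 2 := by
  have h1 : ‖∑ j, a j * b j‖ ≤ ∑ j, ‖a j‖ * ‖b j‖ :=
    (norm_sum_le _ _).trans (le_of_eq (by simp))
  exact (pow_le_pow_left₀ (norm_nonneg _) h1 2).trans
    (Finset.sum_mul_sq_le_sq_mul_sq _ _ _)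

lemma norm_add_sq_le_two (a b : ℂ) : ‖a + b‖ ^ 2 ≤ 2 * ‖a‖ ^ 2 + 2 * ‖b‖ ^ 2 := by
  have := norm_add_le a b
  nlinarith [norm_nonneg (a + b), norm_nonneg a, norm_nonneg b, sq_nonneg (‖a‖ - ‖b‖)]

lemma sum_sum_norm_sub_sq_le {ι : Type*} [Fintype ι] (a b : ι → ℂ) :
    ∑ j, ∑ k, ‖a k * b j - a j * b k‖ ^ 2 ≤ 4 * ((∑ j, ‖a j‖ ^ 2) * ∑ j, ‖b j‖ ^ 2) := by
  have h (j k : ι) : ‖a k * b j - a j * b k‖ ^ 2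
      ≤ 2 * (‖a k‖ ^ 2 * ‖b j‖ ^ 2) + 2 * (‖a j‖ ^ 2 * ‖b k‖ ^ 2) := by
    have := norm_add_sq_le_two (a k * b j) (-(a j * b k))
    simpa [← sub_eq_add_neg, mul_pow] using this
  refine (Finset.sum_le_sum fun j _ => Finset.sum_le_sum fun k _ => h j k).trans (le_of_eq ?_)
  simp only [Finset.sum_add_distrib, ← Finset.mul_sum, ← Finset.sum_mul]
  ring

lemma cutoff_estimate {ι : Type*} [Fintype ι] {V : Set E} {Φ s : E → ℝ} {e : ι → E} {δ C M : ℝ}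
    (h : LeviExhaustion V Φ s e δ C) (hM : ∀ x, |deriv Real.smoothTransition x| ≤ M)
    {β : ι → E → ℂ} {D : E → ℂ} (hβ : WeakDual V Φ s e β D) (J : ℝ) :
    δ * ∑ j, ∫ z, ‖(cutoff V s J z : ℂ) * β j z‖ ^ 2 * Real.exp (-Φ z)
      ≤ 4 * (∫ z, ‖D z‖ ^ 2 * Real.exp (Φ z - 2 * s z))
        + ∫ z, 6 * M ^ 2 * C * {z ∈ V | J ≤ s z}.indicator
            (fun z => ∑ j, ‖β j z‖ ^ 2 * Real.exp (-Φ z + s z)) z := by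
  have hV := h.isOpen
  have hp := h.proper
  set K : Set E := {z ∈ V | s z ≤ J + 1} with hKdef
  have hK : IsCompact K := hp _
  have hKV : K ⊆ V := fun z hz => hz.1
  set Φ' : E → ℝ := fun z => cutoff V s (J + 2) z • Φ z with hΦ'
  set s' : E → ℝ := fun z => cutoff V s (J + 2) z • s z with hs'
  have cΦ : ContDiff ℝ (⊤ : ℕ∞) Φ' := contDiff_cutoff_mul hV h.smooth hp _ h.smooth_weight
  have cs : ContDiff ℝ (⊤ : ℕ∞) s' := contDiff_cutoff_mul hV h.smooth hp _ h.smooth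
  have sΦ : HasCompactSupport Φ' := hasCompactSupport_cutoff_mul hp _ _
  have ss : HasCompactSupport s' := hasCompactSupport_cutoff_mul hp _ _
  set V' : Set E := {z ∈ V | s z < J + 2} with hV'
  have oV' : IsOpen V' := h.smooth.continuousOn.isOpen_inter_preimage hV isOpen_Iio
  have hKV' : K ⊆ V' := fun z hz => ⟨hz.1, by linarith [hz.2]⟩
  have eΦ : EqOn Φ' Φ V' := fun z hz => by
    simp only [hΦ', cutoff_eq_one hz.1 hz.2.le, one_smul]
  have es : EqOn s' s V' := fun z hz => by
    simp only [hs', cutoff_eq_one hz.1 hz.2.le, one_smul]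
  have neΦ {z} (hz : z ∈ V') : (fun x => (Φ' x : ℂ)) =ᶠ[𝓝 z] fun x => (Φ x : ℂ) := by
    filter_upwards [oV'.mem_nhds hz] with y hy
    rw [eΦ hy]
  have nes {z} (hz : z ∈ V') : (fun x => (s' x : ℂ)) =ᶠ[𝓝 z] fun x => (s x : ℂ) := by
    filter_upwards [oV'.mem_nhds hz] with y hy
    rw [es hy]
  set η : E → ℂ := fun z => (cutoff V s J z : ℂ) with hη
  have cη : ContDiff ℝ (⊤ : ℕ∞) η := ofRealCLM.contDiff.comp (contDiff_cutoff hV h.smooth hp J)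
  have η0 : ∀ z ∉ K, η z = 0 := fun z hz => by simp only [hη, cutoff_eq_zero hz, ofReal_zero]
  have sη : tsupport η ⊆ K := closure_minimal (fun z hz => by
    by_contra hh; exact hz (η0 z hh)) hK.isClosed
  have wη0 (j : ι) : ∀ z ∉ K, wd η (e j) z = 0 := fun z hz => wd_cutoff_eq_zero hp hz _
  have wbη (j : ι) (z : E) : wb η (e j) z = (starRingEnd ℂ) (wd η (e j) z) := by
    rw [hη, conj_wd_ofReal]
    exact (contDiff_cutoff hV h.smooth hp J).differentiable (by simp) z
  set P : E → ℂ := fun x => (Φ' x : ℂ) with hP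
  set S : E → ℂ := fun x => (s' x : ℂ) with hS
  have cP : ContDiff ℝ (⊤ : ℕ∞) P := ofRealCLM.contDiff.comp cΦ
  have cS : ContDiff ℝ (⊤ : ℕ∞) S := ofRealCLM.contDiff.comp cs
  have hw : ContinuousOn (fun z => -Φ z + s z) V :=
    h.smooth_weight.continuousOn.neg.add h.smooth.continuousOn
  have mem (j : ι) {c : E → ℂ} (hc : Continuous c) (h0 : ∀ z ∉ K, c z = 0) :
      MemLp (fun z => c z * β j z) 2 volume :=
    memLp_mul_of_weight hK hKV hw (hβ.meas j) (hβ.int j) hc h0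
  have loc {f : E → ℂ} (hf : MemLp f 2 volume) : LocallyIntegrable f volume :=
    hf.locallyIntegrable (by norm_num)
  have cwη (j : ι) := (contDiff_wd cη (e j)).continuous
  have cE : ContDiff ℝ (⊤ : ℕ∞) fun z => ((Real.exp (Φ' z - s' z) : ℝ) : ℂ) :=
    ofRealCLM.contDiff.comp (Real.contDiff_exp.comp (cΦ.sub cs))
  set T : E → ℂ := fun z => (∑ j, wd η (e j) z * β j z) + D z * η z * (Real.exp (Φ' z - s' z) : ℂ)
    with hT
  set G : E → ℂ := fun z => T z + ∑ j, (wd P (e j) z - wd S (e j) z) * (η z * β j z) with hG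
  have mD : MemLp (fun z => D z * η z * (Real.exp (Φ' z - s' z) : ℂ)) 2 volume :=
    ((hβ.cont.mul cη.continuous).mul cE.continuous).memLp_of_hasCompactSupport
      (hβ.supp.mul_right.mul_right)
  have mT : MemLp T 2 volume :=
    (memLp_finsetSum _ fun j _ => mem j (cwη j) (wη0 j)).add mD
  have cq (j : ι) : Continuous fun z => (wd P (e j) z - wd S (e j) z) * η z :=
    ((contDiff_wd cP _).continuous.sub (contDiff_wd cS _).continuous).mul cη.continuous
  have mq (j : ι) : MemLp (fun z => (wd P (e j) z - wd S (e j) z) * (η z * β j z)) 2 volume := by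
    have := mem j (cq j) fun z hz => by rw [η0 z hz, mul_zero]
    simpa only [mul_assoc] using this
  have mG : MemLp G 2 volume := mT.add (memLp_finsetSum _ fun j _ => mq j)
  have mF (j k : ι) : MemLp (fun z => wb η (e k) z * β j z - wb η (e j) z * β k z) 2 volume :=
    (mem j (contDiff_wb cη _).continuous fun z hz => by rw [wbη, wη0 k z hz, map_zero]).sub
      (mem k (contDiff_wb cη _).continuous fun z hz => by rw [wbη, wη0 j z hz, map_zero])
  have hdη (z : E) : DifferentiableAt ℝ η z := cη.differentiable (by simp) z
  have key := basic_estimate_L2 e cΦ cs sΦ ss hK oV' hKV' (b := fun j z => η z * β j z)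
    (fun j => mem j cη.continuous η0) (fun j x hx => by
      by_contra hh; exact hx (by rw [η0 x hh, zero_mul])) (G := G) mG
    (F := fun j k z => wb η (e k) z * β j z - wb η (e j) z * β k z) mF ?_ ?_ ?_ (δ := δ)
  · have hT1 (z : E) : G z - ∑ j, (wd P (e j) z - wd S (e j) z) * (η z * β j z) = T z := by
      simp only [hG, add_sub_cancel_right]
    simp only [← hP, ← hS, hT1] at key
    have e1 (j : ι) : ∫ z, ‖η z * β j z‖ ^ 2 * Real.exp (-Φ' z)
        = ∫ z, ‖η z * β j z‖ ^ 2 * Real.exp (-Φ z) := by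
      refine integral_congr_ae (Eventually.of_forall fun z => ?_)
      by_cases hz : z ∈ K
      · simp only [eΦ (hKV' hz)]
      · simp only [η0 z hz]; simp
    simp only [e1] at key
    refine key.trans ?_
    have iT := integrable_norm_sq_mul_exp mT cΦ.continuous sΦ
    have iF (j k : ι) := integrable_norm_sq_mul_exp (mF j k) cΦ.continuous sΦ
    have iD : Integrable fun z => ‖D z‖ ^ 2 * Real.exp (Φ z - 2 * s z) := by
      refine integrable_of_continuousOn hβ.supp hβ.tsupp ?_ fun z hz => by
        rw [image_eq_zero_of_notMem_tsupport hz]; simp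
      exact (hβ.cont.norm.pow 2).continuousOn.mul (h.smooth_weight.continuousOn.sub
        (continuousOn_const.mul h.smooth.continuousOn)).rexp
    have mS : MeasurableSet {z ∈ V | J ≤ s z} := by
      have h1 : IsOpen {z ∈ V | s z < J} :=
        h.smooth.continuousOn.isOpen_inter_preimage hV isOpen_Iio
      have h2 : {z ∈ V | J ≤ s z} = V \ {z ∈ V | s z < J} := by
        ext z; simp only [mem_setOf_eq, mem_diff, not_and, not_lt]; tauto
      rw [h2]
      exact hV.measurableSet.diff h1.measurableSet
    have iB : Integrable ({z ∈ V | J ≤ s z}.indicator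
        fun z => ∑ j, ‖β j z‖ ^ 2 * Real.exp (-Φ z + s z)) :=
      (integrable_finsetSum _ fun j _ => hβ.int j).indicator mS
    have iFF : Integrable fun z => ∑ j, ∑ k,
        ‖wb η (e k) z * β j z - wb η (e j) z * β k z‖ ^ 2 * Real.exp (-Φ' z) :=
      integrable_finsetSum _ fun j _ => integrable_finsetSum _ fun k _ => iF j k
    have e2 : ∑ j, ∑ k, ∫ z, ‖wb η (e k) z * β j z - wb η (e j) z * β k z‖ ^ 2
          * Real.exp (-Φ' z)
        = ∫ z, ∑ j, ∑ k, ‖wb η (e k) z * β j z - wb η (e j) z * β k z‖ ^ 2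
          * Real.exp (-Φ' z) := by
      rw [integral_finsetSum _ fun j _ => integrable_finsetSum _ fun k _ => iF j k]
      exact Finset.sum_congr rfl fun j _ => (integral_finsetSum _ fun k _ => iF j k).symm
    rw [e2, ← integral_const_mul, ← integral_const_mul, ← integral_const_mul,
      ← integral_add (iT.const_mul 2) (iFF.const_mul _),
      ← integral_add (iD.const_mul 4) (iB.const_mul _)]
    refine integral_mono ((iT.const_mul 2).add (iFF.const_mul _))
      ((iD.const_mul 4).add (iB.const_mul _)) fun z => ?_
    simp only [← Finset.sum_mul]
    by_cases hz : z ∈ K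
    · have hzV' := hKV' hz
      set N := ∑ j, ‖wd η (e j) z‖ ^ 2 with hN
      set B := ∑ j, ‖β j z‖ ^ 2 with hB
      have hB0 : 0 ≤ B := Finset.sum_nonneg fun _ _ => by positivity
      have hN1 : N * B ≤ {z ∈ V | J ≤ s z}.indicator
          (fun z => M ^ 2 * (C * Real.exp (s z)) * ∑ j, ‖β j z‖ ^ 2) z := by
        have hN2 : N = |deriv Real.smoothTransition (J + 1 - s z)| ^ 2
            * ∑ j, ‖wd (fun x => (s x : ℂ)) (e j) z‖ ^ 2 := by
          rw [hN, Finset.mul_sum]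
          refine Finset.sum_congr rfl fun j _ => ?_
          rw [hη, wd_cutoff hV h.smooth hz.1, norm_mul, mul_pow, norm_neg, norm_real,
            Real.norm_eq_abs]
        by_cases hJ : z ∈ {z ∈ V | J ≤ s z}
        · rw [indicator_of_mem hJ, hN2]
          gcongr
          · exact hM _
          · exact h.grad z hz.1
        · rw [indicator_of_notMem hJ, hN2, deriv_smoothTransition_eq_zero, abs_zero]
          · simp
          · intro hh
            exact hJ ⟨hz.1, by linarith [hh.2]⟩
      have hX := norm_sum_mul_sq_le (fun j => wd η (e j) z) fun j => β j z
      have hF := sum_sum_norm_sub_sq_le (fun j => wb η (e j) z) fun j => β j z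
      have hwb (j : ι) : ‖wb η (e j) z‖ = ‖wd η (e j) z‖ := by rw [wbη, RCLike.norm_conj]
      simp only [hwb] at hF
      have hXY := norm_add_sq_le_two (∑ j, wd η (e j) z * β j z)
        (D z * η z * (Real.exp (Φ' z - s' z) : ℂ))
      have hY : ‖D z * η z * (Real.exp (Φ' z - s' z) : ℂ)‖ ^ 2 * Real.exp (-Φ z)
          ≤ ‖D z‖ ^ 2 * Real.exp (Φ z - 2 * s z) := by
        have hη1 : ‖η z‖ ^ 2 ≤ 1 := by
          rw [hη, norm_real, Real.norm_of_nonneg (cutoff_nonneg _ _)]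
          exact pow_le_one₀ (cutoff_nonneg _ _) (cutoff_le_one _ _)
        have hr : ‖((Real.exp (Φ' z - s' z) : ℝ) : ℂ)‖ = Real.exp (Φ' z - s' z) := by
          rw [norm_real, Real.norm_of_nonneg (Real.exp_pos _).le]
        rw [norm_mul, norm_mul, hr, eΦ hzV',
          es hzV', mul_pow, mul_pow]
        have h1 : Real.exp (Φ z - s z) ^ 2 * Real.exp (-Φ z) = Real.exp (Φ z - 2 * s z) := by
          rw [← Real.exp_nat_mul, ← Real.exp_add]
          congr 1; push_cast; ring
        calc ‖D z‖ ^ 2 * ‖η z‖ ^ 2 * Real.exp (Φ z - s z) ^ 2 * Real.exp (-Φ z)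
            = ‖D z‖ ^ 2 * ‖η z‖ ^ 2 * Real.exp (Φ z - 2 * s z) := by rw [← h1]; ring
          _ ≤ ‖D z‖ ^ 2 * 1 * Real.exp (Φ z - 2 * s z) := by gcongr
          _ = _ := by ring
      have hind : 6 * M ^ 2 * C * {z ∈ V | J ≤ s z}.indicator
            (fun z => (∑ j, ‖β j z‖ ^ 2) * Real.exp (-Φ z + s z)) z
          = 6 * {z ∈ V | J ≤ s z}.indicator
            (fun z => M ^ 2 * (C * Real.exp (s z)) * ∑ j, ‖β j z‖ ^ 2) z * Real.exp (-Φ z) := by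
        by_cases hJ : z ∈ {z ∈ V | J ≤ s z}
        · rw [indicator_of_mem hJ, indicator_of_mem hJ, Real.exp_add]; ring
        · rw [indicator_of_notMem hJ, indicator_of_notMem hJ]; ring
      rw [hind]
      have hE := Real.exp_pos (-Φ z)
      rw [eΦ hzV']
      simp only [hT]
      have t1 := mul_le_mul_of_nonneg_right hXY hE.le
      have t2 := mul_le_mul_of_nonneg_right hX hE.le
      have t3 := mul_le_mul_of_nonneg_right hF hE.le
      have t4 := mul_le_mul_of_nonneg_right hN1 hE.le
      simp only [← hN, ← hB] at t1 t2 t3 t4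
      linarith
    · have z1 : T z = 0 := by
        simp only [hT, η0 z hz, wη0 _ z hz]; simp
      have z2 (j : ι) : wb η (e j) z = 0 := by rw [wbη, wη0 j z hz, map_zero]
      simp only [z1, z2]
      have hn : 0 ≤ C * {z ∈ V | J ≤ s z}.indicator
          (fun z => (∑ j, ‖β j z‖ ^ 2) * Real.exp (-Φ z + s z)) z := by
        by_cases hJ : z ∈ {z ∈ V | J ≤ s z}
        · have hC : 0 ≤ C := by
            have := (Finset.sum_nonneg fun j _ => by positivity).trans (h.grad z hJ.1)
            exact nonneg_of_mul_nonneg_left this (Real.exp_pos _)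
          rw [indicator_of_mem hJ]
          positivity
        · rw [indicator_of_notMem hJ, mul_zero]
      have hM2 : 0 ≤ 6 * M ^ 2 := by positivity
      have h1 : 0 ≤ 4 * (‖D z‖ ^ 2 * Real.exp (Φ z - 2 * s z)) := by positivity
      have h2 := mul_nonneg hM2 hn
      simp only [norm_zero, zero_mul, sub_zero]
      norm_num
      linarith
  · intro χ cχ sχ
    have cχ' : ContDiff ℝ (⊤ : ℕ∞) fun z => η z * (((Real.exp (Φ' z - s' z) : ℝ) : ℂ) * χ z) :=
      cη.mul (cE.mul cχ)
    have hadj := hβ.adj _ cχ' sχ.mul_left.mul_left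
      ((tsupport_mul_subset_left (f := η)).trans (sη.trans hKV))
    have e1 (j : ι) : ∫ z, β j z * (Real.exp (-Φ z + s z) : ℂ)
        * wd (fun z => η z * (((Real.exp (Φ' z - s' z) : ℝ) : ℂ) * χ z)) (e j) z
        = (∫ z, (wd η (e j) z * β j z) * χ z)
          + (∫ z, (wd P (e j) z - wd S (e j) z) * (η z * β j z) * χ z)
          + ∫ z, η z * β j z * wd χ (e j) z := by
      rw [← integral_add, ← integral_add]
      · refine integral_congr_ae (Eventually.of_forall fun z => ?_)
        have hd1 : DifferentiableAt ℝ (fun z => ((Real.exp (Φ' z - s' z) : ℝ) : ℂ)) z :=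
          cE.differentiable (by simp) z
        have hd2 : DifferentiableAt ℝ χ z := cχ.differentiable (by simp) z
        have hd3 : DifferentiableAt ℝ (fun z => Φ' z - s' z) z :=
          (cΦ.sub cs).differentiable (by simp) z
        simp only
        rw [wd_mul (g := fun z => ((Real.exp (Φ' z - s' z) : ℝ) : ℂ) * χ z) (hdη z) (hd1.mul hd2),
          wd_mul hd1 hd2, wd_exp (φ := fun z => Φ' z - s' z) hd3]
        simp only [ofReal_sub]
        rw [wd_sub (cP.differentiable (by simp) z) (cS.differentiable (by simp) z)]
        by_cases hz : z ∈ K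
        · have h1 : ((Real.exp (-Φ z + s z) : ℝ) : ℂ) * ((Real.exp (Φ' z - s' z) : ℝ) : ℂ) = 1 := by
            rw [eΦ (hKV' hz), es (hKV' hz), ← ofReal_mul, ← Real.exp_add]
            simp
          linear_combination (β j z * (wd η (e j) z * χ z
            + η z * ((wd P (e j) z - wd S (e j) z) * χ z + wd χ (e j) z))) * h1
        · rw [η0 z hz, wη0 j z hz]; ring
      · exact (integrable_mul_cs (loc (mem j (cwη j) (wη0 j))) cχ.continuous sχ).add
          (integrable_mul_cs (loc (mq j)) cχ.continuous sχ)
      · exact integrable_mul_cs (loc (mem j cη.continuous η0)) (contDiff_wd cχ _).continuous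
          (hasCompactSupport_wd sχ _)
      · exact integrable_mul_cs (loc (mem j (cwη j) (wη0 j))) cχ.continuous sχ
      · exact integrable_mul_cs (loc (mq j)) cχ.continuous sχ
    simp only [e1, Finset.sum_add_distrib] at hadj
    have e2 : ∫ z, G z * χ z = (∑ j, ∫ z, (wd η (e j) z * β j z) * χ z)
        + (∫ z, D z * (η z * (((Real.exp (Φ' z - s' z) : ℝ) : ℂ) * χ z)))
        + ∑ j, ∫ z, (wd P (e j) z - wd S (e j) z) * (η z * β j z) * χ z := by
      rw [← integral_finsetSum _ fun j _ =>
        integrable_mul_cs (loc (mem j (cwη j) (wη0 j))) cχ.continuous sχ,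
        ← integral_finsetSum _ fun j _ => integrable_mul_cs (loc (mq j)) cχ.continuous sχ,
        ← integral_add, ← integral_add]
      · refine integral_congr_ae (Eventually.of_forall fun z => ?_)
        simp only [hG, hT, add_mul, Finset.sum_mul]
        ring
      · refine Integrable.add ?_ ?_
        · exact integrable_finsetSum _ fun j _ =>
            integrable_mul_cs (loc (mem j (cwη j) (wη0 j))) cχ.continuous sχ
        · have := integrable_mul_cs (loc mD) cχ.continuous sχ
          simpa only [mul_assoc] using this
      · exact integrable_finsetSum _ fun j _ => integrable_mul_cs (loc (mq j)) cχ.continuous sχ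
      · exact integrable_finsetSum _ fun j _ =>
            integrable_mul_cs (loc (mem j (cwη j) (wη0 j))) cχ.continuous sχ
      · have := integrable_mul_cs (loc mD) cχ.continuous sχ
        simpa only [mul_assoc] using this
    rw [e2]
    linear_combination hadj
  · intro χ cχ sχ j k
    have hcl := hβ.closed _ (cη.mul cχ) sχ.mul_left
      ((tsupport_mul_subset_left (f := η)).trans (sη.trans hKV)) j k
    have e1 (j k : ι) : ∫ z, β j z * wb (fun z => η z * χ z) (e k) z
        = (∫ z, (wb η (e k) z * β j z) * χ z) + ∫ z, η z * β j z * wb χ (e k) z := by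
      rw [← integral_add]
      · refine integral_congr_ae (Eventually.of_forall fun z => ?_)
        simp only
        rw [wb_mul (hdη z) (cχ.differentiable (by simp) z)]
        ring
      · exact integrable_mul_cs (loc (mem j (contDiff_wb cη _).continuous
          fun z hz => by rw [wbη, wη0 k z hz, map_zero])) cχ.continuous sχ
      · exact integrable_mul_cs (loc (mem j cη.continuous η0)) (contDiff_wb cχ _).continuous
          (hasCompactSupport_wb sχ _)
    rw [e1, e1] at hcl
    have e2 : ∫ z, (wb η (e k) z * β j z - wb η (e j) z * β k z) * χ z
        = (∫ z, (wb η (e k) z * β j z) * χ z) - ∫ z, (wb η (e j) z * β k z) * χ z := by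
      rw [← integral_sub]
      · simp only [sub_mul]
      · exact integrable_mul_cs (loc (mem j (contDiff_wb cη _).continuous
          fun z hz => by rw [wbη, wη0 k z hz, map_zero])) cχ.continuous sχ
      · exact integrable_mul_cs (loc (mem k (contDiff_wb cη _).continuous
          fun z hz => by rw [wbη, wη0 j z hz, map_zero])) cχ.continuous sχ
    rw [e2]
    linear_combination hcl
  · intro z hz ξ
    have e1 (j k : ι) : wb (wd P (e j)) (e k) z = wb (wd (fun x => (Φ x : ℂ)) (e j)) (e k) z := by
      refine wb_congr ?_ _
      filter_upwards [oV'.mem_nhds hz] with y hy using wd_congr (neΦ hy) _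
    simp only [← hP, ← hS, e1, wd_congr (nes hz)]
    exact h.levi z hz.1 ξ

lemma WeakDual.integrable {ι : Type*} [Fintype ι] {V : Set E} {Φ s : E → ℝ} {e : ι → E} {δ C : ℝ}
    (h : LeviExhaustion V Φ s e δ C) {β : ι → E → ℂ} {D : E → ℂ} (hβ : WeakDual V Φ s e β D)
    (j : ι) : Integrable fun z => ‖β j z‖ ^ 2 * Real.exp (-Φ z) := by
  have h1 : (fun z => ‖β j z‖ ^ 2 * Real.exp (-Φ z))
      = V.indicator fun z => ‖β j z‖ ^ 2 * Real.exp (-Φ z) := by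
    ext z
    by_cases hz : z ∈ V
    · rw [indicator_of_mem hz]
    · rw [indicator_of_notMem hz, hβ.zero j z hz]; simp
  have hm : AEStronglyMeasurable (fun z => ‖β j z‖ ^ 2 * Real.exp (-Φ z)) volume := by
    rw [h1, aestronglyMeasurable_indicator_iff h.isOpen.measurableSet]
    exact ((hβ.meas j).restrict.norm.pow 2).mul
      (h.smooth_weight.continuousOn.neg.rexp.aestronglyMeasurable h.isOpen.measurableSet)
  refine (hβ.int j).mono hm (Eventually.of_forall fun z => ?_)
  rw [Real.norm_of_nonneg (by positivity), Real.norm_of_nonneg (by positivity)]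
  by_cases hz : z ∈ V
  · gcongr
    linarith [h.nonneg z hz]
  · rw [hβ.zero j z hz]; simp

lemma dual_estimate {ι : Type*} [Fintype ι] {V : Set E} {Φ s : E → ℝ} {e : ι → E} {δ C : ℝ}
    (h : LeviExhaustion V Φ s e δ C) {β : ι → E → ℂ} {D : E → ℂ} (hβ : WeakDual V Φ s e β D) :
    δ * ∑ j, ∫ z, ‖β j z‖ ^ 2 * Real.exp (-Φ z)
      ≤ 4 * ∫ z, ‖D z‖ ^ 2 * Real.exp (Φ z - 2 * s z) := by
  obtain ⟨M, -, hM⟩ := exists_norm_deriv_smoothTransition_le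
  have hint := hβ.integrable h
  have l1 : Tendsto (fun J : ℕ => δ * ∑ j, ∫ z, ‖(cutoff V s J z : ℂ) * β j z‖ ^ 2
      * Real.exp (-Φ z)) atTop (𝓝 (δ * ∑ j, ∫ z, ‖β j z‖ ^ 2 * Real.exp (-Φ z))) := by
    refine Tendsto.const_mul _ (tendsto_finsetSum _ fun j _ => ?_)
    refine tendsto_integral_of_dominated_convergence _ (fun J => ?_) (hint j)
      (fun J => Eventually.of_forall fun z => ?_) (Eventually.of_forall fun z => ?_)
    · have e1 : (fun z => ‖(cutoff V s J z : ℂ) * β j z‖ ^ 2 * Real.exp (-Φ z))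
          = fun z => cutoff V s J z ^ 2 * (‖β j z‖ ^ 2 * Real.exp (-Φ z)) := by
        ext z; rw [norm_mul, mul_pow, norm_real, Real.norm_eq_abs, sq_abs]; ring
      rw [e1]
      exact ((contDiff_cutoff h.isOpen h.smooth h.proper J).continuous.pow 2).aestronglyMeasurable.mul
        (hint j).1
    · rw [Real.norm_of_nonneg (by positivity), norm_mul, norm_real,
        Real.norm_of_nonneg (cutoff_nonneg _ _)]
      have hc := mul_le_of_le_one_left (norm_nonneg (β j z)) (cutoff_le_one (V := V) (s := s) J z)
      have hc0 := mul_nonneg (cutoff_nonneg (V := V) (s := s) J z) (norm_nonneg (β j z))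
      gcongr
    · by_cases hz : z ∈ V
      · refine tendsto_const_nhds.congr' ?_
        filter_upwards [eventually_ge_atTop ⌈s z⌉₊] with J hJ
        rw [cutoff_eq_one hz ((Nat.le_ceil _).trans (by exact_mod_cast hJ))]; simp
      · simp [hβ.zero j z hz]
  have l2 : Tendsto (fun J : ℕ => 4 * (∫ z, ‖D z‖ ^ 2 * Real.exp (Φ z - 2 * s z))
        + ∫ z, 6 * M ^ 2 * C * {z ∈ V | (J : ℝ) ≤ s z}.indicator
            (fun z => ∑ j, ‖β j z‖ ^ 2 * Real.exp (-Φ z + s z)) z) atTop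
      (𝓝 (4 * (∫ z, ‖D z‖ ^ 2 * Real.exp (Φ z - 2 * s z)) + ∫ z : E, (0 : ℝ))) := by
    have iB : Integrable fun z => ∑ j, ‖β j z‖ ^ 2 * Real.exp (-Φ z + s z) :=
      integrable_finsetSum _ fun j _ => hβ.int j
    refine tendsto_const_nhds.add (tendsto_integral_of_dominated_convergence _ (fun J => ?_)
      ((iB.const_mul (6 * M ^ 2 * C)).norm) (fun J => Eventually.of_forall fun z => ?_)
      (Eventually.of_forall fun z => ?_))
    · have mS : MeasurableSet {z ∈ V | (J : ℝ) ≤ s z} := by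
        have h1 : IsOpen {z ∈ V | s z < J} :=
          h.smooth.continuousOn.isOpen_inter_preimage h.isOpen isOpen_Iio
        have h2 : {z ∈ V | (J : ℝ) ≤ s z} = V \ {z ∈ V | s z < J} := by
          ext z; simp only [mem_setOf_eq, mem_diff, not_and, not_lt]; tauto
        rw [h2]
        exact h.isOpen.measurableSet.diff h1.measurableSet
      exact (iB.1.indicator mS).const_mul _
    · rw [norm_mul (6 * M ^ 2 * C), norm_mul (6 * M ^ 2 * C)]
      refine mul_le_mul_of_nonneg_left ?_ (norm_nonneg (6 * M ^ 2 * C))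
      exact norm_indicator_le_norm_self (E := ℝ) _ _
    · refine tendsto_const_nhds.congr' ?_
      filter_upwards [eventually_gt_atTop ⌈s z⌉₊] with J hJ
      rw [indicator_of_notMem, mul_zero]
      intro hh
      have : (⌈s z⌉₊ : ℝ) < J := by exact_mod_cast hJ
      linarith [hh.2, Nat.le_ceil (s z)]
  have := le_of_tendsto_of_tendsto' l1 l2 fun J => cutoff_estimate h hM hβ J
  simpa using this

end APriori

section Riesz

lemma exists_inner_eq {M H : Type*} [AddCommGroup M] [Module ℂ M] [NormedAddCommGroup H]
    [InnerProductSpace ℂ H] [CompleteSpace H] (T : M →ₗ[ℂ] H) (l : M →ₗ[ℂ] ℂ) {C : ℝ}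
    (hC : 0 ≤ C) (h : ∀ m, ‖l m‖ ≤ C * ‖T m‖) :
    ∃ g : H, ‖g‖ ≤ C ∧ ∀ m, l m = inner ℂ g (T m) := by
  obtain ⟨σ, hσ⟩ := T.rangeRestrict.exists_rightInverse_of_surjective T.range_rangeRestrict
  have hσ' (y : LinearMap.range T) : T (σ y) = y := by
    have := congrArg (fun f => ((f y : LinearMap.range T) : H)) hσ
    simpa using this
  let l' : LinearMap.range T →L[ℂ] ℂ := (l.comp σ).mkContinuous C fun y => by
    have := h (σ y)
    rw [hσ' y] at this
    simpa using this
  obtain ⟨F, hF, hFn⟩ := exists_extension_norm_eq (LinearMap.range T) l'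
  refine ⟨(InnerProductSpace.toDual ℂ H).symm F, ?_, fun m => ?_⟩
  · rw [LinearIsometryEquiv.norm_map, hFn]
    exact LinearMap.mkContinuous_norm_le _ hC _
  · rw [InnerProductSpace.toDual_symm_apply]
    have h1 := hF ⟨T m, LinearMap.mem_range_self T m⟩
    rw [show F (T m) = l (σ ⟨T m, LinearMap.mem_range_self T m⟩) from h1]
    have h2 := h (m - σ ⟨T m, LinearMap.mem_range_self T m⟩)
    rw [map_sub T, hσ', sub_self, norm_zero, mul_zero] at h2
    have h3 := norm_le_zero_iff.1 h2
    rw [map_sub] at h3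
    exact sub_eq_zero.1 h3

variable {X : Type*} [MeasurableSpace X] {μ : Measure X} {ι : Type*} [Fintype ι]

/-- The element of `(L²)^ι` given by a tuple of square integrable functions. -/
def vecLp (f : ι → X → ℂ) (hf : ∀ j, MemLp (f j) 2 μ) : PiLp 2 fun _ : ι => Lp ℂ 2 μ :=
  WithLp.toLp 2 fun j => (hf j).toLp

lemma inner_toLp {f g : X → ℂ} (hf : MemLp f 2 μ) (hg : MemLp g 2 μ) :
    inner ℂ hf.toLp hg.toLp = ∫ x, (starRingEnd ℂ) (f x) * g x ∂μ := by
  rw [L2.inner_def]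
  refine integral_congr_ae ?_
  filter_upwards [hf.coeFn_toLp, hg.coeFn_toLp] with x h1 h2
  rw [h1, h2, RCLike.inner_apply, mul_comm]

lemma inner_vecLp {f g : ι → X → ℂ} (hf : ∀ j, MemLp (f j) 2 μ) (hg : ∀ j, MemLp (g j) 2 μ) :
    inner ℂ (vecLp f hf) (vecLp g hg) = ∑ j, ∫ x, (starRingEnd ℂ) (f j x) * g j x ∂μ := by
  rw [PiLp.inner_apply]
  exact Finset.sum_congr rfl fun j _ => inner_toLp (hf j) (hg j)

lemma norm_toLp_sq {f : X → ℂ} (hf : MemLp f 2 μ) : ‖hf.toLp‖ ^ 2 = ∫ x, ‖f x‖ ^ 2 ∂μ := by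
  rw [Lp.norm_toLp, integral_norm_sq_eq hf]

lemma norm_vecLp_sq {f : ι → X → ℂ} (hf : ∀ j, MemLp (f j) 2 μ) :
    ‖vecLp f hf‖ ^ 2 = ∑ j, ∫ x, ‖f j x‖ ^ 2 ∂μ := by
  rw [PiLp.norm_sq_eq_of_L2]
  exact Finset.sum_congr rfl fun j _ => norm_toLp_sq (hf j)

lemma vecLp_coe (h : PiLp 2 fun _ : ι => Lp ℂ 2 μ) :
    vecLp (fun j => (h j : X → ℂ)) (fun j => Lp.memLp (h j)) = h := by
  refine PiLp.ext fun j => ?_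
  exact Lp.toLp_coeFn (h j) (Lp.memLp (h j))

end Riesz

section Wb

variable {E : Type*} [NormedAddCommGroup E] [NormedSpace ℂ E]

lemma wb_wb_comm {f : E → ℂ} {z : E} (hf : ContDiffAt ℝ 2 f z) (a b : E) :
    wb (wb f a) b z = wb (wb f b) a z := by
  have hs : IsSymmSndFDerivAt ℝ f z := hf.isSymmSndFDerivAt (by simp)
  rw [wb, wb, fderiv_wb hf, fderiv_wb hf, fderiv_wb hf, fderiv_wb hf,
    hs.eq a b, hs.eq a (I • b), hs.eq (I • a) b, hs.eq (I • a) (I • b)]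
  ring

lemma wd_const_mul {f : E → ℂ} {z : E} (hf : DifferentiableAt ℝ f z) (c : ℂ) (e : E) :
    wd (fun x => c * f x) e z = c * wd f e z := by
  simp only [wd, fderiv_const_mul hf, smul_apply, smul_eq_mul]; ring

lemma contDiff_conj {f : E → ℂ} (hf : ContDiff ℝ (⊤ : ℕ∞) f) :
    ContDiff ℝ (⊤ : ℕ∞) fun z => (starRingEnd ℂ) (f z) :=
  conjCLE.contDiff.comp hf

lemma hasCompactSupport_conj {f : E → ℂ} (hf : HasCompactSupport f) :
    HasCompactSupport fun z => (starRingEnd ℂ) (f z) :=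
  hf.comp_left (g := starRingEnd ℂ) (map_zero _)

lemma tsupport_conj (f : E → ℂ) : tsupport (fun z => (starRingEnd ℂ) (f z)) = tsupport f := by
  unfold tsupport
  congr 1
  ext z
  simp

/-- Smooth functions with compact support in `V`. -/
structure IsTest (V : Set E) (χ : E → ℂ) : Prop where
  smooth : ContDiff ℝ (⊤ : ℕ∞) χ
  supp : HasCompactSupport χ
  tsupp : tsupport χ ⊆ V

namespace IsTest

variable {V : Set E} {χ ψ : E → ℂ}

lemma conj (h : IsTest V χ) : IsTest V fun z => (starRingEnd ℂ) (χ z) :=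
  ⟨contDiff_conj h.smooth, hasCompactSupport_conj h.supp, (tsupport_conj χ).trans_subset h.tsupp⟩

lemma wd (h : IsTest V χ) (e : E) : IsTest V (wd χ e) :=
  ⟨contDiff_wd h.smooth e, hasCompactSupport_wd h.supp e, (tsupport_wd χ e).trans h.tsupp⟩

lemma wb (h : IsTest V χ) (e : E) : IsTest V (wb χ e) :=
  ⟨contDiff_wb h.smooth e, hasCompactSupport_wb h.supp e, (tsupport_wb χ e).trans h.tsupp⟩

lemma add (h : IsTest V χ) (h' : IsTest V ψ) : IsTest V fun z => χ z + ψ z :=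
  ⟨h.smooth.add h'.smooth, h.supp.add h'.supp,
    (tsupport_add χ ψ).trans (union_subset h.tsupp h'.tsupp)⟩

lemma const_mul (h : IsTest V χ) (c : ℂ) : IsTest V fun z => c * χ z :=
  ⟨contDiff_const.mul h.smooth, h.supp.mul_left,
    (tsupport_mul_subset_right (f := fun _ => c)).trans h.tsupp⟩

lemma zero : IsTest V fun _ : E => (0 : ℂ) :=
  ⟨contDiff_const, HasCompactSupport.zero, by simp [tsupport]⟩

lemma sum {ι : Type*} (s : Finset ι) {χ : ι → E → ℂ} (h : ∀ i, IsTest V (χ i)) :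
    IsTest V fun z => ∑ i ∈ s, χ i z := by
  classical
  induction s using Finset.induction_on with
  | empty => simpa using zero
  | insert a s ha ih => simp only [Finset.sum_insert ha]; exact (h a).add ih

lemma eq_zero (h : IsTest V χ) {z : E} (hz : z ∉ V) : χ z = 0 :=
  image_eq_zero_of_notMem_tsupport fun hh => hz (h.tsupp hh)

lemma differentiable (h : IsTest V χ) (z : E) : DifferentiableAt ℝ χ z :=
  h.smooth.differentiable (by simp) z

variable [MeasureSpace E] [BorelSpace E] [FiniteDimensional ℂ E]
  [(volume : Measure E).IsAddHaarMeasure]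

lemma memLp (h : IsTest V χ) (hV : IsOpen V) {w : E → ℝ} (hw : ContinuousOn w V) :
    MemLp (fun z => χ z * (w z : ℂ)) 2 (volume.restrict V) := by
  have hc : ContinuousOn (fun z => χ z * (w z : ℂ)) V :=
    h.smooth.continuous.continuousOn.mul (continuous_ofReal.comp_continuousOn hw)
  have : ProperSpace E := FiniteDimensional.proper ℂ E
  refine (memLp_two_iff_integrable_sq_norm (hc.aestronglyMeasurable hV.measurableSet)).2 ?_
  refine Integrable.integrableOn ?_
  exact integrable_of_continuousOn h.supp h.tsupp (hc.norm.pow 2) fun z hz => by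
    rw [image_eq_zero_of_notMem_tsupport hz]; simp

lemma setIntegral_eq (h : IsTest V χ) (f : E → ℂ) :
    ∫ z in V, f z * χ z = ∫ z, f z * χ z :=
  setIntegral_eq_integral_of_forall_compl_eq_zero fun z hz => by rw [h.eq_zero hz, mul_zero]

end IsTest

end Wb

section Hormander

variable {E : Type*} [NormedAddCommGroup E] [NormedSpace ℂ E]
variable [MeasureSpace E] [BorelSpace E] [FiniteDimensional ℂ E]
  [(volume : Measure E).IsAddHaarMeasure]

variable {ι : Type*} [Fintype ι] {V : Set E} {Φ s : E → ℝ} {e : ι → E} {δ C : ℝ}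

lemma integral_wb_mul_wb {χ ψ : E → ℂ} (hχ : IsTest V χ) (hψ : IsTest V ψ) (a b : E) :
    ∫ z, wb ψ a z * wb χ b z = ∫ z, wb ψ b z * wb χ a z := by
  have h1 := integral_mul_wb (hψ.wb a).smooth hχ.smooth (hψ.wb a).supp b
  have h2 := integral_mul_wb (hψ.wb b).smooth hχ.smooth (hψ.wb b).supp a
  rw [h1, h2]
  have h3 (z : E) : wb (wb ψ a) b z = wb (wb ψ b) a z :=
    wb_wb_comm ((contDiff_infty.1 hψ.smooth 2).contDiffAt) a b
  simp only [h3]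

/-- Projection of a test form onto the closed forms in a weighted `L²` space. -/
lemma exists_projection (h : LeviExhaustion V Φ s e δ C) (α : ι → E → ℂ)
    (hα : ∀ j, IsTest V (α j)) {v : ι → E → ℂ}
    (hv : ∀ j, MemLp (fun z => v j z * (Real.exp (-(Φ z - s z) / 2) : ℂ)) 2 (volume.restrict V))
    (hvc : ∀ χ, IsTest V χ → ∀ j k, ∫ z in V, v j z * wb χ (e k) z
      = ∫ z in V, v k z * wb χ (e j) z) :
    ∃ β : ι → E → ℂ, WeakDual V Φ s e β (fun z => ∑ j, wd (α j) (e j) z) ∧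
      ∑ j, ∫ z in V, (starRingEnd ℂ) (v j z) * α j z
        = ∑ j, ∫ z in V, (starRingEnd ℂ) (v j z) * β j z * (Real.exp (-(Φ z - s z)) : ℂ) := by
  have hV := h.isOpen
  set μ : Measure E := volume.restrict V with hμ
  have cp : ContinuousOn (fun z => Real.exp ((Φ z - s z) / 2)) V :=
    ((h.smooth_weight.continuousOn.sub h.smooth.continuousOn).div_const 2).rexp
  have cm : ContinuousOn (fun z => Real.exp (-(Φ z - s z) / 2)) V :=
    ((h.smooth_weight.continuousOn.sub h.smooth.continuousOn).neg.div_const 2).rexp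
  set wp : E → ℝ := fun z => Real.exp ((Φ z - s z) / 2) with hwp
  set wm : E → ℝ := fun z => Real.exp (-(Φ z - s z) / 2) with hwm
  have hpm (z : E) : (wp z : ℂ) * wm z = 1 := by
    rw [hwp, hwm, ← ofReal_mul, ← Real.exp_add, ← ofReal_one]
    congr 1
    rw [show (Φ z - s z) / 2 + -(Φ z - s z) / 2 = 0 by ring, Real.exp_zero]
  have hmm (z : E) : (wm z : ℂ) * wm z = (Real.exp (-(Φ z - s z)) : ℂ) := by
    rw [hwm, ← ofReal_mul, ← Real.exp_add]
    congr 2; ring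
  have hmm' (z : E) : (wm z : ℂ) * wm z = (Real.exp (-Φ z + s z) : ℂ) := by
    rw [hmm]; congr 2; ring
  have mt {χ : E → ℂ} (hχ : IsTest V χ) (j : ι) :
      MemLp (fun z => (starRingEnd ℂ) (wb χ (e j) z) * (wp z : ℂ)) 2 μ :=
    (hχ.wb (e j)).conj.memLp hV cp
  let H := PiLp 2 fun _ : ι => Lp ℂ 2 μ
  let Z : Submodule ℂ H :=
    { carrier := {x | ∀ χ (hχ : IsTest V χ) j k,
        inner ℂ (mt hχ j).toLp (x k) = inner ℂ (mt hχ k).toLp (x j)}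
      add_mem' := fun {x y} hx hy χ hχ j k => by
        rw [PiLp.add_apply, PiLp.add_apply, inner_add_right, inner_add_right, hx χ hχ j k,
          hy χ hχ j k]
      zero_mem' := fun χ hχ j k => by simp
      smul_mem' := fun c x hx χ hχ j k => by
        rw [PiLp.smul_apply, PiLp.smul_apply, inner_smul_right, inner_smul_right, hx χ hχ j k] }
  have hZc : IsClosed (Z : Set H) := by
    have : (Z : Set H) = ⋂ χ, ⋂ hχ : IsTest V χ, ⋂ j, ⋂ k, {x : H |
        inner ℂ (mt hχ j).toLp (x k) = inner ℂ (mt hχ k).toLp (x j)} := by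
      ext x; simp [Z]
    rw [this]
    refine isClosed_iInter fun χ => isClosed_iInter fun hχ => isClosed_iInter fun j =>
      isClosed_iInter fun k => isClosed_eq ?_ ?_
    · exact continuous_const.inner (PiLp.continuous_apply 2 _ k)
    · exact continuous_const.inner (PiLp.continuous_apply 2 _ j)
  have : CompleteSpace Z := hZc.completeSpace_coe
  have ma (j : ι) : MemLp (fun z => α j z * (wp z : ℂ)) 2 μ := (hα j).memLp hV cp
  set a : H := vecLp _ ma with ha
  set b : H := Z.starProjection a with hb
  have hbZ : b ∈ Z := Z.starProjection_apply_mem a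
  have hinner {g : H} (hg : g ∈ Z) : inner ℂ g a = inner ℂ g b := by
    have h1 : Z.starProjection g = g := Submodule.starProjection_eq_self_iff.2 hg
    rw [hb, ← Submodule.inner_starProjection_left_eq_right, h1]
  have hbv : b = vecLp (fun j => (b j : E → ℂ)) (fun j => Lp.memLp (b j)) := (vecLp_coe b).symm
  have hbm (j : ι) : MemLp (b j : E → ℂ) 2 μ := Lp.memLp (b j)
  have hZmem {f : ι → E → ℂ} (hf : ∀ j, MemLp (fun z => f j z * (wm z : ℂ)) 2 μ)
      (hc : ∀ χ, IsTest V χ → ∀ j k, ∫ z in V, f j z * wb χ (e k) z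
        = ∫ z in V, f k z * wb χ (e j) z) : vecLp _ hf ∈ Z := by
    intro χ hχ j k
    change inner ℂ (mt hχ j).toLp (hf k).toLp = inner ℂ (mt hχ k).toLp (hf j).toLp
    rw [inner_toLp, inner_toLp]
    have e1 (j k : ι) (z : E) : (starRingEnd ℂ) ((starRingEnd ℂ) (wb χ (e j) z) * (wp z : ℂ))
        * (f k z * (wm z : ℂ)) = f k z * wb χ (e j) z := by
      simp only [map_mul, Complex.conj_conj, conj_ofReal]
      linear_combination (wb χ (e j) z * f k z) * hpm z
    simp only [e1]
    exact (hc χ hχ j k).symm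
  refine ⟨fun j => V.indicator fun z => (b j : E → ℂ) z * (wp z : ℂ), ⟨fun j => ?_, fun j z hz => ?_,
    fun j => ?_, fun χ h1 h2 h3 j k => ?_, fun χ h1 h2 h3 => ?_, ?_, ?_, ?_⟩, ?_⟩
  · rw [aestronglyMeasurable_indicator_iff hV.measurableSet]
    exact (hbm j).1.mul
      ((continuous_ofReal.comp_continuousOn cp).aestronglyMeasurable hV.measurableSet)
  · exact indicator_of_notMem hz _
  · have h1 : Integrable (fun z => ‖(b j : E → ℂ) z‖ ^ 2) μ :=
      (memLp_two_iff_integrable_sq_norm (hbm j).1).1 (hbm j)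
    refine ((integrable_indicator_iff hV.measurableSet).2 h1).congr (Eventually.of_forall fun z => ?_)
    by_cases hz : z ∈ V
    · simp only [indicator_of_mem hz, norm_mul, norm_real, mul_pow]
      rw [mul_assoc, hwp, Real.norm_of_nonneg (Real.exp_pos _).le, ← Real.exp_nat_mul,
        ← Real.exp_add]
      rw [show ((2:ℕ):ℝ) * ((Φ z - s z) / 2) + (-Φ z + s z) = 0 by push_cast; ring, Real.exp_zero,
        mul_one]
    · simp [indicator_of_notMem hz]
  · have hχ : IsTest V χ := ⟨h1, h2, h3⟩
    have e1 (j k : ι) : ∫ z, V.indicator (fun z => (b j : E → ℂ) z * (wp z : ℂ)) z * wb χ (e k) z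
        = inner ℂ (mt hχ k).toLp (b j) := by
      rw [← (hχ.wb (e k)).setIntegral_eq, L2.inner_def]
      refine integral_congr_ae ?_
      filter_upwards [(mt hχ k).coeFn_toLp, ae_restrict_mem hV.measurableSet] with z hz hzV
      rw [hz, indicator_of_mem hzV, RCLike.inner_apply]
      simp only [map_mul, Complex.conj_conj, conj_ofReal]
      ring
    rw [e1, e1]
    exact hbZ χ hχ k j
  · have hχ : IsTest V χ := ⟨h1, h2, h3⟩
    have hg (j : ι) : MemLp (fun z => wb (fun z => (starRingEnd ℂ) (χ z)) (e j) z * (wm z : ℂ)) 2 μ :=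
      (hχ.conj.wb (e j)).memLp hV cm
    have hgZ : vecLp _ hg ∈ Z := hZmem hg fun ψ hψ j k => by
      rw [(hψ.wb _).setIntegral_eq, (hψ.wb _).setIntegral_eq]
      exact integral_wb_mul_wb hψ hχ.conj _ _
    have h4 := hinner hgZ
    rw [ha, hbv, inner_vecLp, inner_vecLp] at h4
    have hc (j : ι) (z : E) : (starRingEnd ℂ) (wb (fun z => (starRingEnd ℂ) (χ z)) (e j) z)
        = wd χ (e j) z := by
      rw [wb_conj (hχ.differentiable z), Complex.conj_conj]
    simp only [map_mul, hc, conj_ofReal] at h4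
    have e1 (j : ι) : ∫ z, V.indicator (fun z => (b j : E → ℂ) z * (wp z : ℂ)) z
        * (Real.exp (-Φ z + s z) : ℂ) * wd χ (e j) z
        = ∫ z in V, wd χ (e j) z * (wm z : ℂ) * (b j : E → ℂ) z := by
      rw [← (hχ.wd (e j)).setIntegral_eq]
      refine setIntegral_congr_fun hV.measurableSet fun z hz => ?_
      simp only
      rw [indicator_of_mem hz, ← hmm']
      linear_combination ((b j : E → ℂ) z * wm z * wd χ (e j) z) * hpm z
    have e2 (j : ι) : ∫ z in V, wd χ (e j) z * (wm z : ℂ) * (α j z * (wp z : ℂ))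
        = -∫ z, wd (α j) (e j) z * χ z := by
      rw [← integral_mul_wd (hα j).smooth hχ.smooth (hα j).supp, ← (hχ.wd (e j)).setIntegral_eq]
      refine integral_congr_ae (Eventually.of_forall fun z => ?_)
      simp only
      linear_combination (α j z * wd χ (e j) z) * hpm z
    simp only [e1]
    rw [← h4]
    rw [Finset.sum_congr rfl fun j _ => e2 j]
    simp only [Finset.sum_mul]
    rw [integral_finsetSum _ fun j _ => ?_, Finset.sum_neg_distrib]
    exact integrable_mul_test ((hα j).wd (e j)).smooth.continuous hχ.smooth.continuous
      ((hα j).wd (e j)).supp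
  · exact (IsTest.sum Finset.univ fun j => (hα j).wd (e j)).smooth.continuous
  · exact (IsTest.sum Finset.univ fun j => (hα j).wd (e j)).supp
  · exact (IsTest.sum Finset.univ fun j => (hα j).wd (e j)).tsupp
  · have h4 := hinner (hZmem hv hvc)
    rw [ha, hbv, inner_vecLp, inner_vecLp] at h4
    refine Eq.trans ?_ (h4.trans ?_)
    · refine Finset.sum_congr rfl fun j _ => integral_congr_ae (Eventually.of_forall fun z => ?_)
      simp only [map_mul, conj_ofReal]
      linear_combination -((starRingEnd ℂ) (v j z) * α j z) * hpm z
    · refine Finset.sum_congr rfl fun j _ => setIntegral_congr_fun hV.measurableSet fun z hz => ?_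
      simp only [map_mul, conj_ofReal]
      rw [indicator_of_mem hz, ← hmm]
      linear_combination -((starRingEnd ℂ) (v j z) * (b j : E → ℂ) z * wm z) * hpm z

end Hormander

section Hormander

variable {E : Type*} [NormedAddCommGroup E] [NormedSpace ℂ E]
variable [MeasureSpace E] [BorelSpace E] [FiniteDimensional ℂ E]
  [(volume : Measure E).IsAddHaarMeasure]

variable {ι : Type*} [Fintype ι] {V : Set E} {Φ s : E → ℝ} {e : ι → E} {δ C : ℝ}

lemma LeviExhaustion.pairing_bound (h : LeviExhaustion V Φ s e δ C) (hδ : 0 < δ)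
    {v : ι → E → ℂ}
    (hv : ∀ j, MemLp (fun z => v j z * (Real.exp (-(Φ z - 2 * s z) / 2) : ℂ)) 2
      (volume.restrict V))
    (hvc : ∀ χ, IsTest V χ → ∀ j k, ∫ z in V, v j z * wb χ (e k) z
      = ∫ z in V, v k z * wb χ (e j) z)
    {α : ι → E → ℂ} (hα : ∀ j, IsTest V (α j)) :
    ‖∑ j, ∫ z in V, (starRingEnd ℂ) (v j z) * α j z‖ ≤ Real.sqrt (4 / δ * ‖vecLp _ hv‖ ^ 2) *
      Real.sqrt (∫ z, ‖∑ j, wd (α j) (e j) z‖ ^ 2 * Real.exp (Φ z - 2 * s z)) := by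
  have hV := h.isOpen
  set μ : Measure E := volume.restrict V with hμ
  have cs : ContinuousOn (fun z => Real.exp (-s z / 2)) V :=
    (h.smooth.continuousOn.neg.div_const 2).rexp
  have hv' (j : ι) : MemLp (fun z => v j z * (Real.exp (-(Φ z - s z) / 2) : ℂ)) 2 μ := by
    refine (hv j).of_le ?_ ?_ (f := fun z => v j z * (Real.exp (-(Φ z - s z) / 2) : ℂ))
    · refine ((hv j).1.mul ((continuous_ofReal.comp_continuousOn cs).aestronglyMeasurable
        hV.measurableSet)).congr (Eventually.of_forall fun z => ?_)
      simp only [Pi.mul_apply, Function.comp_apply]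
      rw [mul_assoc, ← ofReal_mul, ← Real.exp_add]
      congr 3; ring
    · filter_upwards [ae_restrict_mem hV.measurableSet] with z hz
      rw [norm_mul, norm_mul, norm_real, norm_real, Real.norm_of_nonneg (Real.exp_pos _).le,
        Real.norm_of_nonneg (Real.exp_pos _).le]
      have := h.nonneg z hz
      gcongr
      linarith
  obtain ⟨β, hβ, h1⟩ := exists_projection h α hα hv' hvc
  have hd := dual_estimate h hβ
  have hb (j : ι) : MemLp (fun z => β j z * (Real.exp (-Φ z / 2) : ℂ)) 2 μ := by
    have cm : ContinuousOn (fun z => Real.exp (-Φ z / 2)) V :=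
      (h.smooth_weight.continuousOn.neg.div_const 2).rexp
    have hm : AEStronglyMeasurable (fun z => β j z * (Real.exp (-Φ z / 2) : ℂ)) μ :=
      (hβ.meas j).restrict.mul ((continuous_ofReal.comp_continuousOn cm).aestronglyMeasurable
        hV.measurableSet)
    refine (memLp_two_iff_integrable_sq_norm hm).2 ?_
    refine (hβ.integrable h j).integrableOn.congr (Eventually.of_forall fun z => ?_)
    simp only
    rw [norm_mul, mul_pow, norm_real, Real.norm_of_nonneg (Real.exp_pos _).le,
      ← Real.exp_nat_mul]
    congr 2; push_cast; ring
  have h2 : inner ℂ (vecLp _ hv) (vecLp _ hb)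
      = ∑ j, ∫ z in V, (starRingEnd ℂ) (v j z) * α j z := by
    rw [h1, inner_vecLp]
    refine Finset.sum_congr rfl fun j _ => integral_congr_ae (Eventually.of_forall fun z => ?_)
    simp only [map_mul, conj_ofReal]
    rw [show -(Φ z - s z) = -(Φ z - 2 * s z) / 2 + -Φ z / 2 by ring, Real.exp_add, ofReal_mul]
    ring
  have h3 : ‖vecLp _ hb‖ ^ 2 ≤ 4 / δ *
      ∫ z, ‖∑ j, wd (α j) (e j) z‖ ^ 2 * Real.exp (Φ z - 2 * s z) := by
    rw [norm_vecLp_sq]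
    have : ∑ j, ∫ z in V, ‖β j z * (Real.exp (-Φ z / 2) : ℂ)‖ ^ 2
        = ∑ j, ∫ z, ‖β j z‖ ^ 2 * Real.exp (-Φ z) := by
      refine Finset.sum_congr rfl fun j _ => ?_
      rw [← setIntegral_eq_integral_of_forall_compl_eq_zero (s := V)
        (f := fun z => ‖β j z‖ ^ 2 * Real.exp (-Φ z)) fun z hz => by rw [hβ.zero j z hz]; simp]
      refine integral_congr_ae (Eventually.of_forall fun z => ?_)
      simp only
      rw [norm_mul, mul_pow, norm_real, Real.norm_of_nonneg (Real.exp_pos _).le,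
        ← Real.exp_nat_mul]
      congr 2; push_cast; ring
    rw [this, div_mul_eq_mul_div, le_div_iff₀ hδ, mul_comm]
    exact hd
  rw [← h2, ← Real.sqrt_mul (by positivity)]
  refine (norm_inner_le_norm _ _).trans (Real.le_sqrt_of_sq_le ?_)
  rw [mul_pow]
  calc _ ≤ ‖vecLp _ hv‖ ^ 2 * (4 / δ *
      ∫ z, ‖∑ j, wd (α j) (e j) z‖ ^ 2 * Real.exp (Φ z - 2 * s z)) := by gcongr
    _ = _ := by ring

/-- Hörmander's `L²` existence theorem for the `∂̄`-equation. -/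
theorem hormander (h : LeviExhaustion V Φ s e δ C) (hδ : 0 < δ) {v : ι → E → ℂ}
    (hv : ∀ j, MemLp (fun z => v j z * (Real.exp (-(Φ z - 2 * s z) / 2) : ℂ)) 2
      (volume.restrict V))
    (hvc : ∀ χ, IsTest V χ → ∀ j k, ∫ z in V, v j z * wb χ (e k) z
      = ∫ z in V, v k z * wb χ (e j) z) :
    ∃ u : E → ℂ, MemLp (fun z => u z * (Real.exp (-(Φ z - 2 * s z) / 2) : ℂ)) 2
        (volume.restrict V) ∧
      (∀ χ, IsTest V χ → ∀ j, ∫ z in V, v j z * χ z = -∫ z in V, u z * wb χ (e j) z) ∧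
      ∫ z in V, ‖u z * (Real.exp (-(Φ z - 2 * s z) / 2) : ℂ)‖ ^ 2
        ≤ 4 / δ * ∑ j, ∫ z in V, ‖v j z * (Real.exp (-(Φ z - 2 * s z) / 2) : ℂ)‖ ^ 2 := by
  classical
  have hV := h.isOpen
  set μ : Measure E := volume.restrict V with hμ
  have cp : ContinuousOn (fun z => Real.exp ((Φ z - 2 * s z) / 2)) V :=
    ((h.smooth_weight.continuousOn.sub
      (h.smooth.continuousOn.const_mul 2)).div_const 2).rexp
  have hpm (z : E) : (Real.exp ((Φ z - 2 * s z) / 2) : ℂ) * Real.exp (-(Φ z - 2 * s z) / 2) = 1 := by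
    rw [← ofReal_mul, ← Real.exp_add, ← ofReal_one]
    congr 1
    rw [show (Φ z - 2 * s z) / 2 + -(Φ z - 2 * s z) / 2 = 0 by ring, Real.exp_zero]
  let M : Submodule ℂ (ι → E → ℂ) :=
    { carrier := {α | ∀ j, IsTest V (α j)}
      add_mem' := fun ha hb j => (ha j).add (hb j)
      zero_mem' := fun j => IsTest.zero
      smul_mem' := fun c α ha j => (ha j).const_mul c }
  have mD (α : M) : MemLp (fun z => (∑ j, wd (α.1 j) (e j) z)
      * (Real.exp ((Φ z - 2 * s z) / 2) : ℂ)) 2 μ :=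
    (IsTest.sum Finset.univ fun j => (α.2 j).wd (e j)).memLp hV cp
  let T : M →ₗ[ℂ] Lp ℂ 2 μ :=
    { toFun := fun α => (mD α).toLp
      map_add' := fun α β => by
        rw [← MemLp.toLp_add]
        refine MemLp.toLp_congr _ _ (Eventually.of_forall fun z => ?_)
        simp only [Pi.add_apply]
        rw [← add_mul, ← Finset.sum_add_distrib]
        congr 1
        exact Finset.sum_congr rfl fun j _ =>
          wd_add ((α.2 j).differentiable z) ((β.2 j).differentiable z) (e j)
      map_smul' := fun c α => by
        rw [RingHom.id_apply, ← MemLp.toLp_const_smul]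
        refine MemLp.toLp_congr _ _ (Eventually.of_forall fun z => ?_)
        simp only [Pi.smul_apply, smul_eq_mul]
        rw [← mul_assoc, Finset.mul_sum]
        congr 1
        exact Finset.sum_congr rfl fun j _ => wd_const_mul ((α.2 j).differentiable z) c (e j) }
  have hint (j : ι) {χ : E → ℂ} (hχ : IsTest V χ) :
      Integrable (fun z => (starRingEnd ℂ) (v j z) * χ z) μ := by
    have := (hv j).star.integrable_mul (hχ.memLp hV cp)
    refine this.congr (Eventually.of_forall fun z => ?_)
    simp only [Pi.mul_apply, Pi.star_apply, RCLike.star_def, map_mul, conj_ofReal]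
    linear_combination ((starRingEnd ℂ) (v j z) * χ z) * hpm z
  let l : M →ₗ[ℂ] ℂ :=
    { toFun := fun α => ∑ j, ∫ z in V, (starRingEnd ℂ) (v j z) * α.1 j z
      map_add' := fun α β => by
        rw [← Finset.sum_add_distrib]
        refine Finset.sum_congr rfl fun j _ => ?_
        rw [← integral_add (hint j (α.2 j)) (hint j (β.2 j))]
        refine integral_congr_ae (Eventually.of_forall fun z => ?_)
        exact mul_add _ _ _
      map_smul' := fun c α => by
        rw [RingHom.id_apply, smul_eq_mul, Finset.mul_sum]
        refine Finset.sum_congr rfl fun j _ => ?_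
        rw [← integral_const_mul]
        refine integral_congr_ae (Eventually.of_forall fun z => ?_)
        exact mul_left_comm _ _ _ }
  have hT (α : M) : ‖T α‖ = Real.sqrt (∫ z, ‖∑ j, wd (α.1 j) (e j) z‖ ^ 2
      * Real.exp (Φ z - 2 * s z)) := by
    rw [← Real.sqrt_sq (norm_nonneg (T α))]
    congr 1
    refine (norm_toLp_sq (mD α)).trans ?_
    rw [← setIntegral_eq_integral_of_forall_compl_eq_zero (s := V)
      (f := fun z => ‖∑ j, wd (α.1 j) (e j) z‖ ^ 2 * Real.exp (Φ z - 2 * s z)) fun z hz => by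
      rw [(IsTest.sum Finset.univ fun j => (α.2 j).wd (e j)).eq_zero hz]; simp]
    refine integral_congr_ae (Eventually.of_forall fun z => ?_)
    simp only
    rw [norm_mul, mul_pow, norm_real, Real.norm_of_nonneg (Real.exp_pos _).le,
      ← Real.exp_nat_mul]
    congr 2; push_cast; ring
  obtain ⟨g, hg, hgl⟩ := exists_inner_eq T l (Real.sqrt_nonneg (4 / δ * ‖vecLp _ hv‖ ^ 2))
    fun α => by rw [hT]; exact h.pairing_bound hδ hv hvc α.2
  have hum (z : E) : -((g : E → ℂ) z * (Real.exp ((Φ z - 2 * s z) / 2) : ℂ))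
      * (Real.exp (-(Φ z - 2 * s z) / 2) : ℂ) = -(g : E → ℂ) z := by
    linear_combination (-(g : E → ℂ) z) * hpm z
  refine ⟨fun z => -((g : E → ℂ) z * (Real.exp ((Φ z - 2 * s z) / 2) : ℂ)), ?_, fun χ hχ j => ?_, ?_⟩
  · simp only [hum]
    exact (Lp.memLp g).neg
  · let α : M := ⟨fun i => if i = j then fun z => (starRingEnd ℂ) (χ z) else fun _ => 0, fun i => by
      by_cases hi : i = j
      · simp only [hi, if_true]; exact hχ.conj
      · simp only [hi, if_false]; exact IsTest.zero⟩
    have e1 : l α = ∫ z in V, (starRingEnd ℂ) (v j z) * (starRingEnd ℂ) (χ z) := by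
      change ∑ i, ∫ z in V, (starRingEnd ℂ) (v i z) * α.1 i z = _
      rw [Finset.sum_eq_single j (fun i _ hi => by simp [α, hi]) (by simp)]
      simp [α]
    have e2 (z : E) : ∑ i, wd (α.1 i) (e i) z = (starRingEnd ℂ) (wb χ (e j) z) := by
      rw [Finset.sum_eq_single j (fun i _ hi => by simp [α, hi, wd]) (by simp)]
      simp only [α, if_true]
      exact wd_conj (hχ.differentiable z) _
    have e3 : inner ℂ g (T α) = ∫ z in V, (starRingEnd ℂ) ((g : E → ℂ) z)
        * ((starRingEnd ℂ) (wb χ (e j) z) * (Real.exp ((Φ z - 2 * s z) / 2) : ℂ)) := by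
      rw [L2.inner_def]
      refine integral_congr_ae ?_
      filter_upwards [(mD α).coeFn_toLp] with z hz
      have hz' : (T α : E → ℂ) z = _ := hz
      rw [hz', RCLike.inner_apply, e2, mul_comm]
    have e4 := (e1.symm.trans (hgl α)).trans e3
    have e5 := congrArg (starRingEnd ℂ) e4
    rw [← integral_conj, ← integral_conj] at e5
    simp only [map_mul, Complex.conj_conj, conj_ofReal] at e5
    rw [e5, ← integral_neg]
    refine integral_congr_ae (Eventually.of_forall fun z => ?_)
    simp only
    ring
  · simp only [hum, norm_neg]
    rw [← norm_vecLp_sq hv, integral_norm_sq_eq (Lp.memLp g), ← Lp.norm_def]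
    exact (pow_le_pow_left₀ (norm_nonneg g) hg 2).trans_eq (Real.sq_sqrt (by positivity))

end Hormander

section Rotation

variable {E : Type*} [NormedAddCommGroup E] [NormedSpace ℂ E]
variable [MeasureSpace E] [BorelSpace E] [FiniteDimensional ℂ E]
  [(volume : Measure E).IsAddHaarMeasure]

lemma measurePreserving_smul_of_norm_eq_one {c : ℂ} (hc : ‖c‖ = 1) :
    MeasurePreserving (fun x : E => c • x) volume volume := by
  have : FiniteDimensional ℝ E := FiniteDimensional.complexToReal E
  have hc0 : c ≠ 0 := by rintro rfl; simp at hc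
  have hm : Measurable fun x : E => c • x := (continuous_const_smul c).measurable
  let L : E →ₗ[ℝ] E := (LinearMap.lsmul ℂ E c).restrictScalars ℝ
  have hL (x : E) : L x = c • x := rfl
  have hdet : LinearMap.det L ≠ 0 := by
    have h1 : L ∘ₗ ((LinearMap.lsmul ℂ E c⁻¹).restrictScalars ℝ) = LinearMap.id := by
      ext x; simp [L, smul_smul, hc0]
    intro h2
    have h3 := congrArg LinearMap.det h1
    rw [LinearMap.det_comp, h2, zero_mul, LinearMap.det_id] at h3
    exact zero_ne_one h3
  have key (s : Set E) : volume ((fun x : E => c • x) ⁻¹' s)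
      = ENNReal.ofReal |(LinearMap.det L)⁻¹| * volume s :=
    Measure.addHaar_preimage_linearMap volume hdet s
  have hb : (fun x : E => c • x) ⁻¹' ball 0 1 = ball 0 1 := by
    ext x; simp [norm_smul, hc]
  have h1 := key (ball 0 1)
  rw [hb] at h1
  have : ProperSpace E := FiniteDimensional.proper ℂ E
  have h2 : volume (ball (0 : E) 1) ≠ 0 := (measure_ball_pos volume 0 one_pos).ne'
  have h3 : volume (ball (0 : E) 1) ≠ ∞ := measure_ball_lt_top.ne
  have h4 : ENNReal.ofReal |(LinearMap.det L)⁻¹| = 1 := by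
    have := h1.symm
    nth_rewrite 2 [← one_mul (volume (ball (0 : E) 1))] at this
    exact (ENNReal.mul_left_inj h2 h3).1 this
  refine ⟨hm, Measure.ext fun s hs => ?_⟩
  rw [Measure.map_apply hm hs, key, h4, one_mul]

lemma integral_smul_of_norm_eq_one {F : Type*} [NormedAddCommGroup F] [NormedSpace ℝ F]
    {c : ℂ} (hc : ‖c‖ = 1) (g : E → F) : ∫ x, g (c • x) = ∫ x, g x := by
  have hc0 : c ≠ 0 := by rintro rfl; simp at hc
  exact (measurePreserving_smul_of_norm_eq_one hc).integral_comp
    (Homeomorph.smulOfNeZero c hc0).measurableEmbedding g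

/-- Averaging an integral over rotations. -/
lemma integral_eq_integral_circle {F : Type*} [NormedAddCommGroup F] [NormedSpace ℝ F]
    [CompleteSpace F] {g : E → F} (hg : Integrable g) (hgm : StronglyMeasurable g) :
    Integrable (fun x => ∫ θ in (0:ℝ)..(2 * Real.pi), g (Complex.exp (θ * I) • x)) ∧
    ∫ x, g x = (2 * Real.pi)⁻¹ • ∫ x, ∫ θ in (0:ℝ)..(2 * Real.pi), g (Complex.exp (θ * I) • x) := by
  have : ProperSpace E := FiniteDimensional.proper ℂ E
  have hc (θ : ℝ) : ‖Complex.exp (θ * I)‖ = 1 := Complex.norm_exp_ofReal_mul_I θ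
  have hcont : Continuous fun p : ℝ × E => Complex.exp (p.1 * I) • p.2 := by fun_prop
  have hm : StronglyMeasurable fun p : ℝ × E => g (Complex.exp (p.1 * I) • p.2) :=
    hgm.comp_measurable hcont.measurable
  have hint : Integrable (fun p : ℝ × E => g (Complex.exp (p.1 * I) • p.2))
      ((volume.restrict (Ioc 0 (2 * Real.pi))).prod volume) := by
    rw [integrable_prod_iff hm.aestronglyMeasurable]
    refine ⟨Eventually.of_forall fun θ => ?_, ?_⟩
    · exact ((measurePreserving_smul_of_norm_eq_one (hc θ)).integrable_comp
        hgm.aestronglyMeasurable).2 hg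
    · simp only [integral_smul_of_norm_eq_one (hc _) fun x => ‖g x‖]
      exact integrable_const _
  have hpi : (0:ℝ) ≤ 2 * Real.pi := by positivity
  simp only [intervalIntegral.integral_of_le hpi]
  refine ⟨hint.integral_prod_right, ?_⟩
  rw [← integral_integral_swap hint]
  simp only [integral_smul_of_norm_eq_one (hc _) g]
  rw [setIntegral_const, smul_smul]
  rw [Real.volume_real_Ioc_of_le hpi, sub_zero, inv_mul_cancel₀ (by positivity), one_smul]

end Rotation

section MeanValue

variable {E : Type*} [NormedAddCommGroup E] [NormedSpace ℂ E]
variable [MeasureSpace E] [BorelSpace E] [FiniteDimensional ℂ E]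
  [(volume : Measure E).IsAddHaarMeasure]

omit [MeasureSpace E] [BorelSpace E] [FiniteDimensional ℂ E]
  [(volume : Measure E).IsAddHaarMeasure] in
lemma integral_circle_eq {f : E → ℂ} {Ω : Set E} (hΩ : IsOpen Ω) (hf : DifferentiableOn ℂ f Ω)
    {z w : E} (hz : ∀ l : ℂ, ‖l‖ ≤ 1 → z + l • w ∈ Ω) :
    ∫ θ in (0:ℝ)..(2 * Real.pi), f (z + Complex.exp (θ * I) • w) = (2 * Real.pi) • f z := by
  have hd (l : ℂ) (hl : ‖l‖ ≤ 1) : DifferentiableAt ℂ (fun l : ℂ => f (z + l • w)) l :=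
    (hf.differentiableAt (hΩ.mem_nhds (hz l hl))).comp (f := fun l : ℂ => z + l • w) l
      (by fun_prop)
  have h1 : Real.circleAverage (fun l : ℂ => f (z + l • w)) 0 1 = f (z + (0:ℂ) • w) := by
    refine circleAverage_of_differentiable_on_off_countable (s := ∅) countable_empty ?_ ?_
    · intro l hl
      exact (hd l (by simpa using hl)).continuousAt.continuousWithinAt
    · intro l hl
      exact hd l (by simpa using (mem_ball_zero_iff.1 hl.1).le)
  rw [Real.circleAverage_def] at h1
  simp only [circleMap, ofReal_one, one_mul, zero_add, zero_smul, add_zero] at h1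
  rw [← h1, smul_smul, mul_inv_cancel₀ (by positivity), one_smul]

omit [FiniteDimensional ℂ E] [BorelSpace E] [(volume : Measure E).IsAddHaarMeasure] in
lemma IsMollifier.tsupport_subset {ρ : E → ℝ} {r : ℝ} (hρ : IsMollifier ρ r) :
    tsupport ρ ⊆ closedBall 0 r :=
  closure_minimal (fun x hx => by simpa using hρ.norm_le x hx) isClosed_closedBall

omit [FiniteDimensional ℂ E] [BorelSpace E] [(volume : Measure E).IsAddHaarMeasure] in
lemma IsMollifier.continuous_smul {F : Type*} [NormedAddCommGroup F] [NormedSpace ℝ F]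
    {ρ : E → ℝ} {r : ℝ} (hρ : IsMollifier ρ r) {f : E → F} {Ω : Set E}
    (hΩ : IsOpen Ω) (hf : ContinuousOn f Ω) {z : E} (hz : closedBall z r ⊆ Ω) :
    Continuous fun w => ρ w • f (z - w) := by
  rw [continuous_iff_continuousAt]
  intro w
  by_cases hw : w ∈ tsupport ρ
  · have h1 := hρ.tsupport_subset hw
    have h2 : z - w ∈ Ω := hz (by simpa [dist_eq_norm] using h1)
    exact hρ.smooth.continuous.continuousAt.smul
      ((hf.continuousAt (hΩ.mem_nhds h2)).comp (f := fun w => z - w) (by fun_prop))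
  · have h1 : (fun w => ρ w • f (z - w)) =ᶠ[𝓝 w] fun _ => (0 : F) := by
      filter_upwards [(notMem_tsupport_iff_eventuallyEq.1 hw)] with x hx
      rw [hx]; simp
    exact h1.continuousAt

/-- The mean value property for holomorphic functions. -/
lemma IsMollifier.moll_eq {ρ : E → ℝ} {r : ℝ} (hρ : IsMollifier ρ r) {f : E → ℂ} {Ω : Set E}
    (hΩ : IsOpen Ω) (hf : DifferentiableOn ℂ f Ω) {z : E} (hz : closedBall z r ⊆ Ω) :
    moll ρ f z = f z := by
  have hcont := hρ.continuous_smul hΩ hf.continuousOn hz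
  have : ProperSpace E := FiniteDimensional.proper ℂ E
  have hint : Integrable fun w => ρ w • f (z - w) :=
    hcont.integrable_of_hasCompactSupport hρ.hasCompactSupport.smul_right
  rw [moll_apply, (integral_eq_integral_circle hint hcont.stronglyMeasurable).2]
  have h1 (w : E) : ∫ θ in (0:ℝ)..(2 * Real.pi), ρ (Complex.exp (θ * I) • w) •
      f (z - Complex.exp (θ * I) • w) = (2 * Real.pi) • (ρ w • f z) := by
    simp only [hρ.circle _ (Complex.norm_exp_ofReal_mul_I _)]
    rw [intervalIntegral.integral_smul, smul_comm]
    by_cases hw : ρ w = 0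
    · simp [hw]
    congr 1
    have := integral_circle_eq hΩ hf (z := z) (w := -w) fun l hl => hz (by
      have := hρ.norm_le w hw
      simp only [smul_neg, mem_closedBall, dist_eq_norm, add_sub_cancel_left, norm_neg, norm_smul]
      nlinarith [norm_nonneg w, norm_nonneg l])
    simpa [sub_eq_add_neg] using this
  simp only [h1]
  rw [integral_smul, smul_smul, inv_mul_cancel₀ (by positivity), one_smul, integral_smul_const,
    hρ.integral_eq_one, one_smul]

/-- A bound for a holomorphic function by its `L²` norm on a ball. -/
lemma IsMollifier.enorm_sq_le {ρ : E → ℝ} {r : ℝ} (hρ : IsMollifier ρ r) :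
    ∃ M : ℝ≥0, ∀ (f : E → ℂ) (Ω : Set E), IsOpen Ω → DifferentiableOn ℂ f Ω → ∀ z,
      closedBall z r ⊆ Ω → ‖f z‖ₑ ^ 2 ≤ M * ∫⁻ w in closedBall z r, ‖f w‖ₑ ^ 2 := by
  have : ProperSpace E := FiniteDimensional.proper ℂ E
  obtain ⟨M, hM⟩ := hρ.smooth.continuous.bounded_above_of_compact_support hρ.hasCompactSupport
  refine ⟨M.toNNReal, fun f Ω hΩ hf z hz => ?_⟩
  have h1 := hρ.moll_eq hΩ (hf.pow 2) hz
  rw [moll_apply'] at h1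
  rw [← enorm_pow, ← Pi.pow_apply, ← h1]
  refine (enorm_integral_le_lintegral_enorm _).trans ?_
  rw [← lintegral_const_mul' _ _ ENNReal.coe_ne_top, ← lintegral_indicator measurableSet_closedBall]
  refine lintegral_mono fun w => ?_
  by_cases hw : w ∈ closedBall z r
  · rw [indicator_of_mem hw, enorm_smul, Pi.pow_apply, enorm_pow]
    gcongr
    rw [← ofReal_norm_eq_enorm]
    exact ENNReal.ofReal_le_ofReal (hM _)
  · rw [indicator_of_notMem hw]
    have : ρ (z - w) = 0 := by
      by_contra h
      exact hw (by simpa [dist_eq_norm, norm_sub_rev] using hρ.norm_le _ h)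
    simp [this]

end MeanValue

section Weyl

variable {E : Type*} [NormedAddCommGroup E] [NormedSpace ℂ E] {ι : Type*} {e : ι → E}

lemma differentiableAt_of_wb_eq_zero (he : Submodule.span ℂ (range e) = ⊤) {f : E → ℂ} {z : E}
    (hf : DifferentiableAt ℝ f z) (h : ∀ j, wb f (e j) z = 0) : DifferentiableAt ℂ f z := by
  let S : Submodule ℂ E :=
    { carrier := {v | ∀ c : ℂ, fderiv ℝ f z (c • v) = c * fderiv ℝ f z v}
      add_mem' := fun {a b} ha hb c => by
        rw [smul_add, map_add, map_add, ha c, hb c, mul_add]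
      zero_mem' := fun c => by simp
      smul_mem' := fun c v hv d => by rw [smul_smul, hv, hv c, mul_assoc] }
  have hS : S = ⊤ := by
    rw [eq_top_iff, ← he, Submodule.span_le]
    rintro _ ⟨j, rfl⟩ c
    have h1 := h j
    rw [wb, div_eq_zero_iff, or_iff_left two_ne_zero] at h1
    have h2 : fderiv ℝ f z (I • e j) = I * fderiv ℝ f z (e j) := by
      linear_combination (-I) * h1 + (fderiv ℝ f z (I • e j)) * I_sq
    have h3 : c • e j = c.re • e j + c.im • (I • e j) := by
      rw [← coe_smul, ← coe_smul, smul_smul, ← add_smul, re_add_im]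
    rw [h3, map_add, map_smul, map_smul, h2, real_smul, real_smul]
    nth_rewrite 3 [← re_add_im c]
    ring
  rw [differentiableAt_iff_restrictScalars ℝ hf]
  have hlin (c : ℂ) (v : E) : fderiv ℝ f z (c • v) = c * fderiv ℝ f z v :=
    (hS ▸ Submodule.mem_top : v ∈ S) c
  exact ⟨{ (fderiv ℝ f z) with map_smul' := hlin }, by ext; rfl⟩

lemma wb_eq_zero_of_differentiableAt {f : E → ℂ} {z : E} (hf : DifferentiableAt ℂ f z) (e : E) :
    wb f e z = 0 := by
  have h := (hf.hasFDerivAt.restrictScalars ℝ).fderiv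
  rw [wb, h]
  simp only [ContinuousLinearMap.coe_restrictScalars', map_smul, smul_eq_mul]
  linear_combination (fderiv ℂ f z e) / 2 * I_sq

variable [MeasureSpace E] [BorelSpace E] [FiniteDimensional ℂ E]
  [(volume : Measure E).IsAddHaarMeasure]

lemma IsMollifier.isTest_sub {ρ : E → ℝ} {r : ℝ} (hρ : IsMollifier ρ r) {V : Set E} {x : E}
    (h : closedBall x r ⊆ V) : IsTest V fun y => (ρ (x - y) : ℂ) := by
  refine ⟨(hρ.test x).1, (hρ.test x).2, (closure_minimal (fun y hy => ?_)
    isClosed_closedBall).trans h⟩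
  have h1 : ρ (x - y) ≠ 0 := fun h0 => hy (by simp [h0])
  simpa [dist_eq_norm, norm_sub_rev] using hρ.norm_le _ h1

/-- A function is weakly holomorphic if its distributional `∂̄` vanishes. -/
def WeaklyHolomorphic (V : Set E) (e : ι → E) (u : E → ℂ) : Prop :=
  ∀ χ, IsTest V χ → ∀ j, ∫ z in V, u z * wb χ (e j) z = 0

lemma WeaklyHolomorphic.mono {V W : Set E} {u : E → ℂ} (h : WeaklyHolomorphic V e u)
    (hWV : W ⊆ V) : WeaklyHolomorphic W e u := fun χ hχ j => by
  have h1 : IsTest V χ := ⟨hχ.smooth, hχ.supp, hχ.tsupp.trans hWV⟩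
  rw [(hχ.wb (e j)).setIntegral_eq, ← (h1.wb (e j)).setIntegral_eq]
  exact h χ h1 j

lemma WeaklyHolomorphic.moll (he : Submodule.span ℂ (range e) = ⊤) {V : Set E} {u : E → ℂ}
    (h : WeaklyHolomorphic V e u) (hu : LocallyIntegrable (V.indicator u)) (hV : MeasurableSet V)
    {ρ : E → ℝ} {r : ℝ} (hρ : IsMollifier ρ r) {x : E} (hx : closedBall x r ⊆ V) :
    DifferentiableAt ℂ (moll ρ (V.indicator u)) x := by
  refine differentiableAt_of_wb_eq_zero he
    ((contDiff_moll hρ hu).differentiable (by simp) x) fun j => ?_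
  rw [wb_moll hρ hu, neg_eq_zero, ← h _ (hρ.isTest_sub hx) j, ← integral_indicator hV]
  refine integral_congr_ae (Eventually.of_forall fun z => ?_)
  by_cases hz : z ∈ V
  · simp [indicator_of_mem hz]
  · simp [indicator_of_notMem hz]

lemma tendsto_moll_apply {ρ : E → ℝ} {r : ℝ} (hρ : IsMollifier ρ r) {u : ℕ → E → ℂ} {f : E → ℂ}
    (h : L2Tendsto volume u f) (x : E) :
    Tendsto (fun n => Berndtsson.moll ρ (u n) x) atTop (𝓝 (Berndtsson.moll ρ f x)) := by
  have : ProperSpace E := FiniteDimensional.proper ℂ E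
  obtain ⟨M, hM⟩ := hρ.smooth.continuous.bounded_above_of_compact_support hρ.hasCompactSupport
  have hM0 : 0 ≤ M := (norm_nonneg _).trans (hM 0)
  have hl (f : E → ℂ) (hf : MemLp f 2) : Integrable fun t => ρ (x - t) • f t := by
    refine (integrable_mul_cs (hf.locallyIntegrable (by norm_num)) (hρ.test x).1.continuous
      (hρ.test x).2).congr (Eventually.of_forall fun t => ?_)
    simp [mul_comm]
  have hρ2 : MemLp (fun t => (ρ (x - t) : ℂ)) 2 :=
    (hρ.test x).1.continuous.memLp_of_hasCompactSupport (hρ.test x).2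
  rw [tendsto_iff_norm_sub_tendsto_zero]
  have hb (n : ℕ) : ‖Berndtsson.moll ρ (u n) x - Berndtsson.moll ρ f x‖
      ≤ ‖hρ2.toLp‖ * (eLpNorm (fun t => u n t - f t) 2 volume).toReal := by
    have hm : MemLp (fun t => u n t - f t) 2 := (h.memLp n).sub h.memLp_lim
    have e1 : Berndtsson.moll ρ (u n) x - Berndtsson.moll ρ f x
        = inner ℂ hρ2.toLp hm.toLp := by
      rw [inner_toLp, moll_apply', moll_apply', ← integral_sub (hl _ (h.memLp n))
        (hl _ h.memLp_lim)]
      refine integral_congr_ae (Eventually.of_forall fun t => ?_)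
      simp only [conj_ofReal, real_smul]
      ring
    rw [e1]
    refine (norm_inner_le_norm _ _).trans_eq ?_
    rw [Lp.norm_toLp (hf := hm)]
  refine squeeze_zero (fun _ => norm_nonneg _) hb ?_
  have h1 := (ENNReal.tendsto_toReal ENNReal.zero_ne_top).comp h.tendsto
  simpa using h1.const_mul ‖hρ2.toLp‖

lemma WeaklyHolomorphic.exists_local (he : Submodule.span ℂ (range e) = ⊤) {u : E → ℂ} {x : E}
    {r : ℝ} (hr : 0 < r) (h : WeaklyHolomorphic (ball x (4 * r)) e u)
    (hu : MemLp u 2 (volume.restrict (ball x (4 * r)))) :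
    ∃ F : E → ℂ, DifferentiableOn ℂ F (ball x r) ∧ u =ᵐ[volume.restrict (ball x r)] F := by
  set B := ball x (4 * r) with hB
  have hBo : IsOpen B := isOpen_ball
  set u0 := B.indicator u with hu0
  have hu0m : MemLp u0 2 := (memLp_indicator_iff_restrict hBo.measurableSet).2 hu
  have hloc : LocallyIntegrable u0 := hu0m.locallyIntegrable (by norm_num)
  obtain ⟨ρ, hρ⟩ := exists_isMollifier E hr
  obtain ⟨ρn, hρn⟩ := exists_mollifier_seq E
  have hsub (y : E) (s t : ℝ) (hst : t + s ≤ 4 * r) (hy : y ∈ ball x s) (ht : t < 4 * r) :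
      closedBall y t ⊆ B := fun w hw => by
    have h1 := mem_ball.1 hy
    have h2 := mem_closedBall.1 hw
    exact mem_ball.2 ((dist_triangle w y x).trans_lt (by linarith))
  refine ⟨Berndtsson.moll ρ u0, fun y hy => ?_, ?_⟩
  · exact (h.moll he hloc hBo.measurableSet hρ
      (hsub y r r (by linarith) hy (by linarith))).differentiableWithinAt
  have hL := L2Tendsto_moll hρn hu0m
  have hT : TendstoInMeasure volume (fun n => Berndtsson.moll (ρn n) u0) atTop u0 :=
    tendstoInMeasure_of_tendsto_eLpNorm (by norm_num) (fun n => (hL.memLp n).1) hL.memLp_lim.1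
      hL.tendsto
  obtain ⟨ns, hns, hae⟩ := hT.exists_seq_tendsto_ae
  have hsmall : ∀ᶠ n : ℕ in atTop, 1 / ((ns n : ℝ) + 1) < r :=
    (tendsto_one_div_add_atTop_nhds_zero_nat.comp hns.tendsto_atTop).eventually_lt_const hr
  filter_upwards [ae_restrict_of_ae hae, ae_restrict_mem measurableSet_ball] with y hy hyB
  have h1 : Tendsto (fun n => Berndtsson.moll (ρn (ns n)) u0 y) atTop
      (𝓝 (Berndtsson.moll ρ u0 y)) := by
    refine ((tendsto_moll_apply hρ hL y).comp hns.tendsto_atTop).congr' ?_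
    filter_upwards [hsmall] with n hn
    refine hρ.moll_eq (Ω := ball x (3 * r)) isOpen_ball (fun w hw => ?_) fun w hw => ?_
    · exact (h.moll he hloc hBo.measurableSet (hρn (ns n))
        (hsub w (3 * r) _ (by linarith) hw (by linarith))).differentiableWithinAt
    · have h1 := mem_ball.1 hyB
      have h2 := mem_closedBall.1 hw
      exact mem_ball.2 ((dist_triangle w y x).trans_lt (by linarith))
  have h2 := tendsto_nhds_unique hy h1
  rwa [hu0, indicator_of_mem (ball_subset_ball (by linarith) hyB)] at h2

omit [BorelSpace E] [FiniteDimensional ℂ E] in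
lemma eqOn_of_ae_eq {F : Type*} [TopologicalSpace F] [T2Space F] {f g : E → F} {s : Set E}
    (hs : IsOpen s) (hf : ContinuousOn f s) (hg : ContinuousOn g s)
    (h : f =ᵐ[volume.restrict s] g) : EqOn f g s :=
  Measure.eqOn_open_of_ae_eq h hs hf hg

/-- Weyl's lemma: weakly holomorphic functions are almost everywhere holomorphic. -/
theorem WeaklyHolomorphic.exists_holomorphic (he : Submodule.span ℂ (range e) = ⊤) {V : Set E}
    (hV : IsOpen V) {u : E → ℂ} (h : WeaklyHolomorphic V e u)
    (hu : ∀ x r, closedBall x r ⊆ V → MemLp u 2 (volume.restrict (closedBall x r))) :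
    ∃ F : E → ℂ, DifferentiableOn ℂ F V ∧ u =ᵐ[volume.restrict V] F := by
  have : ProperSpace E := FiniteDimensional.proper ℂ E
  have hloc (x : E) : ∃ (r : ℝ) (F : E → ℂ), x ∈ V → 0 < r ∧ ball x r ⊆ V ∧
      DifferentiableOn ℂ F (ball x r) ∧ u =ᵐ[volume.restrict (ball x r)] F := by
    by_cases hx : x ∈ V
    · obtain ⟨R, hR, hRV⟩ := Metric.nhds_basis_closedBall.mem_iff.1 (hV.mem_nhds hx)
      have hb : ball x (4 * (R / 4)) ⊆ closedBall x R := by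
        rw [mul_div_cancel₀ R (by norm_num)]; exact ball_subset_closedBall
      obtain ⟨F, hF, hF'⟩ := exists_local he (r := R / 4) (by positivity)
        (h.mono (hb.trans hRV)) ((hu x R hRV).mono_measure (Measure.restrict_mono hb le_rfl))
      exact ⟨R / 4, F, fun _ => ⟨by positivity,
        (ball_subset_ball (by linarith)).trans (hb.trans hRV), hF, hF'⟩⟩
    · exact ⟨0, 0, fun hx' => absurd hx' hx⟩
  choose r F hF using hloc
  have hEq (x : E) (hx : x ∈ V) : EqOn (fun y => F y y) (F x) (ball x (r x)) := by
    intro y hy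
    obtain ⟨hr, hrV, hd, hae⟩ := hF x hx
    obtain ⟨hr', hrV', hd', hae'⟩ := hF y (hrV hy)
    have h1 : F y =ᵐ[volume.restrict (ball x (r x) ∩ ball y (r y))] F x :=
      EventuallyEq.trans (EventuallyEq.symm
        (ae_restrict_of_ae_restrict_of_subset inter_subset_right hae'))
        (ae_restrict_of_ae_restrict_of_subset inter_subset_left hae)
    exact eqOn_of_ae_eq (isOpen_ball.inter isOpen_ball)
      (hd'.continuousOn.mono inter_subset_right) (hd.continuousOn.mono inter_subset_left) h1
      ⟨hy, mem_ball_self hr'⟩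
  refine ⟨fun y => F y y, fun x hx => ?_, ?_⟩
  · obtain ⟨hr, hrV, hd, -⟩ := hF x hx
    have h1 : DifferentiableAt ℂ (F x) x := hd.differentiableAt (ball_mem_nhds x hr)
    exact (h1.congr_of_eventuallyEq
      ((hEq x hx).eventuallyEq_of_mem (ball_mem_nhds x hr))).differentiableWithinAt
  · rw [Filter.EventuallyEq, ae_restrict_iff' hV.measurableSet, ae_iff]
    refine measure_null_of_locally_null _ fun x hx => ?_
    have hxV : x ∈ V := by by_contra h'; exact hx fun hn => absurd hn h'
    obtain ⟨hr, hrV, -, hae⟩ := hF x hxV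
    refine ⟨_, inter_mem_nhdsWithin _ (ball_mem_nhds x hr), ?_⟩
    rw [Filter.EventuallyEq, ae_restrict_iff' measurableSet_ball, ae_iff] at hae
    refine measure_mono_null (fun y hy => ?_) hae
    simp only [mem_inter_iff, mem_setOf_eq, Classical.not_imp] at hy ⊢
    refine ⟨hy.2, ?_⟩
    rw [← hEq x hxV hy.2]
    exact hy.1.2

end Weyl

section Holomorphic

variable {E : Type*} [NormedAddCommGroup E] [NormedSpace ℂ E]

/-- Cauchy's estimate, in Lipschitz form. -/
lemma norm_sub_le_of_holomorphic {f : E → ℂ} {z : E} {r M : ℝ} (hr : 0 < r)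
    (hf : DifferentiableOn ℂ f (ball z (3 * r))) (hM : ∀ y ∈ ball z (3 * r), ‖f y‖ ≤ M)
    {x y : E} (hx : x ∈ ball z r) (hy : y ∈ ball z r) : ‖f x - f y‖ ≤ M / r * ‖x - y‖ := by
  have hd (w : E) (hw : w ∈ ball z r) : DifferentiableAt ℂ f w :=
    hf.differentiableAt (isOpen_ball.mem_nhds (ball_subset_ball (by linarith) hw))
  have hM0 : 0 ≤ M := (norm_nonneg _).trans (hM z (mem_ball_self (by linarith)))
  refine (convex_ball z r).norm_image_sub_le_of_norm_fderiv_le (𝕜 := ℂ) hd (fun w hw => ?_) hy hx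
  refine ContinuousLinearMap.opNorm_le_bound _ (by positivity) fun v => ?_
  by_cases hv : v = 0
  · simp [hv]
  have hv' : 0 < ‖v‖ := norm_pos_iff.2 hv
  have hin (l : ℂ) (hl : ‖l‖ ≤ r / ‖v‖) : w + l • v ∈ ball z (3 * r) := by
    have h1 := mem_ball.1 hw
    have h2 : dist (w + l • v) w ≤ r := by
      rw [dist_eq_norm, add_sub_cancel_left, norm_smul]
      exact (le_div_iff₀ hv').1 hl
    exact mem_ball.2 ((dist_triangle _ w z).trans_lt (by linarith))
  have hdl (l : ℂ) (hl : ‖l‖ ≤ r / ‖v‖) : DifferentiableAt ℂ (fun l : ℂ => f (w + l • v)) l :=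
    (hf.differentiableAt (isOpen_ball.mem_nhds (hin l hl))).comp (f := fun l : ℂ => w + l • v) l
      (by fun_prop)
  have h1 : ‖deriv (fun l : ℂ => f (w + l • v)) 0‖ ≤ M / (r / ‖v‖) := by
    refine Complex.norm_deriv_le_of_forall_mem_sphere_norm_le (by positivity) ?_ fun l hl =>
      hM _ (hin l (by simpa using (mem_sphere_iff_norm.1 hl).le))
    refine DifferentiableOn.diffContOnCl fun l hl => ?_
    rw [closure_ball _ (by positivity)] at hl
    exact (hdl l (by simpa using hl)).differentiableWithinAt
  have h2 : HasDerivAt (fun l : ℂ => f (w + l • v)) (fderiv ℂ f w v) 0 := by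
    have h3 : HasDerivAt (fun l : ℂ => w + l • v) v 0 := by
      simpa using ((hasDerivAt_id (0:ℂ)).smul_const v).const_add w
    have h4 : HasFDerivAt f (fderiv ℂ f w) (w + (0:ℂ) • v) := by
      simpa using (hd w hw).hasFDerivAt
    exact h4.comp_hasDerivAt (0:ℂ) h3
  rw [h2.deriv] at h1
  rwa [div_div_eq_mul_div, mul_div_right_comm] at h1

variable [MeasureSpace E] [BorelSpace E] [FiniteDimensional ℂ E]
  [(volume : Measure E).IsAddHaarMeasure]

lemma contDiffOn_of_holomorphic {f : E → ℂ} {Ω : Set E} (hΩ : IsOpen Ω)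
    (hf : DifferentiableOn ℂ f Ω) : ContDiffOn ℝ (⊤ : ℕ∞) f Ω := by
  intro x hx
  have : ProperSpace E := FiniteDimensional.proper ℂ E
  obtain ⟨R, hR, hRV⟩ := Metric.nhds_basis_closedBall.mem_iff.1 (hΩ.mem_nhds hx)
  obtain ⟨ρ, hρ⟩ := exists_isMollifier E (r := R / 3) (by positivity)
  have h0 : Integrable ((closedBall x R).indicator f) :=
    (integrable_indicator_iff measurableSet_closedBall).2
      ((hf.continuousOn.mono hRV).integrableOn_compact (isCompact_closedBall x R))
  have h1 : ContDiffAt ℝ (⊤ : ℕ∞) (moll ρ ((closedBall x R).indicator f)) x :=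
    (contDiff_moll hρ h0.locallyIntegrable).contDiffAt
  refine (h1.congr_of_eventuallyEq ?_).contDiffWithinAt
  filter_upwards [ball_mem_nhds x (show 0 < R / 3 by positivity)] with y hy
  have hb (w : E) (hw : w ∈ ball x R) : (closedBall x R).indicator f w = f w :=
    indicator_of_mem (ball_subset_closedBall hw) f
  rw [hρ.moll_eq (Ω := ball x R) isOpen_ball ?_ fun w hw => ?_, hb y (ball_subset_ball (by linarith) hy)]
  · exact (hf.mono (ball_subset_closedBall.trans hRV)).congr hb
  · exact mem_ball.2 ((dist_triangle w y x).trans_lt (by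
      linarith [mem_ball.1 hy, mem_closedBall.1 hw]))

lemma wb_mul_holomorphic {f χ : E → ℂ} {Ω : Set E} (hΩ : IsOpen Ω)
    (hf : DifferentiableOn ℂ f Ω) (hχ : IsTest Ω χ) (e z : E) :
    wb (fun z => χ z * f z) e z = f z * wb χ e z := by
  by_cases hz : z ∈ Ω
  · have h1 := hf.differentiableAt (hΩ.mem_nhds hz)
    rw [wb_mul (hχ.differentiable z) (h1.restrictScalars ℝ), wb_eq_zero_of_differentiableAt h1]
    ring
  · have h1 : (fun z => χ z * f z) =ᶠ[𝓝 z] fun _ => (0:ℂ) := by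
      filter_upwards [notMem_tsupport_iff_eventuallyEq.1 fun h => hz (hχ.tsupp h)] with y hy
      simp [hy]
    rw [(hχ.wb e).eq_zero hz, mul_zero, wb_congr h1]
    simp [wb]

lemma IsTest.mul_holomorphic {f χ : E → ℂ} {Ω : Set E} (hΩ : IsOpen Ω)
    (hf : DifferentiableOn ℂ f Ω) (hχ : IsTest Ω χ) : IsTest Ω fun z => χ z * f z :=
  ⟨contDiff_zero_extend hΩ (isClosed_tsupport χ) hχ.tsupp
    (hχ.smooth.contDiffOn.mul (contDiffOn_of_holomorphic hΩ hf)) fun x hx => by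
      simp [image_eq_zero_of_notMem_tsupport hx],
    hχ.supp.mul_right, (tsupport_mul_subset_left).trans hχ.tsupp⟩

lemma weaklyHolomorphic_of_holomorphic {ι : Type*} {e : ι → E} {f : E → ℂ} {Ω : Set E}
    (hΩ : IsOpen Ω) (hf : DifferentiableOn ℂ f Ω) : WeaklyHolomorphic Ω e f := by
  intro χ hχ j
  have h1 := hχ.mul_holomorphic hΩ hf
  have h2 := integral_mul_wb h1.smooth (contDiff_const (c := (1:ℂ))) h1.supp (e j)
  simp only [wb_mul_holomorphic hΩ hf hχ, mul_one] at h2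
  rw [(hχ.wb (e j)).setIntegral_eq, ← neg_eq_zero, ← h2]
  simp [wb]

/-- Eventual local boundedness of a sequence of holomorphic functions. -/
def LocallyBoundedHol (Ω : Set E) (f : ℕ → E → ℂ) : Prop :=
  ∀ x ∈ Ω, ∃ r M : ℝ, 0 < r ∧ ∀ᶠ j in atTop, DifferentiableOn ℂ (f j) (ball x r) ∧
    ∀ y ∈ ball x r, ‖f j y‖ ≤ M

lemma LocallyBoundedHol.comp {Ω : Set E} {f : ℕ → E → ℂ} (h : LocallyBoundedHol Ω f)
    {ns : ℕ → ℕ} (hns : Tendsto ns atTop atTop) : LocallyBoundedHol Ω fun j => f (ns j) :=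
  fun x hx => let ⟨r, M, hr, h1⟩ := h x hx; ⟨r, M, hr, hns.eventually h1⟩

lemma LocallyBoundedHol.lipschitz {Ω : Set E} {f : ℕ → E → ℂ} (h : LocallyBoundedHol Ω f)
    {x : E} (hx : x ∈ Ω) : ∃ r L : ℝ, 0 < r ∧ 0 ≤ L ∧ ∀ᶠ j in atTop, ∀ y ∈ ball x r,
      ∀ w ∈ ball x r, ‖f j y - f j w‖ ≤ L * ‖y - w‖ := by
  obtain ⟨r, M, hr, h1⟩ := h x hx
  have hM0 : 0 ≤ M := by
    obtain ⟨j, -, hj⟩ := h1.exists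
    exact (norm_nonneg _).trans (hj x (mem_ball_self hr))
  refine ⟨r / 3, M / (r / 3), by positivity, by positivity, ?_⟩
  filter_upwards [h1] with j hj y hy w hw
  have e1 : 3 * (r / 3) = r := by ring
  exact norm_sub_le_of_holomorphic (by positivity) (by rw [e1]; exact hj.1)
    (by rw [e1]; exact hj.2) hy hw

lemma LocallyBoundedHol.differentiableOn_lim {Ω : Set E} (hΩ : IsOpen Ω) {f : ℕ → E → ℂ}
    (h : LocallyBoundedHol Ω f) {F : E → ℂ}
    (hF : ∀ x ∈ Ω, Tendsto (fun j => f j x) atTop (𝓝 (F x))) : DifferentiableOn ℂ F Ω := by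
  intro x hx
  have : ProperSpace E := FiniteDimensional.proper ℂ E
  obtain ⟨r1, M, hr1, h1⟩ := h x hx
  obtain ⟨r2, L, hr2, hL, h2⟩ := h.lipschitz hx
  obtain ⟨r3, hr3, h3⟩ := Metric.isOpen_iff.1 hΩ x hx
  set B := ball x (min r1 (min r2 r3)) with hB
  have hr : 0 < min r1 (min r2 r3) := by positivity
  have hB1 : B ⊆ ball x r1 := ball_subset_ball (min_le_left _ _)
  have hB2 : B ⊆ ball x r2 := ball_subset_ball ((min_le_right _ _).trans (min_le_left _ _))
  have hB3 : B ⊆ Ω := (ball_subset_ball ((min_le_right _ _).trans (min_le_right _ _))).trans h3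
  have hBo : IsOpen B := isOpen_ball
  have hFb (y : E) (hy : y ∈ B) : ‖F y‖ ≤ M :=
    le_of_tendsto (hF y (hB3 hy)).norm (h1.mono fun j hj => hj.2 y (hB1 hy))
  have hFc : ContinuousOn F B := by
    refine LipschitzOnWith.continuousOn (K := L.toNNReal)
      (LipschitzOnWith.of_dist_le_mul fun y hy w hw => ?_)
    rw [dist_eq_norm, dist_eq_norm, Real.coe_toNNReal _ hL]
    exact le_of_tendsto ((hF y (hB3 hy)).sub (hF w (hB3 hw))).norm
      (h2.mono fun j hj => hj y (hB2 hy) w (hB2 hw))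
  let e := Module.finBasis ℂ E
  have hw : WeaklyHolomorphic B e F := by
    intro χ hχ j
    have hχc : Integrable fun z => M * ‖wb χ (e j) z‖ :=
      (((hχ.wb (e j)).smooth.continuous.integrable_of_hasCompactSupport
        (hχ.wb (e j)).supp).norm.const_mul M)
    refine tendsto_nhds_unique (tendsto_integral_filter_of_dominated_convergence (l := atTop)
      (fun z => M * ‖wb χ (e j) z‖) (F := fun n z => f n z * wb χ (e j) z) ?_ ?_
      hχc.integrableOn ?_) ((tendsto_const_nhds (x := (0:ℂ))).congr' ?_)
    · filter_upwards [h1] with n hn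
      exact ((hn.1.mono hB1).continuousOn.aestronglyMeasurable hBo.measurableSet).mul
        (hχ.wb (e j)).smooth.continuous.aestronglyMeasurable
    · filter_upwards [h1] with n hn
      filter_upwards [ae_restrict_mem hBo.measurableSet] with z hz
      rw [norm_mul]
      gcongr
      exact hn.2 z (hB1 hz)
    · filter_upwards [ae_restrict_mem hBo.measurableSet] with z hz
      exact (hF z (hB3 hz)).mul_const _
    · filter_upwards [h1] with n hn
      exact (weaklyHolomorphic_of_holomorphic hBo (hn.1.mono hB1) χ hχ j).symm
  obtain ⟨G, hG, hGF⟩ := hw.exists_holomorphic e.span_eq hBo fun y s hs => by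
    have : IsFiniteMeasure (volume.restrict (closedBall y s)) :=
      ⟨by rw [Measure.restrict_apply_univ]; exact measure_closedBall_lt_top⟩
    refine MemLp.of_bound ((hFc.mono hs).aestronglyMeasurable measurableSet_closedBall) M ?_
    filter_upwards [ae_restrict_mem measurableSet_closedBall] with z hz
    exact hFb z (hs hz)
  have hEq := eqOn_of_ae_eq hBo hFc hG.continuousOn hGF
  exact ((hG.differentiableAt (hBo.mem_nhds (mem_ball_self hr))).congr_of_eventuallyEq
    (hEq.eventuallyEq_of_mem (hBo.mem_nhds (mem_ball_self hr)))).differentiableWithinAt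

/-- Montel's theorem. -/
theorem LocallyBoundedHol.exists_subseq {Ω : Set E} (hΩ : IsOpen Ω) {f : ℕ → E → ℂ}
    (h : LocallyBoundedHol Ω f) : ∃ (ns : ℕ → ℕ) (F : E → ℂ), StrictMono ns ∧
      DifferentiableOn ℂ F Ω ∧ ∀ x ∈ Ω, Tendsto (fun j => f (ns j) x) atTop (𝓝 (F x)) := by
  have : ProperSpace E := FiniteDimensional.proper ℂ E
  obtain ⟨Q, hQc, hQd⟩ := TopologicalSpace.exists_countable_dense Ω
  have : Countable Q := hQc
  have hB (q : Q) : ∃ B : ℝ, ∀ j, ‖f j q.1‖ ≤ B := by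
    obtain ⟨r, M, hr, h1⟩ := h q.1 q.1.2
    have h2 : IsBoundedUnder (· ≤ ·) atTop fun j => ‖f j q.1‖ :=
      ⟨M, eventually_map.2 (h1.mono fun j hj => hj.2 _ (mem_ball_self hr))⟩
    obtain ⟨B, hB⟩ := h2.bddAbove_range
    exact ⟨B, fun j => hB (mem_range_self j)⟩
  choose B hB using hB
  obtain ⟨a, -, ns, hns, ha⟩ := (isCompact_univ_pi fun q : Q =>
    isCompact_closedBall (0:ℂ) (B q)).tendsto_subseq (x := fun j q => f j q.1)
    fun j q _ => by simpa using hB q j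
  rw [tendsto_pi_nhds] at ha
  have h' := h.comp hns.tendsto_atTop
  have hc (x : E) (hx : x ∈ Ω) : ∃ y, Tendsto (fun j => f (ns j) x) atTop (𝓝 y) := by
    refine cauchySeq_tendsto_of_complete (Metric.cauchySeq_iff'.2 fun ε hε => ?_)
    obtain ⟨r, L, hr, hL, h1⟩ := h'.lipschitz hx
    have hδ : 0 < min r (ε / (4 * (L + 1))) := by positivity
    obtain ⟨q, hq, hqQ⟩ := hQd.exists_dist_lt (⟨x, hx⟩ : Ω) hδ
    have hq' : dist x q.1 < min r (ε / (4 * (L + 1))) := hqQ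
    have hqr : (q : E) ∈ ball x r := by
      rw [mem_ball, dist_comm]; exact hq'.trans_le (min_le_left _ _)
    have h2 := (ha ⟨q, hq⟩).cauchySeq
    obtain ⟨N, hN⟩ := Metric.cauchySeq_iff.1 h2 (ε / 4) (by positivity)
    obtain ⟨N', hN'⟩ := eventually_atTop.1 h1
    refine ⟨max N N', fun n hn => ?_⟩
    have k1 := hN' n ((le_max_right _ _).trans hn) x (mem_ball_self hr) q hqr
    have k2 := hN' (max N N') (le_max_right _ _) q hqr x (mem_ball_self hr)
    have k3 := hN n ((le_max_left _ _).trans hn) (max N N') (le_max_left _ _)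
    have k4 : L * ‖x - q‖ ≤ ε / 4 := by
      rw [← dist_eq_norm]
      have := (hq'.trans_le (min_le_right _ _)).le
      rw [le_div_iff₀ (by positivity)] at this
      nlinarith [dist_nonneg (x := x) (y := (q : E))]
    rw [norm_sub_rev (q : E) x] at k2
    rw [← dist_eq_norm] at k1 k2
    have k3' : dist (f (ns n) q) (f (ns (max N N')) q) < ε / 4 := k3
    have t1 := dist_triangle4 (f (ns n) x) (f (ns n) q) (f (ns (max N N')) q) (f (ns (max N N')) x)
    linarith
  choose! F hF using hc
  exact ⟨ns, F, hns, h'.differentiableOn_lim hΩ hF, hF⟩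

end Holomorphic

section WeightedLimit

variable {E : Type*} [NormedAddCommGroup E] [NormedSpace ℂ E]
  [MeasureSpace E] [BorelSpace E] [FiniteDimensional ℂ E] [(volume : Measure E).IsAddHaarMeasure]

/-- The weight `e^{-ψ}` as an extended nonnegative function. -/
def ew {α : Type*} (ψ : α → ℝ) (x : α) : ℝ≥0∞ := ENNReal.ofReal (Real.exp (-ψ x))

lemma aemeasurable_ew {α : Type*} [MeasurableSpace α] {μ : Measure α} {ψ : α → ℝ}
    (h : AEMeasurable ψ μ) : AEMeasurable (ew ψ) μ :=
  (Real.measurable_exp.comp_aemeasurable h.neg).ennreal_ofReal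

/-- The weighted energy `∫_Ω |f|² e^{-ψ}`. -/
def energy (Ω : Set E) (ψ : E → ℝ) (f : E → ℂ) : ℝ≥0∞ := ∫⁻ x in Ω, ‖f x‖ₑ ^ 2 * ew ψ x

lemma aemeasurable_energy_integrand {Ω : Set E} (hΩ : IsOpen Ω) {ψ : E → ℝ} {f : E → ℂ}
    (hf : ContinuousOn f Ω) (hψ : AEMeasurable ψ (volume.restrict Ω)) :
    AEMeasurable (fun x => ‖f x‖ₑ ^ 2 * ew ψ x) (volume.restrict Ω) :=
  ((hf.aemeasurable hΩ.measurableSet).enorm.pow_const 2).mul (aemeasurable_ew hψ)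

/-- Holomorphic functions of bounded energy are locally bounded. -/
lemma enorm_sq_le_energy {r : ℝ} (hr : 0 < r) : ∃ M : ℝ≥0, ∀ (f : E → ℂ) (Ω : Set E) (ψ : E → ℝ)
    (a : ℝ) (z : E), IsOpen Ω → DifferentiableOn ℂ f Ω → closedBall z r ⊆ Ω →
    (∀ y ∈ closedBall z r, ψ y ≤ a) →
    ‖f z‖ₑ ^ 2 ≤ M * ENNReal.ofReal (Real.exp a) * energy Ω ψ f := by
  obtain ⟨ρ, hρ⟩ := exists_isMollifier E hr
  obtain ⟨M, hM⟩ := hρ.enorm_sq_le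
  refine ⟨M, fun f Ω ψ a z hΩ hf hz hψ => (hM f Ω hΩ hf z hz).trans ?_⟩
  rw [mul_assoc]
  gcongr
  rw [energy, ← lintegral_const_mul' _ _ ENNReal.ofReal_ne_top]
  refine (setLIntegral_mono' measurableSet_closedBall fun y hy => ?_).trans
    (lintegral_mono_set hz)
  have h1 : 1 ≤ ENNReal.ofReal (Real.exp a) * ew ψ y := by
    rw [ew, ← ENNReal.ofReal_mul (Real.exp_nonneg _), ← Real.exp_add]
    exact ENNReal.one_le_ofReal.2 (Real.one_le_exp (by linarith [hψ y hy]))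
  calc ‖f y‖ₑ ^ 2 = 1 * ‖f y‖ₑ ^ 2 := (one_mul _).symm
    _ ≤ ENNReal.ofReal (Real.exp a) * ew ψ y * ‖f y‖ₑ ^ 2 := by gcongr
    _ = _ := by ring

/-- Normal families for varying domains and weights. -/
theorem exists_subseq_energy_le {Ωs : ℕ → Set E} {Ω : Set E} {ψs : ℕ → E → ℝ} {ψ : E → ℝ}
    {f : ℕ → E → ℂ} {C : ℝ≥0∞} (hC : C ≠ ⊤) (hΩs : ∀ j, IsOpen (Ωs j)) (hΩ : IsOpen Ω)
    (hL : ∀ L ⊆ Ω, IsCompact L → ∀ᶠ j in atTop, L ⊆ Ωs j)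
    (hψ : ∀ x ∈ Ω, ∀ a > ψ x, ∃ N ∈ 𝓝 x, ∀ᶠ j in atTop, ∀ y ∈ N, ψs j y < a)
    (hm : ∀ j, AEMeasurable (ψs j) (volume.restrict (Ωs j)))
    (hf : ∀ j, DifferentiableOn ℂ (f j) (Ωs j)) (hI : ∀ j, energy (Ωs j) (ψs j) (f j) ≤ C) :
    ∃ (ns : ℕ → ℕ) (F : E → ℂ), StrictMono ns ∧ DifferentiableOn ℂ F Ω ∧
      energy Ω ψ F ≤ C ∧ ∀ x ∈ Ω, Tendsto (fun j => f (ns j) x) atTop (𝓝 (F x)) := by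
  have : ProperSpace E := FiniteDimensional.proper ℂ E
  have hlb : LocallyBoundedHol Ω f := by
    intro x hx
    obtain ⟨N, hN, hN'⟩ := hψ x hx (ψ x + 1) (by simp)
    obtain ⟨R, hR, hRN⟩ := Metric.nhds_basis_closedBall.mem_iff.1
      (inter_mem hN (hΩ.mem_nhds hx))
    obtain ⟨M, hM⟩ := enorm_sq_le_energy (E := E) (r := R / 2) (by positivity)
    set B : ℝ≥0∞ := M * ENNReal.ofReal (Real.exp (ψ x + 1)) * C with hB
    have hBt : B ≠ ⊤ := ENNReal.mul_ne_top (ENNReal.mul_ne_top ENNReal.coe_ne_top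
      ENNReal.ofReal_ne_top) hC
    refine ⟨R / 2, √B.toReal, by positivity, ?_⟩
    filter_upwards [hN', hL _ (hRN.trans inter_subset_right) (isCompact_closedBall x R)]
      with j hj hj'
    have hsub (y : E) (hy : y ∈ ball x (R / 2)) : closedBall y (R / 2) ⊆ closedBall x R :=
      closedBall_subset_closedBall' (by linarith [mem_ball.1 hy])
    refine ⟨(hf j).mono ((ball_subset_closedBall.trans
      (closedBall_subset_closedBall (by linarith))).trans hj'), fun y hy => ?_⟩
    have h1 := hM (f j) (Ωs j) (ψs j) (ψ x + 1) y (hΩs j) (hf j) ((hsub y hy).trans hj')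
      fun w hw => (hj w (hRN (hsub y hy hw)).1).le
    have h2 : ‖f j y‖ₑ ^ 2 ≤ B := h1.trans (by rw [hB]; gcongr; exact hI j)
    refine Real.le_sqrt_of_sq_le ?_
    rw [← ENNReal.ofReal_le_iff_le_toReal hBt, ENNReal.ofReal_pow (norm_nonneg _), ofReal_norm]
    exact h2
  obtain ⟨ns, F, hns, hF, hlim⟩ := hlb.exists_subseq hΩ
  refine ⟨ns, F, hns, hF, ?_, hlim⟩
  set g : ℕ → E → ℝ≥0∞ := fun j => (Ωs (ns j)).indicator
    fun x => ‖f (ns j) x‖ₑ ^ 2 * ew (ψs (ns j)) x with hg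
  have h1 : ∀ x ∈ Ω, ‖F x‖ₑ ^ 2 * ew ψ x ≤ liminf (fun j => g j x) atTop := by
    intro x hx
    have h2 : ∀ a > ψ x, ‖F x‖ₑ ^ 2 * ENNReal.ofReal (Real.exp (-a)) ≤
        liminf (fun j => g j x) atTop := by
      intro a ha
      obtain ⟨N, hN, hN'⟩ := hψ x hx a ha
      have h3 : Tendsto (fun j => ‖f (ns j) x‖ₑ ^ 2 * ENNReal.ofReal (Real.exp (-a))) atTop
          (𝓝 (‖F x‖ₑ ^ 2 * ENNReal.ofReal (Real.exp (-a)))) :=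
        ENNReal.Tendsto.mul_const (((ENNReal.continuous_pow 2).tendsto _).comp
          (hlim x hx).enorm) (Or.inr ENNReal.ofReal_ne_top)
      rw [← h3.liminf_eq]
      refine liminf_le_liminf ?_
      filter_upwards [hns.tendsto_atTop.eventually hN', hns.tendsto_atTop.eventually
        (hL {x} (by simpa using hx) isCompact_singleton)] with j hj hj'
      rw [hg]
      simp only
      rw [indicator_of_mem (hj' rfl), ew]
      gcongr
      exact (hj x (mem_of_mem_nhds hN)).le
    have h4 : Tendsto (fun a : ℝ => ‖F x‖ₑ ^ 2 * ENNReal.ofReal (Real.exp (-a))) (𝓝[>] (ψ x))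
        (𝓝 (‖F x‖ₑ ^ 2 * ENNReal.ofReal (Real.exp (-ψ x)))) := by
      refine ENNReal.Tendsto.const_mul (ENNReal.tendsto_ofReal ?_) (Or.inr (by finiteness))
      exact ((by fun_prop : Continuous fun a : ℝ => Real.exp (-a)).tendsto _).mono_left
        nhdsWithin_le_nhds
    exact le_of_tendsto h4 (by filter_upwards [self_mem_nhdsWithin] with a ha using h2 a ha)
  calc energy Ω ψ F ≤ ∫⁻ x in Ω, liminf (fun j => g j x) atTop :=
        setLIntegral_mono' hΩ.measurableSet h1
    _ ≤ liminf (fun j => ∫⁻ x in Ω, g j x) atTop := by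
        refine lintegral_liminf_le' fun j => AEMeasurable.restrict ?_
        exact (aemeasurable_indicator_iff (hΩs _).measurableSet).2
          (aemeasurable_energy_integrand (hΩs _) (hf _).continuousOn (hm _))
    _ ≤ C := by
        refine (liminf_le_liminf (v := fun _ => C) (Eventually.of_forall fun j => ?_)).trans
          (by simp)
        refine (setLIntegral_le_lintegral _ _).trans ?_
        rw [hg]
        simp only
        rw [lintegral_indicator (hΩs _).measurableSet]
        exact hI _

end WeightedLimit

section SubMean

/-- A bounded upper semicontinuous function on `ℝ` is a limit of continuous majorants. -/
lemma exists_continuous_majorants {g : ℝ → ℝ} {B : ℝ} (hB : ∀ θ, g θ ≤ B)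
    (hg : UpperSemicontinuous g) : ∃ h : ℕ → ℝ → ℝ, (∀ j, Continuous (h j)) ∧
      (∀ j θ, g θ ≤ h j θ) ∧ (∀ j θ, h j θ ≤ B) ∧
      ∀ θ, Tendsto (fun j => h j θ) atTop (𝓝 (g θ)) := by
  have hb (j : ℕ) (θ : ℝ) : BddAbove (range fun η => g η - j * |θ - η|) :=
    ⟨B, by
      rintro _ ⟨η, rfl⟩
      nlinarith [hB η, mul_nonneg (j.cast_nonneg (α := ℝ)) (abs_nonneg (θ - η))]⟩
  have hle (j : ℕ) (θ : ℝ) : g θ ≤ ⨆ η, (g η - j * |θ - η|) :=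
    le_ciSup_of_le (hb j θ) θ (by simp)
  have hleB (j : ℕ) (θ : ℝ) : ⨆ η, (g η - j * |θ - η|) ≤ B :=
    ciSup_le fun η => by
      nlinarith [hB η, mul_nonneg (j.cast_nonneg (α := ℝ)) (abs_nonneg (θ - η))]
  refine ⟨fun j θ => ⨆ η, (g η - j * |θ - η|), fun j => ?_, hle, hleB, fun θ => ?_⟩
  · refine LipschitzWith.continuous (K := j) (LipschitzWith.of_le_add_mul _ fun x y => ?_)
    refine ciSup_le fun η => ?_
    have h1 := le_ciSup (hb j y) η
    have h2 : |y - η| ≤ |x - η| + dist x y := by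
      rw [Real.dist_eq, abs_sub_comm x y, add_comm]; exact abs_sub_le _ _ _
    have h3 := mul_le_mul_of_nonneg_left h2 (j.cast_nonneg (α := ℝ))
    simp only [NNReal.coe_natCast] at *
    linarith
  · refine tendsto_order.2 ⟨fun a ha => Eventually.of_forall fun j => ha.trans_le (hle j θ),
      fun a ha => ?_⟩
    obtain ⟨a', ha', ha''⟩ := exists_between ha
    obtain ⟨δ, hδ, h1⟩ := Metric.eventually_nhds_iff.1 (hg θ a' ha')
    obtain ⟨N, hN⟩ := exists_nat_gt ((B - a') / δ)
    filter_upwards [eventually_ge_atTop N] with j hj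
    refine (ciSup_le fun η => ?_).trans_lt ha''
    by_cases hη : dist η θ < δ
    · have := h1 hη
      nlinarith [mul_nonneg (j.cast_nonneg (α := ℝ)) (abs_nonneg (θ - η))]
    · rw [Real.dist_eq, abs_sub_comm, not_lt] at hη
      have h2 : (N:ℝ) ≤ j := by exact_mod_cast hj
      rw [div_lt_iff₀ hδ] at hN
      nlinarith [hB η]

variable {E : Type*} [NormedAddCommGroup E] [NormedSpace ℂ E]

lemma PshOn.eventually_lt {u : E → ℝ} {Ω : Set E} (hu : PshOn u Ω) (hΩ : IsOpen Ω) {z : E}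
    (hz : z ∈ Ω) {a : ℝ} (ha : u z < a) : ∀ᶠ y in 𝓝 z, u y < a := by
  have h := hu.1 z hz (a : EReal) (EReal.coe_lt_coe_iff.2 ha)
  rw [hΩ.nhdsWithin_eq hz] at h
  filter_upwards [h] with y hy
  exact_mod_cast hy

lemma PshOn.upperSemicontinuousOn {u : E → ℝ} {Ω : Set E} (hu : PshOn u Ω) :
    UpperSemicontinuousOn u Ω := by
  intro z hz a ha
  filter_upwards [hu.1 z hz (a : EReal) (EReal.coe_lt_coe_iff.2 ha)] with y hy
  exact_mod_cast hy

lemma PshOn.mono {u : E → ℝ} {Ω Ω' : Set E} (hu : PshOn u Ω) (h : Ω' ⊆ Ω) : PshOn u Ω' :=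
  ⟨fun z hz a ha => (hu.1 z (h hz) a ha).filter_mono (nhdsWithin_mono z h), fun z hz w r hr hl =>
    hu.2 z (h hz) w r hr fun l hl' => h (hl l hl')⟩

lemma PshOn.max_const {u : E → ℝ} {Ω : Set E} (hu : PshOn u Ω) (c : ℝ) :
    PshOn (fun z => max (u z) c) Ω := by
  refine ⟨fun z hz a ha => ?_, fun z hz w r hr hl h hh hle => ?_⟩
  · have h1 := hu.1 z hz a ((EReal.coe_le_coe_iff.2 (le_max_left _ _)).trans_lt ha)
    have h2 := (EReal.coe_le_coe_iff.2 (le_max_right (u z) c)).trans_lt ha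
    filter_upwards [h1] with y hy
    rcases max_choice (u y) c with h | h
    · simpa only [h] using hy
    · simpa only [h] using h2
  · have h1 := hu.2 z hz w r hr hl h hh fun θ => le_trans
      (EReal.coe_le_coe_iff.2 (le_max_left _ _)) (hle θ)
    have h2 : c ≤ (2 * Real.pi)⁻¹ * ∫ θ in (0:ℝ)..(2 * Real.pi), h θ := by
      have h3 : ∫ θ in (0:ℝ)..(2 * Real.pi), c ≤ ∫ θ in (0:ℝ)..(2 * Real.pi), h θ := by
        refine intervalIntegral.integral_mono_on (by positivity) (by simp)
          (hh.intervalIntegrable _ _) fun θ _ => ?_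
        exact (le_max_right _ _).trans (EReal.coe_le_coe_iff.1 (hle θ))
      rw [intervalIntegral.integral_const, sub_zero, smul_eq_mul] at h3
      rw [le_inv_mul_iff₀ (by positivity)]
      exact h3
    exact EReal.coe_le_coe_iff.2 (max_le (EReal.coe_le_coe_iff.1 h1) h2)

/-- The sub-mean value inequality of `f` on circles in `Q`. -/
def SubMean (f : E → ℝ) (Q : Set E) : Prop :=
  ∀ z w : E, (∀ l : ℂ, ‖l‖ ≤ 1 → z + l • w ∈ Q) →
    2 * Real.pi * f z ≤ ∫ θ in (0:ℝ)..(2 * Real.pi), f (z + Complex.exp (θ * I) • w)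

lemma PshOn.subMean {u : E → ℝ} {Ω : Set E} (hΩ : IsOpen Ω) (hu : PshOn u Ω) {m : ℝ}
    (hm : ∀ z ∈ Ω, m ≤ u z) : SubMean u Ω := by
  intro z w hzw
  have hc (θ : ℝ) : z + Complex.exp (θ * I) • w ∈ Ω :=
    hzw _ (Complex.norm_exp_ofReal_mul_I θ).le
  have hcont : Continuous fun θ : ℝ => z + Complex.exp (θ * I) • w := by fun_prop
  have husc : UpperSemicontinuous fun θ : ℝ => u (z + Complex.exp (θ * I) • w) :=
    fun θ a ha => hcont.continuousAt.eventually (hu.eventually_lt hΩ (hc θ) ha)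
  obtain ⟨B, hB⟩ : ∃ B, ∀ θ : ℝ, u (z + Complex.exp (θ * I) • w) ≤ B := by
    have hK : IsCompact ((fun l : ℂ => z + l • w) '' sphere 0 1) :=
      (isCompact_sphere 0 1).image (by fun_prop)
    obtain ⟨B, hB⟩ := UpperSemicontinuousOn.bddAbove_of_isCompact hK
      (hu.upperSemicontinuousOn.mono (image_subset_iff.2 fun l hl =>
        hzw l (by simpa using (mem_sphere_iff_norm.1 hl).le)))
    exact ⟨B, fun θ => hB (mem_image_of_mem _ ⟨_, by simp [Complex.norm_exp_ofReal_mul_I], rfl⟩)⟩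
  obtain ⟨h, h1, h2, h3, h4⟩ := exists_continuous_majorants hB husc
  have h5 (j : ℕ) : 2 * Real.pi * u z ≤ ∫ θ in (0:ℝ)..(2 * Real.pi), h j θ := by
    have h6 := hu.2 z (by simpa using hzw 0 (by simp)) w 1 one_pos hzw (h j) (h1 j) fun θ => by
      simpa using h2 j θ
    have h7 : u z ≤ (2 * Real.pi)⁻¹ * ∫ θ in (0:ℝ)..(2 * Real.pi), h j θ :=
      EReal.coe_le_coe_iff.1 h6
    rwa [le_inv_mul_iff₀ (by positivity)] at h7
  refine ge_of_tendsto' (intervalIntegral.tendsto_integral_filter_of_dominated_convergence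
    (fun _ => max |m| |B|) (Eventually.of_forall fun j => (h1 j).aestronglyMeasurable)
    (Eventually.of_forall fun j => Eventually.of_forall fun θ _ => ?_)
    intervalIntegrable_const (Eventually.of_forall fun θ _ => h4 θ)) h5
  rw [Real.norm_eq_abs]
  exact abs_le_max_abs_abs ((hm _ (hc θ)).trans (h2 j θ)) (h3 j θ)

end SubMean

section Levi

lemma hasDerivAt_integral_of_continuous {F F' : ℝ → ℝ → ℝ}
    (hF : ∀ s, Continuous (F s)) (hF' : Continuous fun p : ℝ × ℝ => F' p.1 p.2)
    (h : ∀ s θ, HasDerivAt (fun s => F s θ) (F' s θ) s) (a b s : ℝ) :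
    HasDerivAt (fun s => ∫ θ in a..b, F s θ) (∫ θ in a..b, F' s θ) s := by
  obtain ⟨B, hB⟩ := (isCompact_Icc (a := s - 1) (b := s + 1)).prod
    (isCompact_uIcc (a := a) (b := b)) |>.exists_bound_of_continuousOn hF'.continuousOn
  refine (intervalIntegral.hasDerivAt_integral_of_dominated_loc_of_deriv_le (bound := fun _ => B)
    (Icc_mem_nhds (by linarith : s - 1 < s) (by linarith : s < s + 1))
    (Eventually.of_forall fun s => (hF s).aestronglyMeasurable) ((hF s).intervalIntegrable _ _)
    (by fun_prop : Continuous fun θ => F' s θ).aestronglyMeasurable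
    (Eventually.of_forall fun θ hθ x hx => hB (x, θ) ⟨hx, uIoc_subset_uIcc hθ⟩)
    intervalIntegrable_const (Eventually.of_forall fun θ _ x _ => h x θ)).2

lemma second_deriv_nonneg_of_isLocalMin {A A' : ℝ → ℝ} {c x : ℝ} (h : IsLocalMin A x)
    (h1 : ∀ s, HasDerivAt A (A' s) s) (h2 : HasDerivAt A' c x) : 0 ≤ c := by
  by_contra! hc
  have e1 : deriv A = A' := funext fun s => (h1 s).deriv
  have h3 := isLocalMax_of_deriv_deriv_neg (f := A) (x₀ := x) (by rwa [e1, h2.deriv])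
    h.deriv_eq_zero (h1 x).continuousAt
  have h4 : A =ᶠ[𝓝 x] fun _ => A x := by
    filter_upwards [h, h3] with y hy hy' using le_antisymm hy' hy
  have h5 : A' =ᶠ[𝓝 x] fun _ => 0 := by
    filter_upwards [h4.eventuallyEq_nhds] with y hy
    rw [← (h1 y).deriv, hy.deriv_eq, deriv_const]
  have := h2.unique ((hasDerivAt_const x (0:ℝ)).congr_of_eventuallyEq h5)
  exact hc.ne this

variable {E : Type*} [NormedAddCommGroup E] [NormedSpace ℂ E]

/-- The Levi form of a real function. -/
def levi (f : E → ℝ) (v z : E) : ℝ := (wb (wd (fun z => (f z : ℂ)) v) v z).re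

lemma levi_eq {f : E → ℝ} {z : E} (hf : ContDiffAt ℝ 2 f z) (v : E) : levi f v z =
    ((fderiv ℝ (fderiv ℝ fun z => (f z : ℂ)) z v v +
      fderiv ℝ (fderiv ℝ fun z => (f z : ℂ)) z (I • v) (I • v)) / 4).re := by
  have hf' : ContDiffAt ℝ 2 (fun z => (f z : ℂ)) z :=
    ofRealCLM.contDiff.contDiffAt.comp z hf
  have hs := hf'.isSymmSndFDerivAt (by simp)
  rw [levi, wb, fderiv_wd hf', fderiv_wd hf', hs.eq (I • v) v]
  congr 1
  linear_combination (-1/4) * fderiv ℝ (fderiv ℝ fun z => (f z : ℂ)) z (I • v) (I • v) * I_sq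

lemma levi_nonneg_of_submean {f : E → ℝ} (hf : ContDiff ℝ (⊤ : ℕ∞) f) {z v : E}
    (h : ∀ᶠ s : ℝ in 𝓝 0, 2 * Real.pi * f z ≤
      ∫ θ in (0:ℝ)..(2 * Real.pi), f (z + Complex.exp (θ * I) • (s • v))) : 0 ≤ levi f v z := by
  set g : E → ℂ := fun z => (f z : ℂ) with hg
  have hgs : ContDiff ℝ (⊤ : ℕ∞) g := ofRealCLM.contDiff.comp hf
  have hg1 : ContDiff ℝ (⊤ : ℕ∞) (fderiv ℝ g) := hgs.fderiv_right (by simp)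
  have hg2 : ContDiff ℝ (⊤ : ℕ∞) (fderiv ℝ (fderiv ℝ g)) := hg1.fderiv_right (by simp)
  let w : ℝ → E := fun θ => Complex.exp (θ * I) • v
  have hw : Continuous w := by fun_prop
  have hline (s θ : ℝ) : HasDerivAt (fun s : ℝ => z + s • w θ) (w θ) s := by
    simpa using ((hasDerivAt_id s).smul_const (w θ)).const_add z
  have hcomm (s θ : ℝ) : Complex.exp (θ * I) • (s • v) = s • w θ := smul_comm _ _ _
  have hd1 (s θ : ℝ) : HasDerivAt (fun s : ℝ => f (z + s • w θ))
      (fderiv ℝ g (z + s • w θ) (w θ)).re s := by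
    have h1 := ((hgs.differentiable (by simp) (z + s • w θ)).hasFDerivAt).comp_hasDerivAt s
      (hline s θ)
    exact (reCLM.hasFDerivAt (x := g (z + s • w θ))).comp_hasDerivAt s h1
  have hd2 (s θ : ℝ) : HasDerivAt (fun s : ℝ => (fderiv ℝ g (z + s • w θ) (w θ)).re)
      (fderiv ℝ (fderiv ℝ g) (z + s • w θ) (w θ) (w θ)).re s := by
    have h1 := ((hg1.differentiable (by simp) (z + s • w θ)).hasFDerivAt).comp_hasDerivAt s
      (hline s θ)
    have h2 := h1.clm_apply (hasDerivAt_const s (w θ))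
    simp only [map_zero, add_zero] at h2
    exact (reCLM.hasFDerivAt (x := fderiv ℝ g (z + s • w θ) (w θ))).comp_hasDerivAt s h2
  have hc0 : Continuous f := hf.continuous
  have hc1 : Continuous (fderiv ℝ g) := hg1.continuous
  have hc2 : Continuous (fderiv ℝ (fderiv ℝ g)) := hg2.continuous
  have hA := hasDerivAt_integral_of_continuous (F := fun s θ => f (z + s • w θ))
    (F' := fun s θ => (fderiv ℝ g (z + s • w θ) (w θ)).re) (fun s => by fun_prop) (by fun_prop) hd1
    0 (2 * Real.pi)
  have hA' := hasDerivAt_integral_of_continuous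
    (F := fun s θ => (fderiv ℝ g (z + s • w θ) (w θ)).re)
    (F' := fun s θ => (fderiv ℝ (fderiv ℝ g) (z + s • w θ) (w θ) (w θ)).re)
    (fun s => by fun_prop) (by fun_prop) hd2 0 (2 * Real.pi) 0
  have hmin : IsLocalMin (fun s : ℝ => ∫ θ in (0:ℝ)..(2 * Real.pi), f (z + s • w θ)) 0 := by
    filter_upwards [h] with s hs
    simpa [hcomm] using hs
  have h3 := second_deriv_nonneg_of_isLocalMin hmin hA hA'
  set D := fderiv ℝ (fderiv ℝ g) z with hD
  have hexp (θ : ℝ) : (D (w θ) (w θ)).re = Real.cos θ ^ 2 * (D v v).re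
      + Real.sin θ * Real.cos θ * ((D v (I • v)).re + (D (I • v) v).re)
      + Real.sin θ ^ 2 * (D (I • v) (I • v)).re := by
    have : w θ = Real.cos θ • v + Real.sin θ • (I • v) := by
      simp only [w, Complex.exp_mul_I, add_smul, mul_smul, ← Complex.ofReal_cos,
        ← Complex.ofReal_sin, Complex.coe_smul]
    rw [this]
    simp only [map_add, map_smul, add_apply, smul_apply, add_re, Complex.real_smul, re_ofReal_mul]
    ring
  have h4 : ∫ θ in (0:ℝ)..(2 * Real.pi), (D (w θ) (w θ)).re
      = Real.pi * ((D v v).re + (D (I • v) (I • v)).re) := by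
    simp only [hexp]
    rw [intervalIntegral.integral_add (Continuous.intervalIntegrable (by fun_prop) _ _)
      (Continuous.intervalIntegrable (by fun_prop) _ _), intervalIntegral.integral_add
      (Continuous.intervalIntegrable (by fun_prop) _ _)
      (Continuous.intervalIntegrable (by fun_prop) _ _)]
    simp only [intervalIntegral.integral_mul_const, integral_sin_sq, integral_cos_sq,
      integral_sin_mul_cos₁]
    simp
    ring
  simp only [zero_smul, add_zero] at h3
  rw [h4] at h3
  rw [levi_eq (contDiff_infty.1 hf 2).contDiffAt]
  have h5 := nonneg_of_mul_nonneg_right h3 Real.pi_pos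
  have h6 : ((D v v + D (I • v) (I • v)) / 4).re = ((D v v).re + (D (I • v) (I • v)).re) / 4 := by
    rw [show (4:ℂ) = ((4:ℝ):ℂ) by norm_num, div_ofReal_re, add_re]
  rw [h6]
  positivity

end Levi

section Smoothing

variable {E : Type*} [NormedAddCommGroup E] [NormedSpace ℂ E]
  [MeasureSpace E] [BorelSpace E] [FiniteDimensional ℂ E] [(volume : Measure E).IsAddHaarMeasure]

lemma IsMollifier.integrable_smul_sub {ρ : E → ℝ} {r B : ℝ} (hρ : IsMollifier ρ r) {f : E → ℝ}
    (hf : Measurable f) (hB : ∀ x, |f x| ≤ B) (z : E) : Integrable fun t => ρ t • f (z - t) := by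
  refine ((hρ.smooth.continuous.integrable_of_hasCompactSupport hρ.hasCompactSupport).mul_bdd (c := B)
    (hf.comp (by fun_prop)).aestronglyMeasurable (Eventually.of_forall fun t => ?_))
  exact hB _

lemma IsMollifier.le_moll {ρ : E → ℝ} {r B : ℝ} (hρ : IsMollifier ρ r) {f : E → ℝ}
    (hf : Measurable f) (hB : ∀ x, |f x| ≤ B) {Q : Set E} (hs : SubMean f Q) {z : E}
    (hz : closedBall z r ⊆ Q) : f z ≤ moll ρ f z := by
  have : ProperSpace E := FiniteDimensional.proper ℂ E
  have hint := hρ.integrable_smul_sub hf hB z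
  have hm : StronglyMeasurable fun t => ρ t • f (z - t) :=
    (hρ.smooth.continuous.measurable.smul (hf.comp (by fun_prop))).stronglyMeasurable
  obtain ⟨h1, h2⟩ := integral_eq_integral_circle hint hm
  rw [moll_apply, h2, smul_eq_mul, le_inv_mul_iff₀ (by positivity)]
  have h3 : ∫ x, ρ x * (2 * Real.pi * f z) = 2 * Real.pi * f z := by
    rw [integral_mul_const, hρ.integral_eq_one, one_mul]
  rw [← h3]
  refine integral_mono ((hρ.smooth.continuous.integrable_of_hasCompactSupport
    hρ.hasCompactSupport).mul_const _) h1 fun x => ?_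
  simp only [hρ.circle _ (Complex.norm_exp_ofReal_mul_I _), smul_eq_mul]
  rw [intervalIntegral.integral_const_mul]
  by_cases hx : ρ x = 0
  · simp [hx]
  refine mul_le_mul_of_nonneg_left ?_ (hρ.nonneg x)
  have h4 := hs z (-x) fun l hl => hz (by
    have := hρ.norm_le x hx
    rw [mem_closedBall, dist_eq_norm, add_sub_cancel_left, norm_smul, norm_neg]
    nlinarith [norm_nonneg x, norm_nonneg l])
  simpa [sub_eq_add_neg] using h4

lemma IsMollifier.moll_le {ρ : E → ℝ} {r B : ℝ} (hρ : IsMollifier ρ r) {f : E → ℝ}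
    (hf : Measurable f) (hB : ∀ x, |f x| ≤ B) {z : E} {a : ℝ}
    (ha : ∀ y ∈ closedBall z r, f y ≤ a) : moll ρ f z ≤ a := by
  have : ProperSpace E := FiniteDimensional.proper ℂ E
  have hint := hρ.integrable_smul_sub hf hB z
  have h3 : ∫ x, ρ x * a = a := by
    rw [integral_mul_const, hρ.integral_eq_one, one_mul]
  rw [moll_apply, ← h3]
  refine integral_mono hint ((hρ.smooth.continuous.integrable_of_hasCompactSupport
    hρ.hasCompactSupport).mul_const _) fun x => ?_
  by_cases hx : ρ x = 0
  · simp [hx]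
  exact mul_le_mul_of_nonneg_left (ha _ (by
    simpa [dist_eq_norm] using hρ.norm_le x hx)) (hρ.nonneg x)

lemma IsMollifier.moll_subMean {ρ : E → ℝ} {r B : ℝ} (hρ : IsMollifier ρ r) {f : E → ℝ}
    (hf : Measurable f) (hB : ∀ x, |f x| ≤ B) {Q : Set E} (hs : SubMean f Q) {z w : E}
    (hz : ∀ l : ℂ, ‖l‖ ≤ 1 → closedBall (z + l • w) r ⊆ Q) : 2 * Real.pi * moll ρ f z ≤
      ∫ θ in (0:ℝ)..(2 * Real.pi), moll ρ f (z + Complex.exp (θ * I) • w) := by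
  have : ProperSpace E := FiniteDimensional.proper ℂ E
  have hρi : Integrable ρ :=
    hρ.smooth.continuous.integrable_of_hasCompactSupport hρ.hasCompactSupport
  have hpi : (0:ℝ) ≤ 2 * Real.pi := by positivity
  have hm : Measurable fun p : ℝ × E => f (z + Complex.exp (p.1 * I) • w - p.2) :=
    hf.comp (by fun_prop : Continuous fun p : ℝ × E => z + Complex.exp (p.1 * I) • w - p.2).measurable
  have hint : Integrable (fun p : ℝ × E => ρ p.2 • f (z + Complex.exp (p.1 * I) • w - p.2))
      ((volume.restrict (Ioc 0 (2 * Real.pi))).prod volume) :=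
    (hρi.comp_snd (volume.restrict (Ioc 0 (2 * Real.pi)))).mul_bdd (c := B) hm.aestronglyMeasurable
      (Eventually.of_forall fun t => hB _)
  simp only [moll_apply]
  rw [← integral_const_mul, intervalIntegral.integral_of_le hpi, integral_integral_swap hint]
  refine integral_mono ((hρ.integrable_smul_sub hf hB z).const_mul _) hint.integral_prod_right
    fun x => ?_
  simp only [smul_eq_mul]
  rw [integral_const_mul, ← intervalIntegral.integral_of_le hpi, mul_left_comm]
  by_cases hx : ρ x = 0
  · simp [hx]
  refine mul_le_mul_of_nonneg_left ?_ (hρ.nonneg x)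
  have h4 := hs (z - x) w fun l hl => hz l hl (by
    have := hρ.norm_le x hx
    rw [mem_closedBall, dist_eq_norm]
    rwa [show z - x + l • w - (z + l • w) = -x by abel, norm_neg])
  simpa [sub_add_eq_add_sub] using h4

/-- Smoothing of plurisubharmonic functions. -/
theorem PshOn.exists_smoothing {u : E → ℝ} {Ω Q : Set E} {m r : ℝ} (hu : PshOn u Ω)
    (hΩ : IsOpen Ω) (hm : ∀ z ∈ Ω, m ≤ u z) (hQ : IsCompact Q) (hQΩ : Q ⊆ Ω) (hr : 0 < r) :
    ∃ g : E → ℝ, ContDiff ℝ (⊤ : ℕ∞) g ∧ (∀ z, closedBall z r ⊆ Q → u z ≤ g z) ∧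
      (∀ z a, closedBall z r ⊆ Q → (∀ y ∈ closedBall z r, u y ≤ a) → g z ≤ a) ∧
      ∀ z r', r < r' → closedBall z r' ⊆ Q → ∀ v, 0 ≤ levi g v z := by
  have : ProperSpace E := FiniteDimensional.proper ℂ E
  obtain ⟨ρ, hρ⟩ := exists_isMollifier E hr
  obtain ⟨b, hb⟩ := UpperSemicontinuousOn.bddAbove_of_isCompact hQ
    (hu.upperSemicontinuousOn.mono hQΩ)
  set f := Q.indicator u with hf
  have hfQ (x : E) (hx : x ∈ Q) : f x = u x := indicator_of_mem hx u
  have hB (x : E) : |f x| ≤ max |m| |b| := by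
    by_cases hx : x ∈ Q
    · rw [hfQ x hx]
      exact abs_le_max_abs_abs (hm x (hQΩ hx)) (hb (mem_image_of_mem u hx))
    · rw [hf, indicator_of_notMem hx]
      simp
  have hfm : Measurable f := by
    refine measurable_of_Iio fun a => ?_
    have ho : IsOpen {x ∈ Ω | u x < a} := isOpen_iff_mem_nhds.2 fun x hx =>
      inter_mem (hΩ.mem_nhds hx.1) (hu.eventually_lt hΩ hx.1 hx.2)
    have h1 : f ⁻¹' Iio a = Q ∩ {x ∈ Ω | u x < a} ∪ Qᶜ ∩ {_x | 0 < a} := by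
      ext x
      by_cases hx : x ∈ Q
      · simp [hx, hfQ x hx, hQΩ hx]
      · simp [hx, hf]
    rw [h1]
    exact (hQ.measurableSet.inter ho.measurableSet).union
      (hQ.measurableSet.compl.inter (MeasurableSet.const _))
  have hs : SubMean f Q := by
    intro z w hzw
    have h1 := hu.subMean hΩ hm z w fun l hl => hQΩ (hzw l hl)
    rw [hfQ z (by simpa using hzw 0 (by simp))]
    simpa only [hfQ _ (hzw _ (Complex.norm_exp_ofReal_mul_I _).le)] using h1
  have hli : LocallyIntegrable f := by
    have h1 : Integrable f := by
      rw [hf, integrable_indicator_iff hQ.measurableSet]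
      refine IntegrableOn.congr_fun ?_ hfQ hQ.measurableSet
      exact Measure.integrableOn_of_bounded hQ.measure_lt_top.ne hfm.aestronglyMeasurable
        (Eventually.of_forall hB)
    exact h1.locallyIntegrable
  have hsm : ContDiff ℝ (⊤ : ℕ∞) (moll ρ f) := contDiff_moll hρ hli
  refine ⟨moll ρ f, hsm, fun z hz => ?_, fun z a hz ha => ?_, fun z r' hr' hz v => ?_⟩
  · rw [← hfQ z (hz (mem_closedBall_self hr.le))]
    exact hρ.le_moll hfm hB hs hz
  · exact hρ.moll_le hfm hB fun y hy => (hfQ y (hz hy)).trans_le (ha y hy)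
  · refine levi_nonneg_of_submean hsm ?_
    have h1 : ∀ᶠ s : ℝ in 𝓝 0, ‖s • v‖ < r' - r := by
      have : Tendsto (fun s : ℝ => ‖s • v‖) (𝓝 0) (𝓝 ‖(0:ℝ) • v‖) :=
        (by fun_prop : Continuous fun s : ℝ => ‖s • v‖).tendsto 0
      exact this.eventually_lt_const (by simpa using hr')
    filter_upwards [h1] with s hs'
    refine hρ.moll_subMean hfm hB hs fun l hl => (closedBall_subset_closedBall' ?_).trans hz
    rw [dist_eq_norm, add_sub_cancel_left, norm_smul]
    nlinarith [norm_nonneg (s • v), norm_nonneg l]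

end Smoothing

section LeviCalculus

variable {E E' : Type*} [NormedAddCommGroup E] [NormedSpace ℂ E]
  [NormedAddCommGroup E'] [NormedSpace ℂ E']

lemma contDiffAt_ofReal {f : E → ℝ} {z : E} {n : WithTop ℕ∞} (hf : ContDiffAt ℝ n f z) :
    ContDiffAt ℝ n (fun z => (f z : ℂ)) z :=
  ofRealCLM.contDiff.contDiffAt.comp z hf

lemma differentiableAt_wd {f : E → ℂ} {z : E} (hf : ContDiffAt ℝ 2 f z) (v : E) :
    DifferentiableAt ℝ (wd f v) z := by
  have h : DifferentiableAt ℝ (fderiv ℝ f) z :=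
    (hf.fderiv_right (m := 1) (by norm_num)).differentiableAt (by norm_num)
  have h1 : DifferentiableAt ℝ (fun z => (fderiv ℝ f z v - I * fderiv ℝ f z (I • v)) / 2) z := by
    fun_prop
  exact h1

lemma eventually_differentiableAt {f : E → ℂ} {z : E} (hf : ContDiffAt ℝ 2 f z) :
    ∀ᶠ y in 𝓝 z, DifferentiableAt ℝ f y :=
  (hf.eventually (by simp)).mono fun _ hy => hy.differentiableAt (by norm_num)

lemma levi_add {f g : E → ℝ} {z : E} (hf : ContDiffAt ℝ 2 f z) (hg : ContDiffAt ℝ 2 g z) (v : E) :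
    levi (fun z => f z + g z) v z = levi f v z + levi g v z := by
  have hf' := contDiffAt_ofReal hf
  have hg' := contDiffAt_ofReal hg
  rw [levi, levi, levi, ← add_re, ← wb_add (differentiableAt_wd hf' v) (differentiableAt_wd hg' v)]
  congr 1
  refine wb_congr ?_ v
  filter_upwards [eventually_differentiableAt hf', eventually_differentiableAt hg'] with y h1 h2
  simp only [ofReal_add]
  exact wd_add h1 h2 v

lemma levi_const (c : ℝ) (v z : E) : levi (fun _ => c) v z = 0 := by
  have h : wd (fun _ : E => (c : ℂ)) v = fun _ => 0 := by
    ext y; simp [wd]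
  rw [levi, h]
  simp [wb]

lemma levi_sum {ι : Type*} (s : Finset ι) {f : ι → E → ℝ} {z : E}
    (hf : ∀ i ∈ s, ContDiffAt ℝ 2 (f i) z) (v : E) :
    levi (fun z => ∑ i ∈ s, f i z) v z = ∑ i ∈ s, levi (f i) v z := by
  classical
  induction s using Finset.induction_on with
  | empty => simp [levi_const]
  | insert a s ha ih =>
    simp only [Finset.sum_insert ha]
    rw [levi_add (hf a (by simp)) (ContDiffAt.sum fun i hi => hf i (by simp [hi])),
      ih fun i hi => hf i (by simp [hi])]

lemma wd_comp_real {f : E → ℝ} {z : E} (hf : DifferentiableAt ℝ f z) {h : ℝ → ℝ} {c : ℝ}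
    (hh : HasDerivAt h c (f z)) (v : E) :
    wd (fun z => (h (f z) : ℂ)) v z = c * wd (fun z => (f z : ℂ)) v z ∧
    wb (fun z => (h (f z) : ℂ)) v z = c * wb (fun z => (f z : ℂ)) v z := by
  have h1 := ofRealCLM.hasFDerivAt.comp z (hh.comp_hasFDerivAt z hf.hasFDerivAt)
  have h2 := ofRealCLM.hasFDerivAt.comp z hf.hasFDerivAt
  have e1 : fderiv ℝ (fun z => (h (f z) : ℂ)) z = _ := h1.fderiv
  have e2 : fderiv ℝ (fun z => (f z : ℂ)) z = _ := h2.fderiv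
  rw [wd, wd, wb, wb, e1, e2]
  constructor <;> simp <;> ring

/-- The Levi form of `h ∘ f`. -/
lemma levi_comp_real {f : E → ℝ} {z : E} (hf : ContDiffAt ℝ 2 f z) {h h' : ℝ → ℝ} {c : ℝ}
    (hh : ∀ᶠ x in 𝓝 (f z), HasDerivAt h (h' x) x) (hh' : HasDerivAt h' c (f z)) (v : E) :
    levi (fun z => h (f z)) v z =
      h' (f z) * levi f v z + c * ‖wd (fun z => (f z : ℂ)) v z‖ ^ 2 := by
  have hd := hf.differentiableAt (by norm_num)
  have hf' := contDiffAt_ofReal hf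
  have h1 : wd (fun z => (h (f z) : ℂ)) v =ᶠ[𝓝 z]
      fun z => (h' (f z) : ℂ) * wd (fun z => (f z : ℂ)) v z := by
    filter_upwards [hf.continuousAt.eventually hh, (hf.eventually (by simp)).mono
      fun y hy => hy.differentiableAt (by norm_num)] with y hy hy'
    exact (wd_comp_real hy' hy v).1
  have hdh : DifferentiableAt ℝ (fun z => (h' (f z) : ℂ)) z :=
    (ofRealCLM.differentiableAt).comp z (hh'.differentiableAt.comp z hd)
  rw [levi, wb_congr h1, wb_mul hdh (differentiableAt_wd hf' v), (wd_comp_real hd hh' v).2, levi,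
    ← conj_wd_ofReal hd, add_re, re_ofReal_mul, mul_assoc, conj_mul', re_ofReal_mul, add_comm]
  norm_cast

lemma wd_comp_clm {f : E' → ℂ} (L : E →L[ℂ] E') {z : E} (hf : DifferentiableAt ℝ f (L z)) (v : E) :
    wd (fun z => f (L z)) v z = wd f (L v) (L z) ∧ wb (fun z => f (L z)) v z = wb f (L v) (L z) := by
  have h1 := hf.hasFDerivAt.comp z (L.restrictScalars ℝ).hasFDerivAt
  have e1 : fderiv ℝ (fun z => f (L z)) z = _ := h1.fderiv
  rw [wd, wd, wb, wb, e1]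
  simp

lemma levi_comp_clm {f : E' → ℝ} (L : E →L[ℂ] E') {z : E} (hf : ContDiffAt ℝ 2 f (L z)) (v : E) :
    levi (fun z => f (L z)) v z = levi f (L v) (L z) := by
  have hf' := contDiffAt_ofReal hf
  rw [levi, levi, ← (wd_comp_clm L (differentiableAt_wd hf' (L v)) v).2]
  congr 1
  refine wb_congr ?_ v
  filter_upwards [L.continuous.continuousAt.eventually (eventually_differentiableAt hf')] with y hy
  exact (wd_comp_clm (f := fun z => (f z : ℂ)) L hy v).1

lemma levi_norm_sq (L : E →L[ℂ] ℂ) (v z : E) : levi (fun z => ‖L z‖ ^ 2) v z = ‖L v‖ ^ 2 := by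
  have hL (y : E) : DifferentiableAt ℂ (fun z => L z) y := L.differentiableAt
  have hL' (y : E) : DifferentiableAt ℝ (fun z => L z) y := (hL y).restrictScalars ℝ
  have hc (y : E) : DifferentiableAt ℝ (fun z => (starRingEnd ℂ) (L z)) y :=
    (conjCLE.differentiableAt).comp y (hL' y)
  have hwb (y : E) : wb (fun z => L z) v y = 0 := wb_eq_zero_of_differentiableAt (hL y) v
  have hwd (y : E) : wd (fun z => L z) v y = L v := by
    have e : fderiv ℝ (fun z => L z) y = L.restrictScalars ℝ := (L.restrictScalars ℝ).fderiv
    rw [wd, e]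
    simp only [ContinuousLinearMap.coe_restrictScalars', map_smul, smul_eq_mul]
    linear_combination (-1/2) * L v * I_sq
  have h1 : wd (fun z => ((‖L z‖ ^ 2 : ℝ) : ℂ)) v = fun y => L v * (starRingEnd ℂ) (L y) := by
    ext y
    have e : (fun z => ((‖L z‖ ^ 2 : ℝ) : ℂ)) = fun z => L z * (starRingEnd ℂ) (L z) := by
      ext z; rw [mul_conj']; norm_cast
    rw [e, wd_mul (hL' y) (hc y), wd_conj (hL' y), hwb, hwd]
    simp
  rw [levi, h1, wb_mul (differentiableAt_const _) (hc z), wb_conj (hL' z), hwd]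
  have h2 : wb (fun _ : E => L v) v z = 0 := by simp [wb]
  rw [h2, zero_mul, zero_add, mul_conj']
  norm_cast

end LeviCalculus

section Approximants

variable {E : Type*} [NormedAddCommGroup E] [NormedSpace ℂ E]

/-- Smooth approximations of a plurisubharmonic exhaustion (shifted by the level) and of a
plurisubharmonic weight on an exhausting sequence of open sets. -/
structure Approximants {ι : Type*} [Fintype ι] (D : Set E) (φ : E → ℝ) (L : ι → E →L[ℂ] ℂ)
    (O : ℕ → Set E) (p ψ : ℕ → E → ℝ) : Prop where
  isOpen : ∀ j, IsOpen (O j)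
  subset : ∀ j, O j ⊆ D
  smooth : ∀ j, ContDiff ℝ (⊤ : ℕ∞) (p j)
  smooth_weight : ∀ j, ContDiff ℝ (⊤ : ℕ∞) (ψ j)
  proper : ∀ j, ∀ c ≤ 1, IsCompact {z ∈ O j | p j z ≤ c}
  levi : ∀ j, ∀ z ∈ O j, ∀ v, 0 ≤ levi (p j) v z
  levi_weight : ∀ j, ∃ d > 0, ∀ z ∈ O j, ∀ v, d * ∑ i, ‖L i v‖ ^ 2 ≤ Berndtsson.levi (ψ j) v z
  le_weight : ∀ j, ∀ z ∈ O j, φ z ≤ ψ j z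
  eventually_mem : ∀ Q ⊆ D, IsCompact Q → ∀ᶠ j in atTop, ∀ z ∈ Q, z ∈ O j ∧ p j z < 0
  eventually_lt : ∀ z ∈ D, ∀ a > φ z, ∃ N ∈ 𝓝 z, ∀ᶠ j in atTop, ∀ y ∈ N, ψ j y < a

variable [FiniteDimensional ℂ E]

lemma exists_thickening_subset {Q U : Set E} (hQ : IsCompact Q) (hU : IsOpen U) (h : Q ⊆ U) :
    ∃ r > 0, r ≤ 1 ∧ cthickening r Q ⊆ U := by
  obtain ⟨r, hr, h1⟩ := hQ.exists_cthickening_subset_open hU h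
  exact ⟨min r 1, by positivity, min_le_right _ _,
    (cthickening_mono (min_le_left _ _) Q).trans h1⟩

variable [MeasureSpace E] [BorelSpace E] [(volume : Measure E).IsAddHaarMeasure]

lemma PshOn.exists_approximants {ι : Type*} [Fintype ι] {D : Set E} {u φ : E → ℝ} (hD : IsOpen D)
    (hu : PshOn u D) (hc : ∀ c, IsCompact {z ∈ D | u z ≤ c}) (hφ : PshOn φ D)
    (L : ι → E →L[ℂ] ℂ) : ∃ O p ψ, Approximants D φ L O p ψ := by
  have : ProperSpace E := FiniteDimensional.proper ℂ E
  have hu' := hu.max_const 0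
  set U : E → ℝ := fun z => max (u z) 0 with hU
  have hU0 (z) : 0 ≤ U z := le_max_right _ _
  have hc' (j : ℕ) : IsCompact {z ∈ D | U z ≤ j} := by
    convert hc j using 1
    ext z
    simp [hU]
  have hopen (j : ℕ) : IsOpen {z ∈ D | U z < j} := by
    rw [isOpen_iff_mem_nhds]
    rintro z ⟨hz, hzj⟩
    exact inter_mem (hD.mem_nhds hz) (hu'.eventually_lt hD hz hzj)
  have hsub (j : ℕ) : {z ∈ D | U z ≤ ((j + 1 : ℕ) : ℝ)} ⊆ {z ∈ D | U z < ((j + 2 : ℕ) : ℝ)} := by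
    rintro z ⟨hz, h⟩
    refine ⟨hz, h.trans_lt ?_⟩
    push_cast
    linarith
  choose R hR0 hR1 hR using fun j : ℕ => exists_thickening_subset (hc' (j + 1)) (hopen (j + 2)) (hsub j)
  set r : ℕ → ℝ := fun j => R j / 4 / (j + 1) with hr
  have hr0 (j) : 0 < r j := by have := hR0 j; positivity
  have hr4 (j) : 4 * r j ≤ R j := by
    have : R j / 4 / (j + 1) ≤ R j / 4 := div_le_self (by linarith [hR0 j]) (by simp)
    simp only [hr]; linarith
  have hrt : Tendsto r atTop (𝓝 0) := by
    refine squeeze_zero (fun j => (hr0 j).le) (fun j => ?_) tendsto_one_div_add_atTop_nhds_zero_nat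
    simp only [hr]
    gcongr
    linarith [hR1 j]
  set O : ℕ → Set E := fun j => thickening (r j) {z ∈ D | U z ≤ ((j + 1 : ℕ) : ℝ)} with hO
  set Q : ℕ → Set E := fun j => {z ∈ D | U z ≤ ((j + 2 : ℕ) : ℝ)} with hQ
  have hball (j) (z) (hz : z ∈ O j) : closedBall z (2 * r j) ⊆ Q j := by
    obtain ⟨x, hx, hxz⟩ := mem_thickening_iff.1 hz
    intro y hy
    have h1 : y ∈ cthickening (R j) {z ∈ D | U z ≤ ((j + 1 : ℕ) : ℝ)} := by
      refine mem_cthickening_of_dist_le y x _ _ hx ?_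
      linarith [dist_triangle y z x, mem_closedBall.1 hy, hr4 j, hr0 j]
    exact ⟨(hR j h1).1, (hR j h1).2.le⟩
  have hball' (j) (z) (hz : z ∈ O j) : closedBall z (r j) ⊆ Q j :=
    (closedBall_subset_closedBall (by linarith [hr0 j])).trans (hball j z hz)
  have hOD (j) : O j ⊆ D := fun z hz => (hball' j z hz (mem_closedBall_self (hr0 j).le)).1
  choose g hg1 hg2 hg3 hg4 using fun j : ℕ => hu'.exists_smoothing hD (fun z _ => hU0 z)
    (hc' (j + 2)) (sep_subset _ _) (hr0 j)
  choose f hf1 hf2 hf3 hf4 using fun j : ℕ => (hφ.max_const (-(j : ℝ))).exists_smoothing hD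
    (fun z _ => le_max_right (φ z) (-(j : ℝ))) (hc' (j + 2)) (sep_subset _ _) (hr0 j)
  set N : E → ℝ := fun z => ∑ i, ‖L i z‖ ^ 2 with hN
  have hNs : ContDiff ℝ (⊤ : ℕ∞) N :=
    ContDiff.sum fun i _ => ((L i).restrictScalars ℝ).contDiff.norm_sq ℂ
  have hNl (z v : E) : Berndtsson.levi N v z = ∑ i, ‖L i v‖ ^ 2 := by
    rw [hN, levi_sum (f := fun i z => ‖L i z‖ ^ 2) _ fun i _ => ((contDiff_infty.1
      (((L i).restrictScalars ℝ).contDiff.norm_sq ℂ) 2).contDiffAt)]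
    exact Finset.sum_congr rfl fun i _ => levi_norm_sq (L i) v z
  refine ⟨O, fun j z => g j z + -(j : ℝ), fun j z => f j z + 1 / ((j : ℝ) + 1) * N z,
    fun j => isOpen_thickening, hOD, fun j => (hg1 j).add contDiff_const,
    fun j => (hf1 j).add (contDiff_const.mul hNs), fun j c hc1 => ?_, fun j z hz v => ?_,
    fun j => ⟨1 / ((j : ℝ) + 1), by positivity, fun z hz v => ?_⟩, fun j z hz => ?_,
    fun Z hZ hZc => ?_, fun z hz a ha => ?_⟩
  · have h1 : {z ∈ O j | g j z + -(j : ℝ) ≤ c} =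
        {z ∈ D | U z ≤ ((j + 1 : ℕ) : ℝ)} ∩ {z | g j z + -(j : ℝ) ≤ c} := by
      ext z
      constructor
      · rintro ⟨hz, h⟩
        refine ⟨⟨hOD j hz, (hg2 j z (hball' j z hz)).trans ?_⟩, h⟩
        push_cast
        linarith
      · rintro ⟨hz, h⟩
        exact ⟨self_subset_thickening (hr0 j) _ hz, h⟩
    rw [h1]
    exact (hc' (j + 1)).inter_right (isClosed_le ((hg1 j).continuous.add continuous_const)
      continuous_const)
  · rw [levi_add (contDiff_infty.1 (hg1 j) 2).contDiffAt contDiffAt_const, levi_const, add_zero]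
    exact hg4 j z (2 * r j) (by linarith [hr0 j]) (hball j z hz) v
  · have hN2 := (contDiff_infty.1 hNs 2).contDiffAt (x := z)
    rw [levi_add (contDiff_infty.1 (hf1 j) 2).contDiffAt (contDiffAt_const.mul hN2),
      levi_comp_real (h := fun x => 1 / ((j : ℝ) + 1) * x) (h' := fun _ => 1 / ((j : ℝ) + 1)) (c := 0)
        hN2 (Eventually.of_forall fun x => by
          simpa using (hasDerivAt_id x).const_mul (1 / ((j : ℝ) + 1))) (hasDerivAt_const _ _), hNl]
    have := hf4 j z (2 * r j) (by linarith [hr0 j]) (hball j z hz) v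
    linarith
  · have h1 := hf2 j z (hball' j z hz)
    have h2 : 0 ≤ 1 / ((j : ℝ) + 1) * N z :=
      mul_nonneg (by positivity) (Finset.sum_nonneg fun i _ => by positivity)
    linarith [le_max_left (φ z) (-(j : ℝ))]
  · obtain ⟨δ, hδ0, -, hδ⟩ := exists_thickening_subset hZc hD hZ
    have hc2 : IsCompact (cthickening δ Z) := hZc.cthickening
    obtain ⟨b, hb⟩ := UpperSemicontinuousOn.bddAbove_of_isCompact hc2
      (hu'.upperSemicontinuousOn.mono hδ)
    filter_upwards [hrt.eventually (gt_mem_nhds hδ0), eventually_gt_atTop ⌈b⌉₊] with j hj hj' z hz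
    have hbj : b < j := Nat.lt_of_ceil_lt hj'
    have h1 (y) (hy : y ∈ closedBall z (r j)) : y ∈ D ∧ U y ≤ b := by
      have : y ∈ cthickening δ Z := mem_cthickening_of_dist_le y z _ _ hz
        ((mem_closedBall.1 hy).trans hj.le)
      exact ⟨hδ this, hb (mem_image_of_mem _ this)⟩
    have h0 := h1 z (mem_closedBall_self (hr0 j).le)
    refine ⟨self_subset_thickening (hr0 j) _ ⟨h0.1, ?_⟩, ?_⟩
    · push_cast; linarith [h0.2]
    · have := hg3 j z b (fun y hy => ⟨(h1 y hy).1, by push_cast; linarith [(h1 y hy).2]⟩)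
        fun y hy => (h1 y hy).2
      linarith
  · obtain ⟨a', ha', haa⟩ := exists_between ha
    obtain ⟨δ, hδ0, hδ⟩ := nhds_basis_closedBall.mem_iff.1
      (inter_mem (hD.mem_nhds hz) (hφ.eventually_lt hD hz ha'))
    obtain ⟨b, hb⟩ := UpperSemicontinuousOn.bddAbove_of_isCompact (isCompact_closedBall z δ)
      (hu'.upperSemicontinuousOn.mono fun y hy => (hδ hy).1)
    obtain ⟨c, hc⟩ := (isCompact_closedBall z δ).bddAbove_image hNs.continuous.continuousOn
    have ht : Tendsto (fun j : ℕ => a' + 1 / ((j : ℝ) + 1) * c) atTop (𝓝 (a' + 0 * c)) :=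
      (tendsto_one_div_add_atTop_nhds_zero_nat.mul_const c).const_add a'
    refine ⟨closedBall z (δ / 2), closedBall_mem_nhds z (by positivity), ?_⟩
    filter_upwards [hrt.eventually (gt_mem_nhds (half_pos hδ0)), eventually_gt_atTop ⌈b⌉₊,
      eventually_gt_atTop ⌈-a'⌉₊, ht.eventually (gt_mem_nhds (by simpa using haa))]
      with j hj hj' hj'' h4 y hy
    have hbj : b < j := Nat.lt_of_ceil_lt hj'
    have haj : -a' < j := Nat.lt_of_ceil_lt hj''
    have h1 (x) (hx : x ∈ closedBall y (r j)) : x ∈ closedBall z δ := by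
      rw [mem_closedBall] at *
      linarith [dist_triangle x y z]
    have h2 := hf3 j y a' (fun x hx => ⟨(hδ (h1 x hx)).1, by
      have := hb (mem_image_of_mem _ (h1 x hx)); push_cast; linarith⟩)
      fun x hx => max_le (le_of_lt (hδ (h1 x hx)).2) (by linarith)
    have h3 : N y ≤ c := hc (mem_image_of_mem _ (h1 y (mem_closedBall_self (hr0 j).le)))
    have h5 : 1 / ((j : ℝ) + 1) * N y ≤ 1 / ((j : ℝ) + 1) * c := by gcongr
    linarith

end Approximants

section ParameterCutoff

/-- A cutoff function `χ` at scale `ε` in the complex plane, with `∂̄χ = β(w) w` and `‖β‖ ≤ M`. -/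
structure IsCutoff (χ β : ℂ → ℂ) (ε M : ℝ) : Prop where
  smooth : ContDiff ℝ (⊤ : ℕ∞) χ
  smooth' : ContDiff ℝ (⊤ : ℕ∞) β
  wb_eq : ∀ w, wb χ 1 w = β w * w
  inner : ∀ w, ‖w‖ < ε / 2 → χ w = 1 ∧ β w = 0
  outer : ∀ w, 3 / 4 * ε ≤ ‖w‖ → χ w = 0 ∧ β w = 0
  norm_le : ∀ w, ‖χ w‖ ≤ 1
  norm_le' : ∀ w, ‖β w‖ ≤ M

lemma exists_isCutoff {ε : ℝ} (hε : 0 < ε) : ∃ χ β M, IsCutoff χ β ε M := by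
  set f : ℂ → ℝ := fun w => Real.smoothTransition (2 - 4 / ε ^ 2 * ‖w‖ ^ 2) with hf
  set χ : ℂ → ℂ := fun w => (f w : ℂ) with hχ
  have hfs : ContDiff ℝ (⊤ : ℕ∞) f :=
    Real.smoothTransition.contDiff.comp (contDiff_const.sub (contDiff_const.mul (contDiff_id.norm_sq ℂ)))
  have hχs : ContDiff ℝ (⊤ : ℕ∞) χ := ofRealCLM.contDiff.comp hfs
  have hin (w : ℂ) (hw : ‖w‖ < ε / 2) : χ w = 1 := by
    have : 4 / ε ^ 2 * ‖w‖ ^ 2 ≤ 1 := by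
      rw [div_mul_eq_mul_div, div_le_one (by positivity)]
      nlinarith [norm_nonneg w]
    simp only [hχ, hf]
    rw [Real.smoothTransition.one_of_one_le (by linarith), ofReal_one]
  have hout (w : ℂ) (hw : 3 / 4 * ε - ε / 50 < ‖w‖) : χ w = 0 := by
    have : 2 ≤ 4 / ε ^ 2 * ‖w‖ ^ 2 := by
      rw [div_mul_eq_mul_div, le_div_iff₀ (by positivity)]
      nlinarith [norm_nonneg w]
    simp only [hχ, hf]
    rw [Real.smoothTransition.zero_of_nonpos (by linarith), ofReal_zero]
  have hwin (w : ℂ) (hw : ‖w‖ < ε / 2) : wb χ 1 w = 0 := by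
    have : χ =ᶠ[𝓝 w] fun _ => 1 := by
      filter_upwards [continuous_norm.continuousAt.eventually (gt_mem_nhds hw)] with y hy
      exact hin y hy
    rw [wb_congr this]
    simp [wb]
  have hwout (w : ℂ) (hw : 3 / 4 * ε ≤ ‖w‖) : wb χ 1 w = 0 := by
    have : χ =ᶠ[𝓝 w] fun _ => 0 := by
      filter_upwards [continuous_norm.continuousAt.eventually
        (lt_mem_nhds (show 3 / 4 * ε - ε / 50 < ‖w‖ by linarith))] with y hy
      exact hout y hy
    rw [wb_congr this]
    simp [wb]
  set β : ℂ → ℂ := fun w => wb χ 1 w * w⁻¹ with hβ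
  have hβs : ContDiff ℝ (⊤ : ℕ∞) β := by
    rw [contDiff_iff_contDiffAt]
    intro w
    by_cases hw : w = 0
    · have : β =ᶠ[𝓝 w] fun _ => 0 := by
        filter_upwards [continuous_norm.continuousAt.eventually
          (gt_mem_nhds (show ‖w‖ < ε / 2 by rw [hw, norm_zero]; positivity))] with y hy
        simp [hβ, hwin y hy]
      exact contDiffAt_const.congr_of_eventuallyEq this
    · exact (contDiff_wb hχs 1).contDiffAt.mul (contDiffAt_inv ℝ hw)
  have hβ0 (w : ℂ) (hw : 3 / 4 * ε ≤ ‖w‖) : β w = 0 := by simp [hβ, hwout w hw]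
  obtain ⟨M, hM⟩ := hβs.continuous.bounded_above_of_compact_support
    (HasCompactSupport.intro (isCompact_closedBall (0:ℂ) (3 / 4 * ε)) fun w hw => hβ0 w (by
      rw [mem_closedBall_zero_iff, not_le] at hw; exact hw.le))
  refine ⟨χ, β, M, hχs, hβs, fun w => ?_, fun w hw => ⟨hin w hw, by simp [hβ, hwin w hw]⟩,
    fun w hw => ⟨hout w (by linarith), hβ0 w hw⟩, fun w => ?_, hM⟩
  · by_cases hw : w = 0
    · rw [hwin w (by rw [hw, norm_zero]; positivity), hw, mul_zero]
    · simp [hβ, hw]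
  · simp only [hχ, norm_real, Real.norm_eq_abs, hf]
    rw [abs_of_nonneg (Real.smoothTransition.nonneg _)]
    exact Real.smoothTransition.le_one _

variable {E : Type*} [NormedAddCommGroup E] [NormedSpace ℂ E]

lemma contDiffOn_cutoff_mul [MeasureSpace E] [BorelSpace E] [FiniteDimensional ℂ E]
    [(volume : Measure E).IsAddHaarMeasure] {V : Set E} (hV : IsOpen V) (τ : E →L[ℂ] ℂ) {ε : ℝ}
    (hε : 0 < ε) {c : ℂ → ℂ} (hc : ContDiff ℝ (⊤ : ℕ∞) c) (h0 : ∀ w, 3 / 4 * ε ≤ ‖w‖ → c w = 0)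
    {g : E → ℂ} (hg : DifferentiableOn ℂ g {x ∈ V | ‖τ x‖ < ε}) :
    ContDiffOn ℝ (⊤ : ℕ∞) (fun x => c (τ x) * g x) V := by
  have hτ : ContDiff ℝ (⊤ : ℕ∞) fun x => c (τ x) := hc.comp (τ.restrictScalars ℝ).contDiff
  have ho : IsOpen {x ∈ V | ‖τ x‖ < ε} := hV.inter (isOpen_lt τ.continuous.norm continuous_const)
  intro x hx
  by_cases h : ‖τ x‖ < ε
  · exact (hτ.contDiffAt.mul ((contDiffOn_of_holomorphic ho hg).contDiffAt
      (ho.mem_nhds ⟨hx, h⟩))).contDiffWithinAt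
  · have : (fun x => c (τ x) * g x) =ᶠ[𝓝 x] fun _ => 0 := by
      filter_upwards [τ.continuous.norm.continuousAt.eventually
        (lt_mem_nhds (show 3 / 4 * ε < ‖τ x‖ by linarith))] with y hy
      rw [h0 _ hy.le, zero_mul]
    exact (contDiffAt_const.congr_of_eventuallyEq this).contDiffWithinAt

lemma wb_cutoff_mul {V : Set E} (hV : IsOpen V) (τ : E →L[ℂ] ℂ) {ε : ℝ}
    (hε : 0 < ε) {c : ℂ → ℂ} (hc : ContDiff ℝ (⊤ : ℕ∞) c) (h0 : ∀ w, 3 / 4 * ε ≤ ‖w‖ → c w = 0)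
    {g : E → ℂ} (hg : DifferentiableOn ℂ g {x ∈ V | ‖τ x‖ < ε}) {x : E} (hx : x ∈ V) (v : E) :
    wb (fun x => c (τ x) * g x) v x = wb c (τ v) (τ x) * g x := by
  have ho : IsOpen {x ∈ V | ‖τ x‖ < ε} := hV.inter (isOpen_lt τ.continuous.norm continuous_const)
  by_cases h : ‖τ x‖ < ε
  · have h1 := hg.differentiableAt (ho.mem_nhds ⟨hx, h⟩)
    have hc' := hc.differentiable (by simp) (τ x)
    have h2 : DifferentiableAt ℝ (fun x => c (τ x)) x :=
      (hc.comp (τ.restrictScalars ℝ).contDiff).differentiable (by simp) x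
    rw [wb_mul h2 (h1.restrictScalars ℝ), wb_eq_zero_of_differentiableAt h1, (wd_comp_clm τ hc' v).2]
    ring
  · have hx' : 3 / 4 * ε < ‖τ x‖ := by linarith
    have e1 : (fun x => c (τ x) * g x) =ᶠ[𝓝 x] fun _ => 0 := by
      filter_upwards [τ.continuous.norm.continuousAt.eventually (lt_mem_nhds hx')] with y hy
      rw [h0 _ hy.le, zero_mul]
    have e2 : c =ᶠ[𝓝 (τ x)] fun _ => 0 := by
      filter_upwards [continuous_norm.continuousAt.eventually (lt_mem_nhds hx')] with y hy
      exact h0 _ hy.le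
    rw [wb_congr e1, wb_congr e2]
    simp [wb]

variable [MeasureSpace E] [BorelSpace E] [FiniteDimensional ℂ E]
  [(volume : Measure E).IsAddHaarMeasure]

lemma setIntegral_mul_wb_test {V : Set E} (hV : IsOpen V) {G ψ : E → ℂ}
    (hG : ContDiffOn ℝ (⊤ : ℕ∞) G V) (hψ : IsTest V ψ) (e : E) :
    ∫ x in V, G x * wb ψ e x = -∫ x in V, wb G e x * ψ x := by
  have hs : ContDiff ℝ (⊤ : ℕ∞) fun x => G x * ψ x :=
    contDiff_zero_extend hV (isClosed_tsupport ψ) hψ.tsupp (hG.mul hψ.smooth.contDiffOn)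
      fun x hx => by simp [image_eq_zero_of_notMem_tsupport hx]
  have hcs : HasCompactSupport fun x => G x * ψ x := hψ.supp.mul_left
  have h1 := integral_mul_wb hs (contDiff_const (c := (1:ℂ))) hcs e
  have hwc (x : E) : wb (fun _ : E => (1:ℂ)) e x = 0 := by simp [wb]
  simp only [hwc, mul_zero, integral_zero, mul_one] at h1
  have h2 (x : E) : wb (fun x => G x * ψ x) e x = G x * wb ψ e x + wb G e x * ψ x := by
    by_cases hx : x ∈ V
    · have hd : DifferentiableAt ℝ G x :=
        (hG.contDiffAt (hV.mem_nhds hx)).differentiableAt (by simp)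
      rw [wb_mul hd (hψ.differentiable x)]
      ring
    · have hx' : x ∉ tsupport ψ := fun h => hx (hψ.tsupp h)
      have e1 : (fun x => G x * ψ x) =ᶠ[𝓝 x] fun _ => 0 := by
        filter_upwards [notMem_tsupport_iff_eventuallyEq.1 hx'] with y hy
        simp [hy]
      rw [wb_congr e1, hψ.eq_zero hx, (hψ.wb e).eq_zero hx]
      simp [wb]
  have hGc : ContinuousOn (wb G e) V := by
    have := hG.continuousOn_fderiv_of_isOpen hV (by simp)
    exact ((this.clm_apply continuousOn_const).add
      (continuousOn_const.mul (this.clm_apply continuousOn_const))).div_const 2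
  have hK : IsCompact (tsupport ψ) := hψ.supp
  have i1 : Integrable fun x => G x * wb ψ e x :=
    integrable_of_continuousOn hK hψ.tsupp
      (hG.continuousOn.mul (hψ.wb e).smooth.continuous.continuousOn) fun x hx => by
        rw [image_eq_zero_of_notMem_tsupport fun h => hx (tsupport_wb ψ e h), mul_zero]
  have i2 : Integrable fun x => wb G e x * ψ x :=
    integrable_of_continuousOn hK hψ.tsupp
      (hGc.mul hψ.smooth.continuous.continuousOn) fun x hx => by
        rw [image_eq_zero_of_notMem_tsupport hx, mul_zero]
  simp only [h2] at h1
  rw [integral_add i1 i2] at h1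
  rw [(hψ.wb e).setIntegral_eq, hψ.setIntegral_eq]
  linear_combination h1

end ParameterCutoff

section Extension

variable {E : Type*} [NormedAddCommGroup E] [NormedSpace ℂ E]

lemma enorm_sq_mul_exp (z : ℂ) (a : ℝ) :
    ‖z * (Real.exp (-a / 2) : ℂ)‖ₑ ^ 2 = ‖z‖ₑ ^ 2 * ENNReal.ofReal (Real.exp (-a)) := by
  rw [enorm_mul, mul_pow, ← ofReal_norm (Real.exp (-a / 2) : ℂ), norm_real, Real.norm_eq_abs,
    Real.abs_exp, ← ENNReal.ofReal_pow (Real.exp_pos _).le, ← Real.exp_nat_mul]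
  congr 3
  push_cast
  ring

variable [MeasureSpace E] [BorelSpace E] [FiniteDimensional ℂ E]
  [(volume : Measure E).IsAddHaarMeasure]

lemma memLp_of_lintegral_enorm_sq {X : Type*} [MeasurableSpace X] {μ : Measure X} {f : X → ℂ}
    (hf : AEStronglyMeasurable f μ) (h : ∫⁻ x, ‖f x‖ₑ ^ 2 ∂μ < ⊤) : MemLp f 2 μ := by
  refine (memLp_two_iff_integrable_sq_norm hf).2 ⟨hf.norm.pow 2, ?_⟩
  rw [HasFiniteIntegral]
  refine lt_of_le_of_lt (le_of_eq (lintegral_congr fun x => ?_)) h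
  rw [← ofReal_norm, ← ofReal_norm, Real.norm_of_nonneg (by positivity),
    ENNReal.ofReal_pow (norm_nonneg _)]

lemma ofReal_integral_norm_sq {X : Type*} [MeasurableSpace X] {μ : Measure X} {f : X → ℂ}
    (hf : MemLp f 2 μ) : ENNReal.ofReal (∫ x, ‖f x‖ ^ 2 ∂μ) = ∫⁻ x, ‖f x‖ₑ ^ 2 ∂μ := by
  rw [ofReal_integral_eq_lintegral_ofReal ((memLp_two_iff_integrable_sq_norm hf.1).1 hf)
    (Eventually.of_forall fun x => by positivity)]
  refine lintegral_congr fun x => ?_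
  rw [← ofReal_norm, ENNReal.ofReal_pow (norm_nonneg _)]

lemma memLp_bdd_mul {X : Type*} [MeasurableSpace X] {μ : Measure X} {f c : X → ℂ} {M : ℝ}
    (hf : MemLp f 2 μ) (hc : AEStronglyMeasurable c μ) (hM : ∀ᵐ x ∂μ, ‖c x‖ ≤ M) :
    MemLp (fun x => c x * f x) 2 μ := by
  refine hf.of_le_mul (c := M) (hc.mul hf.1) ?_
  filter_upwards [hM] with x hx
  rw [norm_mul]
  gcongr

lemma energy_eq_lintegral (V : Set E) (ψ : E → ℝ) (f : E → ℂ) :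
    energy V ψ f = ∫⁻ x in V, ‖f x * (Real.exp (-ψ x / 2) : ℂ)‖ₑ ^ 2 :=
  lintegral_congr fun x => (enorm_sq_mul_exp (f x) (ψ x)).symm

lemma memLp_closedBall_of_weighted {V : Set E} {w : E → ℝ} (hw : ContinuousOn w V)
    (hw0 : ∀ x ∈ V, w x ≠ 0) {u : E → ℂ}
    (hu : MemLp (fun x => u x * (w x : ℂ)) 2 (volume.restrict V)) {x : E} {r : ℝ}
    (h : closedBall x r ⊆ V) : MemLp u 2 (volume.restrict (closedBall x r)) := by
  have : ProperSpace E := FiniteDimensional.proper ℂ E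
  have h1 : MemLp (fun y => u y * (w y : ℂ)) 2 (volume.restrict (closedBall x r)) :=
    hu.mono_measure (Measure.restrict_mono h le_rfl)
  have h2 : ContinuousOn (fun y => ((w y : ℂ))⁻¹) (closedBall x r) :=
    (continuous_ofReal.comp_continuousOn (hw.mono h)).inv₀ fun y hy => by
      simpa using hw0 y (h hy)
  obtain ⟨M, hM⟩ := (isCompact_closedBall x r).exists_bound_of_continuousOn h2
  have h3 := memLp_bdd_mul (M := M) h1 (h2.aestronglyMeasurable isClosed_closedBall.measurableSet)
    ((ae_restrict_iff' isClosed_closedBall.measurableSet).2 (Eventually.of_forall hM))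
  refine h3.ae_eq ?_
  filter_upwards [ae_restrict_mem isClosed_closedBall.measurableSet] with y hy
  have : (w y : ℂ) ≠ 0 := by simpa using hw0 y (h hy)
  field_simp

variable {ι : Type*} [Fintype ι] {V : Set E} {Φ s : E → ℝ} {e : ι → E} {δ C : ℝ}

lemma enorm_sub_sq_le (a b : ℂ) : ‖a - b‖ₑ ^ 2 ≤ 2 * ‖a‖ₑ ^ 2 + 2 * ‖b‖ₑ ^ 2 := by
  simp only [← ofReal_norm, ← ENNReal.ofReal_pow (norm_nonneg _)]
  rw [show (2:ℝ≥0∞) = ENNReal.ofReal 2 by simp, ← ENNReal.ofReal_mul (by norm_num),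
    ← ENNReal.ofReal_mul (by norm_num), ← ENNReal.ofReal_add (by positivity) (by positivity)]
  refine ENNReal.ofReal_le_ofReal ?_
  have := norm_sub_le a b
  nlinarith [sq_nonneg (‖a‖ - ‖b‖), norm_nonneg (a - b), norm_nonneg a, norm_nonneg b]

/-- Extension of holomorphic functions from the hyperplane `τ = 0`, with estimates. -/
theorem LeviExhaustion.exists_extension (h : LeviExhaustion V Φ s e δ C) (hδ : 0 < δ)
    (he : Submodule.span ℂ (range e) = ⊤) (τ : E →L[ℂ] ℂ) {o : ι} (ho : τ (e o) = 1)
    (ho' : ∀ k ≠ o, τ (e k) = 0) {ε M R : ℝ} (hε : 0 < ε) {χ β : ℂ → ℂ} (hc : IsCutoff χ β ε M)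
    (hR : ∀ x ∈ V, ‖τ x‖ ≤ R) {g : E → ℂ} (hg : DifferentiableOn ℂ g {x ∈ V | ‖τ x‖ < ε})
    (hA : energy {x ∈ V | ‖τ x‖ < ε} (fun x => Φ x - 2 * s x) g ≠ ⊤) :
    ∃ F : E → ℂ, DifferentiableOn ℂ F V ∧ (∀ x ∈ V, τ x = 0 → F x = g x) ∧
      energy V (fun x => Φ x - 2 * s x) F ≤ ENNReal.ofReal (2 + 2 * R ^ 2 * (4 / δ * M ^ 2)) *
        energy {x ∈ V | ‖τ x‖ < ε} (fun x => Φ x - 2 * s x) g := by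
  classical
  have hV := h.isOpen
  set ψ : E → ℝ := fun x => Φ x - 2 * s x with hψ
  set Vε := {x ∈ V | ‖τ x‖ < ε} with hVε
  have hVεo : IsOpen Vε := hV.inter (isOpen_lt τ.continuous.norm continuous_const)
  have hwc : ContinuousOn (fun x => Real.exp (-ψ x / 2)) V :=
    ((h.smooth_weight.continuousOn.sub (continuousOn_const.mul h.smooth.continuousOn)).neg.div_const
      2).rexp
  have hχ0 (w) (hw : 3 / 4 * ε ≤ ‖w‖) : χ w = 0 := (hc.outer w hw).1
  have hβ0 (w) (hw : 3 / 4 * ε ≤ ‖w‖) : β w = 0 := (hc.outer w hw).2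
  set a : E → ℂ := fun x => χ (τ x) * g x with ha
  set b : E → ℂ := fun x => β (τ x) * g x with hb
  have has : ContDiffOn ℝ (⊤ : ℕ∞) a V := contDiffOn_cutoff_mul hV τ hε hc.smooth hχ0 hg
  have hbs : ContDiffOn ℝ (⊤ : ℕ∞) b V := contDiffOn_cutoff_mul hV τ hε hc.smooth' hβ0 hg
  have hwb0 (c : ℂ → ℂ) (w : ℂ) : wb c 0 w = 0 := by simp [wb]
  -- energies of truncated functions
  have hen (c : ℂ → ℂ) (m : ℝ) (hm : ∀ w, ‖c w‖ ≤ m) (h0 : ∀ w, 3 / 4 * ε ≤ ‖w‖ → c w = 0) :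
      energy V ψ (fun x => c (τ x) * g x) ≤ ENNReal.ofReal (m ^ 2) * energy Vε ψ g := by
    have hm0 : 0 ≤ m := (norm_nonneg _).trans (hm 0)
    rw [energy, energy, ← lintegral_const_mul' _ _ ENNReal.ofReal_ne_top,
      ← lintegral_indicator hV.measurableSet, ← lintegral_indicator hVεo.measurableSet]
    refine lintegral_mono fun x => ?_
    by_cases hx : x ∈ Vε
    · rw [indicator_of_mem hx, indicator_of_mem hx.1, enorm_mul, mul_pow, mul_assoc]
      gcongr
      rw [← ofReal_norm, ← ENNReal.ofReal_pow (norm_nonneg _)]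
      exact ENNReal.ofReal_le_ofReal (pow_le_pow_left₀ (norm_nonneg _) (hm _) 2)
    · rw [indicator_of_notMem hx]
      by_cases hx' : x ∈ V
      · rw [indicator_of_mem hx', h0 (τ x) (by
          by_contra hh
          exact hx ⟨hx', by linarith⟩)]
        simp
      · rw [indicator_of_notMem hx']
  have hbL : MemLp (fun x => b x * (Real.exp (-ψ x / 2) : ℂ)) 2 (volume.restrict V) := by
    refine memLp_of_lintegral_enorm_sq ((hbs.continuousOn.mul
      (continuous_ofReal.comp_continuousOn hwc)).aestronglyMeasurable hV.measurableSet) ?_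
    rw [← energy_eq_lintegral]
    exact (hen β M hc.norm_le' hβ0).trans_lt (ENNReal.mul_lt_top ENNReal.ofReal_lt_top hA.lt_top)
  set v : ι → E → ℂ := fun j => if j = o then b else fun _ => 0 with hv
  have hvo : v o = b := by simp [hv]
  have hvk (k) (hk : k ≠ o) (x) : v k x = 0 := by simp [hv, hk]
  have hbk (k) (hk : k ≠ o) (χ') (hχ' : IsTest V χ') : ∫ z in V, b z * wb χ' (e k) z = 0 := by
    rw [setIntegral_mul_wb_test hV hbs hχ', neg_eq_zero]
    refine setIntegral_eq_zero_of_forall_eq_zero fun x hx => ?_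
    rw [wb_cutoff_mul hV τ hε hc.smooth' hβ0 hg hx, ho' k hk, hwb0, zero_mul, zero_mul]
  obtain ⟨u, hu1, hu2, hu3⟩ := hormander h hδ (v := v) (fun j => by
    by_cases hj : j = o
    · rw [hj, hvo]; exact hbL
    · simp only [hvk j hj, zero_mul]; exact MemLp.zero') (fun χ' hχ' j k => by
    by_cases hj : j = o <;> by_cases hk : k = o
    · rw [hj, hk]
    · simp only [hvk k hk, zero_mul, integral_zero]
      rw [hj, hvo, hbk k hk χ' hχ']
    · simp only [hvk j hj, zero_mul, integral_zero]
      rw [hk, hvo, hbk j hj χ' hχ']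
    · simp only [hvk j hj, hvk k hk, zero_mul])
  have huB (x r) (hx : closedBall x r ⊆ V) : MemLp u 2 (volume.restrict (closedBall x r)) :=
    memLp_closedBall_of_weighted hwc (fun x _ => (Real.exp_pos _).ne') hu1 hx
  have huE : energy V ψ u ≤ ENNReal.ofReal (4 / δ * M ^ 2) * energy Vε ψ g := by
    have h1 : ∑ j, ∫ z in V, ‖v j z * (Real.exp (-(Φ z - 2 * s z) / 2) : ℂ)‖ ^ 2 =
        ∫ z in V, ‖b z * (Real.exp (-ψ z / 2) : ℂ)‖ ^ 2 := by
      rw [Finset.sum_eq_single o, hvo]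
      · intro k _ hk
        simp [hvk k hk]
      · simp
    rw [h1] at hu3
    have h2 := ENNReal.ofReal_le_ofReal hu3
    rw [ofReal_integral_norm_sq hu1, ENNReal.ofReal_mul (by positivity),
      ofReal_integral_norm_sq hbL, ← energy_eq_lintegral, ← energy_eq_lintegral V ψ] at h2
    rw [ENNReal.ofReal_mul (by positivity), mul_assoc]
    exact h2.trans (by gcongr; exact hen β M hc.norm_le' hβ0)
  have hτd : DifferentiableOn ℂ (fun x => τ x) V := τ.differentiable.differentiableOn
  have hτs : ContDiffOn ℝ (⊤ : ℕ∞) (fun x => τ x) V := contDiffOn_of_holomorphic hV hτd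
  have : ProperSpace E := FiniteDimensional.proper ℂ E
  set F0 : E → ℂ := fun x => a x - τ x * u x with hF0
  have hloc (x r) (hx : closedBall x r ⊆ V) : MemLp F0 2 (volume.restrict (closedBall x r)) := by
    have hcl (f : E → ℂ) (hf : ContinuousOn f V) : ∃ M, ∀ᵐ y ∂volume.restrict (closedBall x r),
        ‖f y‖ ≤ M := by
      obtain ⟨M, hM⟩ := (isCompact_closedBall x r).exists_bound_of_continuousOn (hf.mono hx)
      exact ⟨M, (ae_restrict_iff' isClosed_closedBall.measurableSet).2 (Eventually.of_forall hM)⟩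
    have hm (f : E → ℂ) (hf : ContinuousOn f V) :
        AEStronglyMeasurable f (volume.restrict (closedBall x r)) :=
      (hf.mono hx).aestronglyMeasurable isClosed_closedBall.measurableSet
    have hfin : IsFiniteMeasure (volume.restrict (closedBall x r)) :=
      ⟨by rw [Measure.restrict_apply_univ]; exact measure_closedBall_lt_top⟩
    obtain ⟨M1, hM1⟩ := hcl a has.continuousOn
    obtain ⟨M2, hM2⟩ := hcl _ τ.continuous.continuousOn
    exact (MemLp.of_bound (hm a has.continuousOn) M1 hM1).sub
      (memLp_bdd_mul (M := M2) (huB x r hx) (hm _ τ.continuous.continuousOn) hM2)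
  have hweak : WeaklyHolomorphic V e F0 := by
    intro χ' hχ' k
    have hK : IsCompact (tsupport χ') := hχ'.supp
    have hτχ := hχ'.mul_holomorphic hV hτd
    have e1 := hu2 _ hτχ k
    simp only [wb_mul_holomorphic hV hτd hχ'] at e1
    have e2 := setIntegral_mul_wb_test hV has hχ' (e k)
    have e3 : ∫ x in V, wb a (e k) x * χ' x = ∫ x in V, v k x * (χ' x * τ x) := by
      refine setIntegral_congr_fun hV.measurableSet fun x hx => ?_
      simp only [ha]
      rw [wb_cutoff_mul hV τ hε hc.smooth hχ0 hg hx]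
      by_cases hk : k = o
      · rw [hk, ho, hc.wb_eq, hvo, hb]; ring
      · rw [ho' k hk, hwb0, hvk k hk]; ring
    have i1 : IntegrableOn (fun x => a x * wb χ' (e k) x) V :=
      (integrable_of_continuousOn hK hχ'.tsupp
        (has.continuousOn.mul (hχ'.wb (e k)).smooth.continuous.continuousOn) fun x hx => by
          rw [Pi.mul_apply, image_eq_zero_of_notMem_tsupport fun h =>
            hx (tsupport_wb χ' (e k) h), mul_zero]).integrableOn
    have i2 : IntegrableOn (fun x => u x * (τ x * wb χ' (e k) x)) V := by
      have hcw : ContinuousOn (fun x => (Real.exp (-ψ x / 2))⁻¹) V :=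
        hwc.inv₀ fun x _ => (Real.exp_pos _).ne'
      have h5 : MemLp (fun x => (τ x * wb χ' (e k) x) * ((Real.exp (-ψ x / 2))⁻¹ : ℝ)) 2
          (volume.restrict V) := by
        have : IsTest V fun x => wb χ' (e k) x * τ x := (hχ'.wb (e k)).mul_holomorphic hV hτd
        simpa only [mul_comm] using this.memLp hV hcw
      refine (hu1.integrable_mul h5).congr (Eventually.of_forall fun x => ?_)
      have h6 : (Real.exp (-ψ x / 2) : ℂ) ≠ 0 := ofReal_ne_zero.2 (Real.exp_pos _).ne'
      simp only [Pi.mul_apply, ofReal_inv]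
      rw [show -(Φ x - 2 * s x) / 2 = -ψ x / 2 from rfl]
      generalize (Real.exp (-ψ x / 2) : ℂ) = y at h6 ⊢
      field_simp
    have e4 : ∫ x in V, F0 x * wb χ' (e k) x =
        ∫ x in V, (a x * wb χ' (e k) x - u x * (τ x * wb χ' (e k) x)) :=
      integral_congr_ae (Eventually.of_forall fun x => by simp only [hF0]; ring)
    rw [e4, integral_sub i1 i2, e2, e3, e1]
    ring
  obtain ⟨F, hF, hFae⟩ := hweak.exists_holomorphic he hV hloc
  refine ⟨F, hF, fun x hx hx0 => ?_, ?_⟩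
  · set V0 := {x ∈ V | ‖τ x‖ < ε / 2} with hV0
    have hV0o : IsOpen V0 := hV.inter (isOpen_lt τ.continuous.norm continuous_const)
    have hV0V : V0 ⊆ V := sep_subset _ _
    have hwu : WeaklyHolomorphic V0 e u := by
      intro χ' hχ' k
      have h1 : IsTest V χ' := ⟨hχ'.smooth, hχ'.supp, hχ'.tsupp.trans hV0V⟩
      rw [(hχ'.wb (e k)).setIntegral_eq, ← (h1.wb (e k)).setIntegral_eq, ← neg_eq_zero,
        ← hu2 χ' h1 k]
      refine setIntegral_eq_zero_of_forall_eq_zero fun y _ => ?_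
      by_cases hy : y ∈ V0
      · by_cases hk : k = o
        · rw [hk, hvo]
          simp only [hb]
          rw [(hc.inner _ hy.2).2, zero_mul, zero_mul]
        · rw [hvk k hk, zero_mul]
      · rw [hχ'.eq_zero hy, mul_zero]
    obtain ⟨u0, hu0, hu0ae⟩ := hwu.exists_holomorphic he hV0o fun x r hx => huB x r (hx.trans hV0V)
    have hV0ε : V0 ⊆ Vε := fun y hy => ⟨hy.1, by linarith [hy.2]⟩
    have hx' : x ∈ V0 := ⟨hx, by rw [hx0, norm_zero]; positivity⟩
    have := eqOn_of_ae_eq hV0o (hF.continuousOn.mono hV0V)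
      (((hg.continuousOn.mono hV0ε).sub ((τ.continuous.continuousOn).mul hu0.continuousOn))) (by
        filter_upwards [hu0ae, ae_restrict_of_ae_restrict_of_subset hV0V hFae,
          ae_restrict_mem hV0o.measurableSet] with y h1 h2 h3
        rw [← h2, hF0, Pi.sub_apply, Pi.mul_apply, ← h1]
        simp only [ha]
        rw [(hc.inner _ h3.2).1, one_mul]) hx'
    rw [this]
    simp [hx0]
  · have h1 : energy V ψ F = ∫⁻ x in V, ‖F0 x‖ₑ ^ 2 * ew ψ x := by
      refine lintegral_congr_ae ?_
      filter_upwards [hFae] with x hx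
      rw [hx]
    have h2 : ∫⁻ x in V, ‖F0 x‖ₑ ^ 2 * ew ψ x ≤
        ∫⁻ x in V, (2 * (‖a x‖ₑ ^ 2 * ew ψ x) + ENNReal.ofReal (2 * R ^ 2) * (‖u x‖ₑ ^ 2 * ew ψ x)) := by
      refine setLIntegral_mono' hV.measurableSet fun x hx => ?_
      have h3 : ‖τ x‖ₑ ^ 2 ≤ ENNReal.ofReal (R ^ 2) := by
        rw [← ofReal_norm, ← ENNReal.ofReal_pow (norm_nonneg _)]
        exact ENNReal.ofReal_le_ofReal (pow_le_pow_left₀ (norm_nonneg _) (hR x hx) 2)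
      calc ‖F0 x‖ₑ ^ 2 * ew ψ x
          ≤ (2 * ‖a x‖ₑ ^ 2 + 2 * (‖τ x‖ₑ ^ 2 * ‖u x‖ₑ ^ 2)) * ew ψ x := by
            gcongr
            rw [← mul_pow, ← enorm_mul]
            exact enorm_sub_sq_le _ _
        _ ≤ (2 * ‖a x‖ₑ ^ 2 + 2 * (ENNReal.ofReal (R ^ 2) * ‖u x‖ₑ ^ 2)) * ew ψ x := by gcongr
        _ = _ := by
            rw [ENNReal.ofReal_mul (by norm_num), ENNReal.ofReal_ofNat]
            ring
    have hma : AEMeasurable (fun x => 2 * (‖a x‖ₑ ^ 2 * ew ψ x)) (volume.restrict V) :=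
      (aemeasurable_energy_integrand hV has.continuousOn
        ((h.smooth_weight.continuousOn.sub (continuousOn_const.mul
          h.smooth.continuousOn)).aemeasurable hV.measurableSet)).const_mul 2
    rw [lintegral_add_left' hma, lintegral_const_mul' _ _ (by simp),
      lintegral_const_mul' _ _ ENNReal.ofReal_ne_top] at h2
    calc energy V ψ F ≤ 2 * energy V ψ a + ENNReal.ofReal (2 * R ^ 2) * energy V ψ u := h1.trans_le h2
      _ ≤ 2 * (ENNReal.ofReal (1 ^ 2) * energy Vε ψ g) + ENNReal.ofReal (2 * R ^ 2) *
          (ENNReal.ofReal (4 / δ * M ^ 2) * energy Vε ψ g) := by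
        gcongr
        exact hen χ 1 hc.norm_le hχ0
      _ = _ := by
        rw [ENNReal.ofReal_add (by norm_num) (by positivity),
          ENNReal.ofReal_mul (p := 2 * R ^ 2) (by positivity)]
        simp only [one_pow, ENNReal.ofReal_one, ENNReal.ofReal_ofNat]
        ring

end Extension

section LeviSum

variable {E : Type*} [NormedAddCommGroup E] [NormedSpace ℂ E]

lemma smul_eq_re_add_im (c : ℂ) (a : E) : c • a = c.re • a + c.im • (I • a) := by
  rw [← Complex.coe_smul, ← Complex.coe_smul, smul_smul, ← add_smul, re_add_im]

lemma wd_smul_add (f : E → ℂ) (c : ℂ) (a b z : E) :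
    wd f (c • a + b) z = wd f a z * c + wd f b z := by
  have h2 : (I • (I • a) : E) = -a := by rw [smul_smul, I_mul_I, neg_one_smul]
  have h3 (r : ℝ) (w : E) : (I • r • w : E) = r • I • w := smul_comm _ _ _
  simp only [wd, smul_eq_re_add_im c a, smul_add, h3, h2, map_add, map_smul, map_neg, real_smul,
    smul_neg]
  linear_combination (1/2) * (fderiv ℝ f z a - I * fderiv ℝ f z (I • a)) * (re_add_im c) +
    (1/2) * c.im * fderiv ℝ f z (I • a) * I_sq

lemma wb_smul_add (f : E → ℂ) (c : ℂ) (a b z : E) :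
    wb f (c • a + b) z = wb f a z * (starRingEnd ℂ) c + wb f b z := by
  have h2 : (I • (I • a) : E) = -a := by rw [smul_smul, I_mul_I, neg_one_smul]
  have h3 (r : ℝ) (w : E) : (I • r • w : E) = r • I • w := smul_comm _ _ _
  have h4 : (starRingEnd ℂ) c = c.re - c.im * I := by
    apply Complex.ext <;> simp
  simp only [wb, smul_eq_re_add_im c a, smul_add, h3, h2, map_add, map_smul, map_neg, real_smul,
    smul_neg, h4]
  linear_combination (1/2) * c.im * fderiv ℝ f z (I • a) * I_sq

lemma wd_sum_smul {ι : Type*} (t : Finset ι) (f : E → ℂ) (ξ : ι → ℂ) (e : ι → E) (z : E) :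
    wd f (∑ j ∈ t, ξ j • e j) z = ∑ j ∈ t, wd f (e j) z * ξ j := by
  classical
  induction t using Finset.induction_on with
  | empty => simp [wd]
  | insert a s ha ih => rw [Finset.sum_insert ha, Finset.sum_insert ha, wd_smul_add, ih]

lemma wb_sum_smul {ι : Type*} (t : Finset ι) (f : E → ℂ) (ξ : ι → ℂ) (e : ι → E) (z : E) :
    wb f (∑ j ∈ t, ξ j • e j) z = ∑ j ∈ t, wb f (e j) z * (starRingEnd ℂ) (ξ j) := by
  classical
  induction t using Finset.induction_on with
  | empty => simp [wb]
  | insert a s ha ih => rw [Finset.sum_insert ha, Finset.sum_insert ha, wb_smul_add, ih]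

lemma wb_sum_mul_const {ι : Type*} (t : Finset ι) {f : ι → E → ℂ} {z : E}
    (hf : ∀ j, DifferentiableAt ℝ (f j) z) (c : ι → ℂ) (v : E) :
    wb (fun x => ∑ j ∈ t, f j x * c j) v z = ∑ j ∈ t, wb (f j) v z * c j := by
  have : fderiv ℝ (fun x => ∑ j ∈ t, f j x * c j) z = ∑ j ∈ t, c j • fderiv ℝ (f j) z := by
    have h := HasFDerivAt.fun_sum (u := t) (fun j _ => (hf j).hasFDerivAt.mul_const (c j))
    exact h.fderiv
  simp only [wb, this, _root_.sum_apply, smul_apply, smul_eq_mul, Finset.mul_sum]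
  rw [← Finset.sum_add_distrib, Finset.sum_div]
  exact Finset.sum_congr rfl fun j _ => by ring

lemma levi_sum_smul {ι : Type*} [Fintype ι] {Φ : E → ℝ} {z : E} (hΦ : ContDiffAt ℝ 2 Φ z)
    (e : ι → E) (ξ : ι → ℂ) :
    (∑ j, ∑ k, wb (wd (fun x => (Φ x : ℂ)) (e j)) (e k) z * ξ j * (starRingEnd ℂ) (ξ k)).re =
      levi Φ (∑ j, ξ j • e j) z := by
  have hΦ' := contDiffAt_ofReal hΦ
  have h1 : wd (fun x => (Φ x : ℂ)) (∑ j, ξ j • e j) =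
      fun x => ∑ j, wd (fun x => (Φ x : ℂ)) (e j) x * ξ j := by
    ext x; exact wd_sum_smul _ _ _ _ _
  rw [levi, wb_sum_smul, h1, Finset.sum_comm]
  congr 1
  refine Finset.sum_congr rfl fun k _ => ?_
  rw [wb_sum_mul_const _ fun j => differentiableAt_wd hΦ' (e j), Finset.sum_mul]

end LeviSum

section TensorPower

variable {Y : Type*} [NormedAddCommGroup Y] [NormedSpace ℂ Y] [FiniteDimensional ℂ Y]
  {κ : Type*} [Fintype κ]

/-- The map `(τ, ζ) ↦ (τ, ζ i)`. -/
def slot (Y : Type*) [NormedAddCommGroup Y] [NormedSpace ℂ Y] {m : ℕ} (i : Fin m) :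
    (ℂ × (Fin m → Y)) →L[ℂ] ℂ × Y :=
  (ContinuousLinearMap.fst ℂ ℂ (Fin m → Y)).prod
    ((ContinuousLinearMap.proj i).comp (ContinuousLinearMap.snd ℂ ℂ (Fin m → Y)))

@[simp] lemma slot_apply {m : ℕ} (i : Fin m) (x : ℂ × (Fin m → Y)) :
    slot Y i x = (x.1, x.2 i) := rfl

/-- The linear coordinates of `ℂ × Y` associated with a basis of `Y`. -/
def frame (b : Module.Basis κ ℂ Y) : Option κ → (ℂ × Y →L[ℂ] ℂ)
  | none => ContinuousLinearMap.fst ℂ ℂ Y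
  | some l => (LinearMap.toContinuousLinearMap (b.coord l)).comp (ContinuousLinearMap.snd ℂ ℂ Y)

/-- The basis of `ℂ × Y ^ m` associated with a basis of `Y`. -/
def tensorFrame (b : Module.Basis κ ℂ Y) (m : ℕ) : Option (Fin m × κ) → ℂ × (Fin m → Y)
  | none => (1, 0)
  | some j => (0, Pi.single j.1 (b j.2))

lemma sum_tensorFrame (b : Module.Basis κ ℂ Y) (m : ℕ) (ξ : Option (Fin m × κ) → ℂ) :
    ∑ j, ξ j • tensorFrame b m j = (ξ none, fun i => ∑ l, ξ (some (i, l)) • b l) := by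
  rw [Fintype.sum_option]
  refine Prod.ext ?_ ?_
  · simp [tensorFrame, Prod.fst_sum]
  · ext i
    simp only [tensorFrame, Fintype.sum_prod_type, Prod.snd_add, Prod.smul_snd, Prod.snd_sum,
      smul_zero, zero_add, Finset.sum_apply, Pi.smul_apply]
    rw [Finset.sum_eq_single i]
    · simp
    · intro k _ hk
      simp [Pi.single_eq_of_ne hk.symm]
    · simp

lemma span_tensorFrame (b : Module.Basis κ ℂ Y) (m : ℕ) :
    Submodule.span ℂ (range (tensorFrame b m)) = ⊤ := by
  rw [eq_top_iff]
  rintro x -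
  have : x = ∑ j, (Option.elim j x.1 fun k => b.repr (x.2 k.1) k.2 : ℂ) • tensorFrame b m j := by
    rw [sum_tensorFrame]
    refine Prod.ext rfl ?_
    ext i
    simp only [Option.elim]
    exact (b.sum_repr (x.2 i)).symm
  rw [this]
  exact Submodule.sum_mem _ fun j _ => Submodule.smul_mem _ _ (Submodule.subset_span ⟨j, rfl⟩)

lemma sum_norm_sq_le_frame (b : Module.Basis κ ℂ Y) {m : ℕ} (hm : 0 < m)
    (ξ : Option (Fin m × κ) → ℂ) :
    ∑ j, ‖ξ j‖ ^ 2 ≤ ∑ i, ∑ l, ‖frame b l (slot Y i (∑ j, ξ j • tensorFrame b m j))‖ ^ 2 := by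
  rw [sum_tensorFrame, Fintype.sum_option, Fintype.sum_prod_type]
  simp only [Fintype.sum_option, Finset.sum_add_distrib]
  refine add_le_add ?_ (le_of_eq ?_)
  · simp only [frame, slot_apply, ContinuousLinearMap.coe_fst', Finset.sum_const, Finset.card_univ,
      Fintype.card_fin, nsmul_eq_mul]
    have : (1 : ℝ) ≤ m := by exact_mod_cast hm
    nlinarith [sq_nonneg ‖ξ none‖]
  · refine Finset.sum_congr rfl fun i _ => Finset.sum_congr rfl fun l _ => ?_
    congr 2
    simp only [frame, slot_apply, ContinuousLinearMap.coe_comp', Function.comp_apply,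
      ContinuousLinearMap.coe_snd', LinearMap.coe_toContinuousLinearMap', Module.Basis.coord_apply]
    rw [Module.Basis.repr_sum_self]

/-- The exhaustion function of the fibred power built from `p`. -/
def tensorExhaustion (p : ℂ × Y → ℝ) (m : ℕ) (x : ℂ × (Fin m → Y)) : ℝ :=
  ∑ i, (m : ℝ)⁻¹ * (1 - p (slot Y i x))⁻¹

lemma hasDerivAt_inv_one_sub (a : ℝ) {y : ℝ} (hy : y < 1) :
    HasDerivAt (fun y => a * (1 - y)⁻¹) (a * ((1 - y) ^ 2)⁻¹) y := by
  have h0 : HasDerivAt (fun y : ℝ => 1 - y) (-1) y := (hasDerivAt_id' y).const_sub 1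
  refine ((h0.fun_inv (by linarith)).const_mul a).congr_deriv ?_
  rw [neg_neg, one_div]

lemma hasDerivAt_inv_one_sub_sq (a : ℝ) {y : ℝ} (hy : y < 1) :
    HasDerivAt (fun y => a * ((1 - y) ^ 2)⁻¹) (a * (2 * ((1 - y) ^ 3)⁻¹)) y := by
  have h0 : HasDerivAt (fun y : ℝ => 1 - y) (-1) y := (hasDerivAt_id' y).const_sub 1
  have h1 : 1 - y ≠ 0 := by linarith
  refine (((h0.fun_pow 2).fun_inv (pow_ne_zero 2 h1)).const_mul a).congr_deriv ?_
  field_simp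
  norm_num
  ring

lemma contDiffAt_tensorExhaustion_aux {p : ℂ × Y → ℝ} (hp : ContDiff ℝ (⊤ : ℕ∞) p) {m : ℕ}
    (i : Fin m) {x : ℂ × (Fin m → Y)} (hx : p (slot Y i x) < 1) :
    ContDiffAt ℝ (⊤ : ℕ∞) (fun x => (m : ℝ)⁻¹ * (1 - p (slot Y i x))⁻¹) x := by
  have h1 : ContDiff ℝ (⊤ : ℕ∞) fun x : ℂ × (Fin m → Y) => p (slot Y i x) :=
    hp.comp ((slot Y i).restrictScalars ℝ).contDiff
  exact contDiffAt_const.mul ((contDiffAt_const.sub h1.contDiffAt).inv (by linarith))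

lemma sum_inv_sq_le {m : ℕ} (hm : 0 < m) {a : Fin m → ℝ} (ha : ∀ i, 0 < a i) :
    ∑ i, (m : ℝ)⁻¹ * (a i ^ 2)⁻¹ ≤ m * (∑ i, (m : ℝ)⁻¹ * (a i)⁻¹) ^ 2 := by
  have h : ∑ i, ((a i)⁻¹) ^ 2 ≤ (∑ i, (a i)⁻¹) ^ 2 := 
    Finset.sum_sq_le_sq_sum_of_nonneg fun i _ => (inv_pos.2 (ha i)).le
  have hm' : (0 : ℝ) < m := by exact_mod_cast hm
  rw [← Finset.mul_sum, ← Finset.mul_sum, mul_pow]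
  simp only [inv_pow] at h
  calc _ ≤ (m : ℝ)⁻¹ * (∑ i, (a i)⁻¹) ^ 2 := by gcongr
    _ = _ := by field_simp

lemma pow_four_le_exp {s : ℝ} (hs : 0 ≤ s) : s ^ 4 ≤ 24 * Real.exp s := by
  have h := Real.pow_div_factorial_le_exp s hs 4
  rw [div_le_iff₀ (by positivity)] at h
  simpa [Nat.factorial, mul_comm] using h

lemma wd_tensorExhaustion {p : ℂ × Y → ℝ} (hp : ContDiff ℝ (⊤ : ℕ∞) p) {m : ℕ}
    {x : ℂ × (Fin m → Y)} (hx : ∀ i, p (slot Y i x) < 1) (v : ℂ × (Fin m → Y)) :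
    wd (fun x => (tensorExhaustion p m x : ℂ)) v x =
      ∑ i, ((m : ℝ)⁻¹ * ((1 - p (slot Y i x)) ^ 2)⁻¹ : ℝ) *
        wd (fun z => (p z : ℂ)) (slot Y i v) (slot Y i x) := by
  have hd (i : Fin m) : DifferentiableAt ℝ
      (fun x => (((m : ℝ)⁻¹ * (1 - p (slot Y i x))⁻¹ : ℝ) : ℂ)) x :=
    (contDiffAt_ofReal (contDiffAt_tensorExhaustion_aux hp i (hx i))).differentiableAt (by simp)
  have h1 : fderiv ℝ (fun x => (tensorExhaustion p m x : ℂ)) x = ∑ i, fderiv ℝ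
      (fun x => (((m : ℝ)⁻¹ * (1 - p (slot Y i x))⁻¹ : ℝ) : ℂ)) x := by
    have h := HasFDerivAt.fun_sum (u := Finset.univ) (fun i _ => (hd i).hasFDerivAt)
    rw [← h.fderiv]
    congr 1
    ext x
    simp only [tensorExhaustion, ofReal_sum]
  have h2 : wd (fun x => (tensorExhaustion p m x : ℂ)) v x = ∑ i, wd
      (fun x => (((m : ℝ)⁻¹ * (1 - p (slot Y i x))⁻¹ : ℝ) : ℂ)) v x := by
    simp only [wd, h1, _root_.sum_apply]
    rw [Finset.mul_sum, ← Finset.sum_sub_distrib, Finset.sum_div]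
  rw [h2]
  refine Finset.sum_congr rfl fun i _ => ?_
  have hpd : Differentiable ℝ p := hp.differentiable (by simp)
  have h3 := (wd_comp_real (f := fun x => p (slot Y i x))
    ((hpd _).comp x ((slot Y i).restrictScalars ℝ).differentiableAt)
    (hasDerivAt_inv_one_sub (m : ℝ)⁻¹ (hx i)) v).1
  rw [h3, (wd_comp_clm (slot Y i) (f := fun z => (p z : ℂ)) (z := x)
    ((contDiffAt_ofReal hp.contDiffAt).differentiableAt (by simp)) v).1]

lemma levi_tensorExhaustion_nonneg {p : ℂ × Y → ℝ} (hp : ContDiff ℝ (⊤ : ℕ∞) p) {m : ℕ}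
    {x : ℂ × (Fin m → Y)} (hx : ∀ i, p (slot Y i x) < 1)
    (hl : ∀ i v, 0 ≤ levi p v (slot Y i x)) (v : ℂ × (Fin m → Y)) :
    0 ≤ levi (tensorExhaustion p m) v x := by
  unfold tensorExhaustion
  rw [levi_sum _ fun i _ => (contDiffAt_tensorExhaustion_aux hp i (hx i)).of_le
    (WithTop.coe_le_coe.2 le_top)]
  refine Finset.sum_nonneg fun i _ => ?_
  have hc : ContDiffAt ℝ 2 (fun x : ℂ × (Fin m → Y) => p (slot Y i x)) x :=
    (contDiff_infty.1 (hp.comp ((slot Y i).restrictScalars ℝ).contDiff) 2).contDiffAt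
  rw [levi_comp_real (f := fun x => p (slot Y i x)) (h := fun y => (m : ℝ)⁻¹ * (1 - y)⁻¹) hc
    ((eventually_lt_nhds (hx i)).mono fun y hy => hasDerivAt_inv_one_sub _ hy)
    (hasDerivAt_inv_one_sub_sq _ (hx i)), levi_comp_clm (slot Y i)
    (contDiff_infty.1 hp 2).contDiffAt]
  have h1 : 0 < 1 - p (slot Y i x) := by linarith [hx i]
  have := hl i (slot Y i v)
  positivity

lemma isCompact_tensor {K : Set (ℂ × Y)} (hK : IsCompact K) {m : ℕ} (hm : 0 < m) :
    IsCompact {x : ℂ × (Fin m → Y) | ∀ i, slot Y i x ∈ K} := by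
  have h1 : IsCompact ((Prod.fst '' K) ×ˢ univ.pi fun _ : Fin m => Prod.snd '' K) :=
    (hK.image continuous_fst).prod (isCompact_univ_pi fun _ => hK.image continuous_snd)
  refine h1.of_isClosed_subset ?_ fun x hx => ⟨⟨_, hx ⟨0, hm⟩, rfl⟩, fun i _ => ⟨_, hx i, rfl⟩⟩
  rw [setOf_forall]
  exact isClosed_iInter fun i => hK.isClosed.preimage (slot Y i).continuous

lemma contDiffAt_tensorExhaustion {p : ℂ × Y → ℝ} (hp : ContDiff ℝ (⊤ : ℕ∞) p) {m : ℕ}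
    {x : ℂ × (Fin m → Y)} (hx : ∀ i, p (slot Y i x) < 1) :
    ContDiffAt ℝ (⊤ : ℕ∞) (tensorExhaustion p m) x := by
  unfold tensorExhaustion
  exact ContDiffAt.sum fun i _ => contDiffAt_tensorExhaustion_aux hp i (hx i)

lemma isCompact_tensorExhaustion_le {O : Set (ℂ × Y)} {p : ℂ × Y → ℝ}
    (hp : ContDiff ℝ (⊤ : ℕ∞) p) (hc : ∀ c ≤ 1, IsCompact {z ∈ O | p z ≤ c}) {m : ℕ} (hm : 0 < m)
    (c : ℝ) :
    IsCompact {x ∈ {x | ∀ i, slot Y i x ∈ O ∧ p (slot Y i x) < 1} | tensorExhaustion p m x ≤ c} := by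
  have hm' : (0 : ℝ) < m := by exact_mod_cast hm
  have hsub {x : ℂ × (Fin m → Y)} (hx : ∀ i, p (slot Y i x) < 1)
      (hs : tensorExhaustion p m x ≤ c) (i : Fin m) : 0 < c ∧ p (slot Y i x) ≤ 1 - (c * m)⁻¹ := by
    have h1 (i : Fin m) : 0 < 1 - p (slot Y i x) := by linarith [hx i]
    have h2 : (m : ℝ)⁻¹ * (1 - p (slot Y i x))⁻¹ ≤ c := le_trans
      (Finset.single_le_sum (f := fun i => (m : ℝ)⁻¹ * (1 - p (slot Y i x))⁻¹)
        (fun i _ => by have := h1 i; positivity) (Finset.mem_univ i)) hs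
    have h3 : 0 < (m : ℝ)⁻¹ * (1 - p (slot Y i x))⁻¹ := by have := h1 i; positivity
    have hc0 : 0 < c := h3.trans_le h2
    refine ⟨hc0, ?_⟩
    rw [← mul_inv, inv_le_iff_one_le_mul₀ (by have := h1 i; positivity)] at h2
    have : (c * m)⁻¹ ≤ 1 - p (slot Y i x) := by
      rw [inv_le_iff_one_le_mul₀ (by positivity)]
      linarith
    linarith
  by_cases hc0 : 0 < c
  · have hlt : 1 - (c * m)⁻¹ < 1 := sub_lt_self _ (by positivity)
    have hT := isCompact_tensor (hc (1 - (c * m)⁻¹) hlt.le) hm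
    have h1 : ContinuousOn (tensorExhaustion p m)
        {x : ℂ × (Fin m → Y) | ∀ i, slot Y i x ∈ {z ∈ O | p z ≤ 1 - (c * m)⁻¹}} := fun x hx =>
      (contDiffAt_tensorExhaustion hp
        fun i => (hx i).2.trans_lt hlt).continuousAt.continuousWithinAt
    have h2 := hT.of_isClosed_subset
      (h1.preimage_isClosed_of_isClosed hT.isClosed (isClosed_Iic (a := c))) inter_subset_left
    convert h2 using 1
    ext x
    exact ⟨fun hx => ⟨fun i => ⟨(hx.1 i).1, (hsub (fun i => (hx.1 i).2) hx.2 i).2⟩, hx.2⟩,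
      fun hx => ⟨fun i => ⟨(hx.1 i).1, (hx.1 i).2.trans_lt hlt⟩, hx.2⟩⟩
  · convert isCompact_empty
    refine eq_empty_of_forall_notMem fun x hx => hc0 (hsub (fun i => (hx.1 i).2) hx.2 ⟨0, hm⟩).1

lemma exists_grad_tensorExhaustion_le {O : Set (ℂ × Y)} {p : ℂ × Y → ℝ}
    (hp : ContDiff ℝ (⊤ : ℕ∞) p) (hc : IsCompact {z ∈ O | p z ≤ 1}) {m : ℕ} (hm : 0 < m)
    {ι : Type*} [Fintype ι] (e : ι → ℂ × (Fin m → Y)) :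
    ∃ C, ∀ x, (∀ i, slot Y i x ∈ O ∧ p (slot Y i x) < 1) →
      ∑ j, ‖wd (fun x => (tensorExhaustion p m x : ℂ)) (e j) x‖ ^ 2 ≤
        C * Real.exp (tensorExhaustion p m x) := by
  have hm' : (0 : ℝ) < m := by exact_mod_cast hm
  have hp' : ContDiff ℝ (⊤ : ℕ∞) fun z => (p z : ℂ) := ofRealCLM.contDiff.comp hp
  have hb (j : ι) (i : Fin m) : ∃ A, ∀ z ∈ {z ∈ O | p z ≤ 1},
      ‖wd (fun z => (p z : ℂ)) (slot Y i (e j)) z‖ ≤ A :=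
    hc.exists_bound_of_continuousOn (contDiff_wd hp' _).continuous.continuousOn
  choose A hA using hb
  have hS (j : ι) (x : ℂ × (Fin m → Y)) (hx : ∀ i, slot Y i x ∈ O ∧ p (slot Y i x) < 1) :
      ‖wd (fun x => (tensorExhaustion p m x : ℂ)) (e j) x‖ ≤
        (∑ i, |A j i|) * (m * tensorExhaustion p m x ^ 2) := by
    have h1 (i : Fin m) : 0 < 1 - p (slot Y i x) := by linarith [(hx i).2]
    rw [wd_tensorExhaustion hp fun i => (hx i).2]
    calc _ ≤ ∑ i, (∑ i, |A j i|) * ((m : ℝ)⁻¹ * ((1 - p (slot Y i x)) ^ 2)⁻¹) := by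
          refine (norm_sum_le _ _).trans (Finset.sum_le_sum fun i _ => ?_)
          have h2 := h1 i
          rw [norm_mul, norm_real, Real.norm_of_nonneg (by positivity), mul_comm]
          gcongr
          exact (hA j i _ ⟨(hx i).1, (hx i).2.le⟩).trans ((le_abs_self _).trans
            (Finset.single_le_sum (f := fun i => |A j i|) (fun i _ => abs_nonneg _)
              (Finset.mem_univ i)))
      _ ≤ _ := by
          rw [← Finset.mul_sum]
          gcongr
          exact sum_inv_sq_le hm h1
  refine ⟨∑ j, ((∑ i, |A j i|) * m) ^ 2 * 24, fun x hx => ?_⟩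
  rw [Finset.sum_mul]
  refine Finset.sum_le_sum fun j _ => ?_
  have hs : 0 ≤ tensorExhaustion p m x := Finset.sum_nonneg fun i _ => by
    have : 0 < 1 - p (slot Y i x) := by linarith [(hx i).2]
    positivity
  calc _ ≤ ((∑ i, |A j i|) * (m * tensorExhaustion p m x ^ 2)) ^ 2 := by
        gcongr; exact hS j x hx
    _ = ((∑ i, |A j i|) * m) ^ 2 * tensorExhaustion p m x ^ 4 := by ring
    _ ≤ _ := by
        rw [mul_assoc (_ ^ 2)]
        gcongr
        exact pow_four_le_exp hs

/-- The weight on the fibred power used to extend holomorphic functions from a fibre. -/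
def tensorWeight (p ψ : ℂ × Y → ℝ) (m : ℕ) (x : ℂ × (Fin m → Y)) : ℝ :=
  ∑ i, ψ (slot Y i x) + (tensorExhaustion p m x ^ 2 + 2 * tensorExhaustion p m x)

theorem exists_leviExhaustion_tensor (b : Module.Basis κ ℂ Y) {O : Set (ℂ × Y)} (hO : IsOpen O)
    {p ψ : ℂ × Y → ℝ} (hp : ContDiff ℝ (⊤ : ℕ∞) p) (hψ : ContDiff ℝ (⊤ : ℕ∞) ψ)
    (hc : ∀ c ≤ 1, IsCompact {z ∈ O | p z ≤ c}) (hl : ∀ z ∈ O, ∀ v, 0 ≤ levi p v z)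
    {d : ℝ} (hd : 0 < d) (hd' : ∀ z ∈ O, ∀ v, d * ∑ l, ‖frame b l v‖ ^ 2 ≤ levi ψ v z)
    {m : ℕ} (hm : 0 < m) :
    ∃ C, LeviExhaustion {x | ∀ i, slot Y i x ∈ O ∧ p (slot Y i x) < 1} (tensorWeight p ψ m)
      (tensorExhaustion p m) (tensorFrame b m) d C := by
  obtain ⟨C, hC⟩ := exists_grad_tensorExhaustion_le hp (hc 1 le_rfl) hm (tensorFrame b m)
  have hs {x : ℂ × (Fin m → Y)} (hx : ∀ i, slot Y i x ∈ O ∧ p (slot Y i x) < 1) :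
      ContDiffAt ℝ (⊤ : ℕ∞) (tensorExhaustion p m) x :=
    contDiffAt_tensorExhaustion hp fun i => (hx i).2
  have hψ' (i : Fin m) : ContDiff ℝ (⊤ : ℕ∞) fun x : ℂ × (Fin m → Y) => ψ (slot Y i x) :=
    hψ.comp ((slot Y i).restrictScalars ℝ).contDiff
  have hsum : ContDiff ℝ (⊤ : ℕ∞) fun x : ℂ × (Fin m → Y) => ∑ i, ψ (slot Y i x) :=
    ContDiff.sum fun i _ => hψ' i
  have hW {x : ℂ × (Fin m → Y)} (hx : ∀ i, slot Y i x ∈ O ∧ p (slot Y i x) < 1) :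
      ContDiffAt ℝ (⊤ : ℕ∞) (tensorWeight p ψ m) x :=
    hsum.contDiffAt.add (((hs hx).pow 2).add (contDiffAt_const.mul (hs hx)))
  have hs0 (x : ℂ × (Fin m → Y)) (hx : ∀ i, slot Y i x ∈ O ∧ p (slot Y i x) < 1) :
      0 ≤ tensorExhaustion p m x := Finset.sum_nonneg fun i _ => by
    have : 0 < 1 - p (slot Y i x) := by linarith [(hx i).2]
    positivity
  refine ⟨C, ?_, fun x hx => (hW hx).contDiffWithinAt, fun x hx => (hs hx).contDiffWithinAt,
    hs0, isCompact_tensorExhaustion_le hp hc hm, hC, fun x hx ξ => ?_⟩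
  · rw [setOf_forall]
    refine isOpen_iInter_of_finite fun i => ?_
    exact (hO.preimage (slot Y i).continuous).inter
      (isOpen_lt (hp.continuous.comp (slot Y i).continuous) continuous_const)
  · have h2 {f : ℂ × (Fin m → Y) → ℝ} (hf : ContDiffAt ℝ (⊤ : ℕ∞) f x) : ContDiffAt ℝ 2 f x :=
      hf.of_le (WithTop.coe_le_coe.2 le_top)
    rw [levi_sum_smul (h2 (hW hx)), ← wd_sum_smul]
    unfold tensorWeight
    rw [levi_add (h2 hsum.contDiffAt) (h2 (((hs hx).pow 2).add (contDiffAt_const.mul (hs hx)))),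
      levi_sum _ fun i _ => h2 (hψ' i).contDiffAt]
    rw [levi_comp_real (f := tensorExhaustion p m) (h := fun y => y ^ 2 + 2 * y)
      (h' := fun y => 2 * y + 2) (c := 2) (h2 (hs hx))
      (Eventually.of_forall fun y => by
        simpa using ((hasDerivAt_id' y).fun_pow 2).fun_add ((hasDerivAt_id' y).const_mul 2))
      (by simpa using ((hasDerivAt_id' (tensorExhaustion p m x)).const_mul 2).add_const 2)]
    have h3 := levi_tensorExhaustion_nonneg hp (fun i => (hx i).2) (fun i => hl _ (hx i).1)
      (∑ j, ξ j • tensorFrame b m j)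
    have h4 : d * ∑ j, ‖ξ j‖ ^ 2 ≤ ∑ i, levi (fun x => ψ (slot Y i x))
        (∑ j, ξ j • tensorFrame b m j) x := by
      refine (mul_le_mul_of_nonneg_left (sum_norm_sq_le_frame b hm ξ) hd.le).trans ?_
      rw [Finset.mul_sum]
      refine Finset.sum_le_sum fun i _ => ?_
      rw [levi_comp_clm (slot Y i) (contDiff_infty.1 hψ 2).contDiffAt]
      exact hd' _ (hx i).1 _
    have h5 := hs0 x hx
    have h6 := mul_nonneg (by linarith : 0 ≤ 2 * tensorExhaustion p m x + 2) h3
    linarith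

end TensorPower

section Power

variable {Y : Type*} [NormedAddCommGroup Y] [NormedSpace ℂ Y] [FiniteDimensional ℂ Y]

lemma secondCountable_of_finiteDimensional : SecondCountableTopology Y :=
  have : ProperSpace Y := FiniteDimensional.proper ℂ Y
  inferInstance

variable [MeasureSpace Y] [BorelSpace Y] [(volume : Measure Y).IsAddHaarMeasure]

lemma isAddHaarMeasure_prod : (volume : Measure (ℂ × Y)).IsAddHaarMeasure :=
  have : SecondCountableTopology Y := secondCountable_of_finiteDimensional
  Measure.prod.instIsAddHaarMeasure volume volume

lemma sigmaFinite_volume : SigmaFinite (volume : Measure Y) :=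
  have : ProperSpace Y := FiniteDimensional.proper ℂ Y
  inferInstance

lemma isAddHaarMeasure_prod_pi (m : ℕ) : (volume : Measure (ℂ × (Fin m → Y))).IsAddHaarMeasure :=
  have : SecondCountableTopology Y := secondCountable_of_finiteDimensional
  isAddHaarMeasure_prod

lemma lintegral_pi_succ {m : ℕ} {q : (Fin (m + 1) → Y) → ℝ≥0∞} (hq : Measurable q) :
    ∫⁻ ζ, q ζ = ∫⁻ y : Y, ∫⁻ ζ : Fin m → Y, q (Fin.cons y ζ) := by
  have := sigmaFinite_volume (Y := Y)
  have h := (volume_preserving_piFinSuccAbove (fun _ : Fin (m + 1) => Y) 0).symm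
  rw [← h.lintegral_comp hq, Measure.volume_eq_prod, lintegral_prod]
  · refine lintegral_congr fun y => lintegral_congr fun ζ => ?_
    simp [MeasurableEquiv.piFinSuccAbove, Fin.insertNthEquiv]
  · exact (hq.comp h.measurable).aemeasurable

lemma lintegral_pi_prod {q : Y → ℝ≥0∞} (hq : Measurable q) (m : ℕ) :
    ∫⁻ ζ : Fin m → Y, ∏ i, q (ζ i) = (∫⁻ y, q y) ^ m := by
  have := sigmaFinite_volume (Y := Y)
  induction m with
  | zero => simp [lintegral_unique, volume_pi]
  | succ m ih =>
    have hm (m : ℕ) : Measurable fun ζ : Fin m → Y => ∏ i, q (ζ i) :=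
      Finset.measurable_prod _ fun i _ => hq.comp (measurable_pi_apply i)
    rw [lintegral_pi_succ (hm _)]
    simp only [Fin.prod_univ_succ, Fin.cons_zero, Fin.cons_succ]
    simp only [lintegral_const_mul _ (hm m), ih]
    rw [lintegral_mul_const _ hq, pow_succ, mul_comm]

/-- The integrand of the energy, extended by zero, for an open set. -/
lemma measurable_indicator_energy {E : Type*} [NormedAddCommGroup E] [MeasurableSpace E]
    [BorelSpace E] {Ω : Set E} (hΩ : IsOpen Ω) {f : E → ℂ} (hf : ContinuousOn f Ω) {ψ : E → ℝ}
    (hψ : Continuous ψ) : Measurable (Ω.indicator fun x => ‖f x‖ₑ ^ 2 * ew ψ x) := by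
  classical
  have h1 : Measurable (Ω.indicator f) := by
    rw [← Set.piecewise_eq_indicator]
    exact hf.measurable_piecewise continuousOn_const hΩ.measurableSet
  have h2 : Measurable (ew ψ) :=
    ENNReal.measurable_ofReal.comp (Real.measurable_exp.comp hψ.measurable.neg)
  convert (h1.enorm.pow_const 2).mul h2 using 1
  ext x
  by_cases hx : x ∈ Ω <;> simp [hx]

lemma energy_eq_lintegral_indicator {E : Type*} [NormedAddCommGroup E] [MeasureSpace E]
    [BorelSpace E] {Ω : Set E} (hΩ : IsOpen Ω) (ψ : E → ℝ) (f : E → ℂ) :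
    energy Ω ψ f = ∫⁻ x, Ω.indicator (fun x => ‖f x‖ₑ ^ 2 * ew ψ x) x :=
  (lintegral_indicator hΩ.measurableSet _).symm

lemma isOpen_pi_mem {m : ℕ} {Ω : Set Y} (hΩ : IsOpen Ω) :
    IsOpen {ζ : Fin m → Y | ∀ i, ζ i ∈ Ω} := by
  rw [setOf_forall]
  exact isOpen_iInter_of_finite fun i => hΩ.preimage (continuous_apply i)

/-- A pointwise estimate by the energy is inherited by Cartesian powers. -/
theorem enorm_sq_le_energy_pi {Ω : Set Y} (hΩ : IsOpen Ω) {ψ : Y → ℝ} (hψ : Continuous ψ)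
    (h0 : (0 : Y) ∈ Ω) {c : ℝ≥0∞} (hc : c ≠ ⊤)
    (h : ∀ g, DifferentiableOn ℂ g Ω → ‖g 0‖ₑ ^ 2 ≤ c * energy Ω ψ g) (m : ℕ)
    {G : (Fin m → Y) → ℂ} (hG : DifferentiableOn ℂ G {ζ | ∀ i, ζ i ∈ Ω}) :
    ‖G 0‖ₑ ^ 2 ≤ c ^ m * energy {ζ | ∀ i, ζ i ∈ Ω} (fun ζ => ∑ i, ψ (ζ i)) G := by
  have hψm (m : ℕ) : Continuous fun ζ : Fin m → Y => ∑ i, ψ (ζ i) :=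
    continuous_finsetSum _ fun i _ => hψ.comp (continuous_apply i)
  induction m with
  | zero =>
    rw [energy_eq_lintegral_indicator (isOpen_pi_mem hΩ), lintegral_unique]
    have : (default : Fin 0 → Y) = 0 := Subsingleton.elim _ _
    simp [volume_pi, ew, this]
  | succ m ih =>
    have hslice (y : Y) (hy : y ∈ Ω) :
        DifferentiableOn ℂ (fun ζ : Fin m → Y => G (Fin.cons y ζ)) {ζ | ∀ i, ζ i ∈ Ω} := by
      refine hG.comp (t := {ζ : Fin (m + 1) → Y | ∀ i, ζ i ∈ Ω}) ?_ ?_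
      · refine Differentiable.differentiableOn (differentiable_pi.2 fun i => ?_)
        refine Fin.cases ?_ (fun i => ?_) i
        · simp
        · simpa using differentiable_apply i
      · intro ζ hζ i
        refine Fin.cases ?_ (fun i => ?_) i
        · simpa using hy
        · simpa using hζ i
    have hg : DifferentiableOn ℂ (fun y => G (Fin.cons y 0)) Ω := by
      refine hG.comp (t := {ζ : Fin (m + 1) → Y | ∀ i, ζ i ∈ Ω}) ?_ ?_
      · refine Differentiable.differentiableOn (differentiable_pi.2 fun i => ?_)
        refine Fin.cases ?_ (fun i => ?_) i
        · simp
        · simp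
      · intro y hy i
        refine Fin.cases ?_ (fun i => ?_) i
        · simpa using hy
        · simpa using h0
    have hcons : (Fin.cons (0 : Y) (0 : Fin m → Y) : Fin (m + 1) → Y) = 0 := by
      ext i
      refine Fin.cases ?_ (fun i => ?_) i <;> simp
    have h1 := h _ hg
    rw [hcons] at h1
    refine h1.trans ?_
    have hmeas := measurable_indicator_energy (isOpen_pi_mem hΩ) hG.continuousOn (hψm (m + 1))
    rw [pow_succ', mul_assoc]
    gcongr
    rw [energy_eq_lintegral_indicator (isOpen_pi_mem hΩ), lintegral_pi_succ hmeas, energy,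
      ← lintegral_const_mul' _ _ (ENNReal.pow_ne_top hc), ← lintegral_indicator hΩ.measurableSet]
    refine lintegral_mono fun y => ?_
    by_cases hy : y ∈ Ω
    · rw [indicator_of_mem hy]
      calc _ ≤ c ^ m * energy {ζ | ∀ i, ζ i ∈ Ω} (fun ζ => ∑ i, ψ (ζ i))
            (fun ζ : Fin m → Y => G (Fin.cons y ζ)) * ew ψ y := by
              gcongr; exact ih (hslice y hy)
        _ = _ := by
          rw [mul_assoc, energy_eq_lintegral_indicator (isOpen_pi_mem hΩ),
            ← lintegral_mul_const' _ _ (by exact ENNReal.ofReal_ne_top)]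
          congr 1
          refine lintegral_congr fun ζ => ?_
          by_cases hζ : ∀ i, ζ i ∈ Ω
          · rw [indicator_of_mem (by exact hζ), indicator_of_mem
              (by intro i; refine Fin.cases ?_ (fun i => ?_) i; exacts [hy, hζ i])]
            simp only [ew, Fin.sum_univ_succ, Fin.cons_zero, Fin.cons_succ]
            rw [mul_assoc, ← ENNReal.ofReal_mul (Real.exp_pos _).le, ← Real.exp_add]
            congr 3
            ring
          · rw [indicator_of_notMem (by exact hζ), indicator_of_notMem, zero_mul]
            intro h; exact hζ fun i => by simpa using h i.succ
    · rw [indicator_of_notMem hy]; exact zero_le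

lemma exists_fibre_close {O : Set (ℂ × Y)} (hO : IsOpen O) {p ψ : ℂ × Y → ℝ}
    (hc : IsCompact {z ∈ O | p z ≤ 1}) (hψ : Continuous ψ) {η : ℝ} (hη : 0 < η) :
    ∃ ε > 0, ∀ z ∈ O, p z < 1 → ‖z.1‖ < ε → ((0 : ℂ), z.2) ∈ O ∧ ψ (0, z.2) ≤ ψ z + η := by
  have : ProperSpace Y := FiniteDimensional.proper ℂ Y
  obtain ⟨r, hr, h1⟩ := hc.exists_cthickening_subset_open hO fun z hz => hz.1
  have hu := (hc.cthickening (r := r)).uniformContinuousOn_of_continuous hψ.continuousOn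
  rw [Metric.uniformContinuousOn_iff] at hu
  obtain ⟨ε, hε, h2⟩ := hu η hη
  refine ⟨min r ε, by positivity, fun z hz hp hz1 => ?_⟩
  have hzK : z ∈ {z ∈ O | p z ≤ 1} := ⟨hz, hp.le⟩
  have hd : dist ((0 : ℂ), z.2) z = ‖z.1‖ := by
    rw [Prod.dist_eq, dist_self, dist_eq_norm, zero_sub, norm_neg]
    exact max_eq_left (norm_nonneg _)
  have hm : ((0 : ℂ), z.2) ∈ cthickening r {z ∈ O | p z ≤ 1} :=
    mem_cthickening_of_dist_le _ z _ _ hzK (hd.le.trans (hz1.le.trans (min_le_left _ _)))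
  refine ⟨h1 hm, ?_⟩
  have h3 := h2 _ hm z (self_subset_cthickening _ hzK)
    (hd.trans_lt (hz1.trans_le (min_le_right _ _)))
  rw [Real.dist_eq] at h3
  linarith [(abs_lt.1 h3).2]

lemma enorm_prod_eq {ι : Type*} (s : Finset ι) (f : ι → ℂ) : ‖∏ i ∈ s, f i‖ₑ = ∏ i ∈ s, ‖f i‖ₑ := by
  classical
  induction s using Finset.induction_on with
  | empty => simp
  | insert a s ha ih => rw [Finset.prod_insert ha, Finset.prod_insert ha, enorm_mul, ih]

lemma differentiableOn_finset_prod {E ι : Type*} [NormedAddCommGroup E] [NormedSpace ℂ E]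
    {S : Set E} (s : Finset ι) {f : ι → E → ℂ} (hf : ∀ i ∈ s, DifferentiableOn ℂ (f i) S) :
    DifferentiableOn ℂ (fun x => ∏ i ∈ s, f i x) S := by
  classical
  induction s using Finset.induction_on with
  | empty => simp
  | insert a s ha ih =>
    simp only [Finset.prod_insert ha]
    exact (hf a (by simp)).mul (ih fun i hi => hf i (by simp [hi]))

lemma energy_tensor_le {O : Set (ℂ × Y)} (hO : IsOpen O) {p ψ : ℂ × Y → ℝ} (hψ : Continuous ψ)
    {η ε : ℝ} (h : ∀ z ∈ O, p z < 1 → ‖z.1‖ < ε → ((0 : ℂ), z.2) ∈ O ∧ ψ (0, z.2) ≤ ψ z + η)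
    {f : Y → ℂ} (hf : ContinuousOn f {ζ | ((0 : ℂ), ζ) ∈ O}) {m : ℕ}
    {S : Set (ℂ × (Fin m → Y))} (hSm : MeasurableSet S)
    (hS : ∀ x ∈ S, (∀ i, slot Y i x ∈ O ∧ p (slot Y i x) < 1) ∧ ‖x.1‖ < ε)
    {Ψ : ℂ × (Fin m → Y) → ℝ} (hΨ : ∀ x ∈ S, ∑ i, ψ (slot Y i x) ≤ Ψ x) :
    energy S Ψ (fun x => ∏ i, f (x.2 i)) ≤ volume (ball (0 : ℂ) ε) *
      (ENNReal.ofReal (Real.exp η) * energy {ζ | ((0 : ℂ), ζ) ∈ O} (fun ζ => ψ (0, ζ)) f) ^ m := by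
  have := sigmaFinite_volume (Y := Y)
  have hO0 : IsOpen {ζ : Y | ((0 : ℂ), ζ) ∈ O} := hO.preimage (by fun_prop)
  set q : Y → ℝ≥0∞ := {ζ : Y | ((0 : ℂ), ζ) ∈ O}.indicator
    fun ζ => ‖f ζ‖ₑ ^ 2 * ew (fun ζ => ψ (0, ζ)) ζ with hq
  have hqm : Measurable q := measurable_indicator_energy hO0 hf (hψ.comp (by fun_prop))
  rw [energy_eq_lintegral_indicator hO0, ← hq, mul_pow, ← lintegral_pi_prod hqm,
    ← lintegral_const_mul' _ _ (ENNReal.pow_ne_top ENNReal.ofReal_ne_top),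
    ← lintegral_indicator_one measurableSet_ball, energy, ← lintegral_indicator hSm,
    ← lintegral_prod_mul, ← Measure.volume_eq_prod]
  · refine lintegral_mono fun x => ?_
    by_cases hx : x ∈ S
    · obtain ⟨h1, h2⟩ := hS x hx
      have h3 (i : Fin m) := h _ (h1 i).1 (h1 i).2 h2
      have h4 (i : Fin m) : q (x.2 i) = ‖f (x.2 i)‖ₑ ^ 2 * ew (fun ζ => ψ (0, ζ)) (x.2 i) :=
        indicator_of_mem (by exact (h3 i).1) _
      rw [indicator_of_mem hx, indicator_of_mem (by simpa using h2)]
      simp only [h4, Finset.prod_mul_distrib, Pi.one_apply, one_mul, ew]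
      rw [enorm_prod_eq, Finset.prod_pow, mul_left_comm, ← ENNReal.ofReal_pow (Real.exp_pos _).le,
        ← ENNReal.ofReal_prod_of_nonneg fun i _ => (Real.exp_pos _).le,
        ← ENNReal.ofReal_mul (by positivity), ← Real.exp_sum, ← Real.exp_nat_mul, ← Real.exp_add]
      gcongr
      have h5 : ∑ i, ψ (0, x.2 i) ≤ ∑ i : Fin m, (ψ (slot Y i x) + η) :=
        Finset.sum_le_sum fun i _ => (h3 i).2
      rw [Finset.sum_add_distrib] at h5
      simp only [Finset.sum_const, Finset.card_univ, Fintype.card_fin, nsmul_eq_mul] at h5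
      rw [Finset.sum_neg_distrib]
      linarith [hΨ x hx]
    · rw [indicator_of_notMem hx]; exact zero_le
  · exact (measurable_const.indicator measurableSet_ball).aemeasurable
  · exact ((Finset.measurable_prod _ fun i _ =>
      hqm.comp (measurable_pi_apply i)).const_mul _).aemeasurable

/-- Extension of `f(ζ₁) ⋯ f(ζₘ)` from the central fibre, with a constant independent of `m`. -/
theorem exists_tensor_extension {κ : Type*} [Fintype κ] (b : Module.Basis κ ℂ Y)
    {O : Set (ℂ × Y)} (hO : IsOpen O)
    {p ψ : ℂ × Y → ℝ} (hp : ContDiff ℝ (⊤ : ℕ∞) p) (hψ : ContDiff ℝ (⊤ : ℕ∞) ψ)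
    (hc : ∀ c ≤ 1, IsCompact {z ∈ O | p z ≤ c}) (hl : ∀ z ∈ O, ∀ v, 0 ≤ levi p v z)
    {d : ℝ} (hd : 0 < d) (hd' : ∀ z ∈ O, ∀ v, d * ∑ l, ‖frame b l v‖ ^ 2 ≤ levi ψ v z)
    (h0 : (0 : ℂ × Y) ∈ O) (h0' : p 0 < 1) {η : ℝ} (hη : 0 < η) :
    ∃ A : ℝ≥0∞, A ≠ ⊤ ∧ ∀ f, DifferentiableOn ℂ f {ζ | ((0 : ℂ), ζ) ∈ O} →
      energy {ζ | ((0 : ℂ), ζ) ∈ O} (fun ζ => ψ (0, ζ)) f ≠ ⊤ → ∀ m > 0,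
      ∃ F : ℂ × (Fin m → Y) → ℂ,
        DifferentiableOn ℂ F {x | ∀ i, slot Y i x ∈ {z ∈ O | p z < 0}} ∧ F 0 = f 0 ^ m ∧
        energy {x | ∀ i, slot Y i x ∈ {z ∈ O | p z < 0}} (fun x => ∑ i, ψ (slot Y i x)) F ≤
          A * (ENNReal.ofReal (Real.exp η) *
            energy {ζ | ((0 : ℂ), ζ) ∈ O} (fun ζ => ψ (0, ζ)) f) ^ m := by
  obtain ⟨ε, hε, hε'⟩ := exists_fibre_close hO (hc 1 le_rfl) hψ.continuous hη
  obtain ⟨χ, β, M, hcut⟩ := exists_isCutoff hε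
  obtain ⟨R, hR⟩ := (hc 1 le_rfl).exists_bound_of_continuousOn
    (f := fun z : ℂ × Y => z.1) continuous_fst.continuousOn
  refine ⟨ENNReal.ofReal (Real.exp 1) * (ENNReal.ofReal (2 + 2 * R ^ 2 * (4 / d * M ^ 2)) *
    volume (ball (0 : ℂ) ε)), by finiteness, fun f hf hI m hm => ?_⟩
  obtain ⟨C, hC⟩ := exists_leviExhaustion_tensor b hO hp hψ hc hl hd hd' hm
  have := isAddHaarMeasure_prod_pi (Y := Y) m
  set V : Set (ℂ × (Fin m → Y)) := {x | ∀ i, slot Y i x ∈ O ∧ p (slot Y i x) < 1} with hV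
  set τ := ContinuousLinearMap.fst ℂ ℂ (Fin m → Y) with hτ
  set s := tensorExhaustion p m with hs
  have hWV (x : ℂ × (Fin m → Y)) :
      tensorWeight p ψ m x - 2 * s x = ∑ i, ψ (slot Y i x) + s x ^ 2 := by
    rw [tensorWeight]; ring
  set S : Set (ℂ × (Fin m → Y)) := {x ∈ V | ‖τ x‖ < ε} with hS
  have hSo : IsOpen S := hC.isOpen.inter (isOpen_lt τ.continuous.norm continuous_const)
  have hE : energy S (fun x => tensorWeight p ψ m x - 2 * s x) (fun x => ∏ i, f (x.2 i)) ≤ _ :=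
    energy_tensor_le hO hψ.continuous hε' hf.continuousOn hSo.measurableSet (fun x hx => hx)
      fun x hx => by rw [hWV]; nlinarith [sq_nonneg (s x)]
  have hgd : DifferentiableOn ℂ (fun x : ℂ × (Fin m → Y) => ∏ i, f (x.2 i)) S := by
    refine differentiableOn_finset_prod _ fun i _ => ?_
    refine hf.comp (t := {ζ | ((0 : ℂ), ζ) ∈ O})
      (f := fun x : ℂ × (Fin m → Y) => x.2 i) (by fun_prop) fun x hx => ?_
    exact (hε' _ (hx.1 i).1 (hx.1 i).2 hx.2).1
  obtain ⟨F, hF, hF0, hFE⟩ := hC.exists_extension hd (span_tensorFrame b m) τ (o := none) rfl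
    (fun k hk => by
      cases k with
      | none => exact absurd rfl hk
      | some k => rfl) hε hcut
    (fun x hx => hR _ ⟨(hx ⟨0, hm⟩).1, (hx ⟨0, hm⟩).2.le⟩) hgd
    (ne_top_of_le_ne_top (by finiteness) hE)
  have hsub : {x : ℂ × (Fin m → Y) | ∀ i, slot Y i x ∈ {z ∈ O | p z < 0}} ⊆ V :=
    fun x hx i => ⟨(hx i).1, (hx i).2.trans one_pos⟩
  refine ⟨F, hF.mono hsub, ?_, ?_⟩
  · rw [hF0 0 (fun i => ⟨h0, h0'⟩) rfl]
    simp
  · have hWo : IsOpen {x : ℂ × (Fin m → Y) | ∀ i, slot Y i x ∈ {z ∈ O | p z < 0}} := by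
      rw [setOf_forall]
      exact isOpen_iInter_of_finite fun i => (hO.inter
        (isOpen_lt hp.continuous continuous_const)).preimage (slot Y i).continuous
    calc _ ≤ ∫⁻ x in {x : ℂ × (Fin m → Y) | ∀ i, slot Y i x ∈ {z ∈ O | p z < 0}},
          ENNReal.ofReal (Real.exp 1) *
            (‖F x‖ₑ ^ 2 * ew (fun x => tensorWeight p ψ m x - 2 * s x) x) := by
          refine setLIntegral_mono' hWo.measurableSet fun x hx => ?_
          rw [mul_left_comm, ew, ew, ← ENNReal.ofReal_mul (Real.exp_pos _).le, ← Real.exp_add]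
          gcongr
          rw [hWV]
          have h1 : s x ≤ 1 := by
            have h2 : s x ≤ ∑ i : Fin m, (m : ℝ)⁻¹ * 1 := Finset.sum_le_sum fun i _ => by
              gcongr
              exact inv_le_one_of_one_le₀ (by linarith [(hx i).2])
            have hm' : (m : ℝ) ≠ 0 := by exact_mod_cast hm.ne'
            simpa [hm'] using h2
          have h2 := hC.nonneg x (hsub hx)
          nlinarith
      _ ≤ ENNReal.ofReal (Real.exp 1) * energy V (fun x => tensorWeight p ψ m x - 2 * s x) F := by
          rw [lintegral_const_mul' _ _ ENNReal.ofReal_ne_top]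
          gcongr
          exact lintegral_mono_set hsub
      _ ≤ _ := by
          rw [mul_assoc, mul_assoc]
          gcongr
          refine hFE.trans ?_
          gcongr

end Power

section Annulus

/-- The mean value inequality over an annulus. -/
lemma enorm_sq_le_annulus {H : ℂ → ℂ} {Ω : Set ℂ} (hΩ : IsOpen Ω) (hH : DifferentiableOn ℂ H Ω)
    {r : ℝ} (hr : closedBall 0 r ⊆ Ω) (q : ℝ) :
    volume {τ : ℂ | q ≤ ‖τ‖ ∧ ‖τ‖ ≤ r} * ‖H 0‖ₑ ^ 2 ≤
      ∫⁻ τ in {τ : ℂ | q ≤ ‖τ‖ ∧ ‖τ‖ ≤ r}, ‖H τ‖ₑ ^ 2 := by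
  classical
  set A : Set ℂ := {τ : ℂ | q ≤ ‖τ‖ ∧ ‖τ‖ ≤ r} with hA
  have hAc : IsCompact A := by
    refine (isCompact_closedBall (0 : ℂ) r).of_isClosed_subset ?_ fun x hx => by simpa using hx.2
    exact (isClosed_le continuous_const continuous_norm).inter
      (isClosed_le continuous_norm continuous_const)
  have hAm := hAc.measurableSet
  have hAΩ : A ⊆ Ω := fun x hx => hr (by simpa using hx.2)
  have hc : ContinuousOn (fun τ => H τ ^ 2) A := (hH.continuousOn.mono hAΩ).pow 2
  have hint : Integrable (A.indicator fun τ => H τ ^ 2) :=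
    (integrable_indicator_iff hAm).2 (hc.integrableOn_compact hAc)
  have hmeas : StronglyMeasurable (A.indicator fun τ => H τ ^ 2) := by
    refine Measurable.stronglyMeasurable ?_
    rw [← Set.piecewise_eq_indicator]
    exact hc.measurable_piecewise continuousOn_const hAm
  have h1 := (integral_eq_integral_circle hint hmeas).2
  have h2 (x : ℂ) : ∫ θ in (0:ℝ)..(2 * Real.pi),
      A.indicator (fun τ => H τ ^ 2) (Complex.exp (θ * I) • x) =
      A.indicator (fun _ => (2 * Real.pi) • H 0 ^ 2) x := by
    have hm (θ : ℝ) : Complex.exp (θ * I) • x ∈ A ↔ x ∈ A := by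
      simp only [hA, mem_setOf_eq, norm_smul, Complex.norm_exp_ofReal_mul_I, one_mul]
    by_cases hx : x ∈ A
    · rw [indicator_of_mem hx]
      have h3 := integral_circle_eq hΩ (hH.pow 2) (z := 0) (w := x) fun l hl => hr (by
        simp only [zero_add, mem_closedBall, dist_zero_right, norm_smul]
        nlinarith [hx.2, norm_nonneg x])
      simp only [zero_add, Pi.pow_apply] at h3
      rw [← h3]
      congr 1
      ext θ
      rw [indicator_of_mem ((hm θ).2 hx)]
    · have h3 (θ : ℝ) : A.indicator (fun τ => H τ ^ 2) (Complex.exp (θ * I) • x) = 0 :=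
        indicator_of_notMem (mt (hm θ).1 hx) _
      simp only [h3, indicator_of_notMem hx, intervalIntegral.integral_zero]
  simp only [h2] at h1
  rw [integral_indicator hAm, integral_indicator hAm, setIntegral_const,
    smul_comm (2 * Real.pi)⁻¹ (volume.real A), smul_smul (2 * Real.pi)⁻¹ (2 * Real.pi),
    inv_mul_cancel₀ (by positivity), one_smul] at h1
  calc _ = ‖∫ τ in A, H τ ^ 2‖ₑ := by
        rw [h1, enorm_smul, enorm_pow, Real.enorm_of_nonneg measureReal_nonneg,
          ofReal_measureReal hAc.measure_lt_top.ne]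
    _ ≤ _ := (enorm_integral_le_lintegral_enorm _).trans_eq (by simp only [enorm_pow])

lemma annulus_volume_pos {r a : ℝ} (hr : 0 < r) (ha : 0 < a) :
    volume {τ : ℂ | r - a ≤ ‖τ‖ ∧ ‖τ‖ ≤ r} ≠ 0 := by
  have h : IsOpen {τ : ℂ | r - a < ‖τ‖ ∧ ‖τ‖ < r} :=
    (isOpen_lt continuous_const continuous_norm).inter (isOpen_lt continuous_norm continuous_const)
  refine (lt_of_lt_of_le (h.measure_pos volume ⟨(((max 0 (r - a) + r) / 2 : ℝ) : ℂ), ?_⟩)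
    (measure_mono (t := {τ : ℂ | r - a ≤ ‖τ‖ ∧ ‖τ‖ ≤ r}) fun τ hτ => ⟨hτ.1.le, hτ.2.le⟩)).ne'
  have h1 : max 0 (r - a) < r := max_lt hr (by linarith)
  have h2 := le_max_left 0 (r - a)
  have h3 := le_max_right 0 (r - a)
  rw [mem_setOf_eq, norm_real, Real.norm_of_nonneg (by linarith)]
  constructor <;> linarith

lemma le_of_forall_mul_pow_le {c A X Z : ℝ≥0∞} (hc : c ≠ 0) (hA : A ≠ ⊤) (hX : X ≠ ⊤)
    (h : ∀ m > 0, c * X ^ m ≤ A * Z ^ m) : X ≤ Z := by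
  by_contra! hlt
  have hZ : Z ≠ ⊤ := hlt.ne_top
  have hc' : c ≠ ⊤ := by
    rintro rfl
    have := h 1 one_pos
    rw [pow_one, pow_one, ENNReal.top_mul (by rintro rfl; simp at hlt), top_le_iff] at this
    exact ENNReal.mul_ne_top hA hZ this
  lift c to ℝ≥0 using hc'
  lift A to ℝ≥0 using hA
  lift X to ℝ≥0 using hX
  lift Z to ℝ≥0 using hZ
  have hlt' : Z < X := by exact_mod_cast hlt
  have h' (m : ℕ) (hm : m > 0) : c * X ^ m ≤ A * Z ^ m := by exact_mod_cast h m hm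
  have hc0 : 0 < c := pos_iff_ne_zero.2 (by exact_mod_cast hc)
  have hX0 : 0 < X := lt_of_le_of_lt zero_le hlt'
  rcases eq_or_ne Z 0 with rfl | hZ0
  · have := h' 1 one_pos
    simp only [pow_one, mul_zero, nonpos_iff_eq_zero, mul_eq_zero] at this
    rcases this with h | h
    · exact hc0.ne' h
    · exact hX0.ne' h
  · have hZ0' : 0 < Z := pos_iff_ne_zero.2 hZ0
    obtain ⟨m, hm⟩ := pow_unbounded_of_one_lt (A / c) ((one_lt_div hZ0').2 hlt')
    have h1 := h' (m + 1) m.succ_pos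
    have h2 : (X / Z) ^ (m + 1) ≤ A / c := by
      rw [div_pow, div_le_div_iff₀ (by positivity) hc0]
      linarith [mul_comm c (X ^ (m + 1))]
    have h3 : (X / Z) ^ m ≤ (X / Z) ^ (m + 1) :=
      pow_le_pow_right₀ ((one_lt_div hZ0').2 hlt').le m.le_succ
    exact absurd hm (not_lt.2 (h3.trans h2))

variable {Y : Type*} [NormedAddCommGroup Y] [NormedSpace ℂ Y] [FiniteDimensional ℂ Y]
  [MeasureSpace Y] [BorelSpace Y] [(volume : Measure Y).IsAddHaarMeasure]

lemma enorm_sq_le_of_annulus {W : Set (ℂ × Y)} (hW : IsOpen W) {ψ : ℂ × Y → ℝ} (hψ : Continuous ψ)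
    {r q δ : ℝ} (hr : ∀ τ : ℂ, ‖τ‖ ≤ r → (τ, (0 : Y)) ∈ W) {P : ℂ → ℂ} (hP : Differentiable ℂ P)
    (h : ∀ τ, q ≤ ‖τ‖ → ‖τ‖ ≤ r → ∀ g, DifferentiableOn ℂ g {ζ | (τ, ζ) ∈ W} →
      ‖g 0‖ₑ ^ 2 ≤ ENNReal.ofReal (Real.exp ((P τ).re + δ)) *
        energy {ζ | (τ, ζ) ∈ W} (fun ζ => ψ (τ, ζ)) g) {m : ℕ} {F : ℂ × (Fin m → Y) → ℂ}
    (hF : DifferentiableOn ℂ F {x | ∀ i, slot Y i x ∈ W}) :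
    volume {τ : ℂ | q ≤ ‖τ‖ ∧ ‖τ‖ ≤ r} * ‖F 0‖ₑ ^ 2 ≤
      ENNReal.ofReal (Real.exp ((P 0).re + δ)) ^ m *
        energy {x | ∀ i, slot Y i x ∈ W} (fun x => ∑ i, ψ (slot Y i x)) F := by
  have := sigmaFinite_volume (Y := Y)
  have := secondCountable_of_finiteDimensional (Y := Y)
  set A : Set ℂ := {τ : ℂ | q ≤ ‖τ‖ ∧ ‖τ‖ ≤ r} with hA
  have hAm : MeasurableSet A := ((isClosed_le continuous_const continuous_norm).inter
      (isClosed_le continuous_norm continuous_const)).measurableSet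
  have hWm : IsOpen {x : ℂ × (Fin m → Y) | ∀ i, slot Y i x ∈ W} := by
    rw [setOf_forall]
    exact isOpen_iInter_of_finite fun i => hW.preimage (slot Y i).continuous
  set H : ℂ → ℂ := fun τ => F (τ, 0) * Complex.exp (-(m / 2) * P τ) with hH
  have hHd : DifferentiableOn ℂ H {τ : ℂ | (τ, (0 : Y)) ∈ W} := by
    refine DifferentiableOn.mul ?_ (by fun_prop)
    exact hF.comp (t := {x : ℂ × (Fin m → Y) | ∀ i, slot Y i x ∈ W}) (by fun_prop)
      fun τ hτ i => hτ
  have hHn (τ : ℂ) : ‖H τ‖ₑ ^ 2 = ‖F (τ, 0)‖ₑ ^ 2 * ENNReal.ofReal (Real.exp (-(m * (P τ).re))) := by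
    rw [hH, enorm_mul, mul_pow, ← ofReal_norm (Complex.exp _), Complex.norm_exp,
      ← ENNReal.ofReal_pow (Real.exp_pos _).le, ← Real.exp_nat_mul]
    congr 3
    simp
    ring
  have h1 := enorm_sq_le_annulus (r := r) (hW.preimage (by fun_prop)) hHd
    (fun τ hτ => hr τ (by simpa using hτ)) q
  have h2 : ∫⁻ τ in A, ‖H τ‖ₑ ^ 2 ≤ ENNReal.ofReal (Real.exp δ) ^ m *
      energy {x | ∀ i, slot Y i x ∈ W} (fun x => ∑ i, ψ (slot Y i x)) F := by
    have hmeas := measurable_indicator_energy hWm hF.continuousOn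
      (ψ := fun x => ∑ i, ψ (slot Y i x))
      (continuous_finsetSum _ fun i _ => hψ.comp (slot Y i).continuous)
    rw [energy_eq_lintegral_indicator hWm, Measure.volume_eq_prod, lintegral_prod _
      hmeas.aemeasurable, ← lintegral_const_mul' _ _ (by finiteness)]
    refine (setLIntegral_mono' hAm fun τ hτ => ?_).trans (setLIntegral_le_lintegral A _)
    have hWτ : IsOpen {ζ : Y | (τ, ζ) ∈ W} := hW.preimage (by fun_prop)
    have hFτ : DifferentiableOn ℂ (fun ζ => F (τ, ζ))
        {ζ : Fin m → Y | ∀ i, ζ i ∈ {ζ : Y | (τ, ζ) ∈ W}} :=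
      hF.comp (t := {x : ℂ × (Fin m → Y) | ∀ i, slot Y i x ∈ W}) (by fun_prop)
        fun ζ hζ i => hζ i
    have h3 := enorm_sq_le_energy_pi hWτ (ψ := fun ζ => ψ (τ, ζ)) (hψ.comp (by fun_prop))
      (hr τ hτ.2) ENNReal.ofReal_ne_top (h τ hτ.1 hτ.2) m hFτ
    rw [hHn, mul_comm]
    refine (mul_le_mul_right h3 _).trans (le_of_eq ?_)
    rw [← mul_assoc, energy_eq_lintegral_indicator (isOpen_pi_mem hWτ),
      ← ENNReal.ofReal_pow (Real.exp_pos _).le, ← ENNReal.ofReal_pow (Real.exp_pos _).le,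
      ← ENNReal.ofReal_mul (Real.exp_pos _).le, ← Real.exp_nat_mul, ← Real.exp_nat_mul,
      ← Real.exp_add]
    congr 2
    congr 1
    ring
  have h4 := h1.trans h2
  rw [hHn, ← mul_assoc] at h4
  have h5 : ENNReal.ofReal (Real.exp (-(m * (P 0).re))) *
      ENNReal.ofReal (Real.exp (m * (P 0).re)) = 1 := by
    rw [← ENNReal.ofReal_mul (Real.exp_pos _).le, ← Real.exp_add]; simp
  calc _ = volume A * ‖F (0, 0)‖ₑ ^ 2 * ENNReal.ofReal (Real.exp (-(m * (P 0).re))) *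
        ENNReal.ofReal (Real.exp (m * (P 0).re)) := by rw [mul_assoc, h5, mul_one]; rfl
    _ ≤ _ := mul_le_mul_left h4 _
    _ = _ := by
      rw [mul_right_comm, ← ENNReal.ofReal_pow (Real.exp_pos _).le,
        ← ENNReal.ofReal_pow (Real.exp_pos _).le, ← Real.exp_nat_mul, ← Real.exp_nat_mul,
        ← ENNReal.ofReal_mul (Real.exp_pos _).le, ← Real.exp_add]
      congr 3
      ring

end Annulus

section Extremal

lemma energy_const_mul {E : Type*} [NormedAddCommGroup E] [MeasureSpace E] (Ω : Set E) (ψ : E → ℝ)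
    (c : ℂ) (f : E → ℂ) : energy Ω ψ (fun x => c * f x) = ‖c‖ₑ ^ 2 * energy Ω ψ f := by
  rw [energy, energy, ← lintegral_const_mul' _ _ (by finiteness)]
  simp only [enorm_mul, mul_pow, mul_assoc]

lemma ofReal_exp_mul (a b : ℝ) : ENNReal.ofReal (Real.exp a) * ENNReal.ofReal (Real.exp b) =
    ENNReal.ofReal (Real.exp (a + b)) := by
  rw [← ENNReal.ofReal_mul (Real.exp_pos _).le, ← Real.exp_add]

lemma energy_le_of_ofReal_exp_mul_le_one {I : ℝ≥0∞} {a : ℝ}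
    (h : ENNReal.ofReal (Real.exp a) * I ≤ 1) : I ≤ ENNReal.ofReal (Real.exp (-a)) := by
  calc I = ENNReal.ofReal (Real.exp (-a)) * (ENNReal.ofReal (Real.exp a) * I) := by
        rw [← mul_assoc, ofReal_exp_mul]; simp
    _ ≤ ENNReal.ofReal (Real.exp (-a)) * 1 := mul_le_mul_right h _
    _ = _ := mul_one _

variable {Y : Type*} [NormedAddCommGroup Y] [NormedSpace ℂ Y] [FiniteDimensional ℂ Y]
  [MeasureSpace Y] [BorelSpace Y] [(volume : Measure Y).IsAddHaarMeasure]

lemma Approximants.exists_annulus {ι : Type*} [Fintype ι] {D : Set (ℂ × Y)} {φ : ℂ × Y → ℝ}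
    {L : ι → ℂ × Y →L[ℂ] ℂ} {O : ℕ → Set (ℂ × Y)} {p ψ : ℕ → ℂ × Y → ℝ}
    (hA : Approximants D φ L O p ψ) (hD : IsOpen D) {r : ℝ}
    (hr : ∀ τ : ℂ, ‖τ‖ = r → (τ, (0 : Y)) ∈ D) {P : ℂ → ℝ} (hP : Continuous P)
    (h : ∀ τ : ℂ, ‖τ‖ = r → ∀ f, DifferentiableOn ℂ f {ζ | (τ, ζ) ∈ D} →
      ‖f 0‖ₑ ^ 2 ≤ ENNReal.ofReal (Real.exp (P τ)) *
        energy {ζ | (τ, ζ) ∈ D} (fun ζ => φ (τ, ζ)) f) {δ : ℝ} (hδ : 0 < δ) :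
    ∃ a > 0, ∀ᶠ j in atTop, ∀ τ : ℂ, r - a ≤ ‖τ‖ → ‖τ‖ ≤ r → ∀ g,
      DifferentiableOn ℂ g {ζ | (τ, ζ) ∈ {z ∈ O j | p j z < 0}} →
      ‖g 0‖ₑ ^ 2 ≤ ENNReal.ofReal (Real.exp (P τ + δ)) *
        energy {ζ | (τ, ζ) ∈ {z ∈ O j | p j z < 0}} (fun ζ => ψ j (τ, ζ)) g := by
  have : ProperSpace Y := FiniteDimensional.proper ℂ Y
  by_contra! hcon
  have hcon' (k : ℕ) : ∃ j ≥ k, ∃ τ : ℂ, r - 1 / ((k : ℝ) + 1) ≤ ‖τ‖ ∧ ‖τ‖ ≤ r ∧ ∃ g,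
      DifferentiableOn ℂ g {ζ | (τ, ζ) ∈ {z ∈ O j | p j z < 0}} ∧
      ENNReal.ofReal (Real.exp (P τ + δ)) *
        energy {ζ | (τ, ζ) ∈ {z ∈ O j | p j z < 0}} (fun ζ => ψ j (τ, ζ)) g < ‖g 0‖ₑ ^ 2 :=
    frequently_atTop.1 (hcon (1 / ((k : ℝ) + 1)) (by positivity)) k
  choose J hJ τ hτ1 hτ2 g hg hlt using hcon'
  obtain ⟨τ', -, s, hs, hτ⟩ := (isCompact_closedBall (0 : ℂ) r).tendsto_subseq
    (x := τ) fun k => by simpa using hτ2 k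
  have hτ' : ‖τ'‖ = r := by
    refine le_antisymm (le_of_tendsto hτ.norm (Eventually.of_forall fun k => hτ2 _)) ?_
    have h1 := (tendsto_one_div_add_atTop_nhds_zero_nat (𝕜 := ℝ)).comp hs.tendsto_atTop
    have h2 := h1.const_sub r
    rw [sub_zero] at h2
    exact le_of_tendsto_of_tendsto' h2 hτ.norm fun k => hτ1 _
  have hPτ : ∀ᶠ k in atTop, P τ' - δ / 2 ≤ P (τ (s k)) :=
    ((hP.tendsto τ').comp hτ).eventually (eventually_ge_nhds (by linarith))
  obtain ⟨N, hN⟩ := eventually_atTop.1 hPτ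
  set σ : ℕ → ℕ := fun k => s (k + N) with hσ
  have hσt : Tendsto σ atTop atTop := hs.tendsto_atTop.comp (tendsto_add_atTop_nat N)
  have hJt : Tendsto (fun k => J (σ k)) atTop atTop :=
    tendsto_atTop_mono (fun k => hJ (σ k)) hσt
  have hτσ : Tendsto (fun k => τ (σ k)) atTop (𝓝 τ') := hτ.comp (tendsto_add_atTop_nat N)
  have hW (j : ℕ) : IsOpen {z ∈ O j | p j z < 0} :=
    (hA.isOpen j).inter (isOpen_lt (hA.smooth j).continuous continuous_const)
  have h0 (k : ℕ) : g k 0 ≠ 0 := by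
    intro h0
    have := hlt k
    rw [h0] at this
    simp at this
  obtain ⟨ns, F, hns, hF, hFe, hFt⟩ := exists_subseq_energy_le
    (Ωs := fun k => {ζ | (τ (σ k), ζ) ∈ {z ∈ O (J (σ k)) | p (J (σ k)) z < 0}})
    (Ω := {ζ | (τ', ζ) ∈ D}) (ψs := fun k ζ => ψ (J (σ k)) (τ (σ k), ζ))
    (ψ := fun ζ => φ (τ', ζ)) (f := fun k ζ => (g (σ k) 0)⁻¹ * g (σ k) ζ)
    (C := ENNReal.ofReal (Real.exp (-(P τ' + δ / 2)))) ENNReal.ofReal_ne_top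
    (fun k => (hW _).preimage (by fun_prop)) (hD.preimage (by fun_prop))
    (fun L hLD hL => by
      have hQ : IsCompact ({τ'} ×ˢ L : Set (ℂ × Y)) := isCompact_singleton.prod hL
      obtain ⟨ρ, hρ, hρ'⟩ := hQ.exists_cthickening_subset_open hD (by
        rintro ⟨a, b⟩ ⟨rfl, hb⟩
        exact hLD hb)
      filter_upwards [hJt.eventually (hA.eventually_mem _ hρ' hQ.cthickening),
        hτσ.eventually (closedBall_mem_nhds τ' hρ)] with k hk1 hk2 ζ hζ
      refine hk1 (τ (σ k), ζ) (mem_cthickening_of_dist_le _ (τ', ζ) _ _ ⟨rfl, hζ⟩ ?_)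
      rw [Prod.dist_eq, dist_self]
      exact max_le hk2 hρ.le)
    (fun x hx a ha => by
      obtain ⟨N, hN, hN'⟩ := hA.eventually_lt (τ', x) hx a ha
      rw [nhds_prod_eq] at hN
      obtain ⟨U, hU, V, hV, hUV⟩ := mem_prod_iff.1 hN
      refine ⟨V, hV, ?_⟩
      filter_upwards [hJt.eventually hN', hτσ.eventually hU] with k hk1 hk2 y hy
      exact hk1 _ (hUV ⟨hk2, hy⟩))
    (fun k => ((hA.smooth_weight _).continuous.comp (by fun_prop)).aemeasurable)
    (fun k => (hg _).const_mul _)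
    (fun k => by
      rw [energy_const_mul]
      refine (energy_le_of_ofReal_exp_mul_le_one (a := P (τ (σ k)) + δ) ?_).trans
        (ENNReal.ofReal_le_ofReal (Real.exp_le_exp.2 ?_))
      · rw [mul_left_comm]
        refine (mul_le_mul_right (hlt (σ k)).le _).trans_eq ?_
        rw [← mul_pow, ← enorm_mul, inv_mul_cancel₀ (h0 _)]
        simp
      · have := hN (k + N) (Nat.le_add_left _ _)
        simp only [hσ]
        linarith)
  have hF0 : F 0 = 1 := by
    refine tendsto_nhds_unique (hFt 0 (hr τ' hτ')) ?_
    simp only [inv_mul_cancel₀ (h0 _)]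
    exact tendsto_const_nhds
  have h1 := (h τ' hτ' F hF).trans (mul_le_mul_right hFe _)
  rw [hF0, ofReal_exp_mul, enorm_one, one_pow, ENNReal.one_le_ofReal, Real.one_le_exp_iff] at h1
  linarith

/-- A bound for evaluation at the origin of the fibres over the boundary of an analytic disk, given
by the real part of an entire function, persists over the centre of the disk. -/
theorem enorm_sq_le_of_circle {D : Set (ℂ × Y)} (hD : IsOpen D) {u φ : ℂ × Y → ℝ} (hu : PshOn u D)
    (hc : ∀ c : ℝ, IsCompact {z ∈ D | u z ≤ c}) (hφ : PshOn φ D) {r : ℝ} (hr0 : 0 < r)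
    (hr : ∀ τ : ℂ, ‖τ‖ ≤ r → (τ, (0 : Y)) ∈ D) {P : ℂ → ℂ} (hP : Differentiable ℂ P)
    (h : ∀ τ : ℂ, ‖τ‖ = r → ∀ f, DifferentiableOn ℂ f {ζ | (τ, ζ) ∈ D} →
      ‖f 0‖ₑ ^ 2 ≤ ENNReal.ofReal (Real.exp (P τ).re) *
        energy {ζ | (τ, ζ) ∈ D} (fun ζ => φ (τ, ζ)) f) {f : Y → ℂ}
    (hf : DifferentiableOn ℂ f {ζ | ((0 : ℂ), ζ) ∈ D})
    (hI : energy {ζ | ((0 : ℂ), ζ) ∈ D} (fun ζ => φ (0, ζ)) f ≠ ⊤) :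
    ‖f 0‖ₑ ^ 2 ≤ ENNReal.ofReal (Real.exp (P 0).re) *
      energy {ζ | ((0 : ℂ), ζ) ∈ D} (fun ζ => φ (0, ζ)) f := by
  have := isAddHaarMeasure_prod (Y := Y)
  have := secondCountable_of_finiteDimensional (Y := Y)
  set I := energy {ζ | ((0 : ℂ), ζ) ∈ D} (fun ζ => φ (0, ζ)) f with hIdef
  set b := Module.finBasis ℂ Y
  obtain ⟨O, p, ψ, hA⟩ := PshOn.exists_approximants hD hu hc hφ (frame b)
  suffices key : ∀ δ > 0, ‖f 0‖ₑ ^ 2 ≤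
      ENNReal.ofReal (Real.exp ((P 0).re + δ)) * (ENNReal.ofReal (Real.exp δ) * I) by
    have h1 : Tendsto (fun δ : ℝ => ENNReal.ofReal (Real.exp ((P 0).re + 2 * δ)) * I) (𝓝[>] 0)
        (𝓝 (ENNReal.ofReal (Real.exp (P 0).re) * I)) := by
      refine ENNReal.Tendsto.mul_const ?_ (Or.inr hI)
      refine ENNReal.tendsto_ofReal ?_
      have : ContinuousAt (fun δ : ℝ => Real.exp ((P 0).re + 2 * δ)) 0 := by fun_prop
      simpa using this.tendsto.mono_left nhdsWithin_le_nhds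
    refine ge_of_tendsto h1 (eventually_mem_nhdsWithin.mono fun δ hδ => ?_)
    refine (key δ hδ).trans_eq ?_
    rw [← mul_assoc, ofReal_exp_mul]
    congr 3
    ring
  intro δ hδ
  obtain ⟨a, ha, hev⟩ := hA.exists_annulus hD (fun τ hτ => hr τ hτ.le)
    (Complex.continuous_re.comp hP.continuous) h hδ
  have hQ : IsCompact (closedBall (0 : ℂ) r ×ˢ {(0 : Y)}) :=
    (isCompact_closedBall _ _).prod isCompact_singleton
  obtain ⟨j, hj1, hj2⟩ := (hev.and (hA.eventually_mem _ (by
    rintro ⟨τ, y⟩ ⟨hτ, rfl⟩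
    exact hr τ (by simpa using hτ)) hQ)).exists
  have hdisk (τ : ℂ) (hτ : ‖τ‖ ≤ r) : (τ, (0 : Y)) ∈ {z ∈ O j | p j z < 0} :=
    hj2 (τ, 0) ⟨by simpa using hτ, rfl⟩
  have h00 : (0 : ℂ × Y) ∈ {z ∈ O j | p j z < 0} := hdisk 0 (by simpa using hr0.le)
  obtain ⟨d, hd, hd'⟩ := hA.levi_weight j
  obtain ⟨A, hA1, hA2⟩ := exists_tensor_extension b (hA.isOpen j) (hA.smooth j)
    (hA.smooth_weight j) (hA.proper j) (hA.levi j) hd hd' h00.1 (h00.2.trans one_pos) hδ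
  have hsub : {ζ : Y | ((0 : ℂ), ζ) ∈ O j} ⊆ {ζ | ((0 : ℂ), ζ) ∈ D} := fun ζ hζ => hA.subset j hζ
  have hle : energy {ζ | ((0 : ℂ), ζ) ∈ O j} (fun ζ => ψ j (0, ζ)) f ≤ I := by
    refine (setLIntegral_mono' ((hA.isOpen j).preimage (by fun_prop)).measurableSet
      fun ζ hζ => ?_).trans (lintegral_mono_set hsub)
    refine mul_le_mul_right (ENNReal.ofReal_le_ofReal (Real.exp_le_exp.2 ?_)) _
    exact neg_le_neg (hA.le_weight j _ hζ)
  have hext := hA2 f (hf.mono hsub) (ne_top_of_le_ne_top hI hle)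
  have hW : IsOpen {z ∈ O j | p j z < 0} :=
    (hA.isOpen j).inter (isOpen_lt (hA.smooth j).continuous continuous_const)
  have hvol := annulus_volume_pos hr0 ha
  refine le_of_forall_mul_pow_le hvol hA1 (by finiteness) fun m hm => ?_
  obtain ⟨F, hF, hF0, hFe⟩ := hext m hm
  have h1 := enorm_sq_le_of_annulus hW (hA.smooth_weight j).continuous hdisk hP hj1 hF
  rw [hF0, enorm_pow, pow_right_comm] at h1
  refine h1.trans ((mul_le_mul_right hFe _).trans ?_)
  rw [mul_left_comm, ← mul_pow]
  exact mul_le_mul_right (pow_le_pow_left' (mul_le_mul_right (mul_le_mul_right hle _) _) m) _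

end Extremal

section Fourier

lemma exists_entire_of_mem_span {q : C(AddCircle (2 * Real.pi), ℂ)}
    (hq : q ∈ Submodule.span ℂ (range (fourier (T := 2 * Real.pi)))) :
    ∃ P : ℂ → ℂ, Differentiable ℂ P ∧
      ∀ θ : ℝ, (P (Complex.exp (θ * I))).re = (q (θ : AddCircle (2 * Real.pi))).re := by
  suffices key : ∀ c : ℂ, ∃ P : ℂ → ℂ, Differentiable ℂ P ∧
      ∀ θ : ℝ, (P (Complex.exp (θ * I))).re = (c * q (θ : AddCircle (2 * Real.pi))).re by
    simpa using key 1
  induction hq using Submodule.span_induction with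
  | mem x hx =>
    obtain ⟨n, rfl⟩ := hx
    intro c
    have hexp (n : ℤ) (θ : ℝ) : fourier n (θ : AddCircle (2 * Real.pi)) =
        Complex.exp (θ * I) ^ n := by
      rw [fourier_coe_apply, ← Complex.exp_int_mul]
      congr 1
      have : (Real.pi : ℂ) ≠ 0 := by exact_mod_cast Real.pi_ne_zero
      push_cast
      field_simp
    simp only [hexp]
    rcases Int.eq_nat_or_neg n with ⟨m, rfl | rfl⟩
    · exact ⟨fun z => c * z ^ m, by fun_prop, fun θ => by simp⟩
    · refine ⟨fun z => (starRingEnd ℂ) c * z ^ m, by fun_prop, fun θ => ?_⟩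
      rw [← Complex.conj_re]
      congr 1
      simp only [map_mul, Complex.conj_conj, map_pow, ← Complex.exp_conj, Complex.conj_ofReal,
        Complex.conj_I, zpow_neg, zpow_natCast, mul_neg, Complex.exp_neg, inv_pow]
  | zero => exact fun c => ⟨0, differentiable_const _, by simp⟩
  | add x y _ _ hx hy =>
    intro c
    obtain ⟨P, hP, hP'⟩ := hx c
    obtain ⟨Q, hQ, hQ'⟩ := hy c
    refine ⟨fun z => P z + Q z, hP.add hQ, fun θ => ?_⟩
    rw [ContinuousMap.add_apply, mul_add, Complex.add_re, Complex.add_re, hP', hQ']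
  | smul a x _ hx =>
    intro c
    obtain ⟨P, hP, hP'⟩ := hx (c * a)
    refine ⟨P, hP, fun θ => ?_⟩
    rw [hP', ContinuousMap.smul_apply, smul_eq_mul, mul_assoc]

lemma exists_entire_approx {h : ℝ → ℝ} (hh : Continuous h) (hp : h 0 = h (2 * Real.pi)) {ε : ℝ}
    (hε : 0 < ε) : ∃ P : ℂ → ℂ, Differentiable ℂ P ∧
      ∀ θ ∈ Ico 0 (2 * Real.pi), |(P (Complex.exp (θ * I))).re - h θ| ≤ ε := by
  have : Fact (0 < 2 * Real.pi) := ⟨Real.two_pi_pos⟩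
  set H : C(AddCircle (2 * Real.pi), ℂ) := ⟨AddCircle.liftIco (2 * Real.pi) 0 fun θ => (h θ : ℂ),
    AddCircle.liftIco_zero_continuous (by rw [hp]) (by fun_prop)⟩ with hH
  have hmem : H ∈ closure (Submodule.span ℂ (range (fourier (T := 2 * Real.pi))) :
      Set C(AddCircle (2 * Real.pi), ℂ)) := by
    rw [← Submodule.topologicalClosure_coe, span_fourier_closure_eq_top]
    trivial
  obtain ⟨q, hq, hqd⟩ := Metric.mem_closure_iff.1 hmem ε hε
  obtain ⟨P, hP, hP'⟩ := exists_entire_of_mem_span hq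
  refine ⟨P, hP, fun θ hθ => ?_⟩
  have h1 := (ContinuousMap.dist_apply_le_dist (f := H) (g := q) (θ : AddCircle _)).trans hqd.le
  have h2 : H (θ : AddCircle _) = (h θ : ℂ) :=
    AddCircle.liftIco_zero_coe_apply (f := fun θ => (h θ : ℂ)) hθ
  rw [hP', abs_sub_comm]
  rw [h2, dist_eq_norm] at h1
  simpa using (Complex.abs_re_le_norm _).trans h1

lemma mean_re_eq {P : ℂ → ℂ} (hP : Differentiable ℂ P) :
    (2 * Real.pi)⁻¹ * ∫ θ in (0:ℝ)..(2 * Real.pi), (P (Complex.exp (θ * I))).re = (P 0).re := by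
  have h1 := integral_circle_eq (E := ℂ) isOpen_univ hP.differentiableOn (z := 0) (w := 1)
    fun _ _ => mem_univ _
  simp only [smul_eq_mul, mul_one, zero_add] at h1
  have h2 : IntervalIntegrable (fun θ : ℝ => P (Complex.exp (θ * I))) volume 0 (2 * Real.pi) :=
    (hP.continuous.comp (by fun_prop)).intervalIntegrable _ _
  have h3 := Complex.reCLM.intervalIntegral_comp_comm h2
  simp only [Complex.reCLM_apply] at h3
  rw [h3, h1, Complex.real_smul, Complex.re_ofReal_mul, inv_mul_cancel_left₀ (by positivity)]

/-- The real parts of entire functions dominate continuous functions on the circle with almost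
no loss in the mean. -/
theorem exists_entire_majorant {h : ℝ → ℝ} (hh : Continuous h) {ε : ℝ} (hε : 0 < ε) :
    ∃ P : ℂ → ℂ, Differentiable ℂ P ∧
      (∀ θ ∈ Ico 0 (2 * Real.pi), h θ ≤ (P (Complex.exp (θ * I))).re) ∧
      (P 0).re ≤ (2 * Real.pi)⁻¹ * (∫ θ in (0:ℝ)..(2 * Real.pi), h θ) + ε := by
  set d := h (2 * Real.pi) - h 0 with hd
  have hpi := Real.two_pi_pos
  obtain ⟨N, hN⟩ := exists_nat_gt (|d| / (ε / 3))
  rw [div_lt_iff₀ (by positivity)] at hN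
  set H : ℝ → ℝ := fun θ => h θ + max d 0 * (1 - θ / (2 * Real.pi)) ^ (N + 1) +
    max (-d) 0 * (θ / (2 * Real.pi)) ^ (N + 1) with hH
  have hHc : Continuous H := by fun_prop
  have hp : H 0 = H (2 * Real.pi) := by
    have : max d 0 - max (-d) 0 = d := by
      rcases le_total d 0 with h | h
      · rw [max_eq_right h, max_eq_left (by linarith)]; ring
      · rw [max_eq_left h, max_eq_right (by linarith)]; ring
    simp only [hH, zero_div, sub_zero, one_pow, mul_one, div_self hpi.ne', sub_self, zero_pow
      N.succ_ne_zero, mul_zero, add_zero]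
    linarith
  obtain ⟨P, hP, hPH⟩ := exists_entire_approx hHc hp (ε := ε / 3) (by positivity)
  refine ⟨fun z => P z + ((ε / 3 : ℝ) : ℂ), by fun_prop, fun θ hθ => ?_, ?_⟩
  · have h1 := (abs_le.1 (hPH θ hθ)).1
    have h2 : 0 ≤ θ / (2 * Real.pi) := div_nonneg hθ.1 hpi.le
    have h3 : 0 ≤ 1 - θ / (2 * Real.pi) := by
      rw [sub_nonneg, div_le_one hpi]; exact hθ.2.le
    have h4 : h θ ≤ H θ := by
      have := mul_nonneg (le_max_right d 0) (pow_nonneg h3 (N + 1))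
      have := mul_nonneg (le_max_right (-d) 0) (pow_nonneg h2 (N + 1))
      simp only [hH]
      linarith
    rw [Complex.add_re, Complex.ofReal_re]
    linarith
  · have hi (f : ℝ → ℝ) (hf : Continuous f) : IntervalIntegrable f volume 0 (2 * Real.pi) :=
      hf.intervalIntegrable _ _
    have hPc : Continuous fun θ : ℝ => (P (Complex.exp (θ * I))).re :=
      Complex.continuous_re.comp (hP.continuous.comp (by fun_prop))
    have h1 : ∫ θ in (0:ℝ)..(2 * Real.pi), (P (Complex.exp (θ * I))).re ≤
        ∫ θ in (0:ℝ)..(2 * Real.pi), (H θ + ε / 3) := by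
      refine intervalIntegral.integral_mono_on_of_le_Ioo hpi.le (hi _ hPc) (hi _ (by fun_prop))
        fun θ hθ => ?_
      linarith [(abs_le.1 (hPH θ ⟨hθ.1.le, hθ.2⟩)).2]
    have h2 : ∫ θ in (0:ℝ)..(2 * Real.pi), (θ / (2 * Real.pi)) ^ (N + 1) =
        2 * Real.pi / (N + 2) := by
      rw [intervalIntegral.integral_comp_div (fun x => x ^ (N + 1)) hpi.ne', integral_pow]
      simp only [zero_div, div_self hpi.ne', smul_eq_mul]
      push_cast
      ring
    have h3 : ∫ θ in (0:ℝ)..(2 * Real.pi), (1 - θ / (2 * Real.pi)) ^ (N + 1) =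
        2 * Real.pi / (N + 2) := by
      rw [intervalIntegral.integral_comp_sub_div (fun x => x ^ (N + 1)) hpi.ne', integral_pow]
      simp only [zero_div, div_self hpi.ne', smul_eq_mul]
      push_cast
      ring
    have h4 : ∫ θ in (0:ℝ)..(2 * Real.pi), (H θ + ε / 3) =
        (∫ θ in (0:ℝ)..(2 * Real.pi), h θ) + max d 0 * (2 * Real.pi / (N + 2)) +
          max (-d) 0 * (2 * Real.pi / (N + 2)) + 2 * Real.pi * (ε / 3) := by
      simp only [hH]
      rw [intervalIntegral.integral_add (hi _ (by fun_prop)) (hi _ (by fun_prop)),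
        intervalIntegral.integral_add (hi _ (by fun_prop)) (hi _ (by fun_prop)),
        intervalIntegral.integral_add (hi _ (by fun_prop)) (hi _ (by fun_prop)),
        intervalIntegral.integral_const_mul, intervalIntegral.integral_const_mul, h2, h3,
        intervalIntegral.integral_const, smul_eq_mul, sub_zero]
    have h5 : max d 0 + max (-d) 0 = |d| := by
      rcases le_total d 0 with h | h
      · rw [max_eq_right h, max_eq_left (by linarith), abs_of_nonpos h]; ring
      · rw [max_eq_left h, max_eq_right (by linarith), abs_of_nonneg h]; ring
    have h6 : |d| / (N + 2) ≤ ε / 3 := by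
      rw [div_le_iff₀ (by positivity)]
      nlinarith
    rw [Complex.add_re, Complex.ofReal_re, ← mean_re_eq hP]
    have h7 : (2 * Real.pi)⁻¹ * ∫ θ in (0:ℝ)..(2 * Real.pi), (P (Complex.exp (θ * I))).re ≤
        (2 * Real.pi)⁻¹ * ((∫ θ in (0:ℝ)..(2 * Real.pi), h θ) + max d 0 * (2 * Real.pi / (N + 2)) +
          max (-d) 0 * (2 * Real.pi / (N + 2)) + 2 * Real.pi * (ε / 3)) :=
      mul_le_mul_of_nonneg_left (h1.trans_eq h4) (by positivity)
    have h8 : (2 * Real.pi)⁻¹ * ((∫ θ in (0:ℝ)..(2 * Real.pi), h θ) +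
        max d 0 * (2 * Real.pi / (N + 2)) + max (-d) 0 * (2 * Real.pi / (N + 2)) +
        2 * Real.pi * (ε / 3)) = (2 * Real.pi)⁻¹ * (∫ θ in (0:ℝ)..(2 * Real.pi), h θ) +
        (max d 0 + max (-d) 0) / (N + 2) + ε / 3 := by
      field_simp
      ring
    rw [h8, h5] at h7
    linarith

end Fourier

section BergmanSpace

variable {k n : ℕ}

instance : (volume : Measure (Cn n)).IsAddHaarMeasure :=
  (EuclideanSpace.equiv (Fin n) ℂ).symm.isAddHaarMeasure_map volume

lemma aemeasurable_of_upperSemicontinuousOn {X : Type*} [TopologicalSpace X] [MeasurableSpace X]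
    [BorelSpace X] {μ : Measure X} {f : X → ℝ} {s : Set X} (hs : IsOpen s)
    (hf : UpperSemicontinuousOn f s) : AEMeasurable f (μ.restrict s) :=
  aemeasurable_restrict_of_measurable_subtype hs.measurableSet
    (upperSemicontinuousOn_iff_restrict.2 hf).measurable

lemma PshOn.aemeasurable_comp {X E : Type*} [TopologicalSpace X] [MeasurableSpace X]
    [BorelSpace X] {μ : Measure X} [NormedAddCommGroup E] [NormedSpace ℂ E] {φ : E → ℝ}
    {D : Set E} (hφ : PshOn φ D) (hD : IsOpen D) {T : X → E} (hT : Continuous T) :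
    AEMeasurable (fun w => φ (T w)) (μ.restrict {w | T w ∈ D}) :=
  aemeasurable_of_upperSemicontinuousOn (hD.preimage hT) fun _ hw _ ha =>
    (hT.continuousAt.eventually (hφ.eventually_lt hD hw ha)).filter_mono nhdsWithin_le_nhds

lemma enorm_normSq_mul_exp {X : Type*} (f : X → ℂ) (φ : X → ℝ) (x : X) :
    ‖‖f x‖ ^ 2 * Real.exp (-φ x)‖ₑ = ‖f x‖ₑ ^ 2 * ew φ x := by
  rw [enorm_mul, enorm_pow, enorm_norm, Real.enorm_of_nonneg (Real.exp_pos _).le, ew]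

lemma memA2_iff {Ω : Set (Cn n)} (hΩ : IsOpen Ω) {φ : Cn n → ℝ}
    (hφ : AEMeasurable φ (volume.restrict Ω)) {f : Cn n → ℂ} :
    MemA2 Ω φ f ↔ DifferentiableOn ℂ f Ω ∧ energy Ω φ f ≠ ⊤ := by
  refine and_congr_right fun hf => ?_
  have hm : AEStronglyMeasurable (fun x => ‖f x‖ ^ 2 * Real.exp (-φ x)) (volume.restrict Ω) :=
    (((hf.continuousOn.aemeasurable hΩ.measurableSet).norm.pow_const 2).mul
      (Real.measurable_exp.comp_aemeasurable hφ.neg)).aestronglyMeasurable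
  rw [IntegrableOn, Integrable, and_iff_right hm, hasFiniteIntegral_iff_enorm, energy,
    lt_top_iff_ne_top]
  simp only [enorm_normSq_mul_exp]

lemma IsBergmanKernelAt.ofReal_re_eq {Ω : Set (Cn n)} {φ : Cn n → ℝ} {z : Cn n} {K : Cn n → ℂ}
    (hK : IsBergmanKernelAt Ω φ z K) : 0 ≤ (K z).re ∧
      ((K z).re : ℂ) = K z ∧ ENNReal.ofReal (K z).re = energy Ω φ K := by
  have h1 := hK.2 K hK.1
  have h2 (ζ) : K ζ * (starRingEnd ℂ) (K ζ) * (Real.exp (-φ ζ) : ℂ) =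
      ((‖K ζ‖ ^ 2 * Real.exp (-φ ζ) : ℝ) : ℂ) := by
    rw [Complex.mul_conj, Complex.normSq_eq_norm_sq]
    push_cast
    rfl
  simp only [h2] at h1
  rw [integral_complex_ofReal] at h1
  have h3 : (K z).re = ∫ ζ in Ω, ‖K ζ‖ ^ 2 * Real.exp (-φ ζ) := by
    rw [← h1]
    exact Complex.ofReal_re _
  have h4 : ∀ ζ, 0 ≤ ‖K ζ‖ ^ 2 * Real.exp (-φ ζ) := fun ζ => by positivity
  refine ⟨h3 ▸ integral_nonneg h4, by rw [h3]; exact h1, ?_⟩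
  rw [h3, ofReal_integral_eq_lintegral_ofReal hK.1.2 (Eventually.of_forall h4), energy]
  congr 1
  ext ζ
  rw [← enorm_normSq_mul_exp, Real.enorm_of_nonneg (h4 ζ)]

lemma IsBergmanKernelAt.enorm_sq_le {Ω : Set (Cn n)} (hΩ : IsOpen Ω) {φ : Cn n → ℝ}
    (hφ : AEMeasurable φ (volume.restrict Ω)) {z : Cn n} {K : Cn n → ℂ}
    (hK : IsBergmanKernelAt Ω φ z K) {f : Cn n → ℂ} (hf : MemA2 Ω φ f) :
    ‖f z‖ₑ ^ 2 ≤ ENNReal.ofReal (K z).re * energy Ω φ f := by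
  have hmeas (g : Cn n → ℂ) (hg : DifferentiableOn ℂ g Ω) : AEMeasurable
      (fun ζ => ‖g ζ‖ₑ * ENNReal.ofReal (Real.exp (-φ ζ / 2))) (volume.restrict Ω) :=
    (hg.continuousOn.aemeasurable hΩ.measurableSet).enorm.mul
      (Real.measurable_exp.comp_aemeasurable (hφ.neg.div_const 2)).ennreal_ofReal
  have hsq (g : Cn n → ℂ) : ∫⁻ ζ in Ω, (‖g ζ‖ₑ * ENNReal.ofReal (Real.exp (-φ ζ / 2))) ^ (2 : ℝ) =
      energy Ω φ g := by
    rw [energy]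
    congr 1
    ext ζ
    rw [ENNReal.rpow_two, mul_pow, ← ENNReal.ofReal_pow (Real.exp_pos _).le, ← Real.exp_nat_mul, ew]
    congr 3
    push_cast
    ring
  have h1 : ‖f z‖ₑ ≤ energy Ω φ f ^ (1 / 2 : ℝ) * energy Ω φ K ^ (1 / 2 : ℝ) := by
    rw [← hK.2 f hf, ← hsq f, ← hsq K]
    refine (enorm_integral_le_lintegral_enorm _).trans (le_trans (le_of_eq ?_)
      (ENNReal.lintegral_mul_le_Lp_mul_Lq _ Real.HolderConjugate.two_two (hmeas f hf.1)
        (hmeas K hK.1.1)))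
    congr 1
    ext ζ
    have h2 : ‖(Real.exp (-φ ζ) : ℂ)‖ₑ = ENNReal.ofReal (Real.exp (-φ ζ / 2)) *
        ENNReal.ofReal (Real.exp (-φ ζ / 2)) := by
      rw [ofReal_exp_mul, ← ofReal_norm, Complex.norm_real, Real.norm_of_nonneg (Real.exp_pos _).le]
      congr 2
      ring
    rw [enorm_mul, enorm_mul, h2, ← ofReal_norm ((starRingEnd ℂ) _), RCLike.norm_conj, ofReal_norm,
      Pi.mul_apply]
    ring
  have h3 (x : ℝ≥0∞) : (x ^ (1 / 2 : ℝ)) ^ 2 = x := by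
    rw [← ENNReal.rpow_natCast, ← ENNReal.rpow_mul]
    norm_num
  calc _ ≤ (energy Ω φ f ^ (1 / 2 : ℝ) * energy Ω φ K ^ (1 / 2 : ℝ)) ^ 2 := by gcongr
    _ = _ := by rw [mul_pow, h3, h3, hK.ofReal_re_eq.2.2, mul_comm]

lemma energy_translate {E : Type*} [NormedAddCommGroup E] [MeasureSpace E] [BorelSpace E]
    [(volume : Measure E).IsAddLeftInvariant] {Ω : Set E} (hΩ : IsOpen Ω) (ψ : E → ℝ)
    (f : E → ℂ) (z : E) :
    energy {ζ | z + ζ ∈ Ω} (fun ζ => ψ (z + ζ)) (fun ζ => f (z + ζ)) = energy Ω ψ f := by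
  rw [energy_eq_lintegral_indicator hΩ, energy_eq_lintegral_indicator
    (Ω := {ζ | z + ζ ∈ Ω}) (hΩ.preimage (continuous_const_add z)),
    ← lintegral_add_left_eq_self (Ω.indicator fun x => ‖f x‖ₑ ^ 2 * ew ψ x) z]
  rfl

lemma elog_le_iff {x a : ℝ} : elog x ≤ (a : EReal) ↔ x ≤ Real.exp a := by
  rw [elog]
  split_ifs with h
  · rw [EReal.coe_le_coe_iff, Real.log_le_iff_le_exp h]
  · simp only [bot_le, true_iff]
    linarith [Real.exp_pos a]

lemma PshOn.max {E : Type*} [NormedAddCommGroup E] [NormedSpace ℂ E] {u v : E → ℝ} {D : Set E}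
    (hu : PshOn u D) (hv : PshOn v D) : PshOn (fun z => max (u z) (v z)) D := by
  refine ⟨fun z hz a ha => ?_, fun z hz w r hr hl h hh hle => ?_⟩
  · filter_upwards [hu.1 z hz a ((EReal.coe_le_coe_iff.2 (le_max_left _ _)).trans_lt ha),
      hv.1 z hz a ((EReal.coe_le_coe_iff.2 (le_max_right _ _)).trans_lt ha)] with y h1 h2
    rcases max_choice (u y) (v y) with h | h
    · simpa only [h] using h1
    · simpa only [h] using h2
  · have h1 := hu.2 z hz w r hr hl h hh fun θ => le_trans
      (EReal.coe_le_coe_iff.2 (le_max_left _ _)) (hle θ)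
    have h2 := hv.2 z hz w r hr hl h hh fun θ => le_trans
      (EReal.coe_le_coe_iff.2 (le_max_right _ _)) (hle θ)
    exact EReal.coe_le_coe_iff.2 (max_le (EReal.coe_le_coe_iff.1 h1) (EReal.coe_le_coe_iff.1 h2))

lemma PshOn.norm_clm {E : Type*} [NormedAddCommGroup E] [NormedSpace ℂ E] (T : E →L[ℂ] ℂ)
    (D : Set E) : PshOn (fun z => ‖T z‖) D := by
  refine ⟨?_, fun z hz w r hr hl h hh hle => ?_⟩
  · exact ((continuous_coe_real_ereal.comp T.continuous.norm).upperSemicontinuous).upperSemicontinuousOn _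
  · have h1 := integral_circle_eq isOpen_univ T.differentiable.differentiableOn (z := z)
      (w := (r : ℂ) • w) fun _ _ => mem_univ _
    have h2 : ‖∫ θ in (0:ℝ)..(2 * Real.pi), T (z + Complex.exp (θ * I) • (r : ℂ) • w)‖ ≤
        ∫ θ in (0:ℝ)..(2 * Real.pi), h θ := by
      refine intervalIntegral.norm_integral_le_of_norm_le Real.two_pi_pos.le
        (Eventually.of_forall fun θ _ => ?_) (hh.intervalIntegrable _ _)
      rw [smul_smul, mul_comm (Complex.exp _)]
      exact EReal.coe_le_coe_iff.1 (hle θ)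
    rw [h1, norm_smul, Real.norm_of_nonneg Real.two_pi_pos.le] at h2
    refine EReal.coe_le_coe_iff.2 ?_
    rw [le_inv_mul_iff₀ (by positivity)]
    exact h2

lemma PshOn.comp_affine {E F : Type*} [NormedAddCommGroup E] [NormedSpace ℂ E]
    [NormedAddCommGroup F] [NormedSpace ℂ F] {u : F → ℝ} {D : Set F} (hu : PshOn u D)
    (T : E →L[ℂ] F) (c : F) : PshOn (fun x => u (c + T x)) {x | c + T x ∈ D} := by
  refine ⟨fun z hz a ha => ?_, fun z hz w r hr hl h hh hle => ?_⟩
  · have hc : Tendsto (fun x => c + T x) (𝓝[{x | c + T x ∈ D}] z) (𝓝[D] (c + T z)) :=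
      tendsto_nhdsWithin_iff.2 ⟨((continuous_const.add T.continuous).tendsto z).mono_left
        nhdsWithin_le_nhds, eventually_mem_nhdsWithin⟩
    exact hc.eventually (hu.1 _ hz a ha)
  · have h1 (l : ℂ) : c + T (z + l • w) = c + T z + l • T w := by
      rw [map_add, map_smul, add_assoc]
    exact hu.2 (c + T z) hz (T w) r hr (fun l hl' => h1 l ▸ hl l hl') h hh
      fun θ => h1 _ ▸ hle θ

end BergmanSpace

section Bergman

variable {k n : ℕ} {D : Set (Cn k × Cn n)} {φ : Cn k × Cn n → ℝ} {K : Cn k → Cn n → Cn n → ℂ}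

lemma energy_translate_fibre (hD : IsOpen D) (t : Cn k) (z : Cn n) (f : Cn n → ℂ) :
    energy {ζ | (t, z + ζ) ∈ D} (fun ζ => φ (t, z + ζ)) (fun ζ => f (z + ζ)) =
      energy {w | (t, w) ∈ D} (fun w => φ (t, w)) f :=
  energy_translate (hD.preimage (f := fun w => (t, w)) (by fun_prop)) (fun w => φ (t, w)) f z

lemma IsBergmanKernelAt.enorm_sq_le_fibre (hD : IsOpen D) (hφ : PshOn φ D) {t : Cn k} {z : Cn n}
    {Kz : Cn n → ℂ} (hK : IsBergmanKernelAt {w | (t, w) ∈ D} (fun w => φ (t, w)) z Kz) {κ : ℝ≥0∞}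
    (hκ : ENNReal.ofReal (Kz z).re ≤ κ) (hκ0 : κ ≠ 0) {g : Cn n → ℂ}
    (hg : DifferentiableOn ℂ g {ζ | (t, z + ζ) ∈ D}) :
    ‖g 0‖ₑ ^ 2 ≤ κ * energy {ζ | (t, z + ζ) ∈ D} (fun ζ => φ (t, z + ζ)) g := by
  have hΩ : IsOpen {w | (t, w) ∈ D} := hD.preimage (by fun_prop)
  have h1 : energy {ζ | (t, z + ζ) ∈ D} (fun ζ => φ (t, z + ζ)) g =
      energy {w | (t, w) ∈ D} (fun w => φ (t, w)) (fun w => g (w - z)) := by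
    rw [← energy_translate_fibre hD t z]
    simp
  rcases eq_or_ne (energy {ζ | (t, z + ζ) ∈ D} (fun ζ => φ (t, z + ζ)) g) ⊤ with h | h
  · rw [h, ENNReal.mul_top hκ0]
    exact le_top
  · have hm : AEMeasurable (fun w => φ (t, w)) (volume.restrict {w | (t, w) ∈ D}) :=
      hφ.aemeasurable_comp hD (T := fun w => (t, w)) (by fun_prop)
    have hg' : DifferentiableOn ℂ (fun w => g (w - z)) {w | (t, w) ∈ D} :=
      hg.comp (by fun_prop) fun w hw => by simpa using hw
    have h2 := hK.enorm_sq_le hΩ hm ((memA2_iff hΩ hm).2 ⟨hg', h1 ▸ h⟩)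
    rw [sub_self, ← h1] at h2
    exact h2.trans (mul_le_mul_left hκ _)

theorem upperSemicontinuousOn_bergman (hD : IsOpen D) (hφ : PshOn φ D)
    (hK : ∀ t z, (t, z) ∈ D →
      IsBergmanKernelAt {w | (t, w) ∈ D} (fun w => φ (t, w)) z (fun ζ => K t ζ z)) :
    UpperSemicontinuousOn (fun p => elog ((K p.1 p.2 p.2).re)) D := by
  rintro ⟨t, z⟩ hp a ha
  obtain ⟨c, hc1, hc2⟩ := EReal.lt_iff_exists_real_btwn.1 ha
  have hlt : (K t z z).re < Real.exp c :=
    not_le.1 fun h => hc1.not_ge <| by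
      change _ ≤ elog (K t z z).re
      rw [elog, if_pos ((Real.exp_pos c).trans_le h), EReal.coe_le_coe_iff]
      exact (Real.le_log_iff_exp_le ((Real.exp_pos c).trans_le h)).2 h
  suffices h : ∀ᶠ q in 𝓝[D] (t, z), (K q.1 q.2 q.2).re < Real.exp c from
    h.mono fun q hq => (elog_le_iff.2 hq.le).trans_lt hc2
  by_contra hcon
  obtain ⟨q, hq, hq'⟩ := exists_seq_forall_of_frequently
    ((not_eventually.1 hcon).and_eventually eventually_mem_nhdsWithin)
  have hqt : Tendsto q atTop (𝓝 (t, z)) := hq.mono_right nhdsWithin_le_nhds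
  have hqD (j) : ((q j).1, (q j).2) ∈ D := (hq' j).2
  have hκ (j) : Real.exp c ≤ (K (q j).1 (q j).2 (q j).2).re := not_lt.1 (hq' j).1
  have hne (j) : K (q j).1 (q j).2 (q j).2 ≠ 0 := fun h => by
    have := hκ j
    rw [h, Complex.zero_re] at this
    exact absurd this (not_le.2 (Real.exp_pos c))
  obtain ⟨ns, F, hns, hF, hFe, hFt⟩ := exists_subseq_energy_le
    (Ωs := fun j => {ζ | ((q j).1, (q j).2 + ζ) ∈ D}) (Ω := {ζ | (t, z + ζ) ∈ D})
    (ψs := fun j ζ => φ ((q j).1, (q j).2 + ζ)) (ψ := fun ζ => φ (t, z + ζ))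
    (f := fun j ζ => (K (q j).1 (q j).2 (q j).2)⁻¹ * K (q j).1 ((q j).2 + ζ) (q j).2)
    (C := ENNReal.ofReal (Real.exp (-c))) ENNReal.ofReal_ne_top
    (fun j => hD.preimage (by fun_prop)) (hD.preimage (by fun_prop))
    (fun L hLD hL => by
      have h1 : ∀ᶠ x : Cn k × Cn n in 𝓝 (t, z), ∀ y ∈ L, (x.1, x.2 + y) ∈ D :=
        hL.eventually_forall_of_forall_eventually fun y hy =>
          (show Continuous fun v : (Cn k × Cn n) × Cn n => (v.1.1, v.1.2 + v.2) by
            fun_prop).continuousAt.eventually (hD.mem_nhds (hLD hy))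
      filter_upwards [hqt.eventually h1] with j hj y hy
      exact hj y hy)
    (fun x hx a ha => by
      have h1 := (show Continuous fun v : (Cn k × Cn n) × Cn n => (v.1.1, v.1.2 + v.2) by
        fun_prop).continuousAt (x := ((t, z), x)) |>.eventually (hφ.eventually_lt hD hx ha)
      rw [nhds_prod_eq] at h1
      obtain ⟨U, hU, V, hV, hUV⟩ := mem_prod_iff.1 h1
      refine ⟨V, hV, ?_⟩
      filter_upwards [hqt.eventually hU] with j hj y hy
      exact hUV (mk_mem_prod hj hy))
    (fun j => hφ.aemeasurable_comp hD (T := fun ζ => ((q j).1, (q j).2 + ζ)) (by fun_prop))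
    (fun j => ((hK _ _ (hqD j)).1.1.comp (t := {w | ((q j).1, w) ∈ D})
      (f := fun ζ => (q j).2 + ζ) (by fun_prop) fun ζ hζ => hζ).const_mul _)
    (fun j => by
      obtain ⟨h1, h2, h3⟩ := (hK _ _ (hqD j)).ofReal_re_eq
      rw [energy_const_mul, energy_translate_fibre hD _ _ (fun w => K (q j).1 w (q j).2), ← h3, ← h2, Complex.ofReal_re, ← Complex.ofReal_inv,
        ← ofReal_norm, Complex.norm_real, Real.norm_of_nonneg (inv_nonneg.2 h1),
        ← ENNReal.ofReal_pow (inv_nonneg.2 h1), ← ENNReal.ofReal_mul (by positivity)]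
      have h4 := (Real.exp_pos c).trans_le (hκ j)
      refine ENNReal.ofReal_le_ofReal ?_
      rw [sq, mul_assoc, inv_mul_cancel₀ h4.ne', mul_one, Real.exp_neg]
      exact inv_anti₀ (Real.exp_pos c) (hκ j))
  have h0 : (0 : Cn n) ∈ {ζ | (t, z + ζ) ∈ D} := by simpa using hp
  have hF0 : F 0 = 1 := by
    refine tendsto_nhds_unique (hFt 0 h0) ?_
    simp only [add_zero, inv_mul_cancel₀ (hne _)]
    exact tendsto_const_nhds
  obtain ⟨s, hs1, hs2⟩ := exists_between (max_lt hlt (Real.exp_pos c))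
  have hs0 : 0 < s := (le_max_right _ _).trans_lt hs1
  have h1 := (hK t z hp).enorm_sq_le_fibre hD hφ (κ := ENNReal.ofReal s)
    (ENNReal.ofReal_le_ofReal ((le_max_left _ _).trans hs1.le)) (by simpa using hs0) hF
  have h2 := h1.trans (mul_le_mul_right hFe _)
  rw [hF0, enorm_one, one_pow, ← ENNReal.ofReal_mul hs0.le, ENNReal.one_le_ofReal,
    Real.exp_neg, ← div_eq_mul_inv, one_le_div (Real.exp_pos c)] at h2
  exact absurd hs2 (not_lt.2 h2)

theorem bergman_le_exp_mean (hD : Pseudoconvex D) (hφ : PshOn φ D)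
    (hK : ∀ t z, (t, z) ∈ D →
      IsBergmanKernelAt {w | (t, w) ∈ D} (fun w => φ (t, w)) z (fun ζ => K t ζ z))
    {p w : Cn k × Cn n} (hdisk : ∀ l : ℂ, ‖l‖ ≤ 1 → p + l • w ∈ D) {P : ℂ → ℂ}
    (hP : Differentiable ℂ P)
    (hle : ∀ l : ℂ, ‖l‖ = 1 → (K (p + l • w).1 (p + l • w).2 (p + l • w).2).re ≤
      Real.exp (P l).re) : (K p.1 p.2 p.2).re ≤ Real.exp (P 0).re := by
  obtain ⟨hDo, u, hu, hc⟩ := hD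
  have hpD : (p.1, p.2) ∈ D := by simpa using hdisk 0 (by simp)
  set T : ℂ × Cn n →L[ℂ] Cn k × Cn n := (ContinuousLinearMap.fst ℂ ℂ (Cn n)).smulRight w +
    (ContinuousLinearMap.inr ℂ (Cn k) (Cn n)).comp (ContinuousLinearMap.snd ℂ ℂ (Cn n)) with hT
  have hTa (τ : ℂ) (ζ : Cn n) : p + T (τ, ζ) = ((p + τ • w).1, (p + τ • w).2 + ζ) := by
    ext i <;> simp [hT, add_assoc]
  have hTc : Continuous fun x => p + T x := continuous_const.add T.continuous
  have hexh (c : ℝ) : IsCompact {x ∈ {x | p + T x ∈ D} |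
      max (u (p + T x)) ‖ContinuousLinearMap.fst ℂ ℂ (Cn n) x‖ ≤ c} := by
    have hcl : {x ∈ {x | p + T x ∈ D} |
        max (u (p + T x)) ‖ContinuousLinearMap.fst ℂ ℂ (Cn n) x‖ ≤ c} =
        (fun x => p + T x) ⁻¹' {z ∈ D | u z ≤ c} ∩ {x | ‖x.1‖ ≤ c} := by
      ext x
      simp [and_assoc]
    rw [hcl]
    refine (((isCompact_closedBall (0 : ℂ) c).prod (hc c)).image
      (f := fun x : ℂ × (Cn k × Cn n) => (x.1, x.2.2 - (p.2 + x.1 • w.2)))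
      (by fun_prop)).of_isClosed_subset (((hc c).isClosed.preimage hTc).inter
        (isClosed_le (by fun_prop) continuous_const)) ?_
    rintro ⟨τ, ζ⟩ ⟨h1, h2⟩
    refine ⟨(τ, p + T (τ, ζ)), ⟨by simpa using h2, h1⟩, ?_⟩
    rw [hTa]
    simp
  obtain ⟨h1, h2, h3⟩ := (hK _ _ hpD).ofReal_re_eq
  have key := enorm_sq_le_of_circle (hDo.preimage hTc) ((hu.comp_affine T p).max
    (PshOn.norm_clm (ContinuousLinearMap.fst ℂ ℂ (Cn n)) _)) hexh (hφ.comp_affine T p) one_pos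
    (fun τ hτ => by
      rw [mem_preimage, hTa, add_zero]
      exact hdisk τ hτ) hP
    (fun τ hτ g hg => by
      simp only [mem_preimage, hTa] at hg ⊢
      exact (hK _ _ (hdisk τ hτ.le)).enorm_sq_le_fibre hDo hφ
        (ENNReal.ofReal_le_ofReal (hle τ hτ)) (by simpa using Real.exp_pos _) hg)
    (f := fun ζ => K p.1 (p.2 + ζ) p.2)
  simp only [mem_preimage, hTa, zero_smul, add_zero] at key
  rw [energy_translate_fibre hDo _ _ (fun w => K p.1 w p.2), ← h3] at key
  have h4 := key ((hK _ _ hpD).1.1.comp (t := {w | (p.1, w) ∈ D}) (f := fun ζ => p.2 + ζ)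
    (by fun_prop) fun ζ hζ => hζ) ENNReal.ofReal_ne_top
  rw [← h2, ← ofReal_norm, Complex.norm_real, Complex.ofReal_re, Real.norm_of_nonneg h1,
    ← ENNReal.ofReal_pow h1, ← ENNReal.ofReal_mul (Real.exp_pos _).le,
    ENNReal.ofReal_le_ofReal_iff (by positivity), sq] at h4
  rcases h1.eq_or_lt with h | h
  · rw [← h]
    exact (Real.exp_pos _).le
  · exact le_of_mul_le_mul_right h4 h


theorem plurisubharmonicOn_elog_bergman (hD : Pseudoconvex D) (hφ : PshOn φ D)
    (hK : ∀ t z, (t, z) ∈ D →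
      IsBergmanKernelAt {w | (t, w) ∈ D} (fun w => φ (t, w)) z (fun ζ => K t ζ z)) :
    PlurisubharmonicOn (fun p => elog ((K p.1 p.2 p.2).re)) D := by
  refine ⟨upperSemicontinuousOn_bergman hD.1 hφ hK, fun p hp w r hr hdisk h hh hle => ?_⟩
  rw [elog_le_iff]
  have hw : ∀ l : ℂ, ‖l‖ ≤ 1 → p + l • (r : ℂ) • w ∈ D := fun l hl => by
    rw [smul_smul]
    refine hdisk _ ?_
    rw [norm_mul, Complex.norm_real, Real.norm_of_nonneg hr.le]
    nlinarith
  refine le_of_forall_gt_imp_ge_of_dense fun a ha => ?_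
  obtain ⟨ε, hε, hεa⟩ : ∃ ε > 0,
      Real.exp ((2 * Real.pi)⁻¹ * (∫ θ in (0:ℝ)..(2 * Real.pi), h θ) + ε) < a := by
    have hc : ContinuousAt (fun ε : ℝ =>
        Real.exp ((2 * Real.pi)⁻¹ * (∫ θ in (0:ℝ)..(2 * Real.pi), h θ) + ε)) 0 := by fun_prop
    have h1 := hc.tendsto.eventually_lt_const (u := a) (by simpa using ha)
    obtain ⟨ε, h2, h3⟩ := ((h1.filter_mono nhdsWithin_le_nhds).and
      (eventually_mem_nhdsWithin (a := (0 : ℝ)) (s := Ioi 0))).exists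
    exact ⟨ε, h3, h2⟩
  obtain ⟨P, hP, hPh, hP0⟩ := exists_entire_majorant hh hε
  refine (bergman_le_exp_mean hD hφ hK hw hP fun l hl => ?_).trans
    ((Real.exp_le_exp.2 hP0).trans hεa.le)
  obtain ⟨θ, hθ, rfl⟩ : ∃ θ ∈ Ico 0 (2 * Real.pi), Complex.exp (θ * I) = l := by
    refine ⟨toIcoMod Real.two_pi_pos 0 (arg l), by
      simpa using toIcoMod_mem_Ico Real.two_pi_pos 0 (arg l), ?_⟩
    have h1 := Complex.norm_mul_exp_arg_mul_I l
    rw [hl, Complex.ofReal_one, one_mul] at h1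
    rw [toIcoMod, ← h1, Complex.exp_eq_exp_iff_exists_int]
    refine ⟨-toIcoDiv Real.two_pi_pos 0 (arg l), ?_⟩
    rw [h1]
    generalize toIcoDiv Real.two_pi_pos 0 (arg l) = m
    rw [zsmul_eq_mul]
    push_cast
    ring
  have h1 := elog_le_iff.1 (hle θ)
  rw [mul_comm (r : ℂ), ← smul_smul] at h1
  exact h1.trans (Real.exp_le_exp.2 (hPh θ hθ))

end Bergman

/-- **Theorem 1.1** (Berndtsson). Let `D` be a pseudoconvex domain in `ℂᵏ_t × ℂⁿ_z` and `φ`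
plurisubharmonic on `D`.  For each `t` let `D_t = {z | (t,z) ∈ D}`, `φ^t = φ(t,·)`, and let
`K t ζ z = K_t(ζ,z)` be the Bergman kernel of `A²(D_t, e^{-φ^t})`.  Then
`(t,z) ↦ log K_t(z,z)` is plurisubharmonic on `D`, or identically `-∞`. -/
theorem log_bergman_kernel_psh (k n : ℕ) (D : Set (Cn k × Cn n))
    (hD : Pseudoconvex D) (hDconn : IsConnected D)
    (φ : Cn k × Cn n → ℝ) (hφ : PshOn φ D)
    (K : Cn k → Cn n → Cn n → ℂ)
    (hK : ∀ t z, (t, z) ∈ D →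
      IsBergmanKernelAt {w | (t, w) ∈ D} (fun w => φ (t, w)) z (fun ζ => K t ζ z)) :
    PlurisubharmonicOn (fun p : Cn k × Cn n => elog ((K p.1 p.2 p.2).re)) D ∨
      ∀ p ∈ D, elog ((K p.1 p.2 p.2).re) = (⊥ : EReal) :=
  Or.inl (plurisubharmonicOn_elog_bergman hD hφ hK)

end Berndtsson
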